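/- Let K be a number field and K′ a finite field extension of K of odd degree. Let f₁, …, f_r ∈ K[X] be pairwise distinct monic irreducible polynomials, each symmetric of even degree, let n₁, …, n_r ≥ 1 be integers, and set f = ∏ f_i^{n_i} and g = ∏ f_i. Let V be a K-vector space of dimension deg f and let B be a nondegenerate symmetric bilinear form on V. If the base change of B to K′ ⊗_K V admits an isometry whose characteristic polynomial is the image of f in K′[X] and whose minimal polynomial is the image of g in K′[X], then B admits an isometry with characteristic polynomial f and minimal polynomial g. -/

import Mathlib

open TensorProduct Polynomial

/-- `B` admits an isometry with characteristic polynomial `F` and minimal polynomial `G`. -/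
def HasIsometryWith (L : Type*) [Field L] (W : Type*) [AddCommGroup W] [Module L W]
    [Module.Finite L W] (B : LinearMap.BilinForm L W) (F G : Polynomial L) : Prop :=
  ∃ t : W ≃ₗ[L] W, (∀ x y, B (t x) (t y) = B x y) ∧
    LinearMap.charpoly (t : W →ₗ[L] W) = F ∧ minpoly L (t : W →ₗ[L] W) = G

set_option linter.unusedSectionVars false

namespace QF

open IsDedekindDomain NumberField WithZero

section Basic
variable {F : Type*} [Field F]

/-- The group of nonzero values of the binary form `x² - a y²`. -/
def Nm (a : F) : Subgroup Fˣ where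
  carrier := {z | ∃ x y : F, (z : F) = x ^ 2 - a * y ^ 2}
  one_mem' := ⟨1, 0, by simp⟩
  mul_mem' := by
    rintro z w ⟨x, y, h⟩ ⟨x', y', h'⟩
    exact ⟨x * x' + a * y * y', x * y' + y * x', by rw [Units.val_mul, h, h']; ring⟩
  inv_mem' := by
    rintro z ⟨x, y, h⟩
    have hz : (z : F) ≠ 0 := z.ne_zero
    refine ⟨x / z, y / z, ?_⟩
    rw [Units.val_inv_eq_inv_val]
    field_simp
    rw [← h]

lemma mem_Nm {a : F} {z : Fˣ} : z ∈ Nm a ↔ ∃ x y : F, (z : F) = x ^ 2 - a * y ^ 2 := Iff.rfl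

lemma sq_mem_Nm (a : F) (z : Fˣ) : z ^ 2 ∈ Nm a := ⟨z, 0, by simp⟩

variable [CharZero F] {Γ : Type*} [LinearOrderedCommGroupWithZero Γ]

lemma val_two_le (v : Valuation F Γ) : v 2 ≤ 1 := by
  have := v.map_add 1 1
  norm_num at this
  exact this

lemma val_four (v : Valuation F Γ) : v 4 = v 2 * v 2 := by
  rw [← map_mul]; norm_num

lemma val_four_le (v : Valuation F Γ) : v 4 ≤ 1 := by
  rw [val_four]; exact mul_le_one' (val_two_le v) (val_two_le v)

lemma val_two_pos (v : Valuation F Γ) : 0 < v 2 := by simp [zero_lt_iff]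
lemma val_four_pos (v : Valuation F Γ) : 0 < v 4 := by simp [zero_lt_iff]

/-- elements close to `1` have valuation one -/
lemma val_eq_one_of_sub_lt (v : Valuation F Γ) {x : F} (h : v (x - 1) < 1) : v x = 1 := by
  have : v (1 + (x - 1)) = v 1 := v.map_add_eq_of_lt_left (by simpa using h)
  simpa using this

/-- The `v`-adically local squares. -/
def sqAt (v : Valuation F Γ) : Subgroup Fˣ where
  carrier := {z | ∃ w : Fˣ, v (z * w ^ 2 - 1) < v 4}
  one_mem' := ⟨1, by simpa using val_four_pos v⟩
  mul_mem' := by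
    rintro z z' ⟨w, h⟩ ⟨w', h'⟩
    refine ⟨w * w', ?_⟩
    have e : ((z * z' : Fˣ) : F) * ((w * w' : Fˣ) : F) ^ 2 - 1 =
      (z * w ^ 2) * (z' * w' ^ 2 - 1) + (z * w ^ 2 - 1) := by push_cast; ring
    rw [e]
    refine v.map_add_lt ?_ h
    rwa [map_mul, val_eq_one_of_sub_lt v (h.trans_le (val_four_le v)), one_mul]
  inv_mem' := by
    rintro z ⟨w, h⟩
    refine ⟨w⁻¹, ?_⟩
    have h1 := val_eq_one_of_sub_lt v (h.trans_le (val_four_le v))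
    have e : ((z⁻¹ : Fˣ) : F) * ((w⁻¹ : Fˣ) : F) ^ 2 - 1 =
      - ((z : F) * w ^ 2 - 1) * ((z : F) * w ^ 2)⁻¹ := by
        have := z.ne_zero; have := w.ne_zero; push_cast; field_simp; ring
    rw [e, map_mul, map_inv₀, h1, Valuation.map_neg]
    simpa using h

lemma mem_sqAt {v : Valuation F Γ} {z : Fˣ} :
    z ∈ sqAt v ↔ ∃ w : Fˣ, v (z * w ^ 2 - 1) < v 4 := Iff.rfl

lemma sq_mem_sqAt (v : Valuation F Γ) (z : Fˣ) : z ^ 2 ∈ sqAt v :=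
  ⟨z⁻¹, by simpa using val_four_pos v⟩

lemma mem_sqAt_of_lt {v : Valuation F Γ} {z : Fˣ} (h : v ((z : F) - 1) < v 4) : z ∈ sqAt v :=
  ⟨1, by simpa using h⟩

/-- two elements which are relatively close define the same class modulo local squares -/
lemma div_mem_sqAt {v : Valuation F Γ} {z w : Fˣ} (h : v ((z : F) - w) < v 4 * v w) :
    z / w ∈ sqAt v := by
  apply mem_sqAt_of_lt
  have hw : 0 < v (w : F) := by simp [zero_lt_iff]
  have e : ((z / w : Fˣ) : F) - 1 = ((z : F) - w) / w := by
    have := w.ne_zero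
    push_cast; field_simp
  rw [e, map_div₀]
  exact (div_lt_iff₀ hw).2 h

end Basic

end QF

namespace QF

open IsDedekindDomain NumberField WithZero

section Hensel
variable {F : Type*} [Field F] [CharZero F]

lemma exp_add_one_le {x : ℤᵐ⁰} {k : ℤ} : x < exp (k + 1) ↔ x ≤ exp k := by
  induction x using WithZero.expRecOn with
  | zero => simp
  | exp a => rw [exp_lt_exp, exp_le_exp, Int.lt_add_one_iff]

lemma exists_exp_neg_lt {γ : ℤᵐ⁰} (hγ : γ ≠ 0) : ∃ n : ℕ, exp (-(n : ℤ)) < γ := by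
  induction γ using WithZero.expRecOn with
  | zero => exact absurd rfl hγ
  | exp a =>
    refine ⟨(-a).toNat + 1, ?_⟩
    rw [exp_lt_exp]
    push_cast
    have := Int.self_le_toNat (-a)
    omega

lemma sqAt_improve_aux {v : Valuation F ℤᵐ⁰} {z : Fˣ} (hz : z ∈ sqAt v) (j : ℕ) :
    ∃ (w : Fˣ) (m : F), (z : F) * w ^ 2 = 1 + 4 * m ∧ v m ≤ exp (-(j + 1 : ℤ)) := by
  induction j with
  | zero =>
    obtain ⟨w, hw⟩ := hz
    refine ⟨w, (z * w ^ 2 - 1) / 4, by field_simp; ring, ?_⟩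
    rw [map_div₀, ← exp_add_one_le]
    simpa using (div_lt_one₀ (val_four_pos v)).2 hw
  | succ j ih =>
    obtain ⟨w, m, h, hm⟩ := ih
    have hm1 : v m < 1 := hm.trans_lt (by rw [← exp_zero, exp_lt_exp]; omega)
    have hv : v (1 + 2 * m) = 1 := by
      apply val_eq_one_of_sub_lt
      have e : 1 + 2 * m - 1 = 2 * m := by ring
      rw [e, map_mul]
      exact (mul_le_of_le_one_left' (val_two_le v)).trans_lt hm1
    have h0 : 1 + 2 * m ≠ 0 := by
      intro h0; rw [h0, map_zero] at hv; exact zero_ne_one hv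
    refine ⟨w / Units.mk0 _ h0, -m ^ 2 / (1 + 2 * m) ^ 2, ?_, ?_⟩
    · push_cast
      have h1 : (1 + 2 * m) ^ 2 ≠ 0 := pow_ne_zero 2 h0
      rw [Units.val_mk0, div_pow, ← mul_div_assoc, h, div_eq_iff h1, add_mul, mul_assoc 4,
        div_mul_cancel₀ _ h1]
      ring
    · rw [map_div₀, map_pow, hv, Valuation.map_neg, map_pow, one_pow, div_one]
      calc v m ^ 2 ≤ exp (-(j + 1 : ℤ)) ^ 2 := pow_le_pow_left' hm 2
        _ ≤ _ := by
          rw [pow_two, ← exp_add, exp_le_exp]; push_cast; omega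

/-- Hensel: local squares are arbitrarily close to actual squares. -/
lemma sqAt_improve {v : Valuation F ℤᵐ⁰} {z : Fˣ} (hz : z ∈ sqAt v) {γ : ℤᵐ⁰} (hγ : γ ≠ 0) :
    ∃ w : Fˣ, v ((z : F) * w ^ 2 - 1) < γ := by
  obtain ⟨n, hn⟩ := exists_exp_neg_lt hγ
  obtain ⟨w, m, h, hm⟩ := sqAt_improve_aux hz n
  refine ⟨w, lt_of_le_of_lt ?_ hn⟩
  rw [h, add_sub_cancel_left, map_mul]
  refine (mul_le_of_le_one_left' (val_four_le v)).trans (hm.trans ?_)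
  rw [exp_le_exp]; omega

end Hensel

section Index
variable {F : Type*} [Field F] [NumberField F] (v : HeightOneSpectrum (𝓞 F))

/-- units at `v` -/
def unitsAt : Subgroup Fˣ where
  carrier := {x | v.valuation F (x : F) = 1}
  one_mem' := by simp
  mul_mem' := by intro x y hx hy; simp_all
  inv_mem' := by intro x hx; simp_all

lemma mem_unitsAt {x : Fˣ} : x ∈ unitsAt v ↔ v.valuation F (x : F) = 1 := Iff.rfl

lemma exists_approx (n : ℕ) (x : unitsAt v) :
    ∃ a : 𝓞 F, v.valuation F ((x : Fˣ) - (a : F) : F) ≤ exp (-(n : ℤ)) := by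
  obtain ⟨a, ha⟩ := v.exists_valuation_sub_lt_of_integer (K := F) (x := ((x : Fˣ) : F)) x.2.le
    (γ := Units.mk0 (exp (-(n : ℤ))) exp_ne_zero)
  exact ⟨a, by rw [Valuation.map_sub_swap]; exact ha.le⟩

lemma quot_eq_iff (n : ℕ) (a b : 𝓞 F) :
    (Ideal.Quotient.mk (v.asIdeal ^ n) a = Ideal.Quotient.mk (v.asIdeal ^ n) b) ↔
      v.valuation F ((a : F) - b) ≤ exp (-(n : ℤ)) := by
  rw [Ideal.Quotient.eq, ← v.intValuation_le_pow_iff_mem, ← v.valuation_of_algebraMap (K := F)]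
  simp

lemma val_int_le_one (a : 𝓞 F) : v.valuation F (a : F) ≤ 1 := v.valuation_le_one a

/-- reduction modulo `v ^ n` on `v`-units, as a monoid hom -/
noncomputable def redHom (n : ℕ) : unitsAt v →* (𝓞 F ⧸ v.asIdeal ^ n) where
  toFun x := Ideal.Quotient.mk _ (exists_approx v n x).choose
  map_one' := by
    rw [← map_one (Ideal.Quotient.mk _), quot_eq_iff, Valuation.map_sub_swap]
    simpa using (exists_approx v n 1).choose_spec
  map_mul' x y := by
    rw [← map_mul, quot_eq_iff]
    have hx := (exists_approx v n x).choose_spec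
    have hy := (exists_approx v n y).choose_spec
    have hxy := (exists_approx v n (x * y)).choose_spec
    set a := (exists_approx v n x).choose
    set b := (exists_approx v n y).choose
    set c := (exists_approx v n (x * y)).choose
    have e : ((c : F) - ((a * b : 𝓞 F) : F)) = -((((x * y : unitsAt v) : Fˣ) : F) - c)
        + (((x : Fˣ) : F) * (((y : Fˣ) : F) - b) + (((x : Fˣ) : F) - a) * b) := by
      push_cast; ring
    rw [e]
    refine Valuation.map_add_le _ (by rwa [Valuation.map_neg]) (Valuation.map_add_le _ ?_ ?_)
    · rw [map_mul, x.2, one_mul]; exact hy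
    · rw [map_mul]; exact (mul_le_of_le_one_right' (val_int_le_one v b)).trans hx

lemma redHom_eq_iff (n : ℕ) (x : unitsAt v) (a : 𝓞 F) :
    redHom v n x = Ideal.Quotient.mk _ a ↔
      v.valuation F (((x : Fˣ) : F) - a) ≤ exp (-(n : ℤ)) := by
  have hx := (exists_approx v n x).choose_spec
  change Ideal.Quotient.mk _ (exists_approx v n x).choose = _ ↔ _
  rw [quot_eq_iff]
  set b := (exists_approx v n x).choose
  constructor
  · intro h
    have e : (((x : Fˣ) : F) - a) = (((x : Fˣ) : F) - b) + ((b : F) - a) := by ring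
    rw [e]; exact Valuation.map_add_le _ hx h
  · intro h
    have e : ((b : F) - a) = -(((x : Fˣ) : F) - b) + (((x : Fˣ) : F) - a) := by ring
    rw [e]; exact Valuation.map_add_le _ (by rwa [Valuation.map_neg]) h

lemma redHom_surj (n : ℕ) (hn : n ≠ 0) :
    Function.Surjective (redHom v n).toHomUnits := by
  intro r
  obtain ⟨a, ha⟩ := Ideal.Quotient.mk_surjective (r : 𝓞 F ⧸ v.asIdeal ^ n)
  have hav : a ∉ v.asIdeal := by
    intro h
    have hu : IsUnit (Ideal.Quotient.mk (v.asIdeal ^ n) a) := ha ▸ r.isUnit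
    have hu' := hu.map (Ideal.Quotient.factor (Ideal.pow_le_self (I := v.asIdeal) hn))
    rw [Ideal.Quotient.factor_mk, Ideal.Quotient.eq_zero_iff_mem.2 h] at hu'
    have := Ideal.Quotient.nontrivial_iff.2 v.isPrime.ne_top
    exact not_isUnit_zero hu'
  have h1 : v.valuation F (a : F) = 1 := v.valuation_eq_one_iff_notMem.2 hav
  have h0 : (a : F) ≠ 0 := by intro h; rw [h, map_zero] at h1; exact zero_ne_one h1
  refine ⟨⟨Units.mk0 _ h0, h1⟩, ?_⟩
  ext
  rw [MonoidHom.coe_toHomUnits, ← ha, redHom_eq_iff]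
  simp

lemma index_range_pow_two (G : Type*) [CommGroup G] [Finite G] :
    (powMonoidHom 2 : G →* G).range.index = Nat.card (powMonoidHom 2 : G →* G).ker := by
  have h1 := (powMonoidHom 2 : G →* G).range.card_mul_index
  have h2 := (powMonoidHom 2 : G →* G).ker.card_mul_index
  rw [Subgroup.index_ker, mul_comm] at h2
  have h3 : 0 < Nat.card (powMonoidHom 2 : G →* G).range := Nat.card_pos
  exact Nat.eq_of_mul_eq_mul_left h3 (h1.trans h2.symm)

variable {v}

lemma sqAt_inf_units {k : ℕ} (hk : v.valuation F 2 = exp (-(k : ℤ))) :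
    (sqAt (v.valuation F)).subgroupOf (unitsAt v) =
      (powMonoidHom 2 : (𝓞 F ⧸ v.asIdeal ^ (2 * k + 1))ˣ →* _).range.comap
        (redHom v (2 * k + 1)).toHomUnits := by
  have h4 : ∀ x : F, v.valuation F x < v.valuation F 4 ↔
      v.valuation F x ≤ exp (-((2 * k + 1 : ℕ) : ℤ)) := by
    intro x
    rw [← exp_add_one_le, val_four, hk, ← exp_add]
    congr! 2; push_cast; ring
  have h41 := val_four_le (v.valuation F)
  ext x
  rw [Subgroup.mem_subgroupOf, Subgroup.mem_comap]
  constructor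
  · rintro ⟨w, hw⟩
    have h1 := val_eq_one_of_sub_lt _ (hw.trans_le h41)
    have hwu : w ∈ unitsAt v := by
      rw [map_mul, x.2, one_mul, map_pow] at h1
      exact (pow_eq_one_iff.1 h1).resolve_right two_ne_zero
    refine ⟨(redHom v (2 * k + 1)).toHomUnits ⟨w, hwu⟩⁻¹, ?_⟩
    rw [powMonoidHom_apply, ← map_pow, inv_pow, map_inv, inv_eq_iff_mul_eq_one, ← map_mul]
    ext
    rw [MonoidHom.coe_toHomUnits, Units.val_one, ← map_one (Ideal.Quotient.mk _), redHom_eq_iff,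
      ← h4]
    simpa [mul_comm] using hw
  · rintro ⟨r, hr⟩
    obtain ⟨w, rfl⟩ := redHom_surj v (2 * k + 1) (by omega) r
    refine ⟨(w : Fˣ)⁻¹, ?_⟩
    rw [powMonoidHom_apply, ← map_pow, ← mul_inv_eq_one, ← map_inv, ← map_mul] at hr
    have hr' := congrArg Units.val hr
    rw [MonoidHom.coe_toHomUnits, Units.val_one, ← map_one (Ideal.Quotient.mk _),
      redHom_eq_iff, ← h4] at hr'
    have hx0 : v.valuation F ((x : Fˣ) : F) = 1 := x.2
    have hw0 : v.valuation F ((w : Fˣ) : F) = 1 := w.2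
    have e : ((x : Fˣ) : F) * (((w : Fˣ)⁻¹ : Fˣ) : F) ^ 2 - 1 =
      - (((w : Fˣ) : F) ^ 2 * (((x : Fˣ)⁻¹ : Fˣ) : F) - 1) * (((x : Fˣ) : F) / ((w : Fˣ) : F) ^ 2) := by
      push_cast
      have := (x : Fˣ).ne_zero
      have := (w : Fˣ).ne_zero
      field_simp
      ring
    rw [e, map_mul, map_div₀, map_pow, hx0, hw0, Valuation.map_neg]
    simpa using hr'

lemma card_map_pow {m n : ℕ} (hmn : m ≤ n) :
    Nat.card ((v.asIdeal ^ m).map (Ideal.Quotient.mk (v.asIdeal ^ n))) =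
      (Ideal.absNorm v.asIdeal) ^ (n - m) := by
  have hle : v.asIdeal ^ n ≤ v.asIdeal ^ m := Ideal.pow_le_pow_right hmn
  have h1 := Submodule.card_eq_card_quotient_mul_card
    ((v.asIdeal ^ m).map (Ideal.Quotient.mk (v.asIdeal ^ n)))
  have h2 : Nat.card ((𝓞 F ⧸ v.asIdeal ^ n) ⧸ (v.asIdeal ^ m).map (Ideal.Quotient.mk (v.asIdeal ^ n)))
      = Ideal.absNorm v.asIdeal ^ m := by
    rw [Nat.card_congr (DoubleQuot.quotQuotEquivQuotOfLE hle).toEquiv, ← map_pow]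
    rfl
  have h3 : Nat.card (𝓞 F ⧸ v.asIdeal ^ n) = Ideal.absNorm v.asIdeal ^ n := by
    rw [← map_pow]; rfl
  rw [h2, h3, show Ideal.absNorm v.asIdeal ^ n = Ideal.absNorm v.asIdeal ^ m *
    Ideal.absNorm v.asIdeal ^ (n - m) by rw [← pow_add, Nat.add_sub_of_le hmn]] at h1
  have h4 : 0 < Ideal.absNorm v.asIdeal :=
    Nat.pos_of_ne_zero (by rw [Ne, Ideal.absNorm_eq_zero_iff]; exact v.ne_bot)
  exact (Nat.eq_of_mul_eq_mul_left (pow_pos h4 m) (h1.trans (mul_comm _ _))).symm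

lemma mk_mem_map_pow {m n : ℕ} (hmn : m ≤ n) (a : 𝓞 F) :
    Ideal.Quotient.mk (v.asIdeal ^ n) a ∈ (v.asIdeal ^ m).map (Ideal.Quotient.mk (v.asIdeal ^ n)) ↔
      v.valuation F (a : F) ≤ exp (-(m : ℤ)) := by
  have hle : v.asIdeal ^ n ≤ v.asIdeal ^ m := Ideal.pow_le_pow_right hmn
  rw [Ideal.mem_quotient_iff_mem hle, ← v.intValuation_le_pow_iff_mem,
    ← v.valuation_of_algebraMap (K := F)]

lemma card_ker_sq {k : ℕ} (hk : v.valuation F 2 = exp (-(k : ℤ))) :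
    Nat.card (powMonoidHom 2 : (𝓞 F ⧸ v.asIdeal ^ (2 * k + 1))ˣ →* _).ker =
      2 * (Ideal.absNorm v.asIdeal) ^ k := by
  set R := 𝓞 F ⧸ v.asIdeal ^ (2 * k + 1) with hR
  set J : Ideal R := (v.asIdeal ^ (k + 1)).map (Ideal.Quotient.mk (v.asIdeal ^ (2 * k + 1))) with hJ
  have hfin : Finite R := Ideal.finiteQuotientOfFreeOfNeBot _ (pow_ne_zero _ v.ne_bot)
  have hJc : Nat.card J = Ideal.absNorm v.asIdeal ^ k := by
    rw [hJ, card_map_pow (by omega)]; congr 1; omega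
  have key : ∀ r : R, r ^ 2 = 1 ↔ r - 1 ∈ J ∨ r + 1 ∈ J := by
    intro r
    obtain ⟨a, rfl⟩ := Ideal.Quotient.mk_surjective r
    rw [← map_one (Ideal.Quotient.mk _), ← map_sub, ← map_add, ← map_pow, quot_eq_iff,
      mk_mem_map_pow (by omega), mk_mem_map_pow (by omega)]
    have e : ((a ^ 2 : 𝓞 F) : F) - ((1 : 𝓞 F) : F) = ((a - 1 : 𝓞 F) : F) * ((a + 1 : 𝓞 F) : F) := by
      push_cast; ring
    have e1 : ((a + 1 : 𝓞 F) : F) = ((a - 1 : 𝓞 F) : F) + 2 := by push_cast; ring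
    have e2 : ((a - 1 : 𝓞 F) : F) = ((a + 1 : 𝓞 F) : F) + (-2) := by push_cast; ring
    rw [e, map_mul]
    have hkk : exp (-((k + 1 : ℕ) : ℤ)) ≤ exp (-(k : ℤ)) := by rw [exp_le_exp]; push_cast; omega
    have hprod : exp (-((2 * k + 1 : ℕ) : ℤ)) = exp (-((k + 1 : ℕ) : ℤ)) * exp (-(k : ℤ)) := by
      rw [← exp_add]; congr 1; push_cast; ring
    constructor
    · intro h
      by_contra! hc
      obtain ⟨c1, c2⟩ := hc
      have hlt : ∀ x : ℤᵐ⁰, exp (-((k + 1 : ℕ) : ℤ)) < x → exp (-(k : ℤ)) ≤ x := by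
        intro x hx
        by_contra! hc
        have : x < exp (-((k + 1 : ℕ) : ℤ) + 1) := by
          refine hc.trans_le (le_of_eq ?_); congr 1; push_cast; ring
        exact absurd hx (not_lt.2 (exp_add_one_le.1 this))
      have := mul_le_mul' (hlt _ c1) (hlt _ c2)
      have h3 := this.trans h
      rw [← exp_add, exp_le_exp] at h3
      push_cast at h3; omega
    · rintro (h | h)
      · rw [hprod]
        refine mul_le_mul' h ?_
        rw [e1]
        exact Valuation.map_add_le _ (h.trans hkk) hk.le
      · rw [hprod, mul_comm]
        refine mul_le_mul' h ?_
        rw [e2]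
        exact Valuation.map_add_le _ (h.trans hkk) (by rw [Valuation.map_neg]; exact hk.le)
  have hdisj : ∀ r : R, ¬ (r - 1 ∈ J ∧ r + 1 ∈ J) := by
    rintro r ⟨h1, h2⟩
    have h3 := J.sub_mem h2 h1
    have e : r + 1 - (r - 1) = Ideal.Quotient.mk _ 2 := by rw [map_ofNat]; ring
    rw [e, mk_mem_map_pow (by omega)] at h3
    have : exp (-(k : ℤ)) ≤ exp (-((k + 1 : ℕ) : ℤ)) := by
      rw [← hk]; exact_mod_cast h3
    rw [exp_le_exp] at this
    push_cast at this; omega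
  have e1 : Nat.card {r : R // r - 1 ∈ J} = Nat.card J :=
    Nat.card_congr ((Equiv.subRight (1 : R)).subtypeEquiv (fun r => Iff.rfl))
  have e2 : Nat.card {r : R // r + 1 ∈ J} = Nat.card J :=
    Nat.card_congr ((Equiv.addRight (1 : R)).subtypeEquiv (fun r => Iff.rfl))
  have e3 : Nat.card (powMonoidHom 2 : Rˣ →* Rˣ).ker = Nat.card {r : R // r ^ 2 = 1} := by
    refine Nat.card_congr
      { toFun := fun u => ⟨u.1, by have := congrArg Units.val u.2; simpa using this⟩
        invFun := fun r => ⟨Units.mkOfMulEqOne r.1 r.1 (by rw [← pow_two]; exact r.2), by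
          rw [MonoidHom.mem_ker]; ext; simpa using r.2⟩
        left_inv := fun u => by ext; rfl
        right_inv := fun r => rfl }
  classical
  have e4 : Nat.card {r : R // r ^ 2 = 1} = Nat.card {r : R // r - 1 ∈ J ∨ r + 1 ∈ J} :=
    Nat.card_congr (Equiv.subtypeEquivRight key)
  have e5 : Nat.card {r : R // r - 1 ∈ J ∨ r + 1 ∈ J} =
      Nat.card ({r : R // r - 1 ∈ J} ⊕ {r : R // r + 1 ∈ J}) := by
    refine Nat.card_congr (subtypeOrEquiv (fun r : R => r - 1 ∈ J) (fun r : R => r + 1 ∈ J) ?_)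
    rw [Pi.disjoint_iff]
    intro r
    rw [Prop.disjoint_iff]
    by_contra! h
    exact hdisj r h
  rw [e3, e4, e5, Nat.card_sum, e1, e2, hJc]; ring

lemma relIndex_sqAt {k : ℕ} (hk : v.valuation F 2 = exp (-(k : ℤ))) :
    (sqAt (v.valuation F)).relIndex (unitsAt v) = 2 * (Ideal.absNorm v.asIdeal) ^ k := by
  have hfin : Finite (𝓞 F ⧸ v.asIdeal ^ (2 * k + 1)) :=
    Ideal.finiteQuotientOfFreeOfNeBot _ (pow_ne_zero _ v.ne_bot)
  rw [Subgroup.relIndex, sqAt_inf_units hk,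
    Subgroup.index_comap_of_surjective _ (redHom_surj v _ (by omega)), index_range_pow_two,
    card_ker_sq hk]

/-- the valuation modulo two -/
noncomputable def valHom (v : HeightOneSpectrum (𝓞 F)) : Fˣ →* Multiplicative (ZMod 2) where
  toFun x := Multiplicative.ofAdd ((WithZero.log (v.valuation F (x : F)) : ℤ) : ZMod 2)
  map_one' := by simp
  map_mul' x y := by
    rw [Units.val_mul, map_mul, WithZero.log_mul (by simp) (by simp)]
    simp

lemma mem_valHom_ker {x : Fˣ} :
    x ∈ (valHom v).ker ↔ Even (WithZero.log (v.valuation F (x : F))) := by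
  rw [MonoidHom.mem_ker, ← ZMod.intCast_eq_zero_iff_even, ← ofAdd_eq_one]
  rfl

lemma valHom_ker : (valHom v).ker = sqAt (v.valuation F) ⊔ unitsAt v := by
  apply le_antisymm
  · intro x hx
    obtain ⟨j, hj⟩ := mem_valHom_ker.1 hx
    obtain ⟨w, hw⟩ := v.valuation_surjective F (exp j)
    have hw0 : w ≠ 0 := by rintro rfl; simp at hw; exact exp_ne_zero hw.symm
    rw [← div_mul_cancel x (Units.mk0 w hw0 ^ 2), mul_comm]
    refine Subgroup.mul_mem_sup (sq_mem_sqAt _ _) ?_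
    rw [mem_unitsAt]
    push_cast
    rw [map_div₀, map_pow, Units.val_mk0, hw, pow_two, ← exp_add, ← hj, exp_log (by simp),
      div_self (by simp)]
  · refine sup_le ?_ ?_
    · rintro x ⟨w, hw⟩
      have h1 := val_eq_one_of_sub_lt _ (hw.trans_le (val_four_le _))
      have h2 := congrArg WithZero.log h1
      rw [map_mul, map_pow, WithZero.log_mul (by simp) (by simp), log_one, log_pow] at h2
      rw [mem_valHom_ker]
      refine ⟨-WithZero.log (v.valuation F (w : F)), ?_⟩
      simp only [nsmul_eq_mul, Nat.cast_ofNat] at h2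
      omega
    · intro x hx
      rw [mem_valHom_ker, (mem_unitsAt v).1 hx]
      simp

lemma index_valHom_ker (v : HeightOneSpectrum (𝓞 F)) : (valHom v).ker.index = 2 := by
  obtain ⟨w, hw⟩ := v.valuation_surjective F (exp 1)
  have hw0 : w ≠ 0 := by rintro rfl; simp at hw; exact exp_ne_zero hw.symm
  have : Function.Surjective (valHom v) := by
    intro y
    have hy : y = 1 ∨ y = Multiplicative.ofAdd 1 := by
      revert y; decide
    rcases hy with rfl | rfl
    · exact ⟨1, map_one _⟩
    · refine ⟨Units.mk0 w hw0, ?_⟩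
      simp [valHom, hw]
  rw [Subgroup.index_ker, MonoidHom.range_eq_top.2 this, Subgroup.card_top]
  simp

lemma index_sqAt {k : ℕ} (hk : v.valuation F 2 = exp (-(k : ℤ))) :
    (sqAt (v.valuation F)).index = 4 * (Ideal.absNorm v.asIdeal) ^ k := by
  rw [← Subgroup.relIndex_mul_index (le_sup_left : _ ≤ sqAt (v.valuation F) ⊔ unitsAt v),
    ← valHom_ker, index_valHom_ker, valHom_ker, Subgroup.relIndex_sup_left,
    relIndex_sqAt hk]
  ring

/-- the order of `2` at `v` -/
lemma exists_ord_two (v : HeightOneSpectrum (𝓞 F)) :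
    ∃ k : ℕ, v.valuation F 2 = exp (-(k : ℤ)) := by
  have h := val_two_le (v.valuation F)
  have h0 : v.valuation F 2 ≠ 0 := by simp
  rw [← exp_log h0, ← exp_zero, exp_le_exp] at h
  refine ⟨(-WithZero.log (v.valuation F 2)).toNat, ?_⟩
  rw [Int.toNat_of_nonneg (by omega), neg_neg, exp_log h0]

end Index
end QF

namespace QF

open IsDedekindDomain NumberField WithZero

/-- `E = F(s)` with `s² = a`, `a` not a square in `F`. -/
structure IsQuad {F E : Type*} [Field F] [Field E] [Algebra F E] (a : F) (s : E) : Prop where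
  sq : s ^ 2 = algebraMap F E a
  nsq : ¬ IsSquare a
  gen : ∀ z : E, ∃ x y : F, z = algebraMap F E x + algebraMap F E y * s

namespace IsQuad
variable {F E : Type*} [Field F] [Field E] [Algebra F E] {a : F} {s : E}

lemma ne_zero (h : IsQuad a s) : a ≠ 0 := fun h0 => h.nsq (h0 ▸ IsSquare.zero)

lemma eq_zero_of (h : IsQuad a s) {x y : F}
    (e : algebraMap F E x + algebraMap F E y * s = 0) : x = 0 ∧ y = 0 := by
  have hy : y = 0 := by
    by_contra hy
    refine h.nsq ⟨x / y, ?_⟩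
    have h1 : algebraMap F E x ^ 2 = algebraMap F E y ^ 2 * algebraMap F E a := by
      rw [← h.sq, eq_neg_of_add_eq_zero_left e]; ring
    rw [← map_pow, ← map_pow, ← map_mul] at h1
    have := (algebraMap F E).injective h1
    field_simp
    rw [this]; ring
  subst hy
  simpa using e

lemma inj (h : IsQuad a s) {x y x' y' : F}
    (e : algebraMap F E x + algebraMap F E y * s = algebraMap F E x' + algebraMap F E y' * s) :
    x = x' ∧ y = y' := by
  have := h.eq_zero_of (x := x - x') (y := y - y') (by
    rw [map_sub, map_sub]; linear_combination e)
  exact ⟨sub_eq_zero.1 this.1, sub_eq_zero.1 this.2⟩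

/-- the coordinates with respect to the basis `1, s` -/
noncomputable def re (h : IsQuad a s) (z : E) : F := (h.gen z).choose
/-- the second coordinate with respect to the basis `1, s` -/
noncomputable def im (h : IsQuad a s) (z : E) : F := (h.gen z).choose_spec.choose

lemma eq_re_im (h : IsQuad a s) (z : E) :
    z = algebraMap F E (h.re z) + algebraMap F E (h.im z) * s :=
  (h.gen z).choose_spec.choose_spec

lemma re_im_eq (h : IsQuad a s) {z : E} {x y : F}
    (e : z = algebraMap F E x + algebraMap F E y * s) : h.re z = x ∧ h.im z = y :=
  h.inj ((h.eq_re_im z).symm.trans e)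

lemma s_mul_s (h : IsQuad a s) : s * s = algebraMap F E a := by rw [← pow_two]; exact h.sq

/-- conjugation as an algebra hom -/
noncomputable def conjHom (h : IsQuad a s) : E →ₐ[F] E where
  toFun z := algebraMap F E (h.re z) - algebraMap F E (h.im z) * s
  map_one' := by
    obtain ⟨h1, h2⟩ := h.re_im_eq (z := 1) (x := 1) (y := 0) (by simp)
    rw [h1, h2]; simp
  map_mul' z w := by
    have hz := h.eq_re_im z
    have hw := h.eq_re_im w
    obtain ⟨h1, h2⟩ := h.re_im_eq (z := z * w) (x := h.re z * h.re w + h.im z * h.im w * a)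
      (y := h.re z * h.im w + h.im z * h.re w) (by
        conv_lhs => rw [hz, hw]
        simp only [map_add, map_mul, ← h.s_mul_s]; ring)
    rw [h1, h2]
    simp only [map_add, map_mul, ← h.s_mul_s]; ring
  map_zero' := by
    obtain ⟨h1, h2⟩ := h.re_im_eq (z := 0) (x := 0) (y := 0) (by simp)
    rw [h1, h2]; simp
  map_add' z w := by
    have hz := h.eq_re_im z
    have hw := h.eq_re_im w
    obtain ⟨h1, h2⟩ := h.re_im_eq (z := z + w) (x := h.re z + h.re w) (y := h.im z + h.im w) (by
        conv_lhs => rw [hz, hw]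
        simp only [map_add]; ring)
    rw [h1, h2]
    simp only [map_add]; ring
  commutes' r := by
    obtain ⟨h1, h2⟩ := h.re_im_eq (z := algebraMap F E r) (x := r) (y := 0) (by simp)
    rw [h1, h2]; simp

lemma conjHom_s (h : IsQuad a s) : h.conjHom s = -s := by
  obtain ⟨h1, h2⟩ := h.re_im_eq (z := s) (x := 0) (y := 1) (by simp)
  change algebraMap F E (h.re s) - algebraMap F E (h.im s) * s = -s
  rw [h1, h2]; simp

lemma conjHom_conjHom (h : IsQuad a s) (z : E) : h.conjHom (h.conjHom z) = z := by
  conv_rhs => rw [h.eq_re_im z]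
  conv_lhs => rw [h.eq_re_im z]
  simp [conjHom_s]

/-- conjugation -/
noncomputable def conj (h : IsQuad a s) : E ≃ₐ[F] E :=
  AlgEquiv.ofAlgHom h.conjHom h.conjHom (by ext z; exact h.conjHom_conjHom z)
    (by ext z; exact h.conjHom_conjHom z)

@[simp] lemma conj_s (h : IsQuad a s) : h.conj s = -s := h.conjHom_s
@[simp] lemma conj_conj (h : IsQuad a s) (z : E) : h.conj (h.conj z) = z := h.conjHom_conjHom z

lemma conj_eq (h : IsQuad a s) (z : E) :
    h.conj z = algebraMap F E (h.re z) - algebraMap F E (h.im z) * s := rfl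

lemma mul_conj (h : IsQuad a s) (z : E) :
    z * h.conj z = algebraMap F E (h.re z ^ 2 - a * h.im z ^ 2) := by
  rw [conj_eq]
  conv_lhs => enter [1]; rw [h.eq_re_im z]
  simp only [map_sub, map_pow, map_mul, ← h.s_mul_s]; ring

lemma add_conj (h : IsQuad a s) (z : E) :
    z + h.conj z = algebraMap F E (2 * h.re z) := by
  rw [conj_eq]
  conv_lhs => enter [1]; rw [h.eq_re_im z]
  simp only [map_mul, map_ofNat]; ring

lemma exists_of_conj_eq [CharZero F] (h : IsQuad a s) {z : E} (hz : h.conj z = z) :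
    ∃ x : F, z = algebraMap F E x := by
  refine ⟨h.re z, ?_⟩
  have h1 := h.add_conj z
  rw [hz, map_mul, map_ofNat, ← two_mul] at h1
  have : CharZero E := charZero_of_injective_algebraMap (algebraMap F E).injective
  exact mul_left_cancel₀ two_ne_zero h1

/-- the norm as a homomorphism on units -/
noncomputable def norm (h : IsQuad a s) : Eˣ →* Fˣ where
  toFun z := Units.mk0 (h.re z ^ 2 - a * h.im z ^ 2) (by
    intro h0
    have h1 := h.mul_conj (z : E)
    rw [h0, map_zero, mul_eq_zero] at h1
    rcases h1 with h1 | h1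
    · exact z.ne_zero h1
    · simp at h1)
  map_one' := by
    ext
    apply (algebraMap F E).injective
    rw [Units.val_mk0, ← h.mul_conj]; simp
  map_mul' z w := by
    ext
    apply (algebraMap F E).injective
    rw [Units.val_mk0, ← h.mul_conj, Units.val_mul, Units.val_mul, Units.val_mk0, Units.val_mk0,
      map_mul (algebraMap F E), ← h.mul_conj, ← h.mul_conj, map_mul]; ring

lemma algebraMap_norm (h : IsQuad a s) (z : Eˣ) :
    algebraMap F E (h.norm z) = z * h.conj z := by rw [h.mul_conj]; rfl

lemma range_norm (h : IsQuad a s) : h.norm.range = Nm a := by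
  ext x
  constructor
  · rintro ⟨z, rfl⟩
    exact ⟨_, _, rfl⟩
  · rintro ⟨x', y, e⟩
    have hn : algebraMap F E x' + algebraMap F E y * s ≠ 0 := by
      intro h0
      obtain ⟨rfl, rfl⟩ := h.eq_zero_of h0
      simp at e
    refine ⟨Units.mk0 _ hn, ?_⟩
    ext
    obtain ⟨h1, h2⟩ := h.re_im_eq (z := algebraMap F E x' + algebraMap F E y * s) rfl
    change h.re _ ^ 2 - a * h.im _ ^ 2 = _
    rw [Units.val_mk0, h1, h2, e]

/-- inclusion on units -/
noncomputable def incl (_ : IsQuad a s) : Fˣ →* Eˣ := Units.map (algebraMap F E)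

lemma norm_incl (h : IsQuad a s) (x : Fˣ) : h.norm (h.incl x) = x ^ 2 := by
  ext
  apply (algebraMap F E).injective
  rw [algebraMap_norm]
  simp [incl, pow_two]

lemma isQuadraticExtension (h : IsQuad a s) : Algebra.IsQuadraticExtension F E := by
  have hb : LinearIndependent F ![(1 : E), s] := by
    rw [LinearIndependent.pair_iff]
    intro x y e
    apply h.eq_zero_of
    simpa [Algebra.smul_def] using e
  have hs : ⊤ ≤ Submodule.span F (Set.range ![(1 : E), s]) := by
    intro z _
    obtain ⟨x, y, rfl⟩ := h.gen z
    simp only [Matrix.range_cons, Matrix.range_empty, Set.union_empty, Set.singleton_union]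
    rw [Submodule.mem_span_pair]
    exact ⟨x, y, by simp [Algebra.smul_def]⟩
  exact { finrank_eq_two' := by
            rw [Module.finrank_eq_card_basis (Module.Basis.mk hb hs)]; simp
          toFree := inferInstance }

end IsQuad


lemma exists_isQuad.{u} {F : Type u} [Field F] {a : F} (ha : ¬ IsSquare a) :
    ∃ (E : Type u) (_ : Field E) (_ : Algebra F E) (s : E), IsQuad a s := by
  have hirr : Irreducible (X ^ 2 - C a : F[X]) := by
    refine (X_pow_sub_C_irreducible_iff_of_prime Nat.prime_two).2 ?_
    intro b hb; exact ha ⟨b, by rw [← hb, pow_two]⟩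
  have : Fact (Irreducible (X ^ 2 - C a : F[X])) := ⟨hirr⟩
  refine ⟨AdjoinRoot (X ^ 2 - C a : F[X]), inferInstance, inferInstance, AdjoinRoot.root _, ?_, ha, ?_⟩
  · have := AdjoinRoot.eval₂_root (X ^ 2 - C a : F[X])
    rw [eval₂_sub, eval₂_pow, eval₂_X, eval₂_C, sub_eq_zero] at this
    exact this
  · intro z
    induction z using AdjoinRoot.induction_on with | ih p => 
    have hm : (X ^ 2 - C a : F[X]).Monic := monic_X_pow_sub_C a two_ne_zero
    have h1 : AdjoinRoot.mk (X ^ 2 - C a) p = AdjoinRoot.mk (X ^ 2 - C a) (p %ₘ (X ^ 2 - C a)) := by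
      rw [AdjoinRoot.mk_eq_mk]
      exact ⟨p /ₘ (X ^ 2 - C a), by rw [modByMonic_eq_sub_mul_div, sub_sub_cancel]⟩
    have hd : (p %ₘ (X ^ 2 - C a)).natDegree ≤ 1 := by
      have := natDegree_modByMonic_lt p hm (by
        intro h
        have := congrArg natDegree h
        rw [natDegree_X_pow_sub_C] at this; simp at this)
      rw [natDegree_X_pow_sub_C] at this; omega
    obtain ⟨y, x, e⟩ := exists_eq_X_add_C_of_natDegree_le_one hd
    refine ⟨x, y, ?_⟩
    rw [h1, e]
    simp only [map_add, map_mul, AdjoinRoot.mk_C, AdjoinRoot.mk_X]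
    rw [add_comm]; rfl
end QF

namespace QF

open IsDedekindDomain NumberField WithZero
open scoped Pointwise Classical

section Primes
variable {F E : Type*} [Field F] [Field E] [NumberField F] [NumberField E] [Algebra F E]

/-- the prime below -/
noncomputable def below (F : Type*) {E : Type*} [Field F] [Field E] [NumberField F]
    [NumberField E] [Algebra F E] (w : HeightOneSpectrum (𝓞 E)) : HeightOneSpectrum (𝓞 F) where
  asIdeal := w.asIdeal.under (𝓞 F)
  isPrime := inferInstance
  ne_bot := by
    have := w.ne_bot
    exact mt Ideal.eq_bot_of_comap_eq_bot this

instance (w : HeightOneSpectrum (𝓞 E)) : w.asIdeal.LiesOver (below F w).asIdeal := ⟨rfl⟩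

lemma mem_below {w : HeightOneSpectrum (𝓞 E)} {x : 𝓞 F} :
    x ∈ (below F w).asIdeal ↔ algebraMap (𝓞 F) (𝓞 E) x ∈ w.asIdeal := Iff.rfl

/-- ramification index -/
noncomputable def rami (F : Type*) {E : Type*} [Field F] [Field E] [NumberField F]
    [NumberField E] [Algebra F E] (w : HeightOneSpectrum (𝓞 E)) : ℕ :=
  (below F w).asIdeal.ramificationIdx' w.asIdeal

lemma val_algebraMap (w : HeightOneSpectrum (𝓞 E)) (x : F) :
    w.valuation E (algebraMap F E x) = (below F w).valuation F x ^ rami F w :=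
  (HeightOneSpectrum.valuation_liesOver E (below F w) w x).symm

lemma rami_ne_zero (w : HeightOneSpectrum (𝓞 E)) : rami F w ≠ 0 :=
  Ideal.IsDedekindDomain.ramificationIdx'_ne_zero_of_liesOver w.asIdeal (below F w).ne_bot

lemma val_algebraMap_lt_iff (w : HeightOneSpectrum (𝓞 E)) (x y : F) :
    w.valuation E (algebraMap F E x) < w.valuation E (algebraMap F E y) ↔
      (below F w).valuation F x < (below F w).valuation F y := by
  rw [val_algebraMap, val_algebraMap]
  exact pow_lt_pow_iff_left₀ zero_le zero_le (rami_ne_zero w)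

lemma val_algebraMap_eq_one_iff (w : HeightOneSpectrum (𝓞 E)) (x : F) :
    w.valuation E (algebraMap F E x) = 1 ↔ (below F w).valuation F x = 1 := by
  rw [val_algebraMap, pow_eq_one_iff_of_nonneg zero_le (rami_ne_zero w)]

lemma exists_above (E : Type*) [Field E] [NumberField E] [Algebra F E]
    (v : HeightOneSpectrum (𝓞 F)) : ∃ w : HeightOneSpectrum (𝓞 E), below F w = v := by
  obtain ⟨⟨P, hP, hPv⟩⟩ := (inferInstance : Nonempty (Ideal.primesOver v.asIdeal (𝓞 E)))
  refine ⟨⟨P, hP, Ideal.ne_bot_of_liesOver_of_ne_bot v.ne_bot P⟩, ?_⟩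
  ext1
  exact hPv.over.symm

/-- conjugate prime -/
noncomputable def cjAux (e : E ≃+* E) (w : HeightOneSpectrum (𝓞 E)) : HeightOneSpectrum (𝓞 E) :=
  w.comap (RingOfIntegers.mapRingEquiv e : 𝓞 E →+* 𝓞 E) (RingOfIntegers.mapRingEquiv e).surjective

lemma intVal_cjAux (e : E ≃+* E) (w : HeightOneSpectrum (𝓞 E)) (x : 𝓞 E) :
    (cjAux e w).intValuation x = w.intValuation (RingOfIntegers.mapRingEquiv e x) := by
  have hpow (n : ℕ) : x ∈ (cjAux e w).asIdeal ^ n ↔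
      RingOfIntegers.mapRingEquiv e x ∈ w.asIdeal ^ n := by
    have : (cjAux e w).asIdeal = w.asIdeal.map (RingOfIntegers.mapRingEquiv e).symm := by
      rw [Ideal.map_symm]; rfl
    rw [this, ← Ideal.map_pow, Ideal.map_symm]; rfl
  rcases eq_or_ne x 0 with rfl | hx
  · simp
  have key {a b : ℤᵐ⁰} (ha : a ≠ 0) (hb1 : b ≤ 1) (hb : b ≠ 0)
     (H : ∀ n : ℕ, a ≤ exp (-(n : ℤ)) ↔ b ≤ exp (-(n : ℤ))) : a ≤ b := by
    obtain ⟨k, rfl⟩ : ∃ k : ℕ, b = exp (-(k : ℤ)) := by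
      refine ⟨(-(log b)).toNat, ?_⟩
      have : log b ≤ 0 := by
        rw [← log_one]; exact (log_le_log hb one_ne_zero).2 hb1
      rw [Int.toNat_of_nonneg (by omega), neg_neg, exp_log hb]
    exact (H k).2 le_rfl
  have hx' : RingOfIntegers.mapRingEquiv e x ≠ 0 := by simpa using hx
  apply le_antisymm
  · apply key ((cjAux e w).intValuation_ne_zero _ hx) (w.intValuation_le_one _)
      (w.intValuation_ne_zero _ hx')
    intro n
    rw [HeightOneSpectrum.intValuation_le_pow_iff_mem,
      HeightOneSpectrum.intValuation_le_pow_iff_mem, hpow]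
  · apply key (w.intValuation_ne_zero _ hx') ((cjAux e w).intValuation_le_one _)
      ((cjAux e w).intValuation_ne_zero _ hx)
    intro n
    rw [HeightOneSpectrum.intValuation_le_pow_iff_mem,
      HeightOneSpectrum.intValuation_le_pow_iff_mem, hpow]

lemma val_cjAux (e : E ≃+* E) (w : HeightOneSpectrum (𝓞 E)) (x : E) :
    (cjAux e w).valuation E x = w.valuation E (e x) := by
  obtain ⟨x, y, hy, rfl⟩ := IsFractionRing.div_surjective (A := 𝓞 E) x
  rw [map_div₀, map_div₀, map_div₀, HeightOneSpectrum.valuation_of_algebraMap,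
    HeightOneSpectrum.valuation_of_algebraMap, intVal_cjAux, intVal_cjAux,
    ← HeightOneSpectrum.valuation_of_algebraMap (K := E),
    ← HeightOneSpectrum.valuation_of_algebraMap (K := E)]
  rfl

namespace IsQuad
variable {a : F} {s : E}

/-- conjugate prime -/
noncomputable def cj (h : IsQuad a s) (w : HeightOneSpectrum (𝓞 E)) : HeightOneSpectrum (𝓞 E) :=
  cjAux h.conj.toRingEquiv w

lemma val_cj (h : IsQuad a s) (w : HeightOneSpectrum (𝓞 E)) (x : E) :
    (h.cj w).valuation E x = w.valuation E (h.conj x) := val_cjAux _ w x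

lemma mem_cj (h : IsQuad a s) (w : HeightOneSpectrum (𝓞 E)) (x : 𝓞 E) :
    x ∈ (h.cj w).asIdeal ↔ RingOfIntegers.mapRingEquiv h.conj.toRingEquiv x ∈ w.asIdeal := Iff.rfl

lemma below_cj (h : IsQuad a s) (w : HeightOneSpectrum (𝓞 E)) : below F (h.cj w) = below F w := by
  ext x
  rw [mem_below, mem_below, mem_cj]
  have : (RingOfIntegers.mapRingEquiv h.conj.toRingEquiv) (algebraMap (𝓞 F) (𝓞 E) x)
    = algebraMap (𝓞 F) (𝓞 E) x := by
    ext; 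
    change h.conj (algebraMap F E x) = algebraMap F E x
    simp
  rw [this]

lemma algEquiv_eq (h : IsQuad a s) (σ : E ≃ₐ[F] E) : σ = 1 ∨ σ = h.conj := by
  have h1 : σ s * σ s = s * s := by
    rw [← map_mul, h.s_mul_s]; simp
  rcases mul_self_eq_mul_self_iff.1 h1 with h1 | h1
  · left; ext z
    obtain ⟨x, y, rfl⟩ := h.gen z
    simp [h1]
  · right; ext z
    obtain ⟨x, y, rfl⟩ := h.gen z
    simp [h1]

lemma isGalois (h : IsQuad a s) : IsGalois F E := by
  have := h.isQuadraticExtension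
  infer_instance

lemma smul_eq (h : IsQuad a s) (w : HeightOneSpectrum (𝓞 E)) :
    (h.conj • w.asIdeal : Ideal (𝓞 E)) = (h.cj w).asIdeal := by
  ext x
  rw [Ideal.mem_pointwise_smul_iff_inv_smul_mem, mem_cj]
  have : h.conj⁻¹ • x = (RingOfIntegers.mapRingEquiv h.conj.toRingEquiv) x := by
    rw [inv_smul_eq_iff]
    ext
    change (x : E) = h.conj (h.conj x)
    simp
  rw [this]

lemma eq_or_eq_cj (h : IsQuad a s) {w w' : HeightOneSpectrum (𝓞 E)}
    (hw : below F w' = below F w) : w' = w ∨ w' = h.cj w := by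
  have := h.isGalois
  have := IsGaloisGroup.of_isFractionRing Gal(E/F) (𝓞 F) (𝓞 E) F E
  have : w'.asIdeal.LiesOver (below F w).asIdeal := hw ▸ inferInstance
  obtain ⟨σ, hσ⟩ := Ideal.exists_smul_eq_of_isGaloisGroup (below F w).asIdeal w.asIdeal
    w'.asIdeal Gal(E/F)
  rcases h.algEquiv_eq σ with rfl | rfl
  · left; ext1; rw [← hσ, one_smul]
  · right; ext1; rw [← hσ, smul_eq]

lemma efg (h : IsQuad a s) (w : HeightOneSpectrum (𝓞 E)) :
    ∃ f : ℕ, Ideal.absNorm w.asIdeal = Ideal.absNorm (below F w).asIdeal ^ f ∧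
      (if h.cj w = w then rami F w * f = 2 else rami F w = 1 ∧ f = 1) := by
  have := h.isGalois
  have hq := h.isQuadraticExtension
  have := IsGaloisGroup.of_isFractionRing Gal(E/F) (𝓞 F) (𝓞 E) F E
  set v := below F w with hv
  have : w.asIdeal.LiesOver v.asIdeal := hv ▸ inferInstance
  have hvm : v.asIdeal.IsMaximal := v.isMaximal
  have hn : (v.asIdeal.primesOver (𝓞 E)).ncard = if h.cj w = w then 1 else 2 := by
    have : v.asIdeal.primesOver (𝓞 E) = {w.asIdeal, (h.cj w).asIdeal} := by
      ext P
      constructor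
      · rintro ⟨hP, hPv⟩
        let w' : HeightOneSpectrum (𝓞 E) := ⟨P, hP, Ideal.ne_bot_of_liesOver_of_ne_bot v.ne_bot P⟩
        have : below F w' = below F w := by
          ext1; rw [← hv]
          exact hPv.over.symm
        rcases h.eq_or_eq_cj this with h1 | h1
        · left; rw [← h1]
        · right; rw [← h1]; rfl
      · rintro (rfl | rfl)
        · exact ⟨inferInstance, inferInstance⟩
        · exact ⟨inferInstance, hv ▸ h.below_cj w ▸ inferInstance⟩
    rw [this]
    split_ifs with hc
    · rw [hc]; simp
    · rw [Set.ncard_pair]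
      intro h'; apply hc; ext1; exact h'.symm
  have hm := Ideal.ncard_primesOver_mul_ramificationIdxIn_mul_inertiaDegIn v.asIdeal (𝓞 E) Gal(E/F)
  rw [Ideal.ramificationIdxIn_eq_ramificationIdx v.asIdeal w.asIdeal Gal(E/F),
    Ideal.inertiaDegIn_eq_inertiaDeg v.asIdeal w.asIdeal Gal(E/F),
    IsGaloisGroup.card_eq_finrank Gal(E/F) F E, Algebra.IsQuadraticExtension.finrank_eq_two, hn] at hm
  refine ⟨v.asIdeal.inertiaDeg' w.asIdeal, ?_, ?_⟩
  · exact Ideal.absNorm_eq_pow_inertiaDeg'_of_liesOver _ _ v.isPrime v.ne_bot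
  · have e1 : rami F w = w.asIdeal.ramificationIdx (𝓞 F) := by
      exact Ideal.ramificationIdx'_eq_ramificationIdx _ _ v.ne_bot
    have e2 : v.asIdeal.inertiaDeg' w.asIdeal = w.asIdeal.inertiaDeg (𝓞 F) := Ideal.inertiaDeg'_eq_inertiaDeg _ _
    rw [e1, e2]
    split_ifs at hm ⊢ with hc
    · rw [one_mul] at hm; exact hm
    · have : w.asIdeal.ramificationIdx (𝓞 F) * w.asIdeal.inertiaDeg (𝓞 F) = 1 := by omega
      exact ⟨Nat.eq_one_of_mul_eq_one_right this, Nat.eq_one_of_mul_eq_one_left this⟩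

end IsQuad
end Primes
end QF

namespace QF

open IsDedekindDomain NumberField WithZero
open scoped Pointwise Classical

section Local
variable {F E : Type*} [Field F] [Field E] [NumberField F] [NumberField E] [Algebra F E]

/-- local squares at a finite prime -/
noncomputable abbrev Sq (v : HeightOneSpectrum (𝓞 F)) : Subgroup Fˣ := sqAt (v.valuation F)

lemma sqAt_algebraMap {w : HeightOneSpectrum (𝓞 E)} {z : Fˣ} (hz : z ∈ Sq (below F w)) :
    Units.map (algebraMap F E).toMonoidHom z ∈ Sq w := by
  obtain ⟨y, hy⟩ := mem_sqAt.1 hz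
  refine mem_sqAt.2 ⟨Units.map (algebraMap F E).toMonoidHom y, ?_⟩
  rw [← val_algebraMap_lt_iff w, map_ofNat] at hy
  convert hy using 2
  rw [map_sub, map_mul, map_pow, map_one]; rfl

namespace IsQuad
variable {a : Fˣ} {s : E}

lemma s_ne_zero (h : IsQuad (a : F) s) : s ≠ 0 := by
  rintro rfl
  have := h.sq
  rw [zero_pow two_ne_zero, eq_comm, map_eq_zero] at this
  exact a.ne_zero this

lemma val_conj (h : IsQuad (a : F) s) {w : HeightOneSpectrum (𝓞 E)} (hw : h.cj w = w) (z : E) :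
    w.valuation E (h.conj z) = w.valuation E z := by
  rw [← h.val_cj, hw]

lemma cj_ne_of_mem_sqAt (h : IsQuad (a : F) s) {w : HeightOneSpectrum (𝓞 E)}
    (ha : a ∈ Sq (below F w)) : h.cj w ≠ w := by
  intro hc
  obtain ⟨y, hy⟩ := mem_sqAt.1 ha
  set r : E := s * algebraMap F E y with hr
  have h1 := hy
  rw [← val_algebraMap_lt_iff w, map_ofNat] at h1
  have e : algebraMap F E (a * y ^ 2 - 1) = (r - 1) * (r + 1) := by
    rw [hr, map_sub, map_mul, ← h.s_mul_s]; simp; ring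
  have hc1 : w.valuation E (r + 1) = w.valuation E (r - 1) := by
    rw [← h.val_conj hc (r - 1), ← Valuation.map_neg]
    congr 1
    rw [hr]; simp; ring
  rw [e, map_mul, hc1, val_four] at h1
  have h2 : w.valuation E (r - 1) < w.valuation E 2 :=
    lt_of_not_ge fun hle => absurd h1 (not_lt.2 (mul_le_mul' hle hle))
  have h3 : w.valuation E 2 < w.valuation E 2 := by
    have e2 : (2 : E) = (r + 1) - (r - 1) := by ring
    conv_lhs => rw [e2]
    exact Valuation.map_sub_lt _ (hc1 ▸ h2) h2
  exact lt_irrefl _ h3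

lemma mem_sqAt_of_cj_ne (h : IsQuad (a : F) s) {w : HeightOneSpectrum (𝓞 E)}
    (hc : h.cj w ≠ w) : a ∈ Sq (below F w) := by
  have hs0 : s ≠ 0 := h.s_ne_zero
  have h40 : w.valuation E 4 ≠ 0 := by simp
  obtain ⟨n, hn⟩ := exists_exp_neg_lt h40
  obtain ⟨i, hi, j, hj, hij⟩ : ∃ i ∈ w.asIdeal ^ n, ∃ j ∈ (h.cj w).asIdeal ^ n, i + j = 1 := by
    apply Ideal.isCoprime_iff_exists.1
    apply IsCoprime.pow
    rw [Ideal.isCoprime_iff_sup_eq]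
    apply Ideal.IsMaximal.coprime_of_ne w.isMaximal (h.cj w).isMaximal
    intro h'; apply hc; ext1; exact h'.symm
  have hi' : w.valuation E (i : E) < w.valuation E 4 := by
    refine lt_of_le_of_lt ?_ hn
    rw [HeightOneSpectrum.valuation_of_algebraMap]
    exact (w.intValuation_le_pow_iff_mem i n).2 hi
  have hj' : w.valuation E (h.conj (j : E)) < w.valuation E 4 := by
    refine lt_of_le_of_lt ?_ hn
    rw [← h.val_cj, HeightOneSpectrum.valuation_of_algebraMap]
    exact ((h.cj w).intValuation_le_pow_iff_mem j n).2 hj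
  have hij' : (i : E) + (j : E) = 1 := by exact_mod_cast congrArg (algebraMap (𝓞 E) E) hij
  set z : E := s * (2 * (j : E) - 1) with hz
  set p : F := h.re z with hp
  have e1 : algebraMap F E p - s = s * (h.conj (j : E) * (-1) - (i : E)) := by
    have h2 := h.add_conj z
    rw [map_mul (algebraMap F E), map_ofNat] at h2
    apply mul_left_cancel₀ (two_ne_zero (α := E))
    rw [mul_sub, ← h2, hz]
    simp only [map_mul, map_sub, conj_s, map_one, map_ofNat]
    have : (j : E) = 1 - i := by rw [← hij']; ring
    have : h.conj (j : E) = 1 - h.conj (i : E) := by rw [this]; simp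
    rw [this]
    have : (j : E) = 1 - i := by rw [← hij']; ring
    rw [this]
    ring
  have h1 : w.valuation E (algebraMap F E p - s) < w.valuation E 4 * w.valuation E s := by
    rw [e1, map_mul, mul_comm]
    refine mul_lt_mul_of_pos_right ?_ (by simpa [zero_lt_iff] using hs0)
    exact Valuation.map_sub_lt _ (by simpa using hj') hi'
  have h2 : w.valuation E (algebraMap F E p + s) ≤ w.valuation E s := by
    have e2 : algebraMap F E p + s = (algebraMap F E p - s) + 2 * s := by ring
    rw [e2]
    apply Valuation.map_add_le
    · exact h1.le.trans (mul_le_of_le_one_left' (val_four_le _))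
    · rw [map_mul]; exact (mul_le_of_le_one_left' (val_two_le _))
  have h3 : w.valuation E (algebraMap F E (p ^ 2 - a)) <
      w.valuation E (algebraMap F E (4 * a)) := by
    have e3 : algebraMap F E (p ^ 2 - a) = (algebraMap F E p - s) * (algebraMap F E p + s) := by
      rw [map_sub, map_pow, ← h.s_mul_s]; ring
    have e4 : algebraMap F E (4 * a) = 4 * s * s := by
      rw [map_mul, ← h.s_mul_s, map_ofNat]; ring
    rw [e3, e4, map_mul, map_mul, map_mul]
    exact (mul_le_mul_right h2 _).trans_lt (mul_lt_mul_of_pos_right h1 (by simpa [zero_lt_iff] using hs0))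
  rw [val_algebraMap_lt_iff, map_mul] at h3
  have hp0 : p ≠ 0 := by
    rintro hp0
    rw [hp0, zero_pow two_ne_zero, zero_sub, Valuation.map_neg] at h3
    exact absurd h3 (not_lt.2 (mul_le_of_le_one_left' (val_four_le _)))
  have h4 : (Units.mk0 p hp0) ^ 2 / a ∈ Sq (below F w) := div_mem_sqAt (by simpa using h3)
  have := div_mem (sq_mem_sqAt ((below F w).valuation F) (Units.mk0 p hp0)) h4
  simpa using this

lemma norm_mem_sqAt (h : IsQuad (a : F) s) {w : HeightOneSpectrum (𝓞 E)} (hc : h.cj w = w)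
    {z : Eˣ} (hz : z ∈ Sq w) : h.norm z ∈ Sq (below F w) := by
  obtain ⟨y, hy⟩ := mem_sqAt.1 hz
  refine mem_sqAt.2 ⟨h.norm y, ?_⟩
  rw [← val_algebraMap_lt_iff w]
  have e : algebraMap F E ((h.norm z : F) * (h.norm y : F) ^ 2 - 1) =
     ((z : E) * y ^ 2) * h.conj ((z : E) * y ^ 2 - 1) + (z * y ^ 2 - 1) := by
    simp only [map_sub, map_mul, map_pow, algebraMap_norm, map_one]; ring
  rw [e, map_ofNat]
  refine Valuation.map_add_lt _ ?_ hy
  rw [map_mul, val_eq_one_of_sub_lt _ (hy.trans_le (val_four_le _)), one_mul, h.val_conj hc]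
  exact hy

lemma mem_sqAt_of_incl (h : IsQuad (a : F) s) {w : HeightOneSpectrum (𝓞 E)} (hc : h.cj w = w)
    {f : Fˣ} (hf : h.incl f ∈ Sq w) : f ∈ Sq (below F w) ∨ f * a ∈ Sq (below F w) := by
  have hs0 : s ≠ 0 := h.s_ne_zero
  set V := w.valuation E with hV
  obtain ⟨y, hy⟩ := sqAt_improve hf (γ := V 4 * V 4) (by simp)
  have hf' : ((h.incl f : Eˣ) : E) = algebraMap F E f := rfl
  rw [hf'] at hy
  set φ := algebraMap F E f with hφ
  set t : E := h.conj y with ht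
  have ht0 : t ≠ 0 := by simp [ht]
  have h4 : V 4 * V 4 ≤ V 4 := mul_le_of_le_one_left' (val_four_le _)
  have hct : V (φ * t ^ 2 - 1) < V 4 * V 4 := by
    rw [← h.val_conj hc] at hy
    simpa [hφ, ht] using hy
  have h1 : V (φ * t ^ 2) = 1 := val_eq_one_of_sub_lt _ ((hct.trans_le h4).trans_le (val_four_le _))
  set r : E := y / t with hr
  have hyr : (y : E) = r * t := by rw [hr]; field_simp
  have hrr : V ((r - 1) * (r + 1)) < V 4 * V 4 := by
    have e : φ * t ^ 2 * ((r - 1) * (r + 1)) = (φ * y ^ 2 - 1) - (φ * t ^ 2 - 1) := by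
      rw [hyr]; ring
    rw [← one_mul (V ((r - 1) * (r + 1))), ← h1, ← map_mul, e]
    exact Valuation.map_sub_lt _ hy hct
  -- common conclusion
  have fin (n : E) (hn : V n < V 2) : V (φ * t ^ 2 * (1 + n) ^ 2 - 1) < V 4 := by
    have e : φ * t ^ 2 * (1 + n) ^ 2 - 1 = φ * t ^ 2 * (n * (n + 2)) + (φ * t ^ 2 - 1) := by ring
    rw [e]
    refine Valuation.map_add_lt _ ?_ (hct.trans_le h4)
    rw [map_mul, h1, one_mul, map_mul, val_four]
    exact (mul_le_mul_right (Valuation.map_add_le _ hn.le le_rfl) _).trans_lt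
      (mul_lt_mul_of_pos_right hn (val_two_pos _))
  have half (m : E) (hm : V m < V 4) : V (m / 2) < V 2 := by
    rw [map_div₀, div_lt_iff₀ (val_two_pos _), ← val_four]; exact hm
  have key : V (r - 1) < V 4 ∨ V (r + 1) < V 4 := by
    by_contra! hcon
    rw [map_mul] at hrr
    exact absurd hrr (not_lt.2 (mul_le_mul' hcon.1 hcon.2))
  have hq (z : F) (b : Fˣ) (hz : V (algebraMap F E (b * z ^ 2 - 1)) < V 4) :
      b ∈ Sq (below F w) := by
    have h2 : (below F w).valuation F (b * z ^ 2 - 1) < (below F w).valuation F 4 := by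
      rw [← val_algebraMap_lt_iff w, map_ofNat]; exact hz
    have hz0 : z ≠ 0 := by
      rintro rfl
      have := h2.trans_le (val_four_le _)
      simp at this
    exact mem_sqAt.2 ⟨Units.mk0 z hz0, h2⟩
  rcases key with hk | hk
  · left
    apply hq (h.re y)
    have e2 : algebraMap F E (h.re y) = t * (1 + (r - 1) / 2) := by
      have := h.add_conj (y : E)
      rw [map_mul (algebraMap F E), map_ofNat] at this
      apply mul_left_cancel₀ (two_ne_zero (α := E))
      rw [← this, ← ht, hyr]; ring
    have := fin _ (half _ hk)
    rw [map_sub, map_mul, map_pow, e2, map_one]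
    convert this using 2; ring
  · right
    apply hq (h.im y)
    have e2 : algebraMap F E (h.im y) * s = t * (-(1 + (-((r + 1) / 2)))) := by
      have h5 := h.eq_re_im (y : E)
      have h6 : t = _ := h.conj_eq (y : E)
      apply mul_left_cancel₀ (two_ne_zero (α := E))
      have : 2 * (algebraMap F E (h.im y) * s) = y - t := by
        rw [h6]; conv_rhs => enter [1]; rw [h5]
        ring
      rw [this, hyr]; ring
    have := fin (-((r + 1) / 2)) (by rw [Valuation.map_neg]; exact half _ hk)
    have e3 : algebraMap F E (((f * a : Fˣ) : F) * (h.im y) ^ 2 - 1) =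
      φ * (algebraMap F E (h.im y) * s) ^ 2 - 1 := by
      rw [Units.val_mul, map_sub, map_mul, map_mul, map_pow, ← h.s_mul_s, map_one]; ring
    rw [e3, e2]
    convert this using 2; ring

end IsQuad

/-- local norm group at a finite prime -/
noncomputable abbrev NmAt (a : Fˣ) (v : HeightOneSpectrum (𝓞 F)) : Subgroup Fˣ := Nm (a : F) ⊔ Sq v

lemma index_sqAt_ne_zero (v : HeightOneSpectrum (𝓞 F)) : (Sq v).index ≠ 0 := by
  obtain ⟨k, hk⟩ := exists_ord_two v
  rw [index_sqAt hk]
  have : Ideal.absNorm v.asIdeal ≠ 0 := Ideal.absNorm_eq_zero_iff.not.2 v.ne_bot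
  positivity

theorem NmAt_ne_top {a : Fˣ} {v : HeightOneSpectrum (𝓞 F)} (ha : a ∉ Sq v) : NmAt a v ≠ ⊤ := by
  intro htop
  have hns : ¬ IsSquare (a : F) := by
    rintro ⟨b, hb⟩
    apply ha
    have hb0 : b ≠ 0 := by rintro rfl; simp at hb
    have : a = (Units.mk0 b hb0) ^ 2 := by ext; simp [hb, pow_two]
    rw [this]; exact sq_mem_sqAt _ _
  obtain ⟨E, _, _, s, h⟩ := exists_isQuad hns
  have := h.isQuadraticExtension
  have : NumberField E := NumberField.of_module_finite F E
  obtain ⟨w, rfl⟩ := exists_above E v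
  have hc : h.cj w = w := by
    by_contra hc
    exact ha (h.mem_sqAt_of_cj_ne hc)
  obtain ⟨k, hk⟩ := exists_ord_two (below F w)
  obtain ⟨f, hf, hef⟩ := h.efg w
  rw [if_pos hc] at hef
  have hq0 : 0 < Ideal.absNorm (below F w).asIdeal :=
    Nat.pos_of_ne_zero (Ideal.absNorm_eq_zero_iff.not.2 (below F w).ne_bot)
  set q := Ideal.absNorm (below F w).asIdeal
  have hkE : w.valuation E 2 = exp (-((rami F w * k : ℕ) : ℤ)) := by
    have := val_algebraMap w (2 : F)
    rw [map_ofNat, hk, ← exp_nsmul] at this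
    rw [this]; congr 1; simp
  have hME := index_sqAt hkE
  have hMF := index_sqAt hk
  rw [hf, ← pow_mul, ← mul_assoc, mul_comm f, hef, two_mul, pow_add] at hME
  set H := (Sq (below F w)).comap h.norm with hH
  have h1 : H.index = 4 * q ^ k := by
    rw [hH, Subgroup.index_comap, h.range_norm, ← Subgroup.relIndex_sup_right]
    change (Sq (below F w)).relIndex (NmAt a (below F w)) = _
    rw [htop,
      Subgroup.relIndex_top_right, hMF]
  have h2 : Sq w ≤ H := fun z hz => h.norm_mem_sqAt hc hz
  have h3 := Subgroup.relIndex_mul_index h2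
  rw [h1, hME] at h3
  have hqk : 0 < q ^ k := by positivity
  have h4 : (Sq w).relIndex H = q ^ k := by
    have : (Sq w).relIndex H * (4 * q ^ k) = q ^ k * (4 * q ^ k) := by rw [h3]; ring
    exact Nat.eq_of_mul_eq_mul_right (by positivity) this
  have h5 : h.incl.range ≤ H := by
    rintro _ ⟨x, rfl⟩
    rw [hH, Subgroup.mem_comap, h.norm_incl]
    exact sq_mem_sqAt _ _
  have h6 : (Sq w).relIndex h.incl.range ≤ q ^ k := by
    rw [← h4]
    exact Subgroup.relIndex_le_of_le_right h5 (by rw [h4]; exact hqk.ne')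
  rw [← Subgroup.index_comap] at h6
  have h7 : Sq (below F w) ≤ (Sq w).comap h.incl := fun z hz => sqAt_algebraMap hz
  have h8 := Subgroup.relIndex_mul_index h7
  have h9 : (Sq (below F w)).relIndex ((Sq w).comap h.incl) ∣ 2 := by
    rw [Subgroup.relIndex_dvd_two_iff]
    refine ⟨a, ?_, fun b hb => (h.mem_sqAt_of_incl hc hb).symm⟩
    have : (h.incl a) = (Units.mk0 s h.s_ne_zero) ^ 2 := by
      ext; simp [IsQuad.incl, h.sq]
    rw [Subgroup.mem_comap, this]; exact sq_mem_sqAt _ _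
  have h10 := Nat.le_of_dvd two_pos h9
  have h11 := Nat.mul_le_mul h10 h6
  rw [h8, hMF] at h11
  change 4 * q ^ k ≤ _ at h11
  omega

end Local
end QF

namespace QF

open IsDedekindDomain NumberField WithZero
open scoped Pointwise Classical

section WA
variable {F : Type*} [Field F] [NumberField F]

/-- composition of a real embedding with the inclusion into `ℂ` -/
noncomputable def toC (φ : F →+* ℝ) : F →+* ℂ := Complex.ofRealHom.comp φ

lemma toC_injective : Function.Injective (toC (F := F)) := by
  intro φ ψ h
  ext x
  have := RingHom.congr_fun h x
  simpa [toC] using this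

instance : Finite (F →+* ℝ) := Finite.of_injective _ (toC_injective (F := F))
noncomputable instance : Fintype (F →+* ℝ) := Fintype.ofFinite _

/-- absolute value attached to a finite prime or a real embedding -/
noncomputable def absv : HeightOneSpectrum (𝓞 F) ⊕ (F →+* ℝ) → AbsoluteValue F ℝ
  | .inl v => NumberField.HeightOneSpectrum.adicAbv F v
  | .inr φ => (InfinitePlace.mk (toC φ)).1

lemma absv_inr (φ : F →+* ℝ) (x : F) : absv (.inr φ) x = |φ x| := by
  change InfinitePlace.mk (toC φ) x = _
  simp [toC]

lemma absv_inl_lt (v : HeightOneSpectrum (𝓞 F)) (x y : F) :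
    absv (.inl v) x < absv (.inl v) y ↔ v.valuation F x < v.valuation F y := by
  change NumberField.HeightOneSpectrum.adicAbv F v x < NumberField.HeightOneSpectrum.adicAbv F v y ↔ _
  rw [NumberField.HeightOneSpectrum.adicAbv_def, NumberField.HeightOneSpectrum.adicAbv_def,
    NNReal.coe_lt_coe]
  exact (WithZeroMulInt.toNNReal_strictMono
    (NumberField.HeightOneSpectrum.one_lt_absNorm_nnreal v)).lt_iff_lt

lemma absv_inl_lt_one (v : HeightOneSpectrum (𝓞 F)) (x : F) :
    absv (.inl v) x < 1 ↔ v.valuation F x < 1 := by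
  have := absv_inl_lt v x 1
  rwa [(absv (.inl v)).map_one, (v.valuation F).map_one] at this

lemma weak_approx (P : Finset (HeightOneSpectrum (𝓞 F))) (c : HeightOneSpectrum (𝓞 F) → F)
    (γ : HeightOneSpectrum (𝓞 F) → ℤᵐ⁰) (hγ : ∀ v, γ v ≠ 0) (d : (F →+* ℝ) → F) {ε : ℝ}
    (hε : 0 < ε) :
    ∃ x : F, (∀ v ∈ P, v.valuation F (x - c v) < γ v) ∧ ∀ φ : F →+* ℝ, |φ (x - d φ)| < ε := by
  let ι := P ⊕ (F →+* ℝ)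
  let A : ι → AbsoluteValue F ℝ := fun i => absv (Sum.map Subtype.val id i)
  have hnt : ∀ i, (A i).IsNontrivial := by
    rintro (⟨v, hv⟩ | φ)
    · obtain ⟨π, hπ⟩ := v.valuation_exists_uniformizer F
      refine ⟨π, by rintro rfl; rw [map_zero] at hπ; exact exp_ne_zero hπ.symm, ?_⟩
      have : absv (.inl v) π < 1 := by
        rw [absv_inl_lt_one, hπ, ← exp_zero, exp_lt_exp]; norm_num
      exact this.ne
    · exact InfinitePlace.isNontrivial _
  have hpw : Pairwise fun i j ↦ ¬(A i).IsEquiv (A j) := by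
    have hfi (v : HeightOneSpectrum (𝓞 F)) (φ : F →+* ℝ) :
        ¬ (absv (.inl v)).IsEquiv (absv (.inr φ)) := by
      intro h
      have h1 := (h.le_one_iff (x := 2))
      have h2 : absv (.inl v) (2 : F) ≤ 1 := by
        rw [← not_lt, ← (absv (.inl v)).map_one, absv_inl_lt, (v.valuation F).map_one, not_lt]
        exact val_two_le _
      have := h1.1 h2
      rw [absv_inr, map_ofNat] at this
      norm_num at this
    rintro (⟨v, hv⟩ | φ) (⟨w, hw⟩ | ψ) hne h
    · apply hne
      have : v = w := by
        apply HeightOneSpectrum.eq_of_valuation_isEquiv_valuation (K := F)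
        rw [Valuation.isEquiv_iff_val_lt_one]
        intro x
        have := h.lt_one_iff (x := x)
        change absv (.inl v) x < 1 ↔ absv (.inl w) x < 1 at this
        rwa [absv_inl_lt_one, absv_inl_lt_one] at this
      subst this; rfl
    · exact hfi v ψ h
    · exact hfi w φ h.symm
    · apply hne
      have : InfinitePlace.mk (toC φ) = InfinitePlace.mk (toC ψ) := InfinitePlace.eq_iff_isEquiv.2 h
      rw [InfinitePlace.mk_eq_iff] at this
      have h3 : ComplexEmbedding.conjugate (toC φ) = toC φ := by
        ext x; simp [toC, ComplexEmbedding.conjugate]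
      rw [h3, or_self] at this
      rw [toC_injective this]
  have hd := AbsoluteValue.denseRange_algebraMap_pi hnt hpw
  -- radii
  have hr (v : HeightOneSpectrum (𝓞 F)) : ∃ y : F, y ≠ 0 ∧ v.valuation F y < γ v := by
    obtain ⟨n, hn⟩ := exists_exp_neg_lt (hγ v)
    obtain ⟨y, hy⟩ := v.valuation_surjective F (exp (-(n : ℤ)))
    refine ⟨y, ?_, hy ▸ hn⟩
    rintro rfl; rw [map_zero] at hy; exact exp_ne_zero hy.symm
  choose y hy0 hy using hr
  obtain ⟨r, hr0, hr⟩ : ∃ r : ℝ, 0 < r ∧ ∀ t ∈ insert ε (P.image fun v => absv (.inl v) (y v)),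
      r ≤ t := by
    let T := insert ε (P.image fun v => absv (.inl v) (y v))
    have hT : T.Nonempty := ⟨ε, Finset.mem_insert_self _ _⟩
    refine ⟨T.min' hT, ?_, fun t ht => T.min'_le t ht⟩
    have := T.min'_mem hT
    rw [Finset.mem_insert, Finset.mem_image] at this
    rcases this with h | ⟨v, -, h⟩
    · rwa [h]
    · rw [← h]; exact (absv (.inl v)).pos (hy0 v)
  let z : (i : ι) → WithAbs (A i) := fun i => WithAbs.toAbs (A i) (Sum.elim (fun v => c v.1) d i)
  obtain ⟨x, hx⟩ := Metric.denseRange_iff.1 hd z r hr0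
  have key (i : ι) : A i (x - Sum.elim (fun v => c v.1) d i) < r := by
    have h1 := (dist_le_pi_dist z _ i).trans_lt hx
    rw [dist_comm, dist_eq_norm] at h1
    exact h1
  refine ⟨x, fun v hv => ?_, fun φ => ?_⟩
  · refine lt_trans ?_ (hy v)
    rw [← absv_inl_lt]
    exact (key (.inl ⟨v, hv⟩)).trans_le
      (hr _ (Finset.mem_insert_of_mem (Finset.mem_image_of_mem _ hv)))
  · rw [← absv_inr]
    exact (key (.inr φ)).trans_le (hr _ (Finset.mem_insert_self _ _))

/-- finite primes and real embeddings -/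
abbrev Pl (F : Type*) [Field F] [NumberField F] := HeightOneSpectrum (𝓞 F) ⊕ (F →+* ℝ)

/-- elements positive at a real embedding -/
def posAt (φ : F →+* ℝ) : Subgroup Fˣ where
  carrier := {z | 0 < φ z}
  one_mem' := by simp
  mul_mem' := by intro a b ha hb; simpa using mul_pos ha hb
  inv_mem' := by intro a ha; simpa using ha

lemma mem_posAt {φ : F →+* ℝ} {z : Fˣ} : z ∈ posAt φ ↔ 0 < φ z := Iff.rfl

/-- local squares at a place -/
noncomputable def SqP : Pl F → Subgroup Fˣ
  | .inl v => Sq v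
  | .inr φ => posAt φ

/-- local norms at a place -/
noncomputable abbrev NmP (a : Fˣ) (p : Pl F) : Subgroup Fˣ := Nm (a : F) ⊔ SqP p

lemma sq_mem_SqP (p : Pl F) (z : Fˣ) : z ^ 2 ∈ SqP p := by
  rcases p with v | φ
  · exact sq_mem_sqAt _ _
  · change 0 < φ _
    have : φ (z : F) ≠ 0 := by simp
    rw [Units.val_pow_eq_pow_val, map_pow]; positivity

lemma weak_approx_units (P : Finset (HeightOneSpectrum (𝓞 F))) (c : Pl F → Fˣ) :
    ∃ x : Fˣ, (∀ v ∈ P, x / c (.inl v) ∈ Sq v) ∧ ∀ φ : F →+* ℝ, x / c (.inr φ) ∈ posAt φ := by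
  obtain ⟨ε, hε0, hε⟩ : ∃ ε : ℝ, 0 < ε ∧ ∀ φ : F →+* ℝ, ε ≤ |φ (c (.inr φ))| := by
    let T : Finset ℝ := insert 1 (Finset.univ.image fun φ : F →+* ℝ => |φ (c (.inr φ))|)
    have hT : T.Nonempty := ⟨1, Finset.mem_insert_self _ _⟩
    refine ⟨T.min' hT, ?_, fun φ => T.min'_le _
      (Finset.mem_insert_of_mem (Finset.mem_image_of_mem _ (Finset.mem_univ _)))⟩
    have := T.min'_mem hT
    rw [Finset.mem_insert, Finset.mem_image] at this
    rcases this with h | ⟨v, -, h⟩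
    · rw [h]; exact one_pos
    · rw [← h]; simp
  obtain ⟨x, hx1, hx2⟩ := weak_approx P (fun v => (c (.inl v) : F))
    (fun v => v.valuation F 4 * v.valuation F (c (.inl v)))
    (fun v => mul_ne_zero (val_four_pos (v.valuation F)).ne' (by simp)) (fun φ => (c (.inr φ) : F)) hε0
  by_cases h0 : x = 0
  · subst h0
    refine ⟨1, fun v hv => ?_, fun φ => ?_⟩
    · have := hx1 v hv
      rw [zero_sub, Valuation.map_neg] at this
      exact absurd this (not_lt.2 (mul_le_of_le_one_left' (val_four_le _)))
    · have := hx2 φ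
      rw [zero_sub, map_neg, abs_neg] at this
      exact absurd this (not_lt.2 (hε φ))
  · refine ⟨Units.mk0 x h0, fun v hv => div_mem_sqAt (hx1 v hv), fun φ => ?_⟩
    have h1 := (hx2 φ).trans_le (hε φ)
    have h2 : φ (c (.inr φ)) ≠ 0 := by simp
    rw [mem_posAt, Units.val_div_eq_div_val, map_div₀, Units.val_mk0]
    rw [map_sub] at h1
    rcases lt_or_gt_of_ne h2 with h | h
    · rw [abs_of_neg h, abs_lt] at h1
      exact div_pos_of_neg_of_neg (by linarith) h
    · rw [abs_of_pos h, abs_lt] at h1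
      exact div_pos (by linarith) h

end WA
end QF

namespace QF

open IsDedekindDomain NumberField WithZero
open scoped Pointwise Classical

section Grp

lemma finrank_range_add_ker_int {M M' : Type*} [AddCommGroup M] [AddCommGroup M']
    [Module.Finite ℤ M] (f : M →ₗ[ℤ] M') :
    Module.finrank ℤ (LinearMap.range f) + Module.finrank ℤ (LinearMap.ker f) =
      Module.finrank ℤ M := by
  rw [← Submodule.finrank_quotient_add_finrank (LinearMap.ker f), f.quotKerEquivRange.finrank_eq]

lemma index_range_pow_two_of_fg (G : Type*) [CommGroup G] [Module.Finite ℤ (Additive G)]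
    (hG : ∀ g : G, g ^ 2 = 1 → ∀ h : G, h ^ 2 = 1 → g ≠ 1 → h ≠ 1 → g = h)
    (hG' : ∃ g : G, g ^ 2 = 1 ∧ g ≠ 1) :
    (powMonoidHom 2 : G →* G).range.index = 2 ^ (Module.finrank ℤ (Additive G) + 1) := by
  have hfg : AddGroup.FG (Additive G) := Module.Finite.iff_addGroup_fg.1 inferInstance
  obtain ⟨n, ι, _, p, hp, e, ⟨f⟩⟩ := AddCommGroup.equiv_free_prod_directSum_zmod (Additive G)
  set T := DirectSum ι fun i => ZMod (p i ^ e i)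
  have : ∀ i, NeZero (p i ^ e i) := fun i => ⟨pow_ne_zero _ (hp i).ne_zero⟩
  have : ∀ i, Finite (ZMod (p i ^ e i)) := fun i => Finite.of_fintype _
  have hT : Finite T := Finite.of_equiv _ (DirectSum.addEquivProd _).symm.toEquiv
  have hrk : Module.finrank ℤ (Additive G) = n := by
    let φ := (LinearMap.fst ℤ (Fin n →₀ ℤ) T).comp f.toIntLinearEquiv.toLinearMap
    have hr := finrank_range_add_ker_int φ
    have hφ : Function.Surjective φ := fun x => ⟨f.symm (x, 0), by simp [φ]⟩
    have hk : Finite (LinearMap.ker φ) := by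
      refine Finite.of_injective (fun x : LinearMap.ker φ => (f x.1).2) fun x y hxy => ?_
      have hx : (f x.1).1 = 0 := x.2
      have hy : (f y.1).1 = 0 := y.2
      exact Subtype.ext (f.injective (Prod.ext (hx.trans hy.symm) hxy))
    have h0 : Module.finrank ℤ (LinearMap.ker φ) = 0 := by
      rw [Module.finrank_eq_zero_iff_isTorsion]
      exact isAddTorsion_iff_isTorsion_int.1 isAddTorsion_of_finite
    rw [h0, LinearMap.range_eq_top.2 hφ, finrank_top, Module.finrank_finsupp_self,
      Fintype.card_fin] at hr
    omega
  -- index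
  have h1 : (powMonoidHom 2 : G →* G).range.index =
      (nsmulAddMonoidHom 2 : ((Fin n →₀ ℤ) × T) →+ _).range.index := by
    have : (powMonoidHom 2 : G →* G).range.index =
      (nsmulAddMonoidHom 2 : Additive G →+ _).range.index := rfl
    rw [this, ← AddSubgroup.index_map_equiv _ f, AddMonoidHom.map_range]
    congr 1
    ext x
    constructor
    · rintro ⟨y, rfl⟩; exact ⟨f y, by simp⟩
    · rintro ⟨y, rfl⟩; exact ⟨f.symm y, by simp⟩
  have h2 : (nsmulAddMonoidHom 2 : ((Fin n →₀ ℤ) × T) →+ _).range =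
      (nsmulAddMonoidHom 2 : (Fin n →₀ ℤ) →+ _).range.prod (nsmulAddMonoidHom 2 : T →+ _).range := by
    ext ⟨x, y⟩
    simp [AddSubgroup.mem_prod]
  have h3 : (nsmulAddMonoidHom 2 : (Fin n →₀ ℤ) →+ _).range.index = 2 ^ n := by
    have := ModN.natCard_eq (G := Fin n →₀ ℤ) (n := 2)
    rw [Module.finrank_finsupp_self, Fintype.card_fin] at this
    rw [← this, AddSubgroup.index]
    congr 2
  have h4 : (nsmulAddMonoidHom 2 : T →+ _).range.index = Nat.card (nsmulAddMonoidHom 2 : T →+ _).ker :=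
    index_range_pow_two (Multiplicative T)
  have h5 : Nat.card (nsmulAddMonoidHom 2 : T →+ _).ker = 2 := by
    obtain ⟨g, hg, hg1⟩ := hG'
    have hz : ∀ z : Fin n →₀ ℤ, 2 • z = 0 → z = 0 := fun z hz => by
      ext i; have := DFunLike.congr_fun hz i; simpa using this
    have hfst : ∀ g : G, g ^ 2 = 1 → (f (Additive.ofMul g)).1 = 0 := fun g hg => by
      apply hz
      rw [← Prod.smul_fst, ← map_nsmul, ← ofMul_pow, hg]; simp
    have hsnd : ∀ g : G, g ^ 2 = 1 → 2 • (f (Additive.ofMul g)).2 = 0 := fun g hg => by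
      rw [← Prod.smul_snd, ← map_nsmul, ← ofMul_pow, hg]; simp
    rw [Nat.card_eq_two_iff]
    have key : ∀ t : (nsmulAddMonoidHom 2 : T →+ _).ker, ∃ h : G, h ^ 2 = 1 ∧ f (Additive.ofMul h) = (0, t.1) := by
      rintro ⟨t, ht⟩
      refine ⟨(f.symm (0, t)).toMul, ?_, by simp⟩
      apply Additive.ofMul.injective
      rw [ofMul_pow, ofMul_toMul, ← map_nsmul]
      have ht' : 2 • t = 0 := ht
      rw [Prod.smul_mk, ht']; simp
    refine ⟨0, ⟨(f (Additive.ofMul g)).2, hsnd g hg⟩, ?_, ?_⟩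
    · intro h0
      have h0 := congrArg Subtype.val h0
      apply hg1
      have : f (Additive.ofMul g) = 0 := Prod.ext (hfst g hg) h0.symm
      rw [map_eq_zero_iff f f.injective] at this
      exact this
    · rw [Set.eq_univ_iff_forall]
      intro t
      obtain ⟨h, hh, hft⟩ := key t
      by_cases h1 : h = 1
      · left
        subst h1
        rw [ofMul_one, map_zero] at hft
        exact Subtype.ext (congrArg Prod.snd hft).symm
      · right
        obtain rfl := hG h hh g hg h1 hg1
        exact Subtype.ext (congrArg Prod.snd hft).symm
  rw [h1, h2, AddSubgroup.index_prod, h3, h4, h5, hrk, pow_succ]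

/-- abstract index computation for the cyclic group of order two -/
lemma herbrand_two {U A M : Type*} [CommGroup U] [CommGroup A] [CommGroup M] (N : A →* U)
    (i : U →* A) (θ : A →* M) (j : M →* A) (hN : ∀ u, N (i u) = u ^ 2) (hθ : ∀ m, θ (j m) = m ^ 2)
    (hkN : N.ker = j.range) (hkθ : θ.ker = i.range) (hs : Function.Surjective θ) :
    (powMonoidHom 2 : U →* U).range.index =
      N.range.index * (powMonoidHom 2 : M →* M).range.index := by
  have h1 : (powMonoidHom 2 : U →* U).range = i.range.map N := by
    rw [MonoidHom.map_range]; congr 1; ext u; simp [hN]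
  have h2 : (powMonoidHom 2 : M →* M).range = j.range.map θ := by
    rw [MonoidHom.map_range]; congr 1; ext u; simp [hθ]
  rw [h1, h2, Subgroup.index_map, Subgroup.index_map, hkN, hkθ, MonoidHom.range_eq_top.2 hs,
    Subgroup.index_top, mul_one, sup_comm, mul_comm]

end Grp
end QF

namespace QF

open IsDedekindDomain NumberField WithZero
open scoped Pointwise Classical nonZeroDivisors

section SU
variable {F : Type*} [Field F] [NumberField F]

/-- multiplicity of a prime in an ideal -/
noncomputable def cnt (w : HeightOneSpectrum (𝓞 F)) (I : Ideal (𝓞 F)) : ℕ :=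
  (Associates.mk w.asIdeal).count (Associates.mk I).factors

lemma cnt_mul (w : HeightOneSpectrum (𝓞 F)) {I J : Ideal (𝓞 F)} (hI : I ≠ 0) (hJ : J ≠ 0) :
    cnt w (I * J) = cnt w I + cnt w J := by
  rw [cnt, ← Associates.mk_mul_mk, Associates.count_mul (Associates.mk_ne_zero.2 hI)
    (Associates.mk_ne_zero.2 hJ) w.associates_irreducible]; rfl

lemma cnt_pow (w : HeightOneSpectrum (𝓞 F)) {I : Ideal (𝓞 F)} (hI : I ≠ 0) (k : ℕ) :
    cnt w (I ^ k) = k * cnt w I := by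
  rw [cnt, Associates.mk_pow, Associates.count_pow (Associates.mk_ne_zero.2 hI)
    w.associates_irreducible]; rfl

lemma cnt_self (w : HeightOneSpectrum (𝓞 F)) : cnt w w.asIdeal = 1 :=
  Associates.count_self w.associates_irreducible

lemma cnt_of_ne {w v : HeightOneSpectrum (𝓞 F)} (h : w ≠ v) : cnt w v.asIdeal = 0 := by
  refine Associates.count_eq_zero_of_ne w.associates_irreducible v.associates_irreducible ?_
  intro h'
  exact h (HeightOneSpectrum.ext (associated_iff_eq.1 (Associates.mk_eq_mk_iff_associated.1 h')))

lemma cnt_eq_zero {w : HeightOneSpectrum (𝓞 F)} {I : Ideal (𝓞 F)} (hI : I ≠ 0)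
    (h : ¬ w.asIdeal ∣ I) : cnt w I = 0 := by
  by_contra h'
  exact h ((Associates.count_ne_zero_iff_dvd hI w.irreducible).1 h')

lemma val_eq_cnt (w : HeightOneSpectrum (𝓞 F)) {x : 𝓞 F} (hx : x ≠ 0) :
    w.valuation F (algebraMap (𝓞 F) F x) = exp (-(cnt w (Ideal.span {x}) : ℤ)) := by
  rw [HeightOneSpectrum.valuation_of_algebraMap, HeightOneSpectrum.intValuation_if_neg _ hx]; rfl

lemma finite_val_ne_one (x : Fˣ) : {v : HeightOneSpectrum (𝓞 F) | v.valuation F (x : F) ≠ 1}.Finite := by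
  refine ((HeightOneSpectrum.Support.finite (𝓞 F) (x : F)).union
    (HeightOneSpectrum.Support.finite (𝓞 F) ((x⁻¹ : Fˣ) : F))).subset ?_
  intro v hv
  rcases lt_or_gt_of_ne hv with h | h
  · right
    change 1 < v.valuation F _
    rw [Units.val_inv_eq_inv_val, map_inv₀]
    exact (one_lt_inv₀ (by simp [zero_lt_iff])).2 h
  · exact Or.inl h

/-- the group of `S`-units -/
def UnS (S : Finset (HeightOneSpectrum (𝓞 F))) : Subgroup Fˣ where
  carrier := {x | ∀ v ∉ S, v.valuation F (x : F) = 1}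
  one_mem' := by intro v _; simp
  mul_mem' := by intro x y hx hy v hv; rw [Units.val_mul, map_mul, hx v hv, hy v hv, one_mul]
  inv_mem' := by intro x hx v hv; rw [Units.val_inv_eq_inv_val, map_inv₀, hx v hv, inv_one]

lemma UnS_mono {S T : Finset (HeightOneSpectrum (𝓞 F))} (h : S ⊆ T) : UnS S ≤ UnS T :=
  fun _ hx v hv => hx v fun h' => hv (h h')

lemma exists_mem_UnS (x : Fˣ) : ∃ S : Finset (HeightOneSpectrum (𝓞 F)), x ∈ UnS S :=
  ⟨(finite_val_ne_one x).toFinset, fun v hv => by simpa using hv⟩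

/-- every fractional ideal is principal up to primes in `S` -/
def ClTriv (S : Finset (HeightOneSpectrum (𝓞 F))) : Prop :=
  ∀ n : HeightOneSpectrum (𝓞 F) → ℤ, n.support.Finite →
    ∃ x : Fˣ, ∀ v ∉ S, v.valuation F (x : F) = exp (n v)

lemma ClTriv.mono {S T : Finset (HeightOneSpectrum (𝓞 F))} (hS : ClTriv S) (h : S ⊆ T) :
    ClTriv T := fun n hn => by
  obtain ⟨x, hx⟩ := hS n hn
  exact ⟨x, fun v hv => hx v fun h' => hv (h h')⟩

variable (F) in
lemma exists_ClTriv : ∃ S : Finset (HeightOneSpectrum (𝓞 F)), ClTriv S := by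
  choose J hJ using ClassGroup.mk0_surjective (R := 𝓞 F)
  have hfin (c : ClassGroup (𝓞 F)) : {v : HeightOneSpectrum (𝓞 F) | v.asIdeal ∣ (J c : Ideal (𝓞 F))}.Finite :=
    Ideal.finite_factors (nonZeroDivisors.ne_zero (J c).2)
  let S := Finset.univ.biUnion fun c => (hfin c).toFinset
  have hS (v) (hv : v ∉ S) (c) : cnt v (J c : Ideal (𝓞 F)) = 0 := by
    refine cnt_eq_zero (nonZeroDivisors.ne_zero (J c).2) fun h => hv ?_
    exact Finset.mem_biUnion.2 ⟨c, Finset.mem_univ _, by simpa using h⟩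
  have hone (v : HeightOneSpectrum (𝓞 F)) : ∃ x : Fˣ, ∀ w ∉ S, w.valuation F (x : F) =
      if w = v then exp 1 else 1 := by
    have hv0 : v.asIdeal ∈ (Ideal (𝓞 F))⁰ := mem_nonZeroDivisors_of_ne_zero v.ne_bot
    have := hJ (ClassGroup.mk0 ⟨v.asIdeal, hv0⟩)
    rw [ClassGroup.mk0_eq_mk0_iff] at this
    obtain ⟨x, y, hx, hy, hxy⟩ := this
    have hx' : algebraMap (𝓞 F) F x ≠ 0 := by simpa using hx
    have hy' : algebraMap (𝓞 F) F y ≠ 0 := by simpa using hy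
    refine ⟨Units.mk0 _ hy' * (Units.mk0 _ hx')⁻¹, fun w hw => ?_⟩
    have hc := congrArg (cnt w) hxy
    rw [cnt_mul _ (by simpa using hx) (nonZeroDivisors.ne_zero (J _).2), hS w hw,
      cnt_mul _ (by simpa using hy) v.ne_bot, add_zero] at hc
    rw [Units.val_mul, Units.val_inv_eq_inv_val, Units.val_mk0, Units.val_mk0, map_mul, map_inv₀,
      val_eq_cnt w hx, val_eq_cnt w hy, ← exp_neg, ← exp_add, hc]
    split_ifs with h
    · subst h
      rw [cnt_self]; congr 1; push_cast; ring
    · rw [cnt_of_ne h, ← exp_zero]; congr 1; push_cast; ring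
  choose X hX using hone
  refine ⟨S, fun n hn => ⟨∏ v ∈ hn.toFinset, X v ^ n v, fun w hw => ?_⟩⟩
  rw [Units.coe_prod, map_prod, Finset.prod_eq_single w]
  · rw [Units.val_zpow_eq_zpow_val, map_zpow₀, hX w w hw, if_pos rfl, ← exp_zsmul]; simp
  · intro v _ hv
    rw [Units.val_zpow_eq_zpow_val, map_zpow₀, hX v w hw, if_neg hv.symm, one_zpow]
  · intro h
    have : n w = 0 := by simpa using h
    simp [this]

/-- logarithmic valuations at the primes of `S` -/
noncomputable def logS (S : Finset (HeightOneSpectrum (𝓞 F))) : Additive (UnS S) →ₗ[ℤ] (S → ℤ) :=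
  AddMonoidHom.toIntLinearMap
    { toFun := fun x v => log (v.1.valuation F ((x.toMul : Fˣ) : F))
      map_zero' := by ext v; simp
      map_add' := fun x y => by
        ext v
        simp only [toMul_add, Subgroup.coe_mul, Units.val_mul, map_mul, Pi.add_apply]
        rw [log_mul (by simp) (by simp)] }

lemma val_unit (u : (𝓞 F)ˣ) (v : HeightOneSpectrum (𝓞 F)) :
    v.valuation F (algebraMap (𝓞 F) F u) = 1 := by
  refine le_antisymm (v.valuation_le_one _) ?_
  have h1 := v.valuation_le_one (K := F) ((u⁻¹ : (𝓞 F)ˣ) : 𝓞 F)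
  have h2 : v.valuation F (algebraMap (𝓞 F) F u) *
      v.valuation F (algebraMap (𝓞 F) F ((u⁻¹ : (𝓞 F)ˣ) : 𝓞 F)) = 1 := by
    rw [← map_mul, ← map_mul]; simp
  rw [← h2]
  exact mul_le_of_le_one_right' h1

/-- units of the ring of integers as `S`-units -/
noncomputable def unitHom (S : Finset (HeightOneSpectrum (𝓞 F))) :
    Additive (𝓞 F)ˣ →ₗ[ℤ] Additive (UnS S) :=
  AddMonoidHom.toIntLinearMap (MonoidHom.toAdditive
    ((Units.map (algebraMap (𝓞 F) F).toMonoidHom).codRestrict (UnS S)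
      fun u v _ => val_unit u v))

lemma unitHom_injective (S : Finset (HeightOneSpectrum (𝓞 F))) :
    Function.Injective (unitHom S) := by
  intro x y h
  have h1 : algebraMap (𝓞 F) F (x.toMul : (𝓞 F)ˣ) = algebraMap (𝓞 F) F (y.toMul : (𝓞 F)ˣ) :=
    congrArg (fun z : Additive (UnS S) => ((z.toMul : Fˣ) : F)) h
  exact Additive.toMul.injective (Units.ext (FaithfulSMul.algebraMap_injective _ _ h1))

lemma range_unitHom (S : Finset (HeightOneSpectrum (𝓞 F))) :
    LinearMap.range (unitHom S) = LinearMap.ker (logS S) := by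
  ext x
  constructor
  · rintro ⟨u, rfl⟩
    rw [LinearMap.mem_ker]
    ext v
    change log (v.1.valuation F (algebraMap (𝓞 F) F (u.toMul : (𝓞 F)ˣ))) = 0
    rw [val_unit, log_one]
  · intro hx
    have hx1 (v : HeightOneSpectrum (𝓞 F)) : v.valuation F ((x.toMul : Fˣ) : F) = 1 := by
      by_cases hv : v ∈ S
      · have : log (v.valuation F ((x.toMul : Fˣ) : F)) = 0 := congrFun hx ⟨v, hv⟩
        rw [← exp_log (x := v.valuation F ((x.toMul : Fˣ) : F)) (by simp), this, exp_zero]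
      · exact x.toMul.2 v hv
    obtain ⟨a, ha⟩ := HeightOneSpectrum.mem_integers_of_valuation_le_one F
      ((x.toMul : Fˣ) : F) (fun v => (hx1 v).le)
    obtain ⟨b, hb⟩ := HeightOneSpectrum.mem_integers_of_valuation_le_one F
      (((x.toMul : Fˣ)⁻¹ : Fˣ) : F) (fun v => by
        rw [Units.val_inv_eq_inv_val, map_inv₀, hx1, inv_one])
    have hab : a * b = 1 := by
      apply FaithfulSMul.algebraMap_injective (𝓞 F) F
      rw [map_mul, ha, hb, map_one, Units.mul_inv]
    refine ⟨Additive.ofMul ⟨a, b, hab, by rw [mul_comm, hab]⟩, ?_⟩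
    apply Additive.toMul.injective
    exact Subtype.ext (Units.ext ha)

instance (S : Finset (HeightOneSpectrum (𝓞 F))) : Module.Finite ℤ (Additive (UnS S)) := by
  have h1 : Module.Finite ℤ (LinearMap.ker (logS S)) := by
    rw [← range_unitHom]; infer_instance
  have h2 : Module.Finite ℤ (Additive (UnS S) ⧸ LinearMap.ker (logS S)) :=
    Module.Finite.equiv (logS S).quotKerEquivRange.symm
  exact Module.Finite.of_submodule_quotient (LinearMap.ker (logS S))

lemma finrank_UnS (S : Finset (HeightOneSpectrum (𝓞 F))) :
    Module.finrank ℤ (Additive (UnS S)) + 1 = S.card + Fintype.card (InfinitePlace F) := by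
  have h1 := finrank_range_add_ker_int (logS S)
  have h2 : Module.finrank ℤ (LinearMap.ker (logS S)) + 1 = Fintype.card (InfinitePlace F) := by
    rw [← range_unitHom, LinearMap.finrank_range_of_inj (unitHom_injective S),
      Units.finrank_eq, Units.rank]
    have : 0 < Fintype.card (InfinitePlace F) := Fintype.card_pos
    omega
  have h3 : Module.finrank ℤ (LinearMap.range (logS S)) = S.card := by
    have e : Module.finrank ℤ (S → ℤ) = S.card := by simp
    refine le_antisymm ((Submodule.finrank_le _).trans e.le) ?_
    set h := Fintype.card (ClassGroup (𝓞 F))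
    have hmem (f : S → ℤ) : (h : ℤ) • f ∈ LinearMap.range (logS S) := by
      have hs (v : S) : (h : ℤ) • (Pi.single v 1 : S → ℤ) ∈ LinearMap.range (logS S) := by
        have hv0 : v.1.asIdeal ∈ (Ideal (𝓞 F))⁰ := mem_nonZeroDivisors_of_ne_zero v.1.ne_bot
        have hp : ClassGroup.mk0 (⟨v.1.asIdeal, hv0⟩ ^ h) = 1 := by
          rw [map_pow]; exact pow_card_eq_one
        have hp' : ClassGroup.mk0 ⟨v.1.asIdeal ^ h, pow_mem hv0 h⟩ = 1 := hp
        rw [ClassGroup.mk0_eq_one_iff] at hp'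
        obtain ⟨x, hx⟩ := hp'.principal
        rw [Ideal.submodule_span_eq] at hx
        have hx0 : x ≠ 0 := by
          rintro rfl
          rw [Ideal.span_singleton_eq_bot.2 rfl] at hx
          exact pow_ne_zero h v.1.ne_bot hx
        have hval (w : HeightOneSpectrum (𝓞 F)) : w.valuation F (algebraMap (𝓞 F) F x) =
            exp (-(if w = v.1 then (h : ℤ) else 0)) := by
          rw [val_eq_cnt w hx0, ← hx, cnt_pow _ v.1.ne_bot]
          split_ifs with hw
          · rw [hw, cnt_self, mul_one]
          · rw [cnt_of_ne hw, mul_zero]; rfl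
        have hx' : algebraMap (𝓞 F) F x ≠ 0 := by simpa using hx0
        have hxU : Units.mk0 _ hx' ∈ UnS S := fun w hw => by
          rw [Units.val_mk0, hval, if_neg (by rintro rfl; exact hw v.2), neg_zero, exp_zero]
        refine ⟨-Additive.ofMul ⟨Units.mk0 _ hx', hxU⟩, ?_⟩
        rw [map_neg]
        ext w
        change -log (w.1.valuation F (algebraMap (𝓞 F) F x)) = _
        rw [hval, log_exp, neg_neg]
        by_cases hw : w = v
        · subst hw; simp
        · rw [if_neg (fun h => hw (Subtype.ext h))]; simp [hw]
      have : (h : ℤ) • f = ∑ v, f v • (h : ℤ) • (Pi.single v 1 : S → ℤ) := by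
        ext w; simp [Finset.sum_apply, Pi.single_apply, mul_comm]
      rw [this]
      exact Submodule.sum_mem _ fun v _ => Submodule.smul_mem _ _ (hs v)
    rw [← e]
    refine LinearMap.finrank_le_finrank_of_injective
      (f := ((LinearMap.lsmul ℤ (S → ℤ) (h : ℤ)).codRestrict _ hmem)) ?_
    intro f g hfg
    have hfg' : (h : ℤ) • f = (h : ℤ) • g := congrArg Subtype.val hfg
    have h0 : (h : ℤ) ≠ 0 := by
      have : 0 < h := Fintype.card_pos
      omega
    exact smul_right_injective _ h0 hfg'
  omega

/-- number of square classes of `S`-units -/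
lemma index_sq_UnS (S : Finset (HeightOneSpectrum (𝓞 F))) :
    (powMonoidHom 2 : UnS S →* UnS S).range.index =
      2 ^ (S.card + Fintype.card (InfinitePlace F)) := by
  rw [index_range_pow_two_of_fg, finrank_UnS]
  · have key (g : UnS S) (hg : g ^ 2 = 1) (h1 : g ≠ 1) : ((g : Fˣ) : F) = -1 := by
      have : ((g : Fˣ) : F) ^ 2 = 1 := by
        have := congrArg (fun z : UnS S => ((z : Fˣ) : F)) hg
        simpa using this
      rcases sq_eq_one_iff.1 this with h | h
      · exact absurd (Subtype.ext (Units.ext h)) h1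
      · exact h
    intro g hg h hh g1 h1
    exact Subtype.ext (Units.ext ((key g hg g1).trans (key h hh h1).symm))
  · refine ⟨⟨-1, fun v _ => by simp⟩, Subtype.ext (by simp), fun h => ?_⟩
    have := congrArg (fun z : UnS S => ((z : Fˣ) : F)) h
    norm_num at this

end SU
end QF

namespace QF

open IsDedekindDomain NumberField WithZero
open scoped Pointwise Classical nonZeroDivisors

section RealEmb
variable {F E : Type*} [Field F] [Field E] [Algebra F E] {a : F} {s : E}

/-- extension of a ring hom to a quadratic extension -/
noncomputable def IsQuad.lift (h : IsQuad a s) {R : Type*} [CommRing R] (φ : F →+* R) (r : R)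
    (hr : r * r = φ a) : E →+* R where
  toFun z := φ (h.re z) + φ (h.im z) * r
  map_one' := by
    obtain ⟨h1, h2⟩ := h.re_im_eq (z := 1) (x := 1) (y := 0) (by simp)
    rw [h1, h2]; simp
  map_mul' z w := by
    have hz := h.eq_re_im z
    have hw := h.eq_re_im w
    obtain ⟨h1, h2⟩ := h.re_im_eq (z := z * w) (x := h.re z * h.re w + h.im z * h.im w * a)
      (y := h.re z * h.im w + h.im z * h.re w) (by
        conv_lhs => rw [hz, hw]
        simp only [map_add, map_mul, ← h.s_mul_s]; ring)
    rw [h1, h2]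
    simp only [map_add, map_mul, ← hr]; ring
  map_zero' := by
    obtain ⟨h1, h2⟩ := h.re_im_eq (z := 0) (x := 0) (y := 0) (by simp)
    rw [h1, h2]; simp
  map_add' z w := by
    have hz := h.eq_re_im z
    have hw := h.eq_re_im w
    obtain ⟨h1, h2⟩ := h.re_im_eq (z := z + w) (x := h.re z + h.re w) (y := h.im z + h.im w) (by
        conv_lhs => rw [hz, hw]
        simp only [map_add]; ring)
    rw [h1, h2]
    simp only [map_add]; ring

lemma IsQuad.lift_algebraMap (h : IsQuad a s) {R : Type*} [CommRing R] (φ : F →+* R) (r : R)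
    (hr : r * r = φ a) : (h.lift φ r hr).comp (algebraMap F E) = φ := by
  ext x
  obtain ⟨h1, h2⟩ := h.re_im_eq (z := algebraMap F E x) (x := x) (y := 0) (by simp)
  change φ (h.re _) + φ (h.im _) * r = _
  rw [h1, h2]; simp

lemma IsQuad.lift_s (h : IsQuad a s) {R : Type*} [CommRing R] (φ : F →+* R) (r : R)
    (hr : r * r = φ a) : h.lift φ r hr s = r := by
  obtain ⟨h1, h2⟩ := h.re_im_eq (z := s) (x := 0) (y := 1) (by simp)
  change φ (h.re _) + φ (h.im _) * r = _
  rw [h1, h2]; simp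

lemma IsQuad.hom_ext (h : IsQuad a s) {R : Type*} [CommRing R] {ψ ψ' : E →+* R}
    (h1 : ψ.comp (algebraMap F E) = ψ'.comp (algebraMap F E)) (h2 : ψ s = ψ' s) : ψ = ψ' := by
  ext z
  have h3 (x : F) : ψ (algebraMap F E x) = ψ' (algebraMap F E x) := RingHom.congr_fun h1 x
  rw [h.eq_re_im z, map_add, map_add, map_mul, map_mul, h3, h3, h2]

variable [NumberField F] [NumberField E]

lemma IsQuad.card_real (h : IsQuad a s) :
    Fintype.card (E →+* ℝ) = 2 * (Finset.univ.filter fun φ : F →+* ℝ => 0 < φ a).card := by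
  rw [← Finset.card_univ, Finset.card_eq_sum_card_fiberwise
    (t := Finset.univ.filter fun φ : F →+* ℝ => 0 < φ a) (f := fun ψ => ψ.comp (algebraMap F E))]
  · rw [mul_comm, ← smul_eq_mul, ← Finset.sum_const]
    refine Finset.sum_congr rfl fun φ hφ => ?_
    rw [Finset.mem_filter] at hφ
    have hs : Real.sqrt (φ a) * Real.sqrt (φ a) = φ a := Real.mul_self_sqrt hφ.2.le
    have hp : 0 < Real.sqrt (φ a) := Real.sqrt_pos.2 hφ.2
    rw [Finset.card_eq_two]
    refine ⟨h.lift φ _ hs, h.lift φ (-Real.sqrt (φ a)) (by rw [neg_mul_neg, hs]), ?_, ?_⟩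
    · intro he
      have := RingHom.congr_fun he s
      rw [h.lift_s, h.lift_s] at this
      linarith
    · ext ψ
      rw [Finset.mem_filter, Finset.mem_insert, Finset.mem_singleton]
      constructor
      · rintro ⟨-, hψ⟩
        have h1 : ψ s * ψ s = Real.sqrt (φ a) * Real.sqrt (φ a) := by
          rw [← map_mul, h.s_mul_s, hs, ← hψ]; rfl
        rcases mul_self_eq_mul_self_iff.1 h1 with h1 | h1
        · left; exact h.hom_ext (by rw [h.lift_algebraMap, hψ]) (by rw [h.lift_s, h1])
        · right; exact h.hom_ext (by rw [h.lift_algebraMap, hψ]) (by rw [h.lift_s, h1])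
      · rintro (rfl | rfl) <;> exact ⟨Finset.mem_univ _, h.lift_algebraMap _ _ _⟩
  · intro ψ _
    rw [Finset.mem_coe, Finset.mem_filter]
    refine ⟨Finset.mem_univ _, ?_⟩
    have h1 : ψ s * ψ s = ψ (algebraMap F E a) := by rw [← map_mul, h.s_mul_s]
    have h2 : ψ s ≠ 0 := by
      rw [_root_.map_ne_zero]; rintro rfl
      have := h.sq
      rw [zero_pow two_ne_zero, eq_comm, map_eq_zero] at this
      exact h.ne_zero this
    change 0 < ψ (algebraMap F E a)
    rw [← h1]; exact mul_self_pos.2 h2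

variable (F) in
lemma two_mul_card_infinitePlace :
    2 * Fintype.card (InfinitePlace F) = Module.finrank ℚ F + Fintype.card (F →+* ℝ) := by
  have h1 : Fintype.card (F →+* ℝ) = InfinitePlace.nrRealPlaces F := by
    rw [← InfinitePlace.card_real_embeddings]
    refine Fintype.card_congr (Equiv.ofBijective
      (fun φ => ⟨toC φ, by ext x; simp [toC]⟩) ⟨?_, ?_⟩)
    · intro φ ψ hh
      exact toC_injective (congrArg Subtype.val hh)
    · rintro ⟨φ, hφ⟩
      refine ⟨hφ.embedding, Subtype.ext ?_⟩
      ext x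
      simp [toC]
  have h2 := InfinitePlace.card_add_two_mul_card_eq_rank F
  have h3 := InfinitePlace.card_eq_nrRealPlaces_add_nrComplexPlaces F
  omega

lemma IsQuad.card_infinitePlace (h : IsQuad a s) :
    Fintype.card (InfinitePlace E) + (Finset.univ.filter fun φ : F →+* ℝ => φ a < 0).card =
      2 * Fintype.card (InfinitePlace F) := by
  have h1 := two_mul_card_infinitePlace F
  have h2 := two_mul_card_infinitePlace E
  have h3 := h.card_real
  have h4 : Module.finrank ℚ E = 2 * Module.finrank ℚ F := by
    have := h.isQuadraticExtension
    rw [← Module.finrank_mul_finrank ℚ F E, Algebra.IsQuadraticExtension.finrank_eq_two F E,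
      mul_comm]
  have h5 := Finset.card_filter_add_card_filter_not (s := Finset.univ) (fun φ : F →+* ℝ => 0 < φ a)
  have h6 : (Finset.univ.filter fun φ : F →+* ℝ => ¬ 0 < φ a) =
      Finset.univ.filter fun φ : F →+* ℝ => φ a < 0 := by
    refine Finset.filter_congr fun φ _ => ?_
    have : φ a ≠ 0 := by rw [_root_.map_ne_zero]; exact h.ne_zero
    rw [not_lt]
    exact ⟨fun h => lt_of_le_of_ne h this, le_of_lt⟩
  rw [h6, Finset.card_univ] at h5
  omega

end RealEmb
end QF

namespace QF

open IsDedekindDomain NumberField WithZero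
open scoped Pointwise Classical nonZeroDivisors

namespace IsQuad
variable {F E : Type*} [Field F] [Field E] [NumberField F] [NumberField E] [Algebra F E]
  {a : Fˣ} {s : E}

lemma finite_fiber (h : IsQuad (a : F) s) (S : Finset (HeightOneSpectrum (𝓞 F))) :
    {w : HeightOneSpectrum (𝓞 E) | below F w ∈ S}.Finite := by
  refine Set.Finite.preimage' (f := fun w : HeightOneSpectrum (𝓞 E) => below F w)
    S.finite_toSet fun v _ => ?_
  obtain ⟨w, rfl⟩ := exists_above E v
  refine (Set.toFinite {w, h.cj w}).subset fun w' hw' => h.eq_or_eq_cj hw'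

/-- primes of the quadratic extension above `S` -/
noncomputable def abv (h : IsQuad (a : F) s) (S : Finset (HeightOneSpectrum (𝓞 F))) :
    Finset (HeightOneSpectrum (𝓞 E)) := (h.finite_fiber S).toFinset

lemma mem_abv (h : IsQuad (a : F) s) {S : Finset (HeightOneSpectrum (𝓞 F))}
    {w : HeightOneSpectrum (𝓞 E)} : w ∈ h.abv S ↔ below F w ∈ S := by simp [abv]

lemma card_abv (h : IsQuad (a : F) s) (S : Finset (HeightOneSpectrum (𝓞 F))) :
    (h.abv S).card + (S.filter fun v => a ∉ Sq v).card = 2 * S.card := by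
  rw [Finset.card_eq_sum_card_fiberwise (t := S) (f := fun w => below F w)
    (fun w hw => h.mem_abv.1 hw), Finset.card_filter, ← Finset.sum_add_distrib, mul_comm,
    ← smul_eq_mul, ← Finset.sum_const]
  refine Finset.sum_congr rfl fun v hv => ?_
  obtain ⟨w, rfl⟩ := exists_above E v
  by_cases hw : h.cj w = w
  · rw [if_pos (fun ha => h.cj_ne_of_mem_sqAt ha hw)]
    have : (h.abv S).filter (fun w' => below F w' = below F w) = {w} := by
      ext w'
      rw [Finset.mem_filter, Finset.mem_singleton, h.mem_abv]
      constructor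
      · rintro ⟨-, h'⟩
        rcases h.eq_or_eq_cj h' with h' | h'
        · exact h'
        · rw [h', hw]
      · rintro rfl; exact ⟨hv, rfl⟩
    rw [this, Finset.card_singleton]
  · rw [if_neg (fun ha => ha (h.mem_sqAt_of_cj_ne hw))]
    have : (h.abv S).filter (fun w' => below F w' = below F w) = {w, h.cj w} := by
      ext w'
      rw [Finset.mem_filter, Finset.mem_insert, Finset.mem_singleton, h.mem_abv]
      constructor
      · rintro ⟨-, h'⟩
        exact h.eq_or_eq_cj h'
      · rintro (rfl | rfl)
        · exact ⟨hv, rfl⟩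
        · rw [h.below_cj]; exact ⟨hv, rfl⟩
    rw [this, Finset.card_pair (Ne.symm hw)]

/-- the number of nonsplit places in `S` and at infinity -/
noncomputable def _root_.QF.nsp (a : Fˣ) (S : Finset (HeightOneSpectrum (𝓞 F))) : ℕ :=
  (S.filter fun v => a ∉ Sq v).card + (Finset.univ.filter fun φ : F →+* ℝ => φ (a : F) < 0).card

lemma val_exists_of_unramified (h : IsQuad (a : F) s) {w : HeightOneSpectrum (𝓞 E)}
    (h2 : (below F w).valuation F 2 = 1) (ha : (below F w).valuation F (a : F) = 1)
    (y : Eˣ) : ∃ n : ℤ, w.valuation E (y : E) = exp n ^ rami F w := by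
  have hex (x : F) (hx : x ≠ 0) : ∃ n : ℤ, w.valuation E (algebraMap F E x) = exp n ^ rami F w := by
    refine ⟨log ((below F w).valuation F x), ?_⟩
    rw [exp_log (by simpa using hx), val_algebraMap]
  by_cases hw : h.cj w = w
  · have hs : w.valuation E s = 1 := by
      have : w.valuation E s ^ 2 = 1 := by
        rw [← map_pow, h.sq, val_algebraMap, ha, one_pow]
      exact (pow_eq_one_iff.1 this).resolve_right two_ne_zero
    have h2' : w.valuation E 2 = 1 := by
      have := val_algebraMap (F := F) w 2
      rwa [map_ofNat, h2, one_pow] at this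
    have hx : w.valuation E (algebraMap F E (h.re y)) ≤ w.valuation E (y : E) := by
      have e : 2 * algebraMap F E (h.re y) = y + h.conj y := by
        rw [h.add_conj, map_mul, map_ofNat]
      calc _ = w.valuation E (2 * algebraMap F E (h.re y)) := by rw [map_mul, h2', one_mul]
        _ ≤ max _ _ := by rw [e]; exact (w.valuation E).map_add _ _
        _ = _ := by rw [h.val_conj hw, max_self]
    have hy : w.valuation E (algebraMap F E (h.im y)) ≤ w.valuation E (y : E) := by
      have e : 2 * algebraMap F E (h.im y) * s = y - h.conj y := by
        have e1 := h.eq_re_im (y : E)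
        have e2 := h.conj_eq (y : E)
        linear_combination e2 - e1
      calc _ = w.valuation E (2 * algebraMap F E (h.im y) * s) := by
              rw [map_mul, map_mul, h2', one_mul, hs, mul_one]
        _ ≤ max _ _ := by rw [e]; exact (w.valuation E).map_sub _ _
        _ = _ := by rw [h.val_conj hw, max_self]
    have hmax : w.valuation E (y : E) ≤ max (w.valuation E (algebraMap F E (h.re y)))
        (w.valuation E (algebraMap F E (h.im y))) := by
      conv_lhs => rw [h.eq_re_im (y : E)]
      refine ((w.valuation E).map_add _ _).trans ?_
      rw [map_mul, hs, mul_one]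
    have hy0 : w.valuation E (y : E) ≠ 0 := by simp
    rcases le_max_iff.1 hmax with h' | h'
    · rw [le_antisymm h' hx] at hy0 ⊢
      exact hex _ (fun h0 => hy0 (by rw [h0]; simp))
    · rw [le_antisymm h' hy] at hy0 ⊢
      exact hex _ (fun h0 => hy0 (by rw [h0]; simp))
  · obtain ⟨f, -, hf⟩ := h.efg w
    rw [if_neg hw] at hf
    refine ⟨log (w.valuation E (y : E)), ?_⟩
    rw [hf.1, pow_one, exp_log (by simp)]

/-- units of norm one are quotients of conjugate units -/
lemma hilbert90_units (h : IsQuad (a : F) s) {S : Finset (HeightOneSpectrum (𝓞 F))}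
    (h2 : ∀ v ∉ S, v.valuation F 2 = 1) (ha : a ∈ UnS S) (hcl : ClTriv S) (u : Eˣ)
    (hu : u ∈ UnS (h.abv S)) (hN : (u : E) * h.conj u = 1) :
    ∃ y ∈ UnS (h.abv S), (y : E) = u * h.conj y := by
  obtain ⟨y, hy⟩ : ∃ y : Eˣ, (y : E) = u * h.conj y := by
    by_cases h1 : (u : E) = -1
    · exact ⟨Units.mk0 s h.s_ne_zero, by simp [h1]⟩
    · refine ⟨Units.mk0 (1 + u) (fun h0 => h1 (by linear_combination h0)), ?_⟩
      rw [Units.val_mk0, map_add, map_one, mul_add, hN]; ring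
  choose W hW using exists_above (F := F) E
  have hn (v) : ∃ n : ℤ, v ∉ S → (W v).valuation E (y : E) = exp n ^ rami F (W v) := by
    by_cases hv : v ∈ S
    · exact ⟨0, fun h => absurd hv h⟩
    · obtain ⟨n, hn⟩ := h.val_exists_of_unramified (w := W v) (by rw [hW]; exact h2 v hv)
        (by rw [hW]; exact ha v hv) y
      exact ⟨n, fun _ => hn⟩
  choose n hn using hn
  let n' : HeightOneSpectrum (𝓞 F) → ℤ := fun v => if v ∈ S then 0 else n v
  have hWi : Function.Injective W := fun v v' hv => by rw [← hW v, hv, hW]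
  obtain ⟨x, hx⟩ := hcl n' (by
    refine ((finite_val_ne_one y).preimage hWi.injOn).subset fun v hv => ?_
    change (W v).valuation E (y : E) ≠ 1
    intro h1
    by_cases hvS : v ∈ S
    · exact hv (if_pos hvS)
    · rw [hn v hvS, pow_eq_one_iff, ← exp_zero, exp_inj] at h1
      exact hv ((if_neg hvS).trans (h1.resolve_right (rami_ne_zero _))))
  refine ⟨y * (h.incl x)⁻¹, fun w hw => ?_, ?_⟩
  · set v := below F w with hv
    have hvS : v ∉ S := fun h' => hw (h.mem_abv.2 h')
    have key : (W v).valuation E ((y * (h.incl x)⁻¹ : Eˣ) : E) = 1 := by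
      have hx' : (W v).valuation E (h.incl x : E) = exp (n v) ^ rami F (W v) := by
        change (W v).valuation E (algebraMap F E x) = _
        rw [val_algebraMap, hW, hx v hvS]
        simp only [n', if_neg hvS]
      rw [Units.val_mul, map_mul, Units.val_inv_eq_inv_val, map_inv₀, hn v hvS, hx']
      exact mul_inv_cancel₀ (pow_ne_zero _ exp_ne_zero)
    rcases h.eq_or_eq_cj (w := W v) (w' := w) (by rw [hW]) with h' | h'
    · rw [h']; exact key
    · have hu1 : (W v).valuation E (u : E) = 1 := hu _ (fun h' => hvS (by
        have := h.mem_abv.1 h'; rwa [hW] at this))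
      have : (W v).valuation E (h.conj y) = (W v).valuation E (y : E) := by
        conv_rhs => rw [hy, map_mul, hu1, one_mul]
      rw [h', h.val_cj, ← key, Units.val_mul, map_mul, map_mul, map_mul, this]
      congr 2
      rw [Units.val_inv_eq_inv_val, map_inv₀]
      congr 1
      exact h.conj.commutes _
  · rw [Units.val_mul, Units.val_inv_eq_inv_val, map_mul, map_inv₀]
    have : h.conj (h.incl x : E) = h.incl x := h.conj.commutes _
    rw [this, ← mul_assoc, ← hy]

end IsQuad
end QF

namespace QF

open IsDedekindDomain NumberField WithZero
open scoped Pointwise Classical nonZeroDivisors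

/-- the additive version of the kernel of a homomorphism -/
noncomputable def kerEquiv {A U : Type*} [CommGroup A] [CommGroup U] (N : A →* U) :
    Additive N.ker ≃ₗ[ℤ] LinearMap.ker N.toAdditive.toIntLinearMap :=
  AddEquiv.toIntLinearEquiv
    { toFun := fun x => ⟨Additive.ofMul (x.toMul : A), congrArg Additive.ofMul x.toMul.2⟩
      invFun := fun x => Additive.ofMul ⟨x.1.toMul, congrArg Additive.toMul x.2⟩
      left_inv := fun _ => rfl
      right_inv := fun _ => rfl
      map_add' := fun _ _ => rfl }

lemma finite_ker {A U : Type*} [CommGroup A] [CommGroup U] [Module.Finite ℤ (Additive A)]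
    (N : A →* U) : Module.Finite ℤ (Additive N.ker) :=
  Module.Finite.equiv (kerEquiv N).symm

lemma finrank_ker_of_sq {A U : Type*} [CommGroup A] [CommGroup U] [Module.Finite ℤ (Additive A)]
    [Module.Finite ℤ (Additive U)] (hU : {u : U | u ^ 2 = 1}.Finite)
    (N : A →* U) (hN : ∀ u, u ^ 2 ∈ N.range) :
    Module.finrank ℤ (Additive U) + Module.finrank ℤ (Additive N.ker) =
      Module.finrank ℤ (Additive A) := by
  rw [← finrank_range_add_ker_int N.toAdditive.toIntLinearMap, (kerEquiv N).finrank_eq]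
  congr 1
  refine le_antisymm ?_ (Submodule.finrank_le _)
  let D : Additive U →ₗ[ℤ] Additive U := (powMonoidHom 2 : U →* U).toAdditive.toIntLinearMap
  have h1 := finrank_range_add_ker_int D
  have h2 : Module.finrank ℤ (LinearMap.ker D) = 0 := by
    have : Finite (LinearMap.ker D) := by
      have := hU.to_subtype
      exact Finite.of_injective (β := {u : U | u ^ 2 = 1})
        (fun x => ⟨x.1.toMul, by
          have hx : D x.1 = 0 := LinearMap.mem_ker.1 x.2
          exact congrArg Additive.toMul hx⟩)
        fun x y h => Subtype.ext (congrArg (fun z : {u : U | u ^ 2 = 1} => Additive.ofMul z.1) h)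
    rw [Module.finrank_eq_zero_iff_isTorsion]
    exact isAddTorsion_iff_isTorsion_int.1 isAddTorsion_of_finite
  rw [h2, add_zero] at h1
  rw [← h1]
  refine Submodule.finrank_mono ?_
  rintro _ ⟨u, rfl⟩
  obtain ⟨x, hx⟩ := hN u.toMul
  exact ⟨Additive.ofMul x, congrArg Additive.ofMul hx⟩

namespace IsQuad
variable {F E : Type*} [Field F] [Field E] [NumberField F] [NumberField E] [Algebra F E]
  {a : Fˣ} {s : E}

/-- conjugation on units -/
noncomputable def conjU (h : IsQuad (a : F) s) : Eˣ →* Eˣ :=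
  Units.map (h.conj : E →* E)

lemma val_conjU (h : IsQuad (a : F) s) (y : Eˣ) : (h.conjU y : E) = h.conj y := rfl

lemma conjU_mem (h : IsQuad (a : F) s) {S : Finset (HeightOneSpectrum (𝓞 F))} {y : Eˣ}
    (hy : y ∈ UnS (h.abv S)) : h.conjU y ∈ UnS (h.abv S) := by
  intro w hw
  rw [val_conjU, ← h.val_cj]
  exact hy _ fun h' => hw (by rw [mem_abv] at h' ⊢; rwa [h.below_cj] at h')

lemma incl_mem_iff (h : IsQuad (a : F) s) {S : Finset (HeightOneSpectrum (𝓞 F))} {x : Fˣ} :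
    h.incl x ∈ UnS (h.abv S) ↔ x ∈ UnS S := by
  constructor
  · intro hx v hv
    obtain ⟨w, rfl⟩ := exists_above E v
    have := hx w (fun h' => hv (h.mem_abv.1 h'))
    exact (val_algebraMap_eq_one_iff w _).1 this
  · intro hx w hw
    exact (val_algebraMap_eq_one_iff w _).2 (hx _ fun h' => hw (h.mem_abv.2 h'))

lemma incl_norm (h : IsQuad (a : F) s) (y : Eˣ) : h.incl (h.norm y) = y * h.conjU y :=
  Units.ext (h.algebraMap_norm y)

lemma norm_mem (h : IsQuad (a : F) s) {S : Finset (HeightOneSpectrum (𝓞 F))} {y : Eˣ}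
    (hy : y ∈ UnS (h.abv S)) : h.norm y ∈ UnS S := by
  rw [← h.incl_mem_iff, incl_norm]
  exact mul_mem hy (h.conjU_mem hy)

lemma incl_injective (h : IsQuad (a : F) s) : Function.Injective h.incl :=
  Units.map_injective (algebraMap F E).injective

theorem index_norm_units (h : IsQuad (a : F) s) {S : Finset (HeightOneSpectrum (𝓞 F))}
    (h2 : ∀ v ∉ S, v.valuation F 2 = 1) (ha : a ∈ UnS S) (hcl : ClTriv S) :
    2 * ((UnS (h.abv S)).map h.norm).relIndex (UnS S) = 2 ^ nsp a S := by
  let N : UnS (h.abv S) →* UnS S :=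
    (h.norm.comp (UnS (h.abv S)).subtype).codRestrict (UnS S) fun y => h.norm_mem y.2
  let i : UnS S →* UnS (h.abv S) :=
    (h.incl.comp (UnS S).subtype).codRestrict _ fun x => h.incl_mem_iff.2 x.2
  have hNval (y : UnS (h.abv S)) : ((N y : UnS S) : Fˣ) = h.norm y := rfl
  have hker (y : UnS (h.abv S)) : y ∈ N.ker ↔ (y : Eˣ) * h.conjU y = 1 := by
    rw [MonoidHom.mem_ker, ← h.incl_norm, ← hNval, ← Subtype.coe_inj, ← h.incl_injective.eq_iff]
    simp
  have hcc (y : Eˣ) : h.conjU (h.conjU y) = y := Units.ext (by simp [val_conjU])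
  let cA : UnS (h.abv S) →* UnS (h.abv S) :=
    (h.conjU.comp (UnS (h.abv S)).subtype).codRestrict _ fun y => h.conjU_mem y.2
  have hcA (y) : ((cA y : UnS (h.abv S)) : Eˣ) = h.conjU y := rfl
  have hθmem (y : UnS (h.abv S)) : y / cA y ∈ N.ker := by
    rw [hker, Subgroup.coe_div, _root_.map_div, hcA, hcc]
    simp
  let θ : UnS (h.abv S) →* N.ker :=
    ((MonoidHom.id _) / cA).codRestrict _ hθmem
  have hθ (y) : ((θ y : N.ker) : UnS (h.abv S)) = y / cA y := rfl
  have key := herbrand_two N i θ N.ker.subtype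
    (fun u => Subtype.ext (h.norm_incl u))
    (fun m => by
      have hm := (hker m.1).1 m.2
      apply Subtype.ext
      apply Subtype.ext
      rw [hθ, Subgroup.coe_div, hcA]
      simp only [Subgroup.coe_subtype, Subgroup.coe_pow]
      rw [pow_two, div_eq_mul_inv]
      congr 1
      exact (eq_inv_of_mul_eq_one_left hm).symm)
    (by rw [Subgroup.range_subtype])
    (by
      ext y
      rw [MonoidHom.mem_ker, ← Subtype.coe_inj, hθ, Subgroup.coe_one, div_eq_one]
      constructor
      · intro hy
        have hy' : h.conj ((y : Eˣ) : E) = (y : Eˣ) := by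
          have := congrArg (fun z : UnS (h.abv S) => ((z : Eˣ) : E)) hy
          exact this.symm
        obtain ⟨x, hx⟩ := h.exists_of_conj_eq hy'
        have hx0 : x ≠ 0 := by
          rintro rfl
          exact (y : Eˣ).ne_zero (by rw [hx, map_zero])
        have hyx : h.incl (Units.mk0 x hx0) = y := Units.ext hx.symm
        exact ⟨⟨Units.mk0 x hx0, h.incl_mem_iff.1 (hyx ▸ y.2)⟩, Subtype.ext hyx⟩
      · rintro ⟨x, rfl⟩
        apply Subtype.ext
        apply Units.ext
        exact (h.conj.commutes _).symm)
    (fun m => by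
      have hm := (hker m.1).1 m.2
      obtain ⟨y, hy, hyu⟩ := h.hilbert90_units h2 ha hcl m.1.1 m.1.2 (congrArg Units.val hm)
      refine ⟨⟨y, hy⟩, Subtype.ext (Subtype.ext ?_)⟩
      rw [hθ, Subgroup.coe_div, hcA, div_eq_iff_eq_mul]
      exact Units.ext hyu)
  have hneg : ∃ g : N.ker, g ^ 2 = 1 ∧ g ≠ 1 := by
    have hm : (-1 : Eˣ) ∈ UnS (h.abv S) := fun w _ => by simp
    have hk : (⟨-1, hm⟩ : UnS (h.abv S)) ∈ N.ker := by
      rw [hker]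
      apply Units.ext
      rw [Units.val_mul, val_conjU]
      simp
    refine ⟨⟨⟨-1, hm⟩, hk⟩, Subtype.ext (Subtype.ext (by simp)), fun h1 => ?_⟩
    have := congrArg (fun z : N.ker => ((z.1.1 : Eˣ) : E)) h1
    have h' : (-1 : E) = 1 := by simpa using this
    have : (2 : E) = 0 := by linear_combination -h'
    exact two_ne_zero this
  have huniq : ∀ g : N.ker, g ^ 2 = 1 → ∀ g' : N.ker, g' ^ 2 = 1 → g ≠ 1 → g' ≠ 1 → g = g' := by
    have aux (g : N.ker) (hg : g ^ 2 = 1) (hg1 : g ≠ 1) : ((g.1.1 : Eˣ) : E) = -1 := by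
      have h1 : ((g.1.1 : Eˣ) : E) ^ 2 = 1 := by
        have := congrArg (fun z : N.ker => ((z.1.1 : Eˣ) : E)) hg
        simpa using this
      rcases (sq_eq_one_iff.1 h1) with h' | h'
      · exact absurd (Subtype.ext (Subtype.ext (Units.ext h'))) hg1
      · exact h'
    intro g hg g' hg' h1 h1'
    exact Subtype.ext (Subtype.ext (Units.ext ((aux g hg h1).trans (aux g' hg' h1').symm)))
  have := finite_ker N
  rw [index_sq_UnS, index_range_pow_two_of_fg N.ker huniq hneg] at key
  have hU : {u : UnS S | u ^ 2 = 1}.Finite := by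
    refine Set.Finite.of_finite_image (f := fun u : UnS S => ((u : Fˣ) : F))
      ((Set.toFinite ({1, -1} : Set F)).subset ?_) (fun x _ y _ hxy => Subtype.ext (Units.ext hxy))
    rintro _ ⟨u, hu, rfl⟩
    have h1 : ((u : Fˣ) : F) ^ 2 = 1 := by
      have := congrArg (fun z : UnS S => ((z : Fˣ) : F)) hu
      simpa using this
    simpa using h1
  have hrk := finrank_ker_of_sq hU N (fun u => ⟨i u, Subtype.ext (h.norm_incl u)⟩)
  have r1 := finrank_UnS S
  have r2 := finrank_UnS (h.abv S)
  have r3 := h.card_abv S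
  have r4 := h.card_infinitePlace
  have hidx : N.range.index = ((UnS (h.abv S)).map h.norm).relIndex (UnS S) := by
    rw [Subgroup.relIndex]
    congr 1
    ext x
    rw [Subgroup.mem_subgroupOf]
    constructor
    · rintro ⟨y, rfl⟩; exact ⟨y, y.2, rfl⟩
    · rintro ⟨y, hy, hyx⟩; exact ⟨⟨y, hy⟩, Subtype.ext hyx⟩
  rw [hidx] at key
  have hsum : S.card + Fintype.card (InfinitePlace F) =
      Module.finrank ℤ (Additive N.ker) + nsp a S := by
    rw [nsp]; omega
  rw [hsum, pow_add, pow_succ] at key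
  have := Nat.pos_of_ne_zero (pow_ne_zero (Module.finrank ℤ (Additive N.ker)) (two_ne_zero (α := ℕ)))
  refine Nat.eq_of_mul_eq_mul_left this ?_
  rw [key]; ring

end IsQuad
end QF

namespace QF

open IsDedekindDomain NumberField WithZero
open scoped Pointwise Classical nonZeroDivisors

variable {F : Type*} [Field F] [NumberField F]

/-- finite sets of primes containing the dyadic ones and generating the class group -/
structure Good (S : Finset (HeightOneSpectrum (𝓞 F))) : Prop where
  two : ∀ v ∉ S, v.valuation F 2 = 1
  cl : ClTriv S

lemma Good.mono {S T : Finset (HeightOneSpectrum (𝓞 F))} (hS : Good S) (h : S ⊆ T) : Good T :=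
  ⟨fun v hv => hS.two v fun h' => hv (h h'), hS.cl.mono h⟩

lemma exists_Good (S : Finset (HeightOneSpectrum (𝓞 F))) (x y : Fˣ) :
    ∃ T, S ⊆ T ∧ Good T ∧ x ∈ UnS T ∧ y ∈ UnS T := by
  obtain ⟨T1, h1⟩ := exists_ClTriv F
  obtain ⟨T2, h2⟩ := exists_mem_UnS (Units.mk0 (2 : F) two_ne_zero)
  obtain ⟨T3, h3⟩ := exists_mem_UnS x
  obtain ⟨T4, h4⟩ := exists_mem_UnS y
  refine ⟨S ∪ T1 ∪ T2 ∪ T3 ∪ T4, ?_, ⟨fun v hv => h2 v fun h => hv ?_, h1.mono ?_⟩,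
    UnS_mono ?_ h3, UnS_mono ?_ h4⟩
  · intro v hv; simp [hv]
  · simp [h]
  · intro v hv; simp [hv]
  · intro v hv; simp [hv]
  · intro v hv; simp [hv]

/-- places in `S` or real -/
abbrev PS (S : Finset (HeightOneSpectrum (𝓞 F))) := {v // v ∈ S} ⊕ (F →+* ℝ)

/-- the underlying place -/
def PS.pl {S : Finset (HeightOneSpectrum (𝓞 F))} (p : PS S) : Pl F := p.map Subtype.val id

/-- nonsplit places in `S` or real -/
abbrev NS (a : Fˣ) (S : Finset (HeightOneSpectrum (𝓞 F))) := {p : PS S // a ∉ SqP p.pl}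

lemma notMem_posAt_iff {φ : F →+* ℝ} {a : Fˣ} : a ∉ posAt φ ↔ φ (a : F) < 0 := by
  rw [mem_posAt, not_lt, le_iff_lt_or_eq]
  simp

lemma card_NS (a : Fˣ) (S : Finset (HeightOneSpectrum (𝓞 F))) : Fintype.card (NS a S) = nsp a S := by
  rw [Fintype.card_subtype, ← Finset.univ_disjSum_univ, Finset.card_filter, Finset.sum_disjSum,
    ← Finset.card_filter, ← Finset.card_filter, nsp]
  congr 1
  · rw [Finset.card_filter, Finset.card_filter, ← Finset.sum_attach S, Finset.univ_eq_attach]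
    rfl
  · congr 1
    ext φ
    simp only [Finset.mem_filter, Finset.mem_univ, true_and]
    exact notMem_posAt_iff

/-- a product of quotients -/
def QProd {G : Type*} [CommGroup G] {ι : Type*} (H : ι → Subgroup G) := ∀ i, G ⧸ H i

instance {G : Type*} [CommGroup G] {ι : Type*} (H : ι → Subgroup G) : CommGroup (QProd H) :=
  Pi.commGroup

/-- projection to a product of quotients -/
def toQ {G : Type*} [CommGroup G] {ι : Type*} (H : ι → Subgroup G) : G →* QProd H :=
  MonoidHom.mk' (fun x _ => (x : _)) (fun _ _ => rfl)

lemma toQ_eq_iff {G : Type*} [CommGroup G] {ι : Type*} {H : ι → Subgroup G} {x y : G} :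
    toQ H x = toQ H y ↔ ∀ i, x / y ∈ H i := by
  refine funext_iff.trans (forall_congr' fun i => ?_)
  change (x : G ⧸ H i) = (y : G ⧸ H i) ↔ _
  rw [← QuotientGroup.eq_one_iff, QuotientGroup.mk_div, div_eq_one]

lemma mem_ker_toQ {G : Type*} [CommGroup G] {ι : Type*} {H : ι → Subgroup G} {x : G} :
    x ∈ (toQ H).ker ↔ ∀ i, x ∈ H i := by
  rw [MonoidHom.mem_ker, ← map_one (toQ H), toQ_eq_iff]
  simp

lemma index_posAt (φ : F →+* ℝ) : (posAt φ).index = 2 := by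
  rw [Subgroup.index_eq_two_iff]
  refine ⟨-1, fun b => ?_⟩
  rw [mem_posAt, mem_posAt]
  have : φ (b : F) ≠ 0 := by simp
  rcases lt_or_gt_of_ne this with h | h
  · simp [h, h.le]
  · simp [h, not_lt.2 h.le]

lemma SqP_index_ne_zero (p : Pl F) : (SqP p).index ≠ 0 := by
  rcases p with v | φ
  · exact index_sqAt_ne_zero v
  · change (posAt φ).index ≠ 0
    rw [index_posAt]; exact two_ne_zero

lemma NmP_index_ne_zero (a : Fˣ) (p : Pl F) : (NmP a p).index ≠ 0 :=
  ne_zero_of_dvd_ne_zero (SqP_index_ne_zero p) (Subgroup.index_dvd_of_le le_sup_right)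

lemma NmP_ne_top {a : Fˣ} {p : Pl F} (ha : a ∉ SqP p) : NmP a p ≠ ⊤ := by
  rcases p with v | φ
  · exact NmAt_ne_top ha
  · intro h
    have h1 : (-1 : Fˣ) ∈ NmP a (.inr φ) := h ▸ Subgroup.mem_top _
    have h2 : NmP a (.inr φ) ≤ posAt φ := by
      refine sup_le ?_ le_rfl
      intro z hz
      obtain ⟨x, y, hz⟩ := mem_Nm.1 hz
      have ha' := notMem_posAt_iff.1 ha
      have hz0 : φ (z : F) ≠ 0 := by simp
      rw [mem_posAt]
      refine lt_of_le_of_ne ?_ hz0.symm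
      rw [hz]
      simp only [map_sub, map_mul, map_pow]
      nlinarith [sq_nonneg (φ x), sq_nonneg (φ y)]
    have := h2 h1
    rw [mem_posAt] at this
    norm_num at this

lemma two_le_index_NmP {a : Fˣ} {p : Pl F} (ha : a ∉ SqP p) : 2 ≤ (NmP a p).index := by
  have h1 := NmP_index_ne_zero a p
  have h2 : (NmP a p).index ≠ 1 := fun h => NmP_ne_top ha (Subgroup.index_eq_one.1 h)
  omega

instance (a : Fˣ) (p : Pl F) : Finite (Fˣ ⧸ NmP a p) :=
  have : (NmP a p).FiniteIndex := ⟨NmP_index_ne_zero a p⟩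
  Subgroup.finite_quotient_of_finiteIndex

instance (p : Pl F) : Finite (Fˣ ⧸ SqP p) :=
  have : (SqP p).FiniteIndex := ⟨SqP_index_ne_zero p⟩
  Subgroup.finite_quotient_of_finiteIndex

lemma exists_norm_group {a : Fˣ} (ha : ¬ IsSquare (a : F)) {S : Finset (HeightOneSpectrum (𝓞 F))}
    (hS : Good S) (haS : a ∈ UnS S) :
    ∃ H : Subgroup Fˣ, H ≤ Nm (a : F) ∧ 2 * H.relIndex (UnS S) = 2 ^ nsp a S := by
  obtain ⟨E, _, _, s, h⟩ := exists_isQuad ha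
  have := h.isQuadraticExtension
  have := NumberField.of_module_finite F E
  refine ⟨(UnS (h.abv S)).map h.norm, ?_, h.index_norm_units hS.two haS hS.cl⟩
  rw [← h.range_norm]
  exact Subgroup.map_le_range _ _

/-- localization of global elements modulo norms at the nonsplit places -/
noncomputable abbrev locN (a : Fˣ) (S : Finset (HeightOneSpectrum (𝓞 F))) :
    Fˣ →* QProd fun p : NS a S => NmP a p.1.pl := toQ _

lemma Nm_le_ker_locN (a : Fˣ) (S : Finset (HeightOneSpectrum (𝓞 F))) :
    Nm (a : F) ≤ (locN a S).ker := fun _ hx => mem_ker_toQ.2 fun _ => le_sup_left (a := Nm (a : F)) hx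

lemma card_map_locN {a : Fˣ} (ha : ¬ IsSquare (a : F)) {S : Finset (HeightOneSpectrum (𝓞 F))}
    (hS : Good S) (haS : a ∈ UnS S) : 2 * Nat.card ((UnS S).map (locN a S)) ≤ 2 ^ nsp a S := by
  obtain ⟨H, hH, hi⟩ := exists_norm_group ha hS haS
  rw [← Subgroup.relIndex_ker, ← hi]
  refine Nat.mul_le_mul_left _ (Nat.le_of_dvd ?_ ?_)
  · have : 0 < 2 ^ nsp a S := by positivity
    omega
  · exact Subgroup.relIndex_dvd_of_le_left _ (hH.trans (Nm_le_ker_locN a S))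

lemma two_pow_nsp_le (a : Fˣ) (S : Finset (HeightOneSpectrum (𝓞 F))) :
    2 ^ nsp a S ≤ Nat.card (QProd fun p : NS a S => NmP a p.1.pl) := by
  rw [QProd, Nat.card_pi, ← card_NS, ← Finset.card_univ]
  exact Finset.pow_card_le_prod _ _ _ fun p _ => two_le_index_NmP p.2

lemma not_surjective_locN {a : Fˣ} (ha : ¬ IsSquare (a : F)) {S : Finset (HeightOneSpectrum (𝓞 F))}
    (hS : Good S) (haS : a ∈ UnS S) : ∃ c, ∀ u ∈ UnS S, locN a S u ≠ c := by
  by_contra! h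
  have h1 : (UnS S).map (locN a S) = ⊤ := by
    rw [eq_top_iff]
    intro c _
    obtain ⟨u, hu, rfl⟩ := h c
    exact ⟨u, hu, rfl⟩
  have h2 := card_map_locN ha hS haS
  rw [h1, Subgroup.card_top] at h2
  have h3 := two_pow_nsp_le a S
  have : 0 < 2 ^ nsp a S := by positivity
  omega

lemma PS.pl_injective {S : Finset (HeightOneSpectrum (𝓞 F))} :
    Function.Injective (PS.pl (S := S)) :=
  Sum.map_injective.2 ⟨Subtype.val_injective, Function.injective_id⟩

lemma exists_rep {a : Fˣ} {S : Finset (HeightOneSpectrum (𝓞 F))}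
    (c : QProd fun p : NS a S => NmP a p.1.pl) : ∃ z : Pl F → Fˣ, ∀ u : Fˣ,
      (∀ q : NS a S, u / z q.1.pl ∈ SqP q.1.pl) → locN a S u = c := by
  have hc (p : Pl F) : ∃ z : Fˣ, ∀ q : NS a S, q.1.pl = p →
      ∀ y : Fˣ, y / z ∈ SqP p → (y : Fˣ ⧸ NmP a q.1.pl) = c q := by
    by_cases hp : ∃ q : NS a S, q.1.pl = p
    · obtain ⟨q, rfl⟩ := hp
      obtain ⟨z, hz⟩ := QuotientGroup.mk_surjective (c q)
      refine ⟨z, fun q' hq' y hy => ?_⟩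
      have : q' = q := Subtype.ext (PS.pl_injective hq')
      subst this
      rw [← hz, ← div_eq_one, ← QuotientGroup.mk_div, QuotientGroup.eq_one_iff]
      exact le_sup_right (a := Nm (a : F)) hy
    · exact ⟨1, fun q hq => absurd ⟨q, hq⟩ hp⟩
  choose z hz using hc
  exact ⟨z, fun x hx => funext fun q => hz _ q rfl x (hx q)⟩

/-- a nonsquare is not a local square at infinitely many primes -/
lemma exists_notMem_Sq {a : Fˣ} (ha : ¬ IsSquare (a : F)) (S : Finset (HeightOneSpectrum (𝓞 F))) :
    ∃ v ∉ S, a ∉ Sq v := by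
  by_contra! h
  obtain ⟨S₁, hSS, hg, haS, -⟩ := exists_Good S a 1
  have hs (v) (hv : v ∉ S₁) : a ∈ Sq v := h v fun h' => hv (hSS h')
  have hex (c : QProd fun p : NS a S₁ => NmP a p.1.pl) : ∃ u : Fˣ, locN a S₁ u = c := by
    obtain ⟨z, hz⟩ := exists_rep c
    obtain ⟨x, hx1, hx2⟩ := weak_approx_units S₁ z
    refine ⟨x, hz x fun q => ?_⟩
    rcases q with ⟨v | φ, hq⟩
    · exact hx1 v v.2
    · exact hx2 φ
  choose u hu using hex
  have : Finite (QProd fun p : NS a S₁ => NmP a p.1.pl) := Pi.finite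
  have := Fintype.ofFinite (QProd fun p : NS a S₁ => NmP a p.1.pl)
  choose W hW using fun c => exists_mem_UnS (u c)
  let S₂ := S₁ ∪ Finset.univ.biUnion W
  have h12 : S₁ ⊆ S₂ := Finset.subset_union_left
  obtain ⟨c, hc⟩ := not_surjective_locN ha (hg.mono h12) (UnS_mono h12 haS)
  have hns (q : NS a S₂) : ∃ q' : NS a S₁, q'.1.pl = q.1.pl := by
    rcases q with ⟨⟨v, hv⟩ | φ, hq⟩
    · have hv1 : v ∈ S₁ := by
        by_contra hv1
        exact hq (hs v hv1)
      exact ⟨⟨.inl ⟨v, hv1⟩, hq⟩, rfl⟩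
    · exact ⟨⟨.inr φ, hq⟩, rfl⟩
  let emb : NS a S₁ → NS a S₂ := fun q => ⟨q.1.map (fun v => ⟨v.1, h12 v.2⟩) id, by
    rcases q with ⟨⟨v, hv⟩ | φ, hq⟩ <;> exact hq⟩
  have hemb (q : NS a S₁) : (emb q).1.pl = q.1.pl := by
    rcases q with ⟨⟨v, hv⟩ | φ, hq⟩ <;> rfl
  have hsur (q : NS a S₂) : ∃ q', emb q' = q := by
    obtain ⟨q', hq'⟩ := hns q
    refine ⟨q', Subtype.ext ?_⟩
    exact PS.pl_injective ((hemb q').trans hq')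
  have hrep : ∃ c' : (QProd fun p : NS a S₁ => NmP a p.1.pl), ∀ y : Fˣ,
      locN a S₁ y = c' → locN a S₂ y = c := by
    choose g hg using fun q => QuotientGroup.mk_surjective (c q)
    refine ⟨fun q => (g (emb q) : _), fun y hy => funext fun q => ?_⟩
    obtain ⟨q', rfl⟩ := hsur q
    have h1 := congrFun hy q'
    have h2 : y / g (emb q') ∈ NmP a q'.1.pl := by
      rw [← QuotientGroup.eq_one_iff, QuotientGroup.mk_div, div_eq_one]; exact h1
    rw [← hemb q', ← QuotientGroup.eq_one_iff, QuotientGroup.mk_div, div_eq_one] at h2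
    rw [← hg (emb q')]; exact h2
  obtain ⟨c', hc'⟩ := hrep
  refine hc (u c') (UnS_mono ?_ (hW c')) (hc' _ (hu c'))
  exact (Finset.subset_biUnion_of_mem W (Finset.mem_univ c')).trans Finset.subset_union_right

end QF

namespace QF

open IsDedekindDomain NumberField WithZero
open scoped Pointwise Classical nonZeroDivisors

variable {F : Type*} [Field F] [NumberField F]

lemma relIndex_Sq_unitsAt {v : HeightOneSpectrum (𝓞 F)} (h2 : v.valuation F 2 = 1) :
    (Sq v).relIndex (unitsAt v) = 2 := by
  rw [relIndex_sqAt (k := 0) (by rw [h2]; simp)]; simp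

lemma mul_mem_Sq {v : HeightOneSpectrum (𝓞 F)} (h2 : v.valuation F 2 = 1) {x y : Fˣ}
    (hx : v.valuation F (x : F) = 1) (hy : v.valuation F (y : F) = 1) (hx' : x ∉ Sq v)
    (hy' : y ∉ Sq v) : x * y ∈ Sq v := by
  have h := relIndex_Sq_unitsAt h2
  rw [Subgroup.relIndex] at h
  have := (Subgroup.mul_mem_iff_of_index_two h (a := ⟨x, hx⟩) (b := ⟨y, hy⟩)).2
    (by simp [Subgroup.mem_subgroupOf, hx', hy'])
  exact this

lemma isSquare_of_incl {E : Type*} [Field E] [Algebra F E] {a : Fˣ} {s : E}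
    (h : IsQuad (a : F) s) {u : Fˣ} (hu : IsSquare ((h.incl u : Eˣ) : E)) :
    IsSquare (u : F) ∨ IsSquare ((u * a : Fˣ) : F) := by
  obtain ⟨z, hz⟩ := hu
  have hz' : algebraMap F E (u : F) = z * z := hz
  have e := h.eq_re_im z
  set x := h.re z
  set y := h.im z
  have h1 : algebraMap F E (x ^ 2 + a * y ^ 2 - u) + algebraMap F E (2 * x * y) * s = 0 := by
    rw [map_sub, hz', e, map_add, map_mul, map_mul, map_mul, map_pow, map_pow, ← h.s_mul_s,
      map_ofNat]
    ring
  obtain ⟨h2, h3⟩ := h.eq_zero_of h1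
  have hxy : x = 0 ∨ y = 0 := by simpa using h3
  rcases hxy with h0 | h0
  · right
    refine ⟨a * y, ?_⟩
    rw [Units.val_mul]
    rw [h0] at h2
    linear_combination -(a : F) * h2
  · left
    refine ⟨x, ?_⟩
    rw [h0] at h2
    linear_combination -h2

lemma exists_split_notMem_Sq {a : Fˣ} (ha : ¬ IsSquare (a : F))
    {S : Finset (HeightOneSpectrum (𝓞 F))} (hS : Good S) (haS : a ∈ UnS S) {u : Fˣ} (huS : u ∈ UnS S)
    (hu : ¬ IsSquare (u : F)) (hua : ¬ IsSquare ((u * a : Fˣ) : F)) :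
    ∃ t ∉ S, a ∈ Sq t ∧ u ∉ Sq t := by
  obtain ⟨E, _, _, s, h⟩ := exists_isQuad ha
  have := h.isQuadraticExtension
  have := NumberField.of_module_finite F E
  have huE : ¬ IsSquare ((h.incl u : Eˣ) : E) := fun h' => by
    rcases isSquare_of_incl h h' with h' | h'
    · exact hu h'
    · exact hua h'
  obtain ⟨w, hw, huw⟩ := exists_notMem_Sq huE (h.abv S)
  have ht : below F w ∉ S := fun h' => hw (h.mem_abv.2 h')
  have hut : u ∉ Sq (below F w) := fun h' => huw (sqAt_algebraMap h')
  refine ⟨below F w, ht, ?_, hut⟩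
  by_contra hat
  have h1 := mul_mem_Sq (hS.two _ ht) (huS _ ht) (haS _ ht) hut hat
  have h2 : h.incl (u * a) ∈ Sq w := sqAt_algebraMap h1
  have h3 : h.incl a ∈ Sq w := by
    have : h.incl a = (Units.mk0 s h.s_ne_zero) ^ 2 := Units.ext (by
      rw [Units.val_pow_eq_pow_val, Units.val_mk0, h.sq]; rfl)
    rw [this]; exact sq_mem_sqAt _ _
  rw [map_mul] at h2
  exact huw ((Subgroup.mul_mem_cancel_right _ h3).1 h2)

/-- global squares -/
def SqG (F : Type*) [Field F] : Subgroup Fˣ := (powMonoidHom 2 : Fˣ →* Fˣ).range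

lemma mem_SqG {F : Type*} [Field F] {x : Fˣ} : x ∈ SqG F ↔ IsSquare (x : F) := by
  constructor
  · rintro ⟨y, rfl⟩; exact ⟨y, by simp [pow_two]⟩
  · rintro ⟨y, hy⟩
    have : y ≠ 0 := by rintro rfl; simp at hy
    exact ⟨Units.mk0 y this, Units.ext (by simp [hy, pow_two])⟩

lemma relIndex_SqG (S : Finset (HeightOneSpectrum (𝓞 F))) :
    (SqG F).relIndex (UnS S) = 2 ^ (S.card + Fintype.card (InfinitePlace F)) := by
  rw [← index_sq_UnS, Subgroup.relIndex]
  congr 1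
  ext x
  rw [Subgroup.mem_subgroupOf]
  constructor
  · rintro ⟨y, hy⟩
    have hy' : y ^ 2 = (x : Fˣ) := hy
    have hyS : y ∈ UnS S := fun v hv => by
      have := x.2 v hv
      rw [← hy', Units.val_pow_eq_pow_val, map_pow] at this
      exact (pow_eq_one_iff.1 this).resolve_right two_ne_zero
    exact ⟨⟨y, hyS⟩, Subtype.ext hy'⟩
  · rintro ⟨y, rfl⟩
    exact ⟨y, rfl⟩

/-- `S`-units which are local squares in `T` -/
def KT (S T : Finset (HeightOneSpectrum (𝓞 F))) : Subgroup Fˣ where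
  carrier := {u | u ∈ UnS S ∧ ∀ t ∈ T, u ∈ Sq t}
  one_mem' := ⟨one_mem _, fun _ _ => one_mem _⟩
  mul_mem' := fun hx hy => ⟨mul_mem hx.1 hy.1, fun t ht => mul_mem (hx.2 t ht) (hy.2 t ht)⟩
  inv_mem' := fun hx => ⟨inv_mem hx.1, fun t ht => inv_mem (hx.2 t ht)⟩

lemma exists_aux_primes {a : Fˣ} (ha : ¬ IsSquare (a : F))
    {S : Finset (HeightOneSpectrum (𝓞 F))} (hS : Good S) (haS : a ∈ UnS S) (k : ℕ)
    (hk : k + 1 ≤ S.card + Fintype.card (InfinitePlace F)) :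
    ∃ T : Finset (HeightOneSpectrum (𝓞 F)), T.card = k ∧ (∀ t ∈ T, t ∉ S ∧ a ∈ Sq t) ∧
      (∀ c : HeightOneSpectrum (𝓞 F) → Fˣ, (∀ t ∈ T, t.valuation F (c t : F) = 1) →
        ∃ u ∈ UnS S, ∀ t ∈ T, u / c t ∈ Sq t) ∧ (KT S T).relIndex (UnS S) = 2 ^ k := by
  induction k with
  | zero =>
    refine ⟨∅, rfl, by simp, fun _ _ => ⟨1, one_mem _, by simp⟩, ?_⟩
    rw [pow_zero, Subgroup.relIndex_eq_one]
    intro u hu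
    exact ⟨hu, by simp⟩
  | succ k ih =>
    obtain ⟨T, hT, hsp, hon, hix⟩ := ih (by omega)
    obtain ⟨u, huK, hu, hua⟩ : ∃ u ∈ KT S T, ¬ IsSquare (u : F) ∧ ¬ IsSquare ((u * a : Fˣ) : F) := by
      by_contra! hcon
      have haK : a ∈ KT S T := ⟨haS, fun t ht => (hsp t ht).2⟩
      have h2 : (SqG F).relIndex (KT S T) = 2 := by
        rw [Subgroup.relIndex_eq_two_iff_exists_notMem_and]
        refine ⟨a, haK, fun h => ha (mem_SqG.1 h), fun b hb => ?_⟩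
        rw [mem_SqG, mem_SqG]
        by_cases h : IsSquare (b : F)
        · exact Or.inr h
        · exact Or.inl (hcon b hb h)
      have h3 := relIndex_SqG S
      have hsub : SqG F ⊓ UnS S ≤ KT S T := by
        rintro _ ⟨⟨y, rfl⟩, hy⟩
        exact ⟨hy, fun t _ => sq_mem_sqAt _ _⟩
      have hKU : KT S T ≤ UnS S := fun x hx => hx.1
      have h4 := Subgroup.relIndex_mul_relIndex _ _ _ hsub hKU
      have h5 : (SqG F ⊓ UnS S).relIndex (KT S T) = 2 := by
        rw [← h2, ← Subgroup.inf_relIndex_right (SqG F ⊓ UnS S), inf_assoc, inf_eq_right.2 hKU,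
          Subgroup.inf_relIndex_right]
      rw [h5, hix, Subgroup.inf_relIndex_right, h3, ← pow_succ'] at h4
      have := Nat.pow_right_injective le_rfl h4
      omega
    obtain ⟨t, htS, hat, hut⟩ := exists_split_notMem_Sq ha hS haS huK.1 hu hua
    have htT : t ∉ T := fun h => hut (huK.2 t h)
    refine ⟨insert t T, by rw [Finset.card_insert_of_notMem htT, hT], ?_, ?_, ?_⟩
    · intro t' ht'
      rcases Finset.mem_insert.1 ht' with rfl | h
      · exact ⟨htS, hat⟩
      · exact hsp t' h
    · intro c hc
      obtain ⟨u', hu', hu'c⟩ := hon c fun t' ht' => hc t' (Finset.mem_insert_of_mem ht')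
      by_cases h : u' / c t ∈ Sq t
      · refine ⟨u', hu', fun t' ht' => ?_⟩
        rcases Finset.mem_insert.1 ht' with rfl | ht'
        · exact h
        · exact hu'c t' ht'
      · refine ⟨u' * u, mul_mem hu' huK.1, fun t' ht' => ?_⟩
        rcases Finset.mem_insert.1 ht' with rfl | ht'
        · rw [mul_div_right_comm]
          refine mul_mem_Sq (hS.two _ htS) ?_ (huK.1 _ htS) h hut
          rw [Units.val_div_eq_div_val, map_div₀, hu' _ htS, hc _ ht', div_one]
        · rw [mul_div_right_comm]
          exact mul_mem (hu'c t' ht') (huK.2 t' ht')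
    · have h1 : KT S (insert t T) ≤ KT S T :=
        fun x hx => ⟨hx.1, fun t' ht' => hx.2 t' (Finset.mem_insert_of_mem ht')⟩
      have hKU : KT S T ≤ UnS S := fun x hx => hx.1
      rw [← Subgroup.relIndex_mul_relIndex _ _ _ h1 hKU, hix, pow_succ']
      congr 1
      rw [Subgroup.relIndex_eq_two_iff_exists_notMem_and]
      have hiff (x) (hx : x ∈ KT S T) : x ∈ KT S (insert t T) ↔ x ∈ Sq t := by
        refine ⟨fun h => h.2 t (Finset.mem_insert_self _ _), fun h => ⟨hx.1, fun t' ht' => ?_⟩⟩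
        rcases Finset.mem_insert.1 ht' with rfl | ht'
        · exact h
        · exact hx.2 t' ht'
      refine ⟨u, huK, fun h => hut ((hiff u huK).1 h), fun b hb => ?_⟩
      rw [hiff b hb, hiff _ (mul_mem hb huK)]
      by_cases h : b ∈ Sq t
      · exact Or.inr h
      · exact Or.inl (mul_mem_Sq (hS.two _ htS) (hb.1 _ htS) (huK.1 _ htS) h hut)

lemma isSquare_of_local {S T : Finset (HeightOneSpectrum (𝓞 F))} (hS : Good S)
    (hTS : ∀ t ∈ T, t ∉ S)
    (hon : ∀ c : HeightOneSpectrum (𝓞 F) → Fˣ, (∀ t ∈ T, t.valuation F (c t : F) = 1) →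
        ∃ u ∈ UnS S, ∀ t ∈ T, u / c t ∈ Sq t) {x : Fˣ} (hx : x ∈ UnS (S ∪ T))
    (hxS : ∀ p : PS S, x ∈ SqP p.pl) : IsSquare (x : F) := by
  by_contra hns
  have hsub : S ⊆ S ∪ T := Finset.subset_union_left
  obtain ⟨c, hc⟩ := not_surjective_locN hns (hS.mono hsub) hx
  obtain ⟨z, hz⟩ := exists_rep c
  let n : HeightOneSpectrum (𝓞 F) → ℤ := fun v =>
    if v ∈ T then log (v.valuation F (z (.inl v) : F)) else 0
  obtain ⟨y, hy⟩ := hS.cl n (T.finite_toSet.subset fun v hv => by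
    by_contra h
    exact hv (if_neg h))
  obtain ⟨u, hu, huT⟩ := hon (fun v => z (.inl v) / y) fun t ht => by
    have h0 : t.valuation F (z (.inl t) : F) ≠ 0 := by simp
    rw [Units.val_div_eq_div_val, map_div₀, hy t (hTS t ht)]
    simp only [n, if_pos ht]
    rw [exp_log h0, div_self h0]
  refine hc (u * y) (mul_mem (UnS_mono hsub hu) fun v hv => ?_) (hz _ fun q => ?_)
  · rw [Finset.mem_union, not_or] at hv
    rw [hy v hv.1]
    simp only [n, if_neg hv.2, exp_zero]
  · rcases q with ⟨⟨v, hv⟩ | φ, hq⟩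
    · rcases Finset.mem_union.1 hv with h | h
      · exact absurd (hxS (.inl ⟨v, h⟩)) hq
      · have := huT v h
        rw [div_div_eq_mul_div] at this
        exact this
    · exact absurd (hxS (.inr φ)) hq

lemma prod_absNorm {S : Finset (HeightOneSpectrum (𝓞 F))} (h2 : ∀ v ∉ S, v.valuation F 2 = 1)
    (k : HeightOneSpectrum (𝓞 F) → ℕ) (hk : ∀ v, v.valuation F 2 = exp (-(k v : ℤ))) :
    ∏ v ∈ S, Ideal.absNorm v.asIdeal ^ k v = 2 ^ Module.finrank ℚ F := by
  have h20 : (2 : 𝓞 F) ≠ 0 := two_ne_zero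
  have hI : Ideal.span {(2 : 𝓞 F)} ≠ 0 := by simp
  have hkc (v) : k v = cnt v (Ideal.span {(2 : 𝓞 F)}) := by
    have h1 := val_eq_cnt v h20
    rw [map_ofNat, hk v, exp_inj] at h1
    omega
  have h1 := Ideal.finprod_heightOneSpectrum_factorization hI
  have h3 : Function.mulSupport (fun v : HeightOneSpectrum (𝓞 F) =>
      v.maxPowDividing (Ideal.span {(2 : 𝓞 F)})) ⊆ S := by
    intro v hv
    by_contra hvS
    apply hv
    have h5 := h2 v hvS
    rw [hk v, ← exp_zero, exp_inj] at h5
    have h4 : cnt v (Ideal.span {(2 : 𝓞 F)}) = 0 := by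
      rw [← hkc]; omega
    change v.asIdeal ^ cnt v (Ideal.span {(2 : 𝓞 F)}) = 1
    rw [h4, pow_zero]
  rw [finprod_eq_prod_of_mulSupport_subset _ h3] at h1
  have h6 := congrArg Ideal.absNorm h1
  rw [map_prod, Ideal.absNorm_span_singleton] at h6
  have h7 : Algebra.norm ℤ (2 : 𝓞 F) = 2 ^ Module.finrank ℚ F := by
    rw [← RingOfIntegers.rank]
    simpa using Algebra.norm_algebraMap (R := ℤ) (S := 𝓞 F) 2
  rw [h7] at h6
  have h8 : (2 ^ Module.finrank ℚ F : ℤ).natAbs = 2 ^ Module.finrank ℚ F := by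
    rw [Int.natAbs_pow]; rfl
  rw [h8] at h6
  rw [← h6]
  refine Finset.prod_congr rfl fun v _ => ?_
  rw [hkc, ← map_pow]; rfl

/-- localization modulo squares at the places of `S` and the real places -/
noncomputable abbrev locS (S : Finset (HeightOneSpectrum (𝓞 F))) :
    Fˣ →* QProd fun p : PS S => SqP p.pl := toQ _

lemma card_locS {S : Finset (HeightOneSpectrum (𝓞 F))} (h2 : ∀ v ∉ S, v.valuation F 2 = 1) :
    Nat.card (QProd fun p : PS S => SqP p.pl) =
      4 ^ (S.card + Fintype.card (InfinitePlace F)) := by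
  choose k hk using exists_ord_two (F := F)
  have h1 := two_mul_card_infinitePlace F
  rw [QProd, Nat.card_pi, Fintype.prod_sum_type]
  have e1 : ∏ v : {v // v ∈ S}, Nat.card (Fˣ ⧸ SqP (PS.pl (S := S) (.inl v))) =
      4 ^ S.card * 2 ^ Module.finrank ℚ F := by
    rw [← prod_absNorm h2 k hk, ← Finset.prod_const, ← Finset.prod_mul_distrib,
      ← Finset.prod_coe_sort S]
    refine Finset.prod_congr rfl fun v _ => ?_
    exact index_sqAt (hk v.1)
  have e2 : ∏ φ : F →+* ℝ, Nat.card (Fˣ ⧸ SqP (PS.pl (S := S) (.inr φ))) =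
      2 ^ Fintype.card (F →+* ℝ) := by
    rw [← Finset.card_univ, ← Finset.prod_const]
    exact Finset.prod_congr rfl fun φ _ => index_posAt φ
  rw [e1, e2, mul_assoc, ← pow_add, ← h1, pow_add, pow_mul]
  norm_num

lemma exists_toQ_proj {G : Type*} [CommGroup G] {ι κ : Type*} (H : ι → Subgroup G)
    (K : κ → Subgroup G) (f : κ → ι) (hf : Function.Injective f) (hle : ∀ k, H (f k) ≤ K k) :
    ∃ π : QProd H →* QProd K, π.comp (toQ H) = toQ K ∧ Function.Surjective π := by
  let m (k : κ) : G ⧸ H (f k) →* G ⧸ K k := QuotientGroup.map _ _ (MonoidHom.id _) (hle k)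
  let π : QProd H →* QProd K :=
    MonoidHom.mk' (fun c k => m k (c (f k))) (fun c d => funext fun k =>
      (m k).map_mul (c (f k)) (d (f k)))
  refine ⟨π, rfl, fun c => ?_⟩
  choose g hg using fun k => QuotientGroup.mk_surjective (c k)
  refine ⟨fun i => if h : ∃ k, f k = i then (g h.choose : _) else 1, funext fun k => ?_⟩
  rw [← hg k]
  have h : ∃ k', f k' = f k := ⟨k, rfl⟩
  change m k (if h : ∃ k', f k' = f k then (g h.choose : _) else 1) = _
  rw [dif_pos h, hf h.choose_spec]
  rfl

lemma exists_proj (a : Fˣ) (S : Finset (HeightOneSpectrum (𝓞 F))) :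
    ∃ π : (QProd fun p : PS S => SqP p.pl) →* QProd fun p : NS a S => NmP a p.1.pl,
      π.comp (locS S) = locN a S ∧ Function.Surjective π :=
  exists_toQ_proj _ _ (fun q : NS a S => q.1) Subtype.val_injective fun _ => le_sup_right

lemma locN_core {a : Fˣ} (ha : ¬ IsSquare (a : F))
    {S : Finset (HeightOneSpectrum (𝓞 F))} (hS : Good S) (haS : a ∈ UnS S) :
    (∀ b ∈ UnS S, b ∈ (locN a S).ker → b ∈ Nm (a : F)) ∧
      Nat.card (QProd fun p : NS a S => NmP a p.1.pl) ≤ 2 ^ nsp a S := by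
  have hr : 0 < Fintype.card (InfinitePlace F) := Fintype.card_pos
  obtain ⟨T, hT, hsp, hon, -⟩ := exists_aux_primes ha hS haS
    (S.card + Fintype.card (InfinitePlace F) - 1) (by omega)
  have hsub : S ⊆ S ∪ T := Finset.subset_union_left
  have hdis : Disjoint S T := Finset.disjoint_right.2 fun t ht => (hsp t ht).1
  set U := UnS (S ∪ T) with hU
  have hfinS : Finite (QProd fun p : PS S => SqP p.pl) := Pi.finite
  have hfinN : Finite (QProd fun p : NS a S => NmP a p.1.pl) := Pi.finite
  -- the units have index two modulo squares
  have hker : (locS S).ker ⊓ U = SqG F ⊓ U := by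
    ext x
    constructor
    · rintro ⟨h1, h2⟩
      exact ⟨mem_SqG.2 (isSquare_of_local hS (fun t ht => (hsp t ht).1) hon h2
        (mem_ker_toQ.1 h1)), h2⟩
    · rintro ⟨⟨y, rfl⟩, h2⟩
      exact ⟨mem_ker_toQ.2 fun p => sq_mem_SqP _ _, h2⟩
  have hcard : Nat.card (U.map (locS S)) = 2 ^ (2 * (S.card + Fintype.card (InfinitePlace F)) - 1) := by
    rw [← Subgroup.relIndex_ker, ← Subgroup.inf_relIndex_right, hker, Subgroup.inf_relIndex_right,
      relIndex_SqG, Finset.card_union_of_disjoint hdis, hT]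
    congr 1
    omega
  have hindex : (U.map (locS S)).index = 2 := by
    have h1 := Subgroup.card_mul_index (U.map (locS S))
    rw [card_locS hS.two, hcard, show (4 : ℕ) = 2 ^ 2 by norm_num, ← pow_mul] at h1
    have h2 : 2 * (S.card + Fintype.card (InfinitePlace F)) =
      2 * (S.card + Fintype.card (InfinitePlace F)) - 1 + 1 := by omega
    rw [h2, pow_succ] at h1
    exact Nat.eq_of_mul_eq_mul_left (by positivity) h1
  obtain ⟨π, hπ, hπs⟩ := exists_proj a S
  have hdvd : (U.map (locN a S)).index ∣ 2 := by
    rw [← hπ, ← Subgroup.map_map, ← hindex]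
    exact Subgroup.index_map_dvd _ hπs
  have h2 : (U.map (locN a S)).index ≤ 2 := Nat.le_of_dvd two_pos hdvd
  have h3 := Subgroup.card_mul_index (U.map (locN a S))
  have h4 := two_pow_nsp_le a S
  obtain ⟨H, hH, hi⟩ := exists_norm_group ha (hS.mono hsub) (UnS_mono hsub haS)
  have hnsp : nsp a (S ∪ T) = nsp a S := by
    rw [nsp, nsp, Finset.filter_union, Finset.filter_false_of_mem (s := T), Finset.union_empty]
    intro t ht
    exact not_not.2 (hsp t ht).2
  rw [hnsp] at hi
  have hpos : 0 < 2 ^ nsp a S := by positivity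
  have hHk : H ≤ (locN a S).ker := hH.trans (Nm_le_ker_locN a S)
  have h5 : (locN a S).ker.relIndex U ≤ H.relIndex U := Nat.le_of_dvd
    (by rw [hU]; omega) (Subgroup.relIndex_dvd_of_le_left _ hHk)
  have h6 : Nat.card (U.map (locN a S)) = (locN a S).ker.relIndex U := by rw [Subgroup.relIndex_ker]
  have h7 : Nat.card (QProd fun p : NS a S => NmP a p.1.pl) ≤ 2 * (locN a S).ker.relIndex U := by
    rw [← h3, h6, mul_comm]; exact Nat.mul_le_mul_right _ h2
  refine ⟨fun b hb hbk => ?_, by rw [hU] at h5 h7; omega⟩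
  have h8 : (locN a S).ker.relIndex U = H.relIndex U := by rw [hU] at h5 h7 ⊢; omega
  have hsub2 : H ⊓ U ≤ (locN a S).ker ⊓ U := inf_le_inf_right _ hHk
  have h9 := Subgroup.relIndex_mul_relIndex _ _ _ hsub2 (inf_le_right)
  rw [Subgroup.inf_relIndex_right, Subgroup.inf_relIndex_right, h8] at h9
  have h10 : 0 < H.relIndex U := by rw [hU]; omega
  have h11 : (H ⊓ U).relIndex ((locN a S).ker ⊓ U) = 1 := by
    rw [← Nat.eq_of_mul_eq_mul_right h10 (h9.trans (one_mul _).symm)]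
  exact hH ((Subgroup.relIndex_eq_one.1 h11) ⟨hbk, UnS_mono hsub hb⟩).1

/-- Hasse norm theorem for quadratic extensions -/
theorem mem_Nm_of_local {a b : Fˣ} (ha : ¬ IsSquare (a : F))
    (hb : ∀ p : Pl F, a ∉ SqP p → b ∈ NmP a p) : b ∈ Nm (a : F) := by
  obtain ⟨S, -, hS, haS, hbS⟩ := exists_Good ∅ a b
  exact (locN_core ha hS haS).1 b hbS (mem_ker_toQ.2 fun q => hb _ q.2)

theorem index_NmP {a : Fˣ} (ha : ¬ IsSquare (a : F)) {p : Pl F} (hp : a ∉ SqP p) :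
    (NmP a p).index = 2 := by
  obtain ⟨S, hpS, hS, haS, -⟩ := exists_Good (p.elim (fun v => {v}) fun _ => ∅) a 1
  obtain ⟨q, hq⟩ : ∃ q : NS a S, q.1.pl = p := by
    rcases p with v | φ
    · exact ⟨⟨.inl ⟨v, hpS (Finset.mem_singleton_self v)⟩, hp⟩, rfl⟩
    · exact ⟨⟨.inr φ, hp⟩, rfl⟩
  have h := (locN_core ha hS haS).2
  refine le_antisymm ?_ (two_le_index_NmP hp)
  by_contra! hlt
  refine absurd h (not_le.2 ?_)
  rw [QProd, Nat.card_pi, ← card_NS, ← Finset.card_univ, ← Finset.prod_const]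
  refine Finset.prod_lt_prod (fun _ _ => two_pos) (fun q' _ => two_le_index_NmP q'.2)
    ⟨q, Finset.mem_univ _, ?_⟩
  rw [← hq] at hlt
  exact hlt

end QF

namespace QF

open IsDedekindDomain NumberField WithZero
open scoped Pointwise Classical nonZeroDivisors

variable {F : Type*} [Field F] [NumberField F]

lemma exists_Nm_approx {d z : Fˣ} {v : HeightOneSpectrum (𝓞 F)} (hz : z ∈ NmAt d v)
    {γ : ℤᵐ⁰} (hγ : γ ≠ 0) : ∃ α ∈ Nm (d : F), v.valuation F ((α : F) - z) < γ := by
  obtain ⟨n, hn, σ, hσ, rfl⟩ := Subgroup.mem_sup.1 hz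
  set V := v.valuation F
  have hz0 : V ((n * σ : Fˣ) : F) ≠ 0 := by simp
  obtain ⟨w, hw⟩ := sqAt_improve hσ (γ := min 1 (γ / V ((n * σ : Fˣ) : F)))
    (by
      rw [Ne, ← le_zero_iff, min_le_iff, not_or]
      simp [hγ])
  have h1 : V ((σ : F) * w ^ 2) = 1 :=
    val_eq_one_of_sub_lt V (hw.trans_le (min_le_left _ _))
  refine ⟨n * (w⁻¹) ^ 2, mul_mem hn (sq_mem_Nm _ _), ?_⟩
  have e : ((n * (w⁻¹) ^ 2 : Fˣ) : F) - ((n * σ : Fˣ) : F) =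
      -(((n * σ : Fˣ) : F) * ((σ : F) * (w : F) ^ 2 - 1)) * ((σ : F) * (w : F) ^ 2)⁻¹ := by
    push_cast
    field_simp
    ring
  rw [e, map_mul, Valuation.map_neg, map_mul, map_inv₀, h1, inv_one, mul_one]
  have h2 := hw.trans_le (min_le_right _ _)
  rwa [lt_div_iff₀ (zero_lt_iff.2 hz0), mul_comm] at h2

lemma exists_nat_notMem {d : Fˣ} {v : HeightOneSpectrum (𝓞 F)} (h : (-1 : Fˣ) ∉ NmAt d v) :
    ∃ k : ℕ, ∃ z : Fˣ, (z : F) = k ∧ z ∉ NmAt d v := by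
  by_contra! hcon
  apply h
  set M := Ideal.absNorm v.asIdeal
  have hM : v.valuation F (M : F) < 1 := by
    have h1 : ((M : ℕ) : 𝓞 F) ∈ v.asIdeal := Ideal.absNorm_mem _
    have := (v.valuation_lt_one_iff_mem (K := F) (M : 𝓞 F)).2 h1
    simpa using this
  have hM2 : 2 ≤ M := by
    have h0 : M ≠ 0 := Ideal.absNorm_eq_zero_iff.not.2 v.ne_bot
    have h1 : M ≠ 1 := fun h => v.isPrime.ne_top (Ideal.absNorm_eq_one_iff.1 h)
    omega
  obtain ⟨m, hm⟩ := exists_exp_neg_lt (γ := v.valuation F 4) (val_four_pos _).ne'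
  have hMe : v.valuation F (M : F) ≤ exp (-1) := by
    have h0 : v.valuation F (M : F) ≠ 0 := by
      rw [_root_.map_ne_zero]; exact_mod_cast (by omega : M ≠ 0)
    rw [← exp_log h0, exp_le_exp]
    rw [← exp_log h0, ← exp_zero, exp_lt_exp] at hM
    omega
  have hMm : v.valuation F ((M : F) ^ (m + 1)) < v.valuation F 4 := by
    refine lt_of_le_of_lt ?_ hm
    rw [map_pow]
    calc _ ≤ exp (-1) ^ (m + 1) := pow_le_pow_left' hMe _
      _ = exp (-((m : ℤ) + 1)) := by rw [← exp_nsmul]; congr 1; simp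
      _ ≤ _ := by rw [exp_le_exp]; omega
  have hk0 : ((M ^ (m + 1) - 1 : ℕ) : F) ≠ 0 := by
    have : M ^ 1 ≤ M ^ (m + 1) := Nat.pow_le_pow_right (by omega) (by omega)
    rw [pow_one] at this
    exact_mod_cast (by omega : M ^ (m + 1) - 1 ≠ 0)
  have h1 := hcon (M ^ (m + 1) - 1) (Units.mk0 _ hk0) rfl
  have h2 : Units.mk0 _ hk0 / (-1) ∈ Sq v := by
    apply div_mem_sqAt
    rw [Units.val_mk0, Nat.cast_sub (Nat.one_le_pow _ _ (by omega))]
    simpa using hMm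
  have h3 := (Subgroup.mul_mem_cancel_right _ (inv_mem (le_sup_right (a := Nm (d : F)) h2))).2 h1
  rw [inv_div, mul_comm, div_mul_cancel] at h3
  exact h3

/-- local solvability of quaternion norm equations -/
lemma exists_local_rep {d b c : Fˣ} (hd : ¬ IsSquare (d : F)) {v : HeightOneSpectrum (𝓞 F)}
    (hdv : d ∉ Sq v) (hb : b ∉ NmAt d v) :
    ∃ x y : F, ∃ z : Fˣ, (z : F) = x ^ 2 - d * y ^ 2 - c ∧ z * b ∈ NmAt d v := by
  have h2 : (NmAt d v).index = 2 := index_NmP (p := .inl v) hd hdv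
  have hmul (x y : Fˣ) := Subgroup.mul_mem_iff_of_index_two h2 (a := x) (b := y)
  have hsq (x : Fˣ) (hx : x ∈ Sq v) : x ∈ NmAt d v := le_sup_right (a := Nm (d : F)) hx
  by_cases hc : -c ∈ NmAt d v
  swap
  · exact ⟨0, 0, -c, by simp, by rw [hmul]; tauto⟩
  by_cases h1 : (-1 : Fˣ) ∈ NmAt d v
  · have hc' : c ∈ NmAt d v := by
      have := mul_mem h1 hc
      simpa using this
    have hbv : v.valuation F (b : F) ≠ 0 := by simp
    obtain ⟨m, hm⟩ := exists_exp_neg_lt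
      (γ := v.valuation F 4 * v.valuation F (c : F) / v.valuation F (b : F))
      (by simp)
    obtain ⟨π, hπ⟩ := v.valuation_surjective F (exp (-((m : ℤ))))
    have hπ0 : π ≠ 0 := by rintro rfl; rw [map_zero] at hπ; exact exp_ne_zero hπ.symm
    let β : Fˣ := Units.mk0 π hπ0 ^ 2
    have hβ : v.valuation F (b * β : F) < v.valuation F 4 * v.valuation F (c : F) := by
      have : v.valuation F (β : F) ≤ exp (-(m : ℤ)) := by
        simp only [β, Units.val_pow_eq_pow_val, Units.val_mk0, map_pow, hπ, ← exp_nsmul]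
        rw [exp_le_exp]; simp; omega
      rw [map_mul, mul_comm, ← lt_div_iff₀ (zero_lt_iff.2 hbv)]
      exact this.trans_lt hm
    have hz0 : (c : F) + b * β ≠ 0 := by
      intro h0
      have : (b * β : F) = -c := by linear_combination h0
      rw [this, Valuation.map_neg] at hβ
      exact absurd hβ (not_lt.2 (mul_le_of_le_one_left' (val_four_le _)))
    have hzc : Units.mk0 _ hz0 / c ∈ Sq v := by
      apply div_mem_sqAt
      rw [Units.val_mk0, add_sub_cancel_left]; exact hβ
    have hz : Units.mk0 _ hz0 ∈ NmAt d v := by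
      have := mul_mem (hsq _ hzc) hc'
      rwa [div_mul_cancel] at this
    obtain ⟨α, hα, hαz⟩ := exists_Nm_approx hz
      (γ := v.valuation F 4 * v.valuation F ((b * β : Fˣ) : F)) (by simp)
    obtain ⟨x, y, hxy⟩ := mem_Nm.1 hα
    have hne : (α : F) - c ≠ 0 := by
      intro h0
      have : (α : F) - Units.mk0 _ hz0 = -((b * β : Fˣ) : F) := by
        rw [Units.val_mk0, Units.val_mul]; linear_combination h0
      rw [this, Valuation.map_neg] at hαz
      exact absurd hαz (not_lt.2 (mul_le_of_le_one_left' (val_four_le _)))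
    refine ⟨x, y, Units.mk0 _ hne, by rw [Units.val_mk0, hxy], ?_⟩
    have h3 : Units.mk0 _ hne / (b * β) ∈ Sq v := by
      apply div_mem_sqAt
      have e : (Units.mk0 _ hne : F) - ((b * β : Fˣ) : F) = α - (Units.mk0 _ hz0 : Fˣ) := by
        simp only [Units.val_mk0, Units.val_mul]; ring
      rw [e]; exact hαz
    have h4 := mul_mem (hsq _ h3) (hsq _ (sq_mem_sqAt (v.valuation F) (b * Units.mk0 π hπ0)))
    convert h4 using 1
    apply Units.ext
    simp only [β, Units.val_mul, Units.val_div_eq_div_val, Units.val_pow_eq_pow_val, Units.val_mk0]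
    field_simp
  · obtain ⟨z, hzk, hz⟩ := Nat.find_spec (exists_nat_notMem h1)
    set k := Nat.find (exists_nat_notMem h1) with hk
    have hk0 : k ≠ 0 := by
      intro h0
      rw [h0, Nat.cast_zero] at hzk
      exact z.ne_zero hzk
    have hk1 : k ≠ 1 := by
      intro h0
      rw [h0, Nat.cast_one] at hzk
      have : z = 1 := Units.ext hzk
      exact hz (this ▸ one_mem _)
    have hk' : ((k - 1 : ℕ) : F) ≠ 0 := by exact_mod_cast (by omega : k - 1 ≠ 0)
    have hN : Units.mk0 _ hk' ∈ NmAt d v := by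
      by_contra hcon
      exact Nat.find_min (exists_nat_notMem h1) (by omega : k - 1 < k) ⟨_, rfl, hcon⟩
    obtain ⟨α, hα, hαz⟩ := exists_Nm_approx (mul_mem hc hN)
      (γ := v.valuation F 4 * v.valuation F ((-c * z : Fˣ) : F)) (by simp)
    obtain ⟨x, y, hxy⟩ := mem_Nm.1 hα
    have e : (α : F) - c - ((-c * z : Fˣ) : F) = α - ((-c * Units.mk0 _ hk' : Fˣ) : F) := by
      simp only [Units.val_mk0, Units.val_mul, Units.val_neg, hzk]
      rw [Nat.cast_sub (by omega)]; push_cast; ring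
    rw [← e] at hαz
    have hne : (α : F) - c ≠ 0 := by
      intro h0
      rw [h0, zero_sub, Valuation.map_neg] at hαz
      exact absurd hαz (not_lt.2 (mul_le_of_le_one_left' (val_four_le _)))
    refine ⟨x, y, Units.mk0 _ hne, by rw [Units.val_mk0, hxy], ?_⟩
    have h3 : Units.mk0 _ hne / (-c * z) ∈ Sq v := div_mem_sqAt hαz
    have h4 : Units.mk0 _ hne ∉ NmAt d v := by
      intro h5
      have h7 : -c * z ∈ NmAt d v := by
        have := div_mem h5 (hsq _ h3)
        rwa [div_div_cancel] at this
      rw [hmul] at h7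
      exact hz (h7.1 hc)
    rw [hmul]; tauto

end QF

namespace QF

open IsDedekindDomain NumberField WithZero
open scoped Pointwise Classical nonZeroDivisors

variable {F : Type*} [Field F] [NumberField F]

lemma mem_NmAt_of_unramified {d b : Fˣ} (hd : ¬ IsSquare (d : F)) {v : HeightOneSpectrum (𝓞 F)}
    (hdv : d ∉ Sq v) (h2 : v.valuation F 2 = 1) (hvd : v.valuation F (d : F) = 1)
    (hvb : v.valuation F (b : F) = 1) : b ∈ NmAt d v := by
  obtain ⟨E, _, _, s, h⟩ := exists_isQuad hd
  have := h.isQuadraticExtension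
  have := NumberField.of_module_finite F E
  obtain ⟨w, rfl⟩ := exists_above E v
  have hcj : h.cj w = w := by
    by_contra hne
    exact hdv (h.mem_sqAt_of_cj_ne hne)
  have hle : NmAt d (below F w) ≤ (valHom (below F w)).ker := by
    refine sup_le ?_ (by rw [valHom_ker]; exact le_sup_left)
    rw [← h.range_norm]
    rintro _ ⟨y, rfl⟩
    obtain ⟨n, hn⟩ := h.val_exists_of_unramified (w := w) h2 hvd y
    have h1 := val_algebraMap w (h.norm y : F)
    rw [h.algebraMap_norm, map_mul, ← h.val_cj, hcj, hn] at h1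
    have h3 : (below F w).valuation F (h.norm y : F) = exp n * exp n := by
      rw [← mul_pow] at h1
      exact ((pow_left_inj₀ zero_le zero_le (rami_ne_zero w)).1 h1).symm
    rw [mem_valHom_ker, h3, ← exp_add, log_exp]
    exact ⟨n, rfl⟩
  have hi : (NmAt d (below F w)).index = 2 := index_NmP (p := .inl (below F w)) hd hdv
  have heq : (valHom (below F w)).ker ≤ NmAt d (below F w) := by
    have := Subgroup.relIndex_mul_index hle
    rw [hi, index_valHom_ker] at this
    exact Subgroup.relIndex_eq_one.1 (by omega)
  apply heq
  rw [mem_valHom_ker, hvb]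
  exact ⟨0, by simp⟩

lemma quaternion_norm_of_mem_Nm {F : Type*} [Field F] [CharZero F] {d b : Fˣ} (hb : b ∈ Nm (d : F)) (c : F) :
    ∃ x1 x2 y1 y2 : F, c = (x1 ^ 2 - d * x2 ^ 2) - b * (y1 ^ 2 - d * y2 ^ 2) := by
  obtain ⟨p, q, hpq⟩ := mem_Nm.1 hb
  have hb0 : (b : F) ≠ 0 := b.ne_zero
  refine ⟨(c + 1) / 2, 0, (c - 1) / 2 * p / b, - ((c - 1) / 2 * q / b), ?_⟩
  have : (b : F) * (((c - 1) / 2 * p / b) ^ 2 - d * (-((c - 1) / 2 * q / b)) ^ 2) =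
      ((c - 1) / 2) ^ 2 * (p ^ 2 - d * q ^ 2) / b := by field_simp
  rw [this, ← hpq, mul_div_assoc, div_self hb0]
  ring

/-- descent of a norm representation from `F(√(τ² - 4 * c))` -/
lemma quaternion_norm_of_quad {F L : Type*} [Field F] [CharZero F] [Field L] [Algebra F L]
    {d b : Fˣ} {τ c : F} {r : L} (hd : ¬ IsSquare (d : F)) (h : IsQuad (τ ^ 2 - 4 * c) r)
    {X Y : L} (hXY : algebraMap F L b = X ^ 2 - algebraMap F L d * Y ^ 2) :
    ∃ x1 x2 y1 y2 : F, c = (x1 ^ 2 - d * x2 ^ 2) - b * (y1 ^ 2 - d * y2 ^ 2) := by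
  obtain ⟨x1, x2, rfl⟩ := h.gen X
  obtain ⟨y1, y2, rfl⟩ := h.gen Y
  set δ := τ ^ 2 - 4 * c with hδ
  have h0 : algebraMap F L (x1 ^ 2 + δ * x2 ^ 2 - d * (y1 ^ 2 + δ * y2 ^ 2) - b) +
      algebraMap F L (2 * (x1 * x2 - d * (y1 * y2))) * r = 0 := by
    simp only [map_sub, map_add, map_mul, map_pow, hXY, map_ofNat]
    have := h.sq
    linear_combination (algebraMap F L d * algebraMap F L y2 ^ 2 - algebraMap F L x2 ^ 2) * this
  obtain ⟨e1, e2⟩ := h.eq_zero_of h0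
  have e2' : x1 * x2 - d * (y1 * y2) = 0 := by simpa using e2
  by_cases hl : x2 ^ 2 - d * y2 ^ 2 = 0
  · have hy2 : y2 = 0 := by
      by_contra hy
      exact hd ⟨x2 / y2, by field_simp; linear_combination -hl⟩
    have hx2 : x2 = 0 := by simpa [hy2] using hl
    subst hx2 hy2
    refine quaternion_norm_of_mem_Nm (mem_Nm.2 ⟨x1, y1, ?_⟩) c
    linear_combination -e1
  · set l := x2 ^ 2 - d * y2 ^ 2 with hl'
    have key : l * c = (((τ * x2 + x1) / 2) ^ 2 - d * ((τ * y2 + y1) / 2) ^ 2) - b * (1 / 4) := by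
      rw [hl']
      linear_combination (-1/4) * e1 - τ / 2 * e2' + (x2 ^ 2 - d * y2 ^ 2) / 4 * hδ
    set u := (τ * x2 + x1) / 2
    set w := (τ * y2 + y1) / 2
    refine ⟨(u * x2 - d * w * y2) / l, (w * x2 - u * y2) / l, x2 / (2 * l), y2 / (2 * l), ?_⟩
    have : c = (l * c) * l / l ^ 2 := by field_simp
    rw [this, key]
    field_simp
    rw [hl']
    ring

lemma finite_nonsplit (d b : Fˣ) (hd : ¬ IsSquare (d : F)) :
    {v : HeightOneSpectrum (𝓞 F) | d ∉ Sq v ∧ b ∉ NmAt d v}.Finite := by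
  have h2 : (2 : F) ≠ 0 := two_ne_zero
  refine (((finite_val_ne_one (Units.mk0 (2 : F) h2)).union (finite_val_ne_one d)).union
    (finite_val_ne_one b)).subset ?_
  rintro v ⟨h1, h3⟩
  by_contra hcon
  simp only [Set.mem_union, Set.mem_ofPred_eq, not_or, not_not, Units.val_mk0] at hcon
  exact h3 (mem_NmAt_of_unramified hd h1 hcon.1.1 hcon.1.2 hcon.2)

lemma mem_NmAt_up {L : Type*} [Field L] [NumberField L] [Algebra F L]
    {w : HeightOneSpectrum (𝓞 L)} {d b : Fˣ} (hb : b ∈ NmAt d (below F w)) :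
    Units.map (algebraMap F L).toMonoidHom b ∈
      NmAt (Units.map (algebraMap F L).toMonoidHom d) w := by
  obtain ⟨n, hn, σ, hσ, rfl⟩ := Subgroup.mem_sup.1 hb
  rw [map_mul]
  refine mul_mem (le_sup_left (b := Sq w) ?_) (le_sup_right (a := Nm _) (sqAt_algebraMap hσ))
  obtain ⟨x, y, hxy⟩ := mem_Nm.1 hn
  refine mem_Nm.2 ⟨algebraMap F L x, algebraMap F L y, ?_⟩
  simp [hxy]

theorem exists_quaternion_norm {d b c : Fˣ} (hd : ¬ IsSquare (d : F))
    (hreal : ∀ φ : F →+* ℝ, φ d < 0 → φ b < 0 → 0 < φ c) :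
    ∃ x1 x2 y1 y2 : F, (c : F) = (x1 ^ 2 - d * x2 ^ 2) - b * (y1 ^ 2 - d * y2 ^ 2) := by
  by_cases hb : b ∈ Nm (d : F)
  · exact quaternion_norm_of_mem_Nm hb c
  set R := (finite_nonsplit d b hd).toFinset
  have hR v : v ∈ R ↔ d ∉ Sq v ∧ b ∉ NmAt d v := by simp [R]
  have hloc (v : HeightOneSpectrum (𝓞 F)) : ∃ x y : F, ∃ z : Fˣ, v ∈ R →
      (z : F) = x ^ 2 - d * y ^ 2 - c ∧ z * b ∈ NmAt d v := by
    by_cases hv : v ∈ R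
    · obtain ⟨x, y, z, h⟩ := exists_local_rep (c := c) hd ((hR v).1 hv).1 ((hR v).1 hv).2
      exact ⟨x, y, z, fun _ => h⟩
    · exact ⟨0, 0, 1, fun h => absurd h hv⟩
  choose ξ η z hz using hloc
  have hε : ∃ ε : ℝ, 0 < ε ∧ ε ≤ 1 ∧ ∀ φ : F →+* ℝ, ε ≤ |φ c| := by
    have h1 : ∀ φ : F →+* ℝ, 0 < |φ c| := fun φ => abs_pos.2 (by simp)
    by_cases hne : Nonempty (F →+* ℝ)
    · obtain ⟨φ0, h0⟩ := Finite.exists_min (fun φ : F →+* ℝ => |φ c|)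
      exact ⟨min 1 |φ0 c|, lt_min one_pos (h1 _), min_le_left _ _,
        fun φ => (min_le_right _ _).trans (h0 φ)⟩
    · exact ⟨1, one_pos, le_rfl, fun φ => absurd ⟨φ⟩ hne⟩
  obtain ⟨ε, hε0, hε1, hεc⟩ := hε
  let γ : HeightOneSpectrum (𝓞 F) → ℤᵐ⁰ := fun v =>
    min 1 (v.valuation F 4 * v.valuation F (4 * z v : F) / max 1 (v.valuation F (4 * ξ v : F)))
  have h40 : (4 : F) ≠ 0 := by norm_num
  have hγ v : γ v ≠ 0 := by
    simp only [γ]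
    rw [Ne, ← le_zero_iff, min_le_iff, not_or]
    refine ⟨by simp, ?_⟩
    rw [le_zero_iff, div_eq_zero_iff]
    simp
  obtain ⟨τ, hτ, hτr⟩ := weak_approx R (fun v => 2 * ξ v) γ hγ (fun _ => 0) hε0
  set δ := τ ^ 2 - 4 * (c : F) with hδ
  -- local behaviour of `δ`
  have hreal' : ∀ φ : F →+* ℝ, φ d < 0 → φ b < 0 → φ δ < 0 := by
    intro φ h1 h2
    have h3 := hreal φ h1 h2
    have h4 := hτr φ
    rw [sub_zero] at h4
    have h5 := hεc φ
    rw [abs_of_pos h3] at h5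
    have h6 : (φ τ) ^ 2 < ε ^ 2 := by rw [← sq_abs]; gcongr
    simp only [hδ, map_sub, map_mul, map_pow, map_ofNat]
    nlinarith
  have hfin : ∀ v ∈ R, ∃ t : Fˣ, (t : F) = δ - d * (2 * η v) ^ 2 ∧ t * b ∈ NmAt d v := by
    intro v hv
    obtain ⟨hz1, hz2⟩ := hz v hv
    have hτv := hτ v hv
    set V := v.valuation F
    let z4 : Fˣ := Units.mk0 (4 : F) h40 * z v
    have hlt : V (δ - d * (2 * η v) ^ 2 - z4) < V 4 * V (z4 : F) := by
      have e : δ - d * (2 * η v) ^ 2 - (z4 : F) =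
          (τ - 2 * ξ v) * ((τ - 2 * ξ v) + 4 * ξ v) := by
        simp only [z4, Units.val_mul, Units.val_mk0, hz1, hδ]; ring
      rw [e, map_mul]
      have hm : V (τ - 2 * ξ v + 4 * ξ v) ≤ max 1 (V (4 * ξ v)) :=
        (Valuation.map_add _ _ _).trans
          (max_le_max (hτv.le.trans (min_le_left _ _)) le_rfl)
      have hpos : 0 < max 1 (V (4 * ξ v)) := zero_lt_one.trans_le (le_max_left _ _)
      calc _ ≤ V (τ - 2 * ξ v) * max 1 (V (4 * ξ v)) := by gcongr
        _ < V 4 * V (4 * z v : F) := by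
          rw [← lt_div_iff₀ hpos]
          exact hτv.trans_le (min_le_right _ _)
        _ = _ := rfl
    have ht0 : δ - d * (2 * η v) ^ 2 ≠ 0 := by
      intro h0
      rw [h0, zero_sub, Valuation.map_neg] at hlt
      exact absurd hlt (not_lt.2 (mul_le_of_le_one_left' (val_four_le _)))
    refine ⟨Units.mk0 _ ht0, rfl, ?_⟩
    have h1 : Units.mk0 _ ht0 / z4 ∈ Sq v := div_mem_sqAt hlt
    have h2 := mul_mem (mul_mem (le_sup_right (a := Nm (d : F)) h1) hz2)
      (le_sup_left (b := Sq v) (sq_mem_Nm (d : F) (Units.mk0 (2 : F) two_ne_zero)))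
    convert h2 using 1
    apply Units.ext
    simp only [z4, Units.val_mul, Units.val_div_eq_div_val, Units.val_pow_eq_pow_val, Units.val_mk0]
    field_simp
    ring
  have hδsq : ¬ IsSquare δ := by
    rintro ⟨e, he⟩
    apply hb
    refine mem_Nm_of_local hd fun p hp => ?_
    rcases p with v | φ
    · by_contra hbv
      obtain ⟨t, ht1, ht2⟩ := hfin v ((hR v).2 ⟨hp, hbv⟩)
      have ht : t ∈ NmAt d v := le_sup_left (b := Sq v)
        (mem_Nm.2 ⟨e, 2 * η v, by rw [ht1, he]; ring⟩)
      exact hbv ((Subgroup.mul_mem_cancel_left _ ht).1 ht2)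
    · refine le_sup_right (a := Nm (d : F)) (?_ : b ∈ posAt φ)
      by_contra hbφ
      have := hreal' φ (notMem_posAt_iff.1 hp) (notMem_posAt_iff.1 hbφ)
      rw [he, map_mul] at this
      exact absurd this (not_lt.2 (mul_self_nonneg _))
  obtain ⟨L, _, _, r, h⟩ := exists_isQuad hδsq
  have := h.isQuadraticExtension
  have := NumberField.of_module_finite F L
  let ι := Units.map (algebraMap F L).toMonoidHom
  have hι (x : Fˣ) : (ι x : L) = algebraMap F L x := rfl
  suffices hL : ∃ X Y : L, algebraMap F L b = X ^ 2 - algebraMap F L d * Y ^ 2 by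
    obtain ⟨X, Y, hXY⟩ := hL
    exact quaternion_norm_of_quad hd h hXY
  by_cases hdL : IsSquare (algebraMap F L d)
  · obtain ⟨e, he⟩ := hdL
    have he0 : e ≠ 0 := by
      rintro rfl
      simp at he
    refine ⟨(algebraMap F L b + 1) / 2, (algebraMap F L b - 1) / (2 * e), ?_⟩
    rw [he]; field_simp; ring
  · have : ι b ∈ Nm ((ι d : Lˣ) : L) := by
      refine mem_Nm_of_local hdL fun p hp => ?_
      rcases p with w | ψ
      · by_cases hw : b ∈ NmAt d (below F w)
        · exact mem_NmAt_up hw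
        have hdw : d ∉ Sq (below F w) := fun hd' => hp (sqAt_algebraMap hd')
        obtain ⟨t, ht1, ht2⟩ := hfin _ ((hR _).2 ⟨hdw, hw⟩)
        have h1 := mem_NmAt_up ht2
        rw [map_mul] at h1
        refine (Subgroup.mul_mem_cancel_left _ ?_).1 h1
        refine le_sup_left (b := Sq w) (mem_Nm.2 ⟨r, algebraMap F L (2 * η (below F w)), ?_⟩)
        rw [h.sq]
        change algebraMap F L (t : F) = _ - algebraMap F L d * _
        rw [ht1]; simp
      · refine le_sup_right (a := Nm _) (?_ : ι b ∈ posAt ψ)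
        by_contra hbφ
        have := hreal' (ψ.comp (algebraMap F L)) (notMem_posAt_iff.1 hp) (notMem_posAt_iff.1 hbφ)
        rw [RingHom.comp_apply, ← h.sq, map_pow] at this
        exact absurd this (not_lt.2 (sq_nonneg _))
    obtain ⟨X, Y, hXY⟩ := mem_Nm.1 this
    exact ⟨X, Y, hXY⟩

end QF

namespace QF

open IsDedekindDomain NumberField WithZero
open scoped Pointwise Classical nonZeroDivisors

open LinearMap (BilinForm)
variable {k V V' : Type*} [Field k] [AddCommGroup V] [Module k V] [AddCommGroup V'] [Module k V']

open Module (finrank)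

/-- an inner product: a nondegenerate symmetric bilinear form -/
structure IP (B : BilinForm k V) : Prop where
  symm : ∀ x y, B x y = B y x
  nd : ∀ x, (∀ y, B x y = 0) → x = 0

/-- `L` is its own orthogonal complement -/
def IsLag (B : BilinForm k V) (L : Submodule k V) : Prop :=
  ∀ x, x ∈ L ↔ ∀ y ∈ L, B x y = 0

/-- the form has a Lagrangian -/
def Metabolic (B : BilinForm k V) : Prop := ∃ L : Submodule k V, IsLag B L

/-- orthogonal sum -/
def orth (B : BilinForm k V) (B' : BilinForm k V') : BilinForm k (V × V') :=
  B.compl₁₂ (LinearMap.fst k V V') (LinearMap.fst k V V') +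
    B'.compl₁₂ (LinearMap.snd k V V') (LinearMap.snd k V V')

@[simp] lemma orth_apply (B : BilinForm k V) (B' : BilinForm k V') (x y : V × V') :
    orth B B' x y = B x.1 y.1 + B' x.2 y.2 := rfl

variable {B : BilinForm k V} {B' : BilinForm k V'}

lemma IP.orth (h : IP B) (h' : IP B') : IP (orth B B') where
  symm x y := by simp [h.symm x.1, h'.symm x.2]
  nd x hx := Prod.ext (h.nd _ fun y => by simpa using hx (y, 0))
    (h'.nd _ fun y => by simpa using hx (0, y))

lemma IP.neg (h : IP B) : IP (-B) where
  symm x y := by simp [h.symm x y]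
  nd x hx := h.nd x fun y => by simpa using hx y

lemma IP.nondegenerate (h : IP B) : B.Nondegenerate :=
  ⟨fun x hx => h.nd x hx, fun y hy => h.nd y fun x => by rw [h.symm]; exact hy x⟩

lemma IP.isRefl (h : IP B) : B.IsRefl := fun x y hxy => by rwa [h.symm]

lemma IP.mem_orthogonal (h : IP B) {L : Submodule k V} {x : V} :
    x ∈ B.orthogonal L ↔ ∀ y ∈ L, B x y = 0 := by
  rw [LinearMap.BilinForm.mem_orthogonal_iff]
  refine forall₂_congr fun y _ => ?_
  rw [h.symm x y]

lemma IP.isLag_iff (h : IP B) {L : Submodule k V} : IsLag B L ↔ B.orthogonal L = L := by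
  constructor
  · intro hL
    ext x
    rw [h.mem_orthogonal, hL]
  · intro hL x
    rw [← h.mem_orthogonal, hL]

section

variable [FiniteDimensional k V] [FiniteDimensional k V']

lemma IsLag.two_mul_finrank (h : IP B) {L : Submodule k V} (hL : IsLag B L) :
    2 * finrank k L = finrank k V := by
  have h1 := LinearMap.BilinForm.finrank_orthogonal h.nondegenerate L
  rw [h.isLag_iff.1 hL] at h1
  have := Submodule.finrank_le L
  omega

lemma IP.isLag_of (h : IP B) {L : Submodule k V} (hL : ∀ x ∈ L, ∀ y ∈ L, B x y = 0)
    (hd : finrank k V ≤ 2 * finrank k L) : IsLag B L := by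
  rw [h.isLag_iff]
  refine (Submodule.eq_of_le_of_finrank_le (fun x hx => h.mem_orthogonal.2 (hL x hx)) ?_).symm
  rw [LinearMap.BilinForm.finrank_orthogonal h.nondegenerate L]
  omega

lemma IP.orthogonal_inf (h : IP B) (M N : Submodule k V) :
    B.orthogonal (M ⊓ N) ≤ B.orthogonal M ⊔ B.orthogonal N := by
  rw [← LinearMap.BilinForm.orthogonal_orthogonal h.nondegenerate h.isRefl
    (B.orthogonal M ⊔ B.orthogonal N)]
  apply LinearMap.BilinForm.orthogonal_le
  refine le_inf ?_ ?_
  · rw [← LinearMap.BilinForm.orthogonal_orthogonal h.nondegenerate h.isRefl M]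
    exact LinearMap.BilinForm.orthogonal_le
      (by rw [LinearMap.BilinForm.orthogonal_orthogonal h.nondegenerate h.isRefl]; exact le_sup_left)
  · rw [← LinearMap.BilinForm.orthogonal_orthogonal h.nondegenerate h.isRefl N]
    exact LinearMap.BilinForm.orthogonal_le
      (by rw [LinearMap.BilinForm.orthogonal_orthogonal h.nondegenerate h.isRefl]; exact le_sup_right)

/-- cancellation of metabolic summands -/
lemma Metabolic.of_orth (h : IP B) (h' : IP B') (hm : Metabolic (orth B B')) (hm' : Metabolic B') :
    Metabolic B := by
  obtain ⟨L, hL⟩ := hm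
  obtain ⟨M, hM⟩ := hm'
  have hoo := h.orth h'
  let N : Submodule k (V × V') := M.comap (LinearMap.snd k V V')
  refine ⟨(L ⊓ N).map (LinearMap.fst k V V'), fun x => ⟨?_, fun hx => ?_⟩⟩
  · rintro ⟨⟨x, m⟩, ⟨hxL, hxM⟩, rfl⟩ _ ⟨⟨y, n⟩, ⟨hyL, hyM⟩, rfl⟩
    have h1 := (hL _).1 hxL _ hyL
    have h2 := (hM _).1 hxM _ hyM
    simp only [LinearMap.snd_apply] at h2
    simpa [h2] using h1
  · have h1 : ((x, 0) : V × V') ∈ (orth B B').orthogonal (L ⊓ N) := by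
      rw [hoo.mem_orthogonal]
      rintro ⟨y, n⟩ hy
      simpa using hx y ⟨_, hy, rfl⟩
    have h2 := hoo.orthogonal_inf L N h1
    rw [hoo.isLag_iff.1 hL] at h2
    obtain ⟨l, hl, m, hm, hlm⟩ := Submodule.mem_sup.1 h2
    rw [hoo.mem_orthogonal] at hm
    have hm1 : m.1 = 0 := h.nd _ fun y => by
      simpa using hm (y, 0) (by simp [N])
    have hm2 : m.2 ∈ M := (hM _).2 fun n hn => by
      simpa using hm (0, n) (by simpa [N] using hn)
    have e1 : l.1 = x := by simpa [hm1] using congrArg Prod.fst hlm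
    have e2 : l.2 = -m.2 := by
      have := congrArg Prod.snd hlm
      simp only [Prod.snd_add] at this
      exact eq_neg_of_add_eq_zero_left this
    exact ⟨l, ⟨hl, by simp only [N, SetLike.mem_coe, Submodule.mem_comap, LinearMap.snd_apply, e2]; exact neg_mem hm2⟩, e1⟩

end

lemma Metabolic.congr {e : V ≃ₗ[k] V'} (he : ∀ x y, B' (e x) (e y) = B x y) (h : Metabolic B) :
    Metabolic B' := by
  obtain ⟨L, hL⟩ := h
  refine ⟨L.map e.toLinearMap, fun x => ?_⟩
  obtain ⟨x, rfl⟩ := e.surjective x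
  have : e x ∈ L.map e.toLinearMap ↔ x ∈ L := by simp
  rw [this, hL]
  constructor
  · rintro hx _ ⟨y, hy, rfl⟩
    rw [LinearEquiv.coe_coe, he, hx y hy]
  · intro hx y hy
    rw [← he]
    exact hx _ ⟨y, hy, rfl⟩

lemma Metabolic.orth (h : Metabolic B) (h' : Metabolic B') : Metabolic (orth B B') := by
  obtain ⟨L, hL⟩ := h
  obtain ⟨M, hM⟩ := h'
  refine ⟨L.prod M, fun x => ⟨fun hx y hy => ?_, fun hx => ⟨(hL _).2 fun y hy => ?_, (hM _).2 fun y hy => ?_⟩⟩⟩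
  · rw [orth_apply, (hL _).1 hx.1 _ hy.1, (hM _).1 hx.2 _ hy.2, add_zero]
  · simpa using hx (y, 0) ⟨hy, zero_mem _⟩
  · simpa using hx (0, y) ⟨zero_mem _, hy⟩

lemma metabolic_orth_neg [CharZero k] (h : IP B) {e : V ≃ₗ[k] V'}
    (he : ∀ x y, B' (e x) (e y) = B x y) : Metabolic (orth B (-B')) := by
  refine ⟨LinearMap.range (LinearMap.prod LinearMap.id e.toLinearMap), fun x => ⟨?_, fun hx => ?_⟩⟩
  · rintro ⟨x, rfl⟩ _ ⟨y, rfl⟩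
    simp [he]
  · obtain ⟨x, z⟩ := x
    obtain ⟨z, rfl⟩ := e.surjective z
    have : x - z = 0 := h.nd _ fun y => by
      have := hx (y, e y) ⟨y, rfl⟩
      simp only [orth_apply, LinearMap.neg_apply, he] at this
      rw [map_sub, LinearMap.sub_apply]
      linear_combination this
    exact ⟨x, by simp [sub_eq_zero.1 this]⟩

lemma IP.exists_dual [CharZero k] (h : IP B) {x : V} (hx : x ≠ 0) (hxx : B x x = 0) :
    ∃ y, B x y = 1 ∧ B y y = 0 := by
  obtain ⟨y, hy⟩ : ∃ y, B x y ≠ 0 := by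
    by_contra! hcon
    exact hx (h.nd x hcon)
  let z := (B x y)⁻¹ • y
  have hz : B x z = 1 := by simp [z, hy]
  refine ⟨z - (B z z / 2) • x, by simp [hz, hxx], ?_⟩
  simp only [map_sub, map_smul, LinearMap.sub_apply, LinearMap.smul_apply, smul_eq_mul, hz,
    h.symm z x, hxx]
  ring

lemma finrank_inf_ker_ge [FiniteDimensional k V] (L : Submodule k V) (f : V →ₗ[k] k × k) :
    finrank k L ≤ finrank k (L ⊓ LinearMap.ker f : Submodule k V) + 2 := by
  have h1 := LinearMap.finrank_range_add_finrank_ker f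
  have h2 : finrank k (LinearMap.range f) ≤ 2 := (Submodule.finrank_le _).trans (by simp)
  have h3 := Submodule.finrank_sup_add_finrank_inf_eq L (LinearMap.ker f)
  have h4 := Submodule.finrank_le (L ⊔ LinearMap.ker f)
  omega

/-- Witt-equivalent inner products of the same dimension are isometric -/
theorem exists_isometry_of_metabolic [CharZero k] [FiniteDimensional k V] [FiniteDimensional k V']
    (h : IP B) (h' : IP B') (hdim : finrank k V = finrank k V') (hm : Metabolic (orth B (-B'))) :
    ∃ e : V ≃ₗ[k] V', ∀ x y, B' (e x) (e y) = B x y := by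
  have hoo := h.orth h'.neg
  obtain ⟨L, hL⟩ := hm
  induction hj : finrank k (L.comap (LinearMap.inl k V V')) using Nat.strong_induction_on
    generalizing L with
  | _ j ih =>
  have hLd := hL.two_mul_finrank hoo
  rw [Module.finrank_prod, ← hdim] at hLd
  by_cases hx' : ∃ x' : V', x' ≠ 0 ∧ ((0 : V), x') ∈ L
  · by_cases hx : ∃ x : V, x ≠ 0 ∧ (x, (0 : V')) ∈ L
    · obtain ⟨x, hx0, hxL⟩ := hx
      obtain ⟨x', hx0', hxL'⟩ := hx'
      have hxx : B x x = 0 := by simpa using (hL _).1 hxL _ hxL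
      have hxx' : B' x' x' = 0 := by simpa using (hL _).1 hxL' _ hxL'
      obtain ⟨y, hxy, hyy⟩ := h.exists_dual hx0 hxx
      obtain ⟨y', hxy', hyy'⟩ := h'.exists_dual hx0' hxx'
      have hyx := h.symm y x
      have hyx' := h'.symm y' x'
      let f : V × V' →ₗ[k] k × k := (B.flip y).prodMap (B'.flip y')
      let L0 := L ⊓ LinearMap.ker f
      have hL0 := finrank_inf_ker_ge L f
      have hf {l : V × V'} (hl : l ∈ L0) : B l.1 y = 0 ∧ B' l.2 y' = 0 := by
        have : f l = 0 := hl.2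
        exact ⟨congrArg Prod.fst this, congrArg Prod.snd this⟩
      have hx1 {l : V × V'} (hl : l ∈ L) : B l.1 x = 0 := by simpa using (hL _).1 hl _ hxL
      have hx1' {l : V × V'} (hl : l ∈ L) : B' l.2 x' = 0 := by simpa using (hL _).1 hl _ hxL'
      let g : (L0 × k × k) →ₗ[k] V × V' :=
        L0.subtype.coprod ((LinearMap.toSpanSingleton k _ (x, x')).coprod
          (LinearMap.toSpanSingleton k _ (y, y')))
      have hg (l : L0) (a b : k) : g (l, a, b) = (l : V × V') + (a • (x, x') + b • (y, y')) := rfl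
      have hb (l : L0) (a b : k) : B (g (l, a, b)).1 x = b := by
        simp [hg, hx1 l.2.1, hxx, hyx, hxy]
      have hb' (l : L0) (a b : k) : B' (g (l, a, b)).2 x' = b := by
        simp [hg, hx1' l.2.1, hxx', hyx', hxy']
      have ha (l : L0) (a b : k) : B (g (l, a, b)).1 y = a := by
        simp [hg, hf l.2, hxy, hyy]
      have ha' (l : L0) (a b : k) : B' (g (l, a, b)).2 y' = a := by
        simp [hg, hf l.2, hxy', hyy']
      have hinj : Function.Injective g := by
        rw [← LinearMap.ker_eq_bot, LinearMap.ker_eq_bot']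
        rintro ⟨l, a, b⟩ h0
        have e1 := hb l a b
        have e2 := ha l a b
        rw [h0] at e1 e2
        simp only [Prod.fst_zero, map_zero, LinearMap.zero_apply] at e1 e2
        subst e1 e2
        rw [hg] at h0
        simpa using h0
      let L2 := LinearMap.range g
      have hL2 : IsLag (orth B (-B')) L2 := by
        apply hoo.isLag_of
        · rintro _ ⟨⟨l, a, b⟩, rfl⟩ _ ⟨⟨l', a', b'⟩, rfl⟩
          have e0 := (hL _).1 l.2.1 _ l'.2.1
          have e1 := hb l a b
          have e2 := ha l a b
          have e1' := hb' l a b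
          have e2' := ha' l a b
          have e3 := hx1 l'.2.1
          have e4 := hx1' l'.2.1
          have e5 := hf l'.2
          rw [h.symm] at e3
          rw [h'.symm] at e4
          have e5' := e5.1
          have e5'' := e5.2
          rw [h.symm] at e5'
          rw [h'.symm] at e5''
          simp only [orth_apply, LinearMap.neg_apply] at e0
          rw [hg l' a' b']
          simp only [orth_apply, LinearMap.neg_apply, map_add, map_smul, smul_eq_mul, e1, e2, e1', e2']
          rw [hg l a b]
          simp only [Prod.fst_add, Prod.snd_add, Prod.smul_fst, Prod.smul_snd, map_add, map_smul,
            LinearMap.add_apply, LinearMap.smul_apply, smul_eq_mul, e3, e4, e5', e5'']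
          linear_combination e0
        · have : finrank k L2 = finrank k (L0 × k × k) := LinearMap.finrank_range_of_inj hinj
          rw [this, Module.finrank_prod, Module.finrank_prod, Module.finrank_prod,
            Module.finrank_self, ← hdim]
          change finrank k L ≤ finrank k L0 + 2 at hL0
          omega
      refine ih _ ?_ L2 hL2 rfl
      rw [← hj]
      apply Submodule.finrank_lt_finrank_of_lt
      refine lt_of_le_of_ne ?_ ?_
      · rintro v ⟨⟨l, a, b⟩, hl⟩
        have e1 := hb' l a b
        have e2 := ha' l a b
        rw [hl] at e1 e2
        simp only [LinearMap.inl_apply, map_zero, LinearMap.zero_apply] at e1 e2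
        subst e1 e2
        rw [hg] at hl
        simp only [zero_smul, add_zero] at hl
        rw [Submodule.mem_comap, ← hl]
        exact l.2.1
      · intro heq
        have hxm : x ∈ L2.comap (LinearMap.inl k V V') := by rw [heq]; exact hxL
        obtain ⟨⟨l, a, b⟩, hl⟩ := hxm
        have e1 := ha l a b
        have e2 := ha' l a b
        rw [hl] at e1 e2
        simp only [LinearMap.inl_apply, map_zero, LinearMap.zero_apply, hxy] at e1 e2
        exact one_ne_zero (e1.trans e2.symm)
    · exfalso
      push Not at hx
      have hinj : Function.Injective ((LinearMap.snd k V V').domRestrict L) := by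
        rw [← LinearMap.ker_eq_bot, LinearMap.ker_eq_bot']
        rintro ⟨⟨a, b⟩, hab⟩ (h0 : b = 0)
        subst h0
        by_contra hne
        exact hx a (fun h0 => hne (by subst h0; rfl)) hab
      have hsurj := (LinearMap.injective_iff_surjective_of_finrank_eq_finrank
        (by omega : finrank k L = finrank k V')).1 hinj
      obtain ⟨x', hx0', hxL'⟩ := hx'
      refine hx0' (h'.nd _ fun z => ?_)
      obtain ⟨⟨l, hl⟩, rfl⟩ := hsurj z
      simpa using (hL _).1 hxL' _ hl
  · push Not at hx'
    have hinj : Function.Injective ((LinearMap.fst k V V').domRestrict L) := by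
      rw [← LinearMap.ker_eq_bot, LinearMap.ker_eq_bot']
      rintro ⟨⟨a, b⟩, hab⟩ (h0 : a = 0)
      subst h0
      by_contra hne
      exact hx' b (fun h0 => hne (by subst h0; rfl)) hab
    let e0 := LinearEquiv.ofInjectiveOfFinrankEq _ hinj (by omega : finrank k L = finrank k V)
    let g : V →ₗ[k] V' := ((LinearMap.snd k V V').domRestrict L) ∘ₗ e0.symm.toLinearMap
    have hg (x : V) : (x, g x) ∈ L := by
      obtain ⟨l, rfl⟩ := e0.surjective x
      have : ((e0 l, g (e0 l)) : V × V') = l := by simp [g]; rfl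
      rw [this]
      exact l.2
    have hiso x y : B' (g x) (g y) = B x y := by
      have := (hL _).1 (hg x) _ (hg y)
      simp only [orth_apply, LinearMap.neg_apply] at this
      linear_combination -this
    have hginj : Function.Injective g := by
      rw [← LinearMap.ker_eq_bot, LinearMap.ker_eq_bot']
      intro x hx
      exact h.nd x fun y => by rw [← hiso, hx]; simp
    exact ⟨LinearEquiv.ofInjectiveOfFinrankEq g hginj hdim, hiso⟩

end QF

namespace QF

open IsDedekindDomain NumberField WithZero
open scoped Pointwise Classical nonZeroDivisors

open LinearMap (BilinForm)
open Module (finrank Basis)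

section Diagonal

variable {k V V' : Type*} [Field k] [AddCommGroup V] [Module k V] [AddCommGroup V'] [Module k V']
  {ι κ : Type*} [Fintype ι] [Fintype κ]

/-- the basis `b` is orthogonal for `B` with diagonal entries `a` -/
def DiagOn (B : BilinForm k V) (b : Basis ι k V) (a : ι → kˣ) : Prop :=
  ∀ i j, B (b i) (b j) = if i = j then (a i : k) else 0

lemma DiagOn.apply {B : BilinForm k V} {b : Basis ι k V} {a : ι → kˣ} (h : DiagOn B b a) (x y : V) :
    B x y = ∑ i, (a i : k) * (b.repr x i * b.repr y i) := by
  conv_lhs => rw [← b.sum_repr x, ← b.sum_repr y]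
  simp only [map_sum, LinearMap.sum_apply, map_smul, LinearMap.smul_apply, smul_eq_mul]
  refine Finset.sum_congr rfl fun i _ => ?_
  rw [Finset.sum_eq_single i]
  · rw [h, if_pos rfl]; ring
  · intro j _ hj
    rw [h, if_neg hj]; ring
  · simp

lemma DiagOn.ip {B : BilinForm k V} {b : Basis ι k V} {a : ι → kˣ} (h : DiagOn B b a) : IP B where
  symm x y := by
    rw [h.apply, h.apply]
    exact Finset.sum_congr rfl fun i _ => by ring
  nd x hx := by
    apply b.ext_elem
    intro i
    have := hx (b i)
    rw [h.apply, Finset.sum_eq_single i] at this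
    · simpa using this
    · intro j _ hj
      simp [Finsupp.single_eq_of_ne hj]
    · simp

/-- index type of a multiset -/
def MT {α : Type*} (m : Multiset α) : Type := Fin m.toList.length

noncomputable instance {α : Type*} (m : Multiset α) : Fintype (MT m) := inferInstanceAs (Fintype (Fin _))

/-- the entry with a given index -/
noncomputable def MT.val {α : Type*} {m : Multiset α} (i : MT m) : α := m.toList.get i

lemma map_univ_toType {α : Type*} (m : Multiset α) :
    (Finset.univ.val.map (MT.val : MT m → α)) = m := by
  have : (Finset.univ : Finset (Fin m.toList.length)).val.map m.toList.get = m := by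
    rw [Fin.univ_val_map, List.ofFn_get, Multiset.coe_toList]
  exact this

/-- the form is diagonalised by the multiset `m` -/
def IsDiag (B : BilinForm k V) (m : Multiset kˣ) : Prop :=
  ∃ b : Basis (MT m) k V, DiagOn B b MT.val

lemma card_fiber_eq_count {α σ : Type*} [Fintype σ] (a : σ → α) (y : α) :
    Fintype.card {x // a x = y} = (Finset.univ.val.map a).count y := by
  rw [Fintype.card_subtype, Multiset.count_map]
  change (Finset.univ.filter fun x => a x = y).val.card = _
  rw [Finset.filter_val]
  congr 1
  exact Multiset.filter_congr fun x _ => eq_comm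

lemma exists_equiv_of_map_eq {α : Type*} {a : ι → α} {b : κ → α}
    (h : Finset.univ.val.map a = Finset.univ.val.map b) :
    ∃ e : ι ≃ κ, ∀ i, b (e i) = a i := by
  have hc' : ∀ y, Nonempty ({x // a x = y} ≃ {x // b x = y}) := fun y => by
    refine ⟨Fintype.equivOfCardEq ?_⟩
    rw [card_fiber_eq_count, card_fiber_eq_count, h]
  let e := (Equiv.sigmaFiberEquiv a).symm.trans
    ((Equiv.sigmaCongrRight fun y => (hc' y).some).trans (Equiv.sigmaFiberEquiv b))
  exact ⟨e, fun i => ((hc' (a i)).some ⟨i, rfl⟩).2⟩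

lemma exists_equiv_toType {α : Type*} (a : ι → α) :
    ∃ e : ι ≃ MT (Finset.univ.val.map a), ∀ i, (e i).val = a i :=
  exists_equiv_of_map_eq (map_univ_toType _).symm

lemma DiagOn.isDiag {B : BilinForm k V} {b : Basis ι k V} {a : ι → kˣ} (h : DiagOn B b a) :
    IsDiag B (Finset.univ.val.map a) := by
  obtain ⟨e, he⟩ := exists_equiv_toType a
  refine ⟨b.reindex e, fun i j => ?_⟩
  rw [Basis.reindex_apply, Basis.reindex_apply, h]
  simp only [EmbeddingLike.apply_eq_iff_eq]
  rw [← he, e.apply_symm_apply]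

lemma IsDiag.ip {B : BilinForm k V} {m : Multiset kˣ} (h : IsDiag B m) : IP B := h.choose_spec.ip

lemma IsDiag.finrank_eq {B : BilinForm k V} {m : Multiset kˣ} (h : IsDiag B m) :
    finrank k V = m.card := by
  obtain ⟨b, -⟩ := h
  rw [Module.finrank_eq_card_basis b]
  exact (Fintype.card_fin _).trans (Multiset.length_toList m)

lemma IsDiag.exists_isometry {B : BilinForm k V} {B' : BilinForm k V'} {m : Multiset kˣ}
    (h : IsDiag B m) (h' : IsDiag B' m) : ∃ e : V ≃ₗ[k] V', ∀ x y, B' (e x) (e y) = B x y := by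
  obtain ⟨b, h⟩ := h
  obtain ⟨b', h'⟩ := h'
  refine ⟨b.equiv b' (Equiv.refl _), fun x y => ?_⟩
  rw [h.apply, h'.apply]
  simp [Basis.equiv]

lemma IsDiag.congr {B : BilinForm k V} {B' : BilinForm k V'} {m : Multiset kˣ}
    (h : IsDiag B m) {e : V ≃ₗ[k] V'} (he : ∀ x y, B' (e x) (e y) = B x y) : IsDiag B' m := by
  obtain ⟨b, h⟩ := h
  exact ⟨b.map e, fun i j => by rw [Basis.map_apply, Basis.map_apply, he, h]⟩

lemma IsDiag.orth {B : BilinForm k V} {B' : BilinForm k V'} {m m' : Multiset kˣ}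
    (h : IsDiag B m) (h' : IsDiag B' m') : IsDiag (orth B B') (m + m') := by
  obtain ⟨b, h⟩ := h
  obtain ⟨b', h'⟩ := h'
  have : DiagOn (QF.orth B B') (b.prod b')
      (Sum.elim (MT.val : MT m → kˣ) (MT.val : MT m' → kˣ)) := by
    rintro (i | i) (j | j)
    · simp [h i j]
    · simp
    · simp
    · simp [h' i j]
  have := this.isDiag
  rwa [← Finset.univ_disjSum_univ, Finset.val_disjSum, Multiset.disjSum, Multiset.map_add, Multiset.map_map, Multiset.map_map,
    show (Sum.elim (MT.val : MT m → kˣ) (MT.val : MT m' → kˣ)) ∘ Sum.inl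
      = (MT.val : MT m → kˣ) from rfl,
    show (Sum.elim (MT.val : MT m → kˣ) (MT.val : MT m' → kˣ)) ∘ Sum.inr
      = (MT.val : MT m' → kˣ) from rfl, map_univ_toType, map_univ_toType] at this

lemma IsDiag.neg {B : BilinForm k V} {m : Multiset kˣ} (h : IsDiag B m) :
    IsDiag (-B) (m.map Neg.neg) := by
  obtain ⟨b, h⟩ := h
  have : DiagOn (-B) b (fun i : MT m => - i.val) := by
    intro i j
    rw [LinearMap.neg_apply, LinearMap.neg_apply, h]
    split_ifs <;> simp
  have := this.isDiag
  rwa [show (fun i : MT m => - i.val) = Neg.neg ∘ (MT.val : MT m → kˣ) from rfl,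
    ← Multiset.map_map, map_univ_toType] at this

/-- the diagonal form with entries `a` -/
noncomputable def dg (a : ι → kˣ) : BilinForm k (ι → k) :=
  LinearMap.mk₂ k (fun x y => ∑ i, (a i : k) * (x i * y i))
    (fun x x' y => by simp only [Pi.add_apply, ← Finset.sum_add_distrib]; congr! 1; ring)
    (fun c x y => by simp only [Pi.smul_apply, smul_eq_mul, Finset.mul_sum]; congr! 1; ring)
    (fun x x' y => by simp only [Pi.add_apply, ← Finset.sum_add_distrib]; congr! 1; ring)
    (fun c x y => by simp only [Pi.smul_apply, smul_eq_mul, Finset.mul_sum]; congr! 1; ring)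

lemma dg_apply (a : ι → kˣ) (x y : ι → k) : dg a x y = ∑ i, (a i : k) * (x i * y i) := rfl

lemma diagOn_dg (a : ι → kˣ) : DiagOn (dg a) (Pi.basisFun k ι) a := by
  intro i j
  rw [dg_apply, Finset.sum_eq_single i]
  · simp only [Pi.basisFun_apply, Pi.single_eq_same, one_mul]
    split_ifs with h
    · subst h; simp
    · rw [Pi.single_eq_of_ne h]; simp
  · intro l _ hl
    simp [Pi.single_eq_of_ne hl]
  · simp

lemma isDiag_dg (m : Multiset kˣ) : IsDiag (dg (MT.val : MT m → kˣ)) m :=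
  ⟨_, diagOn_dg _⟩

lemma IP.exists_isDiag [CharZero k] [FiniteDimensional k V] {B : BilinForm k V} (h : IP B) :
    ∃ m, IsDiag B m := by
  have : Invertible (2 : k) := invertibleOfNonzero two_ne_zero
  obtain ⟨v, hv⟩ := LinearMap.BilinForm.exists_orthogonal_basis (B := B) ⟨fun x y => by simpa using h.symm x y⟩
  have hne : ∀ i, B (v i) (v i) ≠ 0 := by
    intro i hi
    refine v.ne_zero i (h.nd _ fun y => ?_)
    rw [← v.sum_repr y, map_sum]
    refine Finset.sum_eq_zero fun j _ => ?_
    rw [map_smul]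
    by_cases hij : i = j
    · subst hij; simp [hi]
    · rw [hv hij, smul_zero]
  have : DiagOn B v (fun i => Units.mk0 _ (hne i)) := by
    intro i j
    split_ifs with hij
    · subst hij; rfl
    · exact hv hij
  exact ⟨_, this.isDiag⟩

/-- the diagonal form of `m` is metabolic -/
def Met (m : Multiset kˣ) : Prop := Metabolic (dg (MT.val : MT m → kˣ))

lemma IsDiag.metabolic_iff {B : BilinForm k V} {m : Multiset kˣ} (h : IsDiag B m) :
    Metabolic B ↔ Met m := by
  obtain ⟨e, he⟩ := h.exists_isometry (isDiag_dg m)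
  obtain ⟨e', he'⟩ := (isDiag_dg m).exists_isometry h
  exact ⟨Metabolic.congr he, Metabolic.congr he'⟩

lemma Met.add {m m' : Multiset kˣ} (h : Met m) (h' : Met m') : Met (m + m') :=
  ((isDiag_dg m).orth (isDiag_dg m')).metabolic_iff.1 (Metabolic.orth h h')

lemma Met.of_add {m m' : Multiset kˣ} (h : Met (m + m')) (h' : Met m') : Met m :=
  Metabolic.of_orth (isDiag_dg m).ip (isDiag_dg m').ip
    (((isDiag_dg m).orth (isDiag_dg m')).metabolic_iff.2 h) h'

lemma Met.neg {m : Multiset kˣ} (h : Met m) : Met (m.map Neg.neg) := by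
  rw [← (isDiag_dg m).neg.metabolic_iff]
  obtain ⟨L, hL⟩ := h
  exact ⟨L, fun x => by rw [hL]; simp⟩

lemma met_add_neg [CharZero k] (m : Multiset kˣ) : Met (m + m.map Neg.neg) :=
  ((isDiag_dg m).orth (isDiag_dg m).neg).metabolic_iff.1
    (metabolic_orth_neg (e := LinearEquiv.refl k _) (isDiag_dg m).ip fun _ _ => rfl)

lemma map_neg_neg (m : Multiset kˣ) : (m.map Neg.neg).map Neg.neg = m := by
  rw [Multiset.map_map]; simp

variable (k) in
/-- Witt equivalence -/
def wittCon [CharZero k] : AddCon (Multiset kˣ) where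
  r m m' := Met (m + m'.map Neg.neg)
  iseqv := by
    refine ⟨met_add_neg, fun {m m'} h => ?_, fun {m m' m''} h h' => ?_⟩
    · have := h.neg
      rwa [Multiset.map_add, map_neg_neg, add_comm] at this
    · refine Met.of_add (m' := m' + m'.map Neg.neg) ?_ (met_add_neg m')
      have := h.add h'
      convert this using 1
      abel
  add' := by
    intro m m' n n' h h'
    have := Met.add h h'
    rw [Multiset.map_add]
    convert this using 1
    abel

variable (k) in
/-- the Witt group -/
def W [CharZero k] : Type _ := (wittCon k).Quotient

variable [CharZero k]

noncomputable instance : AddCommMonoid (W k) := inferInstanceAs (AddCommMonoid (wittCon k).Quotient)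

/-- class of a diagonal form -/
noncomputable def W.mk : Multiset kˣ →+ W k := (wittCon k).mk'

lemma W.mk_eq_mk {m m' : Multiset kˣ} : W.mk m = W.mk m' ↔ Met (m + m'.map Neg.neg) :=
  (wittCon k).eq

lemma W.mk_surjective : Function.Surjective (W.mk : Multiset kˣ → W k) :=
  AddCon.mk'_surjective

lemma W.mk_eq_zero {m : Multiset kˣ} : W.mk m = 0 ↔ Met m := by
  rw [← map_zero W.mk, W.mk_eq_mk]
  simp

lemma W.exists_neg (w : W k) : ∃ w', w' + w = 0 := by
  obtain ⟨m, rfl⟩ := W.mk_surjective w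
  exact ⟨W.mk (m.map Neg.neg), by rw [← map_add, W.mk_eq_zero, add_comm]; exact met_add_neg m⟩

noncomputable instance : AddCommGroup (W k) :=
  { (inferInstance : AddCommMonoid (W k)) with
    neg := fun w => (W.exists_neg w).choose
    zsmul := @zsmulRec _ _ _ ⟨fun w => (W.exists_neg w).choose⟩ nsmulRec
    neg_add_cancel := fun w => (W.exists_neg w).choose_spec }

lemma W.mk_neg (m : Multiset kˣ) : W.mk (m.map Neg.neg) = - W.mk m := by
  rw [eq_neg_iff_add_eq_zero, ← map_add, W.mk_eq_zero, add_comm]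
  exact met_add_neg m

/-- class of a one-dimensional form -/
noncomputable def ang (a : kˣ) : W k := W.mk {a}

lemma W.mk_eq_sum (m : Multiset kˣ) : W.mk m = (m.map ang).sum := by
  induction m using Multiset.induction with
  | empty => simp
  | cons a m ih => rw [← Multiset.singleton_add, map_add, ih, Multiset.map_add, Multiset.sum_add]; simp [ang]

/-- Witt class of a form -/
noncomputable def cl (B : BilinForm k V) : W k :=
  if h : ∃ m, IsDiag B m then W.mk h.choose else 0

lemma IsDiag.cl_eq {B : BilinForm k V} {m : Multiset kˣ} (h : IsDiag B m) : cl B = W.mk m := by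
  have h' : ∃ m, IsDiag B m := ⟨m, h⟩
  rw [cl, dif_pos h', W.mk_eq_mk, ← (h'.choose_spec.orth h.neg).metabolic_iff]
  exact metabolic_orth_neg (e := LinearEquiv.refl k _) h.ip fun _ _ => rfl

lemma DiagOn.cl_eq {B : BilinForm k V} {b : Basis ι k V} {a : ι → kˣ} (h : DiagOn B b a) :
    cl B = ∑ i, ang (a i) := by
  rw [h.isDiag.cl_eq, W.mk_eq_sum, Multiset.map_map]; rfl

section

variable [FiniteDimensional k V] [FiniteDimensional k V'] {B : BilinForm k V} {B' : BilinForm k V'}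

lemma cl_orth (h : IP B) (h' : IP B') : cl (orth B B') = cl B + cl B' := by
  obtain ⟨m, hm⟩ := h.exists_isDiag
  obtain ⟨m', hm'⟩ := h'.exists_isDiag
  rw [(hm.orth hm').cl_eq, hm.cl_eq, hm'.cl_eq, map_add]

lemma cl_neg (h : IP B) : cl (-B) = - cl B := by
  obtain ⟨m, hm⟩ := h.exists_isDiag
  rw [hm.neg.cl_eq, hm.cl_eq, W.mk_neg]

lemma cl_congr (h : IP B) {e : V ≃ₗ[k] V'} (he : ∀ x y, B' (e x) (e y) = B x y) : cl B' = cl B := by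
  obtain ⟨m, hm⟩ := h.exists_isDiag
  rw [hm.cl_eq, (hm.congr he).cl_eq]

lemma cl_eq_zero_iff (h : IP B) : cl B = 0 ↔ Metabolic B := by
  obtain ⟨m, hm⟩ := h.exists_isDiag
  rw [hm.cl_eq, W.mk_eq_zero, hm.metabolic_iff]

theorem exists_isometry_of_cl_eq (h : IP B) (h' : IP B') (hc : cl B = cl B')
    (hd : finrank k V = finrank k V') : ∃ e : V ≃ₗ[k] V', ∀ x y, B' (e x) (e y) = B x y := by
  refine exists_isometry_of_metabolic h h' hd ?_
  rw [← cl_eq_zero_iff (h.orth h'.neg), cl_orth h h'.neg, cl_neg h', hc, add_neg_cancel]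

end

/-- homomorphisms out of the Witt group -/
noncomputable def W.lift {G : Type*} [AddCommGroup G] (g : kˣ → G) (hneg : ∀ a, g (-a) = - g a)
    (hmet : ∀ m, Met m → (m.map g).sum = 0) : W k →+ G :=
  AddCon.lift (wittCon k)
    { toFun := fun m => (m.map g).sum
      map_zero' := by simp
      map_add' := by simp } (by
    intro m m' (h : Met (m + m'.map Neg.neg))
    have := hmet _ h
    rw [Multiset.map_add, Multiset.sum_add, Multiset.map_map] at this
    change (m.map g).sum = (m'.map g).sum
    have h2 : (m'.map (g ∘ Neg.neg)).sum = - (m'.map g).sum := by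
      rw [← Multiset.sum_map_neg]
      congr 1
      exact Multiset.map_congr rfl fun a _ => hneg a
    rw [h2] at this
    exact add_neg_eq_zero.1 this)

lemma W.lift_mk {G : Type*} [AddCommGroup G] (g : kˣ → G) (hneg : ∀ a, g (-a) = - g a)
    (hmet : ∀ m, Met m → (m.map g).sum = 0) (m : Multiset kˣ) :
    W.lift g hneg hmet (W.mk m) = (m.map g).sum := rfl

lemma W.lift_ang {G : Type*} [AddCommGroup G] (g : kˣ → G) (hneg : ∀ a, g (-a) = - g a)
    (hmet : ∀ m, Met m → (m.map g).sum = 0) (a : kˣ) : W.lift g hneg hmet (ang a) = g a := by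
  rw [ang, W.lift_mk]; simp

lemma W.hom_ext {G : Type*} [AddCommGroup G] {f g : W k →+ G} (h : ∀ a, f (ang a) = g (ang a)) :
    f = g := by
  ext w
  obtain ⟨m, rfl⟩ := W.mk_surjective w
  rw [W.mk_eq_sum, map_multiset_sum, map_multiset_sum, Multiset.map_map, Multiset.map_map]
  congr 1
  exact Multiset.map_congr rfl fun a _ => h a

end Diagonal

end QF

namespace QF

open IsDedekindDomain NumberField WithZero
open scoped Pointwise Classical nonZeroDivisors

open LinearMap (BilinForm)
open Module (finrank Basis)

section WittRelations

variable {k V : Type*} [Field k] [CharZero k] [AddCommGroup V] [Module k V] {ι : Type*} [Fintype ι]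

lemma cl_eq_of_ortho [FiniteDimensional k V] {B : BilinForm k V} (v : ι → V) (a : ι → kˣ)
    (h : ∀ i j, B (v i) (v j) = if i = j then (a i : k) else 0)
    (hcard : Fintype.card ι = finrank k V) : cl B = ∑ i, ang (a i) := by
  have hli : LinearIndependent k v := by
    rw [Fintype.linearIndependent_iff]
    intro g hg j
    have h1 : B (∑ i, g i • v i) (v j) = 0 := by rw [hg, map_zero, LinearMap.zero_apply]
    rw [map_sum, LinearMap.sum_apply, Finset.sum_eq_single j] at h1
    · rw [map_smul, LinearMap.smul_apply, h, if_pos rfl, smul_eq_mul] at h1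
      exact (mul_eq_zero.1 h1).resolve_right (a j).ne_zero
    · intro i _ hij
      rw [map_smul, LinearMap.smul_apply, h, if_neg hij, smul_zero]
    · simp
  have hD : DiagOn B (Basis.mk hli (hli.span_eq_top_of_card_eq_finrank' hcard).ge) a := by
    intro i j
    rw [Basis.mk_apply, Basis.mk_apply, h]
  exact hD.cl_eq

lemma ang_mul_sq (a b : kˣ) : ang (a * b ^ 2) = ang a := by
  have h1 := cl_eq_of_ortho (B := dg (fun _ : Unit => a)) (fun _ : Unit => fun _ => (b : k)) (fun _ => a * b ^ 2)
    (by intro i j; simp [dg_apply]; ring) (by simp)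
  have h2 := (diagOn_dg (fun _ : Unit => a)).cl_eq
  simpa using h1.symm.trans h2

lemma ang_add_ang (a b s : kˣ) (hs : (s : k) = a + b) : ang a + ang b = ang s + ang (a * b * s) := by
  have h1 := cl_eq_of_ortho (B := dg ![a, b]) (![![1, 1], ![(b : k), -a]]) ![s, a * b * s]
    (by
      intro i j
      fin_cases i <;> fin_cases j <;> simp [dg_apply, hs] <;> ring) (by simp)
  have h2 := (diagOn_dg ![a, b]).cl_eq
  simpa using h2.symm.trans h1

lemma ang_neg (a : kˣ) : ang (-a) = - ang a := by
  rw [ang, ang, ← W.mk_neg, Multiset.map_singleton]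

lemma IsDiag.smul {B : BilinForm k V} {m : Multiset kˣ} (h : IsDiag B m) (c : kˣ) :
    IsDiag ((c : k) • B) (m.map (c * ·)) := by
  obtain ⟨b, h⟩ := h
  have : DiagOn ((c : k) • B) b (fun i : MT m => c * i.val) := by
    intro i j
    rw [LinearMap.smul_apply, LinearMap.smul_apply, h]
    split_ifs <;> simp
  have := this.isDiag
  rwa [show (fun i : MT m => c * i.val) = (c * ·) ∘ (MT.val : MT m → kˣ) from rfl,
    ← Multiset.map_map, map_univ_toType] at this

/-- scaling of forms -/
noncomputable def scale (c : kˣ) : W k →+ W k :=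
  W.lift (fun a => ang (c * a)) (fun a => by rw [mul_neg, ang_neg]) (by
    intro m hm
    rw [show (fun a => ang (c * a)) = ang ∘ (c * ·) from rfl, ← Multiset.map_map, ← W.mk_eq_sum,
      W.mk_eq_zero, ← ((isDiag_dg m).smul c).metabolic_iff]
    obtain ⟨L, hL⟩ := hm
    exact ⟨L, fun x => by rw [hL]; simp⟩)

@[simp] lemma scale_ang (c a : kˣ) : scale c (ang a) = ang (c * a) := W.lift_ang _ _ _ _

lemma cl_smul [FiniteDimensional k V] {B : BilinForm k V} (h : IP B) (c : kˣ) :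
    cl ((c : k) • B) = scale c (cl B) := by
  obtain ⟨m, hm⟩ := h.exists_isDiag
  rw [(hm.smul c).cl_eq, hm.cl_eq, W.mk_eq_sum, W.mk_eq_sum, map_multiset_sum, Multiset.map_map,
    Multiset.map_map]
  exact congrArg _ (Multiset.map_congr rfl fun a _ => (scale_ang _ _).symm)

end WittRelations

section Transfer

variable {k F V : Type*} [Field k] [CharZero k] [Field F] [CharZero F] [Algebra k F]
  [AddCommGroup V] [Module k V] [Module F V] [IsScalarTower k F V] {ι : Type*} [Fintype ι]

/-- transfer of a form along a functional -/
def resf (s : F →ₗ[k] k) (B : BilinForm F V) : BilinForm k V :=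
  LinearMap.mk₂ k (fun x y => s (B x y)) (by simp)
    (fun c x y => by
      rw [← algebraMap_smul F c x, map_smul, LinearMap.smul_apply, algebraMap_smul, map_smul])
    (by simp)
    (fun c x y => by rw [← algebraMap_smul F c y, map_smul, algebraMap_smul, map_smul])

@[simp] lemma resf_apply (s : F →ₗ[k] k) (B : BilinForm F V) (x y : V) :
    resf s B x y = s (B x y) := rfl

/-- the one-dimensional form -/
noncomputable def oned (a : F) : BilinForm F F := a • LinearMap.mul F F

@[simp] lemma oned_apply (a x y : F) : oned a x y = a * (x * y) := rfl

lemma diagOn_oned (a : Fˣ) : DiagOn (oned (a : F)) (Basis.singleton Unit F) fun _ => a := by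
  intro i j; simp

lemma ip_oned (a : Fˣ) : IP (oned (a : F)) := (diagOn_oned a).ip

@[simp] lemma cl_oned (a : Fˣ) : cl (oned (a : F)) = ang a := by
  simpa using (diagOn_oned a).cl_eq

lemma eq_zero_of_functional {s : F →ₗ[k] k} (hs : s ≠ 0) {B : BilinForm F V} {x y : V}
    (h : ∀ c : F, s (B x (c • y)) = 0) : B x y = 0 := by
  by_contra hne
  refine hs (LinearMap.ext fun z => ?_)
  have := h (z / B x y)
  rwa [map_smul, smul_eq_mul, div_mul_cancel₀ _ hne] at this

lemma IP.resf {s : F →ₗ[k] k} (hs : s ≠ 0) {B : BilinForm F V} (h : IP B) : IP (resf s B) where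
  symm x y := by rw [resf_apply, resf_apply, h.symm]
  nd x hx := h.nd x fun y => eq_zero_of_functional hs fun c => hx _

lemma Metabolic.resf {s : F →ₗ[k] k} (hs : s ≠ 0) {B : BilinForm F V} (h : Metabolic B) :
    Metabolic (resf s B) := by
  obtain ⟨L, hL⟩ := h
  refine ⟨L.restrictScalars k, fun x => ?_⟩
  rw [Submodule.restrictScalars_mem, hL]
  constructor
  · intro hx y hy
    rw [resf_apply, hx y hy, map_zero]
  · intro hx y hy
    exact eq_zero_of_functional hs fun c => hx _ (L.smul_mem c hy)

variable [FiniteDimensional k F]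

lemma DiagOn.cl_resf {s : F →ₗ[k] k} (hs : s ≠ 0) {B : BilinForm F V} {b : Basis ι F V}
    {a : ι → Fˣ} (h : DiagOn B b a) : cl (resf s B) = ∑ i, cl (QF.resf s (oned (a i : F))) := by
  have : FiniteDimensional F V := Module.Finite.of_basis b
  have : FiniteDimensional k V := FiniteDimensional.trans k F V
  have hd : ∀ i, ∃ m, IsDiag (QF.resf s (oned (a i : F))) m := fun i =>
    ((ip_oned (a i)).resf hs).exists_isDiag
  choose m hm using hd
  choose c hc using hm
  have := cl_eq_of_ortho (B := QF.resf s B) (fun p : Σ i, MT (m i) => c p.1 p.2 • b p.1)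
    (fun p => p.2.val) (by
      rintro ⟨i, j⟩ ⟨i', j'⟩
      rw [resf_apply, LinearMap.map_smul, LinearMap.map_smul, LinearMap.smul_apply, h]
      by_cases hi : i = i'
      · subst hi
        have := hc i j j'
        rw [resf_apply, oned_apply] at this
        simp only [Sigma.mk.injEq, heq_eq_eq, true_and, if_true, smul_eq_mul]
        rw [← this]
        congr 1; ring
      · rw [if_neg hi, if_neg (by simp [hi])]; simp) (by
      rw [← Module.finrank_mul_finrank k F V, Module.finrank_eq_card_basis b, Fintype.card_sigma]
      simp only [← Module.finrank_eq_card_basis (c _)]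
      simp [mul_comm])
  rw [this, Fintype.sum_sigma]
  exact Finset.sum_congr rfl fun i _ => (hc i).cl_eq.symm

/-- transfer of Witt classes -/
noncomputable def transfer (s : F →ₗ[k] k) (hs : s ≠ 0) : W F →+ W k :=
  W.lift (fun a => cl (resf s (oned (a : F))))
    (fun a => by
      rw [← cl_neg ((ip_oned a).resf hs)]
      congr 1
      ext; simp)
    (by
      intro m hm
      have h1 := (diagOn_dg (MT.val : MT m → Fˣ)).cl_resf hs
      have h2 : cl (resf s (dg (MT.val : MT m → Fˣ))) = 0 :=
        (cl_eq_zero_iff ((isDiag_dg m).ip.resf hs)).2 (Metabolic.resf hs hm)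
      rw [h2] at h1
      conv_lhs => rw [← map_univ_toType m, Multiset.map_map]
      exact h1.symm)

lemma transfer_ang {s : F →ₗ[k] k} (hs : s ≠ 0) (a : Fˣ) :
    transfer s hs (ang a) = cl (resf s (oned (a : F))) := W.lift_ang _ _ _ _

lemma transfer_cl {s : F →ₗ[k] k} (hs : s ≠ 0) [FiniteDimensional F V] {B : BilinForm F V}
    (h : IP B) : transfer s hs (cl B) = cl (resf s B) := by
  obtain ⟨m, b, hb⟩ := h.exists_isDiag
  rw [hb.cl_resf hs, hb.cl_eq, map_sum]
  exact Finset.sum_congr rfl fun i _ => transfer_ang hs _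

lemma transfer_scale {s : F →ₗ[k] k} (hs : s ≠ 0) (c : kˣ) (w : W F) :
    transfer s hs (scale (Units.map (algebraMap k F).toMonoidHom c) w) = scale c (transfer s hs w) := by
  suffices (transfer s hs).comp (scale (Units.map (algebraMap k F).toMonoidHom c)) =
      (scale c).comp (transfer s hs) from DFunLike.congr_fun this w
  refine W.hom_ext fun a => ?_
  simp only [AddMonoidHom.comp_apply, scale_ang, transfer_ang]
  rw [← cl_smul ((ip_oned a).resf hs)]
  congr 1
  ext
  simp [← Algebra.smul_def]

lemma transfer_transfer {L : Type*} [Field L] [CharZero L] [Algebra F L] [Algebra k L]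
    [IsScalarTower k F L] [FiniteDimensional F L] [FiniteDimensional k L] {s : F →ₗ[k] k} (hs : s ≠ 0)
    {s' : L →ₗ[F] F} (hs' : s' ≠ 0) {t : L →ₗ[k] k} (ht : t ≠ 0) (hst : ∀ x, t x = s (s' x)) (w : W L) :
    transfer s hs (transfer s' hs' w) = transfer t ht w := by
  suffices (transfer s hs).comp (transfer s' hs') = transfer t ht from DFunLike.congr_fun this w
  refine W.hom_ext fun a => ?_
  rw [AddMonoidHom.comp_apply, transfer_ang, transfer_ang, transfer_cl hs ((ip_oned a).resf hs')]
  congr 1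
  ext
  simp [hst]

end Transfer

section Signature

variable {k : Type*} [Field k] [CharZero k] (v : k →+* ℝ)

lemma two_mul_card_pos_le {V ι : Type*} [AddCommGroup V] [Module k V] [Fintype ι]
    {B : BilinForm k V} {b : Basis ι k V} {a : ι → kˣ} (h : DiagOn B b a) (hm : Metabolic B) :
    2 * (Finset.univ.filter fun i => 0 < v (a i)).card ≤ Fintype.card ι := by
  have : FiniteDimensional k V := Module.Finite.of_basis b
  obtain ⟨L, hL⟩ := hm
  have h1 := hL.two_mul_finrank h.ip
  rw [Module.finrank_eq_card_basis b] at h1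
  let f : L →ₗ[k] ({i // ¬ 0 < v (a i)} → k) :=
    LinearMap.pi fun i => (b.coord i.1).comp L.subtype
  have hf : Function.Injective f := by
    rw [← LinearMap.ker_eq_bot, LinearMap.ker_eq_bot']
    intro x hx
    have h2 := congrArg v ((hL x).1 x.2 x x.2)
    rw [h.apply, map_zero, map_sum] at h2
    have h0 : ∀ i, ¬ 0 < v (a i) → b.repr x i = 0 := fun i hi => congrFun hx ⟨i, hi⟩
    rw [Finset.sum_eq_zero_iff_of_nonneg] at h2
    · ext
      refine b.ext_elem fun i => ?_
      by_cases hi : 0 < v (a i)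
      · have := h2 i (Finset.mem_univ _)
        simpa using this
      · simpa using h0 i hi
    · intro i _
      by_cases hi : 0 < v (a i)
      · rw [map_mul, map_mul]
        exact mul_nonneg hi.le (mul_self_nonneg _)
      · simp [h0 i hi]
  have h3 := LinearMap.finrank_le_finrank_of_injective hf
  rw [Module.finrank_fintype_fun_eq_card, Fintype.card_subtype] at h3
  have h4 := Finset.card_filter_add_card_filter_not (s := Finset.univ) (fun i => 0 < v (a i))
  rw [Finset.card_univ] at h4
  omega

lemma sum_sign {ι : Type*} [Fintype ι] (a : ι → ℝ) (ha : ∀ i, a i ≠ 0) :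
    ∑ i, ((SignType.sign (a i) : SignType) : ℤ) =
      (Finset.univ.filter fun i => 0 < a i).card - (Finset.univ.filter fun i => a i < 0).card := by
  rw [Finset.card_filter, Finset.card_filter]
  push_cast
  rw [← Finset.sum_sub_distrib]
  refine Finset.sum_congr rfl fun i _ => ?_
  rcases lt_or_gt_of_ne (ha i) with h | h
  · simp [h, sign_neg h, h.not_gt]
  · simp [h, sign_pos h, h.not_gt]

lemma card_pos_add_card_neg {ι : Type*} [Fintype ι] (a : ι → ℝ) (ha : ∀ i, a i ≠ 0) :
    (Finset.univ.filter fun i => 0 < a i).card + (Finset.univ.filter fun i => a i < 0).card =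
      Fintype.card ι := by
  rw [← Finset.card_univ, ← Finset.card_filter_add_card_filter_not (s := Finset.univ) (fun i => 0 < a i)]
  congr 2
  ext i
  have := ha i
  simp only [Finset.mem_filter, Finset.mem_univ, true_and, not_lt]
  exact ⟨le_of_lt, fun h => lt_of_le_of_ne h this⟩

/-- signature of Witt classes at a real embedding -/
noncomputable def sgn : W k →+ ℤ :=
  W.lift (fun a => ((SignType.sign (v a) : SignType) : ℤ))
    (fun a => by
      rw [Units.val_neg, map_neg, Left.sign_neg]
      generalize SignType.sign (v a) = x
      cases x <;> rfl)
    (by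
      intro m hm
      have hD := diagOn_dg (MT.val : MT m → kˣ)
      have hne : ∀ i : MT m, v i.val ≠ 0 := fun i => (_root_.map_ne_zero v).2 i.val.ne_zero
      have h1 := two_mul_card_pos_le v hD hm
      have h2 : 2 * (Finset.univ.filter fun i : MT m => v i.val < 0).card ≤ Fintype.card (MT m) := by
        have hD' : DiagOn (-dg (MT.val : MT m → kˣ)) (Pi.basisFun k (MT m)) (fun i : MT m => -i.val) := by
          intro i j
          rw [LinearMap.neg_apply, LinearMap.neg_apply, hD i j]
          split_ifs <;> simp
        have := two_mul_card_pos_le v hD' (by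
          obtain ⟨L, hL⟩ := hm
          exact ⟨L, fun x => by rw [hL]; simp⟩)
        simpa using this
      have h3 := card_pos_add_card_neg (fun i : MT m => v i.val) hne
      conv_lhs => rw [← map_univ_toType m, Multiset.map_map]
      have h4 := sum_sign (fun i : MT m => v i.val) hne
      refine Eq.trans h4 ?_
      omega)

@[simp] lemma sgn_ang (a : kˣ) : sgn v (ang a) = ((SignType.sign (v a) : SignType) : ℤ) :=
  W.lift_ang _ _ _ _

lemma sgn_ang_pos {a : kˣ} (h : 0 < v a) : sgn v (ang a) = 1 := by simp [sign_pos h]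

lemma sgn_ang_neg {a : kˣ} (h : v a < 0) : sgn v (ang a) = -1 := by simp [sign_neg h]

lemma sgn_cl {V ι : Type*} [AddCommGroup V] [Module k V] [Fintype ι]
    {B : BilinForm k V} {b : Basis ι k V} {a : ι → kˣ} (h : DiagOn B b a) :
    sgn v (cl B) = (Finset.univ.filter fun i => 0 < v (a i)).card -
      (Finset.univ.filter fun i => v (a i) < 0).card := by
  rw [h.cl_eq, map_sum, ← sum_sign _ fun i => (_root_.map_ne_zero v).2 (a i).ne_zero]
  exact Finset.sum_congr rfl fun i _ => sgn_ang _ _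

end Signature

end QF

namespace QF

open IsDedekindDomain NumberField WithZero
open scoped Pointwise Classical nonZeroDivisors

open LinearMap (BilinForm)
open Module (finrank Basis)

lemma finrank_le_card_neg {ι : Type*} [Fintype ι] (a : ι → ℝ) (ha : ∀ i, a i ≠ 0)
    (U : Submodule ℂ (ι → ℂ)) (hU : ∀ z ∈ U, ∑ i, a i * Complex.normSq (z i) ≤ 0) :
    finrank ℂ U ≤ (Finset.univ.filter fun i => a i < 0).card := by
  let f : U →ₗ[ℂ] ({i // a i < 0} → ℂ) :=
    LinearMap.pi fun i => (LinearMap.proj i.1).comp U.subtype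
  have hf : Function.Injective f := by
    rw [← LinearMap.ker_eq_bot, LinearMap.ker_eq_bot']
    intro x hx
    have h0 : ∀ i, a i < 0 → x.1 i = 0 := fun i hi => congrFun hx ⟨i, hi⟩
    have hnn : ∀ i ∈ Finset.univ, 0 ≤ a i * Complex.normSq (x.1 i) := by
      intro i _
      rcases lt_or_gt_of_ne (ha i) with h | h
      · simp [h0 i h]
      · exact mul_nonneg h.le (Complex.normSq_nonneg _)
    have h2 := (Finset.sum_eq_zero_iff_of_nonneg hnn).1 (le_antisymm (hU _ x.2) (Finset.sum_nonneg hnn))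
    ext i
    have := h2 i (Finset.mem_univ _)
    simpa [ha i] using this
  have h3 := LinearMap.finrank_le_finrank_of_injective hf
  rwa [Module.finrank_fintype_fun_eq_card, Fintype.card_subtype] at h3

section TraceSignature

variable {k F : Type*} [Field k] [CharZero k] [Field F] [CharZero F] [Algebra k F]
  [FiniteDimensional k F]

lemma finrank_coordinates {κ : Type*} [Fintype κ] (I : Set κ) :
    finrank ℂ (⨅ i ∈ Iᶜ, LinearMap.ker (LinearMap.proj i : (κ → ℂ) →ₗ[ℂ] ℂ) : Submodule ℂ (κ → ℂ)) =
      Fintype.card I := by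
  rw [(LinearMap.iInfKerProjEquiv ℂ (fun _ : κ => ℂ) (I := I) (J := Iᶜ) disjoint_compl_right
    (by simp)).finrank_eq, Module.finrank_fintype_fun_eq_card]

/-- conjugation of embeddings over a real embedding -/
noncomputable def conjHom [Algebra k ℂ] (hr : ∀ c : k, starRingEnd ℂ (algebraMap k ℂ c) = algebraMap k ℂ c)
    (φ : F →ₐ[k] ℂ) : F →ₐ[k] ℂ where
  toRingHom := (starRingEnd ℂ).comp φ.toRingHom
  commutes' c := by simp [hr]

lemma card_le_card_neg [Algebra k ℂ] (v : k →+* ℝ) (hv : ∀ c, algebraMap k ℂ c = v c)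
    (hr : ∀ c : k, starRingEnd ℂ (algebraMap k ℂ c) = algebraMap k ℂ c)
    (l : Fˣ) {ι : Type*} [Fintype ι] (b : Basis ι k F) (a : ι → kˣ)
    (h : DiagOn (resf (Algebra.trace k F) (oned (l : F))) b a) (I : Set (F →ₐ[k] ℂ))
    (hI : ∀ φ ∈ I, conjHom hr φ ∈ I → conjHom hr φ = φ ∧ (φ l).re ≤ 0) :
    Fintype.card I ≤ (Finset.univ.filter fun i => v (a i) < 0).card := by
  have horth : ∀ i j, ∑ φ : F →ₐ[k] ℂ, φ l * (φ (b i) * φ (b j)) = if i = j then (v (a i) : ℂ) else 0 := by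
    intro i j
    have := congrArg (algebraMap k ℂ) (h i j)
    rw [resf_apply, oned_apply, trace_eq_sum_embeddings ℂ] at this
    simp only [map_mul] at this
    rw [this]
    split_ifs
    · rw [hv]
    · rw [map_zero]
  let Φ : (ι → ℂ) →ₗ[ℂ] ((F →ₐ[k] ℂ) → ℂ) :=
    LinearMap.pi fun φ => ∑ i, φ (b i) • LinearMap.proj i
  have hΦ : ∀ z φ, Φ z φ = ∑ i, φ (b i) * z i := by intro z φ; simp [Φ]
  have hane : ∀ i, v (a i) ≠ 0 := fun i => (_root_.map_ne_zero v).2 (a i).ne_zero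
  have hbil : ∀ z z', ∑ φ, φ l * (Φ z φ * Φ z' φ) = ∑ i, (v (a i) : ℂ) * (z i * z' i) := by
    intro z z'
    calc ∑ φ, φ l * (Φ z φ * Φ z' φ)
        = ∑ φ : F →ₐ[k] ℂ, ∑ i, ∑ j, (φ l * (φ (b i) * φ (b j))) * (z i * z' j) := by
          refine Finset.sum_congr rfl fun φ _ => ?_
          rw [hΦ, hΦ, Finset.sum_mul_sum, Finset.mul_sum]
          refine Finset.sum_congr rfl fun i _ => ?_
          rw [Finset.mul_sum]
          refine Finset.sum_congr rfl fun j _ => ?_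
          ring
      _ = ∑ i, ∑ j, (∑ φ : F →ₐ[k] ℂ, φ l * (φ (b i) * φ (b j))) * (z i * z' j) := by
          rw [Finset.sum_comm]
          refine Finset.sum_congr rfl fun i _ => ?_
          rw [Finset.sum_comm]
          refine Finset.sum_congr rfl fun j _ => ?_
          rw [Finset.sum_mul]
      _ = _ := by
          refine Finset.sum_congr rfl fun i _ => ?_
          simp [horth]
  have hinj : Function.Injective Φ := by
    rw [← LinearMap.ker_eq_bot, LinearMap.ker_eq_bot']
    intro z hz
    ext i
    have := hbil z (Pi.single i 1)
    rw [hz, Finset.sum_eq_single i] at this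
    · simpa [hane i] using this
    · intro j _ hj
      simp [Pi.single_eq_of_ne hj]
    · simp
  have hconj : ∀ z φ, Φ (fun i => starRingEnd ℂ (z i)) φ = starRingEnd ℂ (Φ z (conjHom hr φ)) := by
    intro z φ
    rw [hΦ, hΦ, map_sum]
    refine Finset.sum_congr rfl fun i _ => ?_
    rw [map_mul]
    congr 1
    exact (Complex.conj_conj _).symm
  have hsurj : Function.Surjective Φ := by
    rw [← LinearMap.injective_iff_surjective_of_finrank_eq_finrank]
    · exact hinj
    · rw [Module.finrank_fintype_fun_eq_card, Module.finrank_fintype_fun_eq_card, AlgHom.card k F ℂ,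
        Module.finrank_eq_card_basis b]
  let e := LinearEquiv.ofBijective Φ ⟨hinj, hsurj⟩
  let U : Submodule ℂ ((F →ₐ[k] ℂ) → ℂ) :=
    ⨅ i ∈ Iᶜ, LinearMap.ker (LinearMap.proj i : ((F →ₐ[k] ℂ) → ℂ) →ₗ[ℂ] ℂ)
  have hU : ∀ w ∈ U, ∀ φ ∉ I, w φ = 0 := by
    intro w hw φ hφ
    simp only [U, Submodule.mem_iInf] at hw
    exact hw φ hφ
  have h1 := finrank_le_card_neg (fun i => v (a i)) hane (U.map e.symm.toLinearMap) (by
    rintro _ ⟨w, hw, rfl⟩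
    set z := e.symm w with hz
    have hw' : Φ z = w := e.apply_symm_apply w
    have h2 := hbil z (fun i => starRingEnd ℂ (z i))
    have h3 := congrArg Complex.re h2
    simp only [Complex.mul_conj, hconj, hw', Complex.re_sum] at h3
    have h4 : ∑ i, v (a i) * Complex.normSq (z i) = ∑ φ, (φ l * (w φ * starRingEnd ℂ (w (conjHom hr φ)))).re := by
      rw [h3]
      refine Finset.sum_congr rfl fun i _ => ?_
      rw [← Complex.ofReal_mul, Complex.ofReal_re]
    change ∑ i, v (a i) * Complex.normSq (z i) ≤ 0
    rw [h4]
    refine Finset.sum_nonpos fun φ _ => ?_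
    by_cases h5 : φ ∈ I
    · by_cases h6 : conjHom hr φ ∈ I
      · obtain ⟨h7, h8⟩ := hI φ h5 h6
        rw [h7, Complex.mul_conj, Complex.re_mul_ofReal]
        exact mul_nonpos_of_nonpos_of_nonneg h8 (Complex.normSq_nonneg _)
      · rw [hU w hw _ h6]; simp
    · rw [hU w hw _ h5]; simp)
  rwa [LinearEquiv.finrank_map_eq, finrank_coordinates] at h1

lemma sgn_transfer_trace [NumberField F] (v : k →+* ℝ) (hs : Algebra.trace k F ≠ 0) (w : W F) :
    sgn v (transfer (Algebra.trace k F) hs w) =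
      ∑ P ∈ (Finset.univ.filter fun P : F →+* ℝ => P.comp (algebraMap k F) = v), sgn P w := by
  suffices (sgn v).comp (transfer (Algebra.trace k F) hs) =
      ∑ P ∈ (Finset.univ.filter fun P : F →+* ℝ => P.comp (algebraMap k F) = v), sgn P by
    rw [← AddMonoidHom.comp_apply, this, AddMonoidHom.finsetSum_apply]
  refine W.hom_ext fun l => ?_
  rw [AddMonoidHom.comp_apply, AddMonoidHom.finsetSum_apply, transfer_ang]
  let _ : Algebra k ℂ := (Complex.ofRealHom.comp v).toAlgebra
  have hv : ∀ c, algebraMap k ℂ c = v c := fun c => rfl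
  have hr : ∀ c : k, starRingEnd ℂ (algebraMap k ℂ c) = algebraMap k ℂ c := fun c => by
    rw [hv, Complex.conj_ofReal]
  obtain ⟨m, b, hb⟩ := ((ip_oned l).resf hs).exists_isDiag
  have hcc : ∀ φ : F →ₐ[k] ℂ, conjHom hr (conjHom hr φ) = φ := fun φ => by
    ext x; exact Complex.conj_conj _
  let c : (F →ₐ[k] ℂ) → ℕ := fun φ => (Fintype.equivFin (F →ₐ[k] ℂ) φ : ℕ)
  have hc : Function.Injective c := Fin.val_injective.comp (Equiv.injective _)
  let S : Finset (F →ₐ[k] ℂ) := Finset.univ.filter fun φ => c φ < c (conjHom hr φ)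
  let Rp : Finset (F →ₐ[k] ℂ) := Finset.univ.filter fun φ => conjHom hr φ = φ ∧ 0 < (φ l).re
  let Rn : Finset (F →ₐ[k] ℂ) := Finset.univ.filter fun φ => conjHom hr φ = φ ∧ (φ l).re < 0
  have hreal : ∀ φ : F →ₐ[k] ℂ, conjHom hr φ = φ → ∀ x, (φ x).im = 0 := by
    intro φ hφ x
    have : starRingEnd ℂ (φ x) = φ x := DFunLike.congr_fun hφ x
    exact Complex.conj_eq_iff_im.1 this
  have hne : ∀ φ : F →ₐ[k] ℂ, conjHom hr φ = φ → (φ l).re ≠ 0 := by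
    intro φ hφ h0
    exact (_root_.map_ne_zero φ).2 l.ne_zero (Complex.ext h0 (hreal φ hφ _))
  have hn : (Rn ∪ S).card ≤ (Finset.univ.filter fun i : MT m => v i.val < 0).card := by
    have := card_le_card_neg v hv hr l b _ hb (↑(Rn ∪ S) : Set (F →ₐ[k] ℂ)) (by
      intro φ h1 h2
      simp only [Rn, S, Finset.coe_union, Finset.coe_filter, Finset.mem_univ, true_and, Set.mem_union,
        Set.mem_ofPred_eq, hcc] at h1 h2
      rcases h1 with h1 | h1
      · exact ⟨h1.1, h1.2.le⟩
      · rcases h2 with h2 | h2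
        · rw [← h2.1] at h1; exact absurd h1 (lt_irrefl _)
        · exact absurd h1 h2.not_gt)
    simpa using this
  have hp : (Rp ∪ S).card ≤ (Finset.univ.filter fun i : MT m => 0 < v i.val).card := by
    have hb' : DiagOn (resf (Algebra.trace k F) (oned ((-l : Fˣ) : F))) b (fun i : MT m => -i.val) := by
      intro i j
      have := hb i j
      simp only [resf_apply, oned_apply] at this ⊢
      rw [Units.val_neg, neg_mul, map_neg, this]
      split_ifs <;> simp
    have := card_le_card_neg v hv hr (-l) b _ hb' (↑(Rp ∪ S) : Set (F →ₐ[k] ℂ)) (by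
      intro φ h1 h2
      simp only [Rp, S, Finset.coe_union, Finset.coe_filter, Finset.mem_univ, true_and, Set.mem_union,
        Set.mem_ofPred_eq, hcc] at h1 h2
      rcases h1 with h1 | h1
      · exact ⟨h1.1, by simpa using h1.2.le⟩
      · rcases h2 with h2 | h2
        · rw [← h2.1] at h1; exact absurd h1 (lt_irrefl _)
        · exact absurd h1 h2.not_gt)
    simpa using this
  have hdn : Disjoint Rn S := by
    rw [Finset.disjoint_left]
    intro φ h1 h2
    simp only [Rn, S, Finset.mem_filter, Finset.mem_univ, true_and] at h1 h2
    rw [h1.1] at h2; exact lt_irrefl _ h2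
  have hdp : Disjoint Rp S := by
    rw [Finset.disjoint_left]
    intro φ h1 h2
    simp only [Rp, S, Finset.mem_filter, Finset.mem_univ, true_and] at h1 h2
    rw [h1.1] at h2; exact lt_irrefl _ h2
  rw [Finset.card_union_of_disjoint hdn] at hn
  rw [Finset.card_union_of_disjoint hdp] at hp
  have htot : Fintype.card (MT m) ≤ Rn.card + Rp.card + S.card + S.card := by
    rw [← Module.finrank_eq_card_basis b, ← AlgHom.card k F ℂ, ← Finset.card_univ]
    have : (Finset.univ : Finset (F →ₐ[k] ℂ)) ⊆ Rn ∪ Rp ∪ S ∪ S.image (conjHom hr) := by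
      intro φ _
      simp only [Finset.mem_union, Finset.mem_image, Rn, Rp, S, Finset.mem_filter, Finset.mem_univ, true_and]
      by_cases h : conjHom hr φ = φ
      · rcases lt_or_gt_of_ne (hne φ h) with h' | h'
        · exact Or.inl (Or.inl (Or.inl ⟨h, h'⟩))
        · exact Or.inl (Or.inl (Or.inr ⟨h, h'⟩))
      · rcases lt_trichotomy (c φ) (c (conjHom hr φ)) with h' | h' | h'
        · exact Or.inl (Or.inr h')
        · exact absurd (hc h').symm h
        · exact Or.inr ⟨conjHom hr φ, by rwa [hcc], hcc φ⟩
    refine (Finset.card_le_card this).trans ?_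
    refine (Finset.card_union_le _ _).trans (add_le_add ((Finset.card_union_le _ _).trans
      (add_le_add (Finset.card_union_le _ _) le_rfl)) Finset.card_image_le)
  have h3 := card_pos_add_card_neg (fun i : MT m => v i.val)
    (fun i => (_root_.map_ne_zero v).2 i.val.ne_zero)
  have h4 := sgn_cl v hb
  have key : ∀ (q : ℝ → Prop), (Finset.univ.filter fun φ : F →ₐ[k] ℂ => conjHom hr φ = φ ∧ q (φ l).re).card =
      ((Finset.univ.filter fun P : F →+* ℝ => P.comp (algebraMap k F) = v).filter fun P => q (P l)).card := by
    intro q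
    symm
    refine Finset.card_bij (fun P hP =>
      { toRingHom := Complex.ofRealHom.comp P
        commutes' := fun c => ?_ }) ?_ ?_ ?_
    · rw [Finset.mem_filter, Finset.mem_filter] at hP
      have := DFunLike.congr_fun hP.1.2 c
      simp only [RingHom.comp_apply] at this
      simp [this, hv]
    · intro P hP
      simp only [Finset.mem_filter, Finset.mem_univ, true_and] at hP ⊢
      refine ⟨?_, ?_⟩
      · ext x; exact Complex.conj_ofReal _
      · exact hP.2
    · intro P hP Q hQ h
      ext x
      exact Complex.ofReal_injective (DFunLike.congr_fun h x)
    · intro φ hφ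
      simp only [Finset.mem_filter, Finset.mem_univ, true_and] at hφ
      have hre : ∀ x, ((φ x).re : ℂ) = φ x := fun x => Complex.ext rfl (by simp [hreal φ hφ.1 x])
      let P : F →+* ℝ :=
        { toFun := fun x => (φ x).re
          map_one' := by simp
          map_zero' := by simp
          map_add' := by simp
          map_mul' := fun x y => by simp [hreal φ hφ.1 x] }
      refine ⟨P, ?_, ?_⟩
      · simp only [Finset.mem_filter, Finset.mem_univ, true_and]
        refine ⟨?_, hφ.2⟩
        ext c
        change (φ (algebraMap k F c)).re = v c
        rw [AlgHom.commutes, hv, Complex.ofReal_re]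
      · ext x; exact hre x
  have kp : Rp.card = _ := key (fun x => 0 < x)
  have kn : Rn.card = _ := key (fun x => x < 0)
  have h5 : ∑ P ∈ (Finset.univ.filter fun P : F →+* ℝ => P.comp (algebraMap k F) = v), sgn P (ang l) =
      (Rp.card : ℤ) - Rn.card := by
    rw [kp, kn, Finset.card_filter, Finset.card_filter _ (Finset.filter _ _)]
    push_cast
    rw [← Finset.sum_sub_distrib]
    refine Finset.sum_congr rfl fun P _ => ?_
    rcases lt_or_gt_of_ne ((_root_.map_ne_zero P).2 l.ne_zero) with h | h
    · simp [h, sign_neg h, h.not_gt]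
    · simp [h, sign_pos h, h.not_gt]
  rw [h5, h4]

  omega

end TraceSignature

end QF

namespace QF

open IsDedekindDomain NumberField WithZero
open scoped Pointwise Classical nonZeroDivisors

open LinearMap (BilinForm)
open Module (finrank Basis)

section Parity

variable {k : Type*} [Field k] [CharZero k]

/-- dimension parity of a Witt class -/
noncomputable def par : W k →+ ZMod 2 :=
  W.lift (fun _ => 1) (fun _ => by decide) (by
    intro m hm
    obtain ⟨L, hL⟩ := hm
    have h1 := hL.two_mul_finrank (isDiag_dg m).ip
    rw [(isDiag_dg m).finrank_eq] at h1
    simp only [Multiset.map_const', Multiset.sum_replicate, nsmul_eq_mul, mul_one]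
    rw [← h1, Nat.cast_mul, show ((2 : ℕ) : ZMod 2) = 0 from rfl, zero_mul])

@[simp] lemma par_ang (a : kˣ) : par (ang a) = 1 := W.lift_ang _ _ _ _

lemma par_mk (m : Multiset kˣ) : par (W.mk m) = m.card := by
  rw [W.mk_eq_sum, map_multiset_sum, Multiset.map_map]
  simp

lemma intCast_sgn (v : k →+* ℝ) (w : W k) : ((sgn v w : ℤ) : ZMod 2) = par w := by
  suffices (Int.castAddHom (ZMod 2)).comp (sgn v) = par from DFunLike.congr_fun this w
  refine W.hom_ext fun a => ?_
  rw [AddMonoidHom.comp_apply, par_ang]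
  rcases lt_or_gt_of_ne ((_root_.map_ne_zero v).2 a.ne_zero) with h | h
  · rw [sgn_ang_neg v h]; decide
  · rw [sgn_ang_pos v h]; decide

lemma par_cl {V : Type*} [AddCommGroup V] [Module k V] [FiniteDimensional k V] {B : BilinForm k V}
    (h : IP B) : par (cl B) = finrank k V := by
  obtain ⟨m, hm⟩ := h.exists_isDiag
  rw [hm.cl_eq, par_mk, hm.finrank_eq]

end Parity

section Hyp

variable {F : Type*} [Field F] [CharZero F]

/-- the unit two -/
noncomputable def two' : Fˣ := Units.mk0 2 two_ne_zero

@[simp] lemma two'_val : ((two' : Fˣ) : F) = 2 := rfl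

/-- multiplication by the scaled Pfister form -/
noncomputable def hh (d : Fˣ) : W F →+ W F := scale two' + scale (-(two' * d))

lemma hh_ang (d a : Fˣ) : hh d (ang a) = ang (two' * a) + ang (-(two' * d) * a) := by
  simp [hh]

lemma ang_congr {a b : Fˣ} (u : Fˣ) (h : (a : F) = b * (u : F) ^ 2) : ang a = ang b := by
  rw [← ang_mul_sq b u]
  congr 1
  exact Units.ext (by simpa using h)

lemma hh_ang_norm (d a a' : Fˣ) (x y : F) (h : (a' : F) = a * (x ^ 2 - d * y ^ 2)) :
    hh d (ang a') = hh d (ang a) := by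
  rw [hh_ang, hh_ang]
  by_cases hy : y = 0
  · have hx : x ≠ 0 := by
      rintro rfl
      exact a'.ne_zero (by rw [h, hy]; ring)
    rw [ang_congr (a := two' * a') (b := two' * a) (Units.mk0 x hx) (by simp [h, hy]; ring),
      ang_congr (a := -(two' * d) * a') (b := -(two' * d) * a) (Units.mk0 x hx) (by simp [h, hy]; ring)]
  by_cases hx : x = 0
  · rw [ang_congr (a := two' * a') (b := -(two' * d) * a) (Units.mk0 y hy) (by simp [h, hx]; ring),
      ang_congr (a := -(two' * d) * a') (b := two' * a) (d * Units.mk0 y hy) (by simp [h, hx]; ring),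
      add_comm]
  have h1 := ang_add_ang (two' * a * Units.mk0 x hx ^ 2) (-(two' * d) * a * Units.mk0 y hy ^ 2)
    (two' * a') (by simp [h]; ring)
  rw [ang_mul_sq, ang_mul_sq] at h1
  rw [h1]
  congr 1
  exact (ang_congr (two' * a * Units.mk0 x hx * Units.mk0 y hy) (by simp; ring)).symm

lemma hh_three (d l₁ l₂ l₃ : Fˣ) (x₁ x₂ y₁ y₂ : F)
    (h : -(l₃ : F) = l₁ * (x₁ ^ 2 - d * x₂ ^ 2) + l₂ * (y₁ ^ 2 - d * y₂ ^ 2)) :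
    hh d (ang l₁ + ang l₂ + ang l₃) = hh d (ang (-(l₁ * l₂ * l₃))) := by
  by_cases h1 : x₁ ^ 2 - d * x₂ ^ 2 = 0
  · have e1 := hh_ang_norm d l₂ (-l₃) y₁ y₂ (by rw [Units.val_neg, h, h1]; ring)
    have e2 := hh_ang_norm d l₁ (-(l₁ * l₂ * l₃)) (l₂ * y₁) (l₂ * y₂) (by
      simp only [Units.val_neg, Units.val_mul]
      have : (l₃ : F) = - (l₂ * (y₁ ^ 2 - d * y₂ ^ 2)) := by
        rw [← neg_neg (l₃ : F), h, h1]; ring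
      rw [this]; ring)
    rw [e2, map_add, map_add, ← e1, ang_neg, map_neg]; abel
  by_cases h2 : y₁ ^ 2 - d * y₂ ^ 2 = 0
  · have e1 := hh_ang_norm d l₁ (-l₃) x₁ x₂ (by rw [Units.val_neg, h, h2]; ring)
    have e2 := hh_ang_norm d l₂ (-(l₁ * l₂ * l₃)) (l₁ * x₁) (l₁ * x₂) (by
      simp only [Units.val_neg, Units.val_mul]
      have : (l₃ : F) = - (l₁ * (x₁ ^ 2 - d * x₂ ^ 2)) := by
        rw [← neg_neg (l₃ : F), h, h2]; ring
      rw [this]; ring)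
    rw [e2, map_add, map_add, ← e1, ang_neg, map_neg]; abel
  have e1 := hh_ang_norm d l₁ (l₁ * Units.mk0 _ h1) x₁ x₂ (by simp)
  have e2 := hh_ang_norm d l₂ (l₂ * Units.mk0 _ h2) y₁ y₂ (by simp)
  have e3 := ang_add_ang (l₁ * Units.mk0 _ h1) (l₂ * Units.mk0 _ h2) (-l₃) (by simp [h])
  have e4 : hh d (ang (l₁ * Units.mk0 _ h1 * (l₂ * Units.mk0 _ h2) * -l₃)) =
      hh d (ang (-(l₁ * l₂ * l₃))) := by
    refine hh_ang_norm d _ _ (x₁ * y₁ + d * x₂ * y₂) (x₁ * y₂ + x₂ * y₁) ?_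
    simp only [Units.val_neg, Units.val_mul, Units.val_mk0]
    ring
  rw [map_add, map_add, ← e1, ← e2, ← map_add, e3, map_add, e4, ang_neg, map_neg]; abel

lemma sgn_hh_neg (P : F →+* ℝ) (d : Fˣ) (hd : P d < 0) (w : W F) : sgn P (hh d w) = 2 * sgn P w := by
  suffices (sgn P).comp (hh d) = (2 : ℤ) • sgn P by
    have := DFunLike.congr_fun this w
    simpa using this
  refine W.hom_ext fun a => ?_
  rw [AddMonoidHom.comp_apply, hh_ang, map_add, AddMonoidHom.smul_apply]
  rcases lt_or_gt_of_ne ((_root_.map_ne_zero P).2 a.ne_zero) with h | h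
  · rw [sgn_ang_neg P h, sgn_ang_neg, sgn_ang_neg]
    · rfl
    · simp only [Units.val_mul, Units.val_neg, two'_val, map_mul, map_neg, map_ofNat]
      nlinarith [mul_pos_of_neg_of_neg hd h]
    · simp only [Units.val_mul, two'_val, map_mul, map_ofNat]; linarith
  · rw [sgn_ang_pos P h, sgn_ang_pos, sgn_ang_pos]
    · rfl
    · simp only [Units.val_mul, Units.val_neg, two'_val, map_mul, map_neg, map_ofNat]
      nlinarith [mul_neg_of_neg_of_pos hd h]
    · simp only [Units.val_mul, two'_val, map_mul, map_ofNat]; linarith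

lemma sgn_hh_pos (P : F →+* ℝ) (d : Fˣ) (hd : 0 < P d) (w : W F) : sgn P (hh d w) = 0 := by
  suffices (sgn P).comp (hh d) = 0 from DFunLike.congr_fun this w
  refine W.hom_ext fun a => ?_
  rw [AddMonoidHom.comp_apply, hh_ang, map_add, AddMonoidHom.zero_apply]
  rcases lt_or_gt_of_ne ((_root_.map_ne_zero P).2 a.ne_zero) with h | h
  · rw [sgn_ang_neg, sgn_ang_pos]
    · rfl
    · simp only [Units.val_mul, Units.val_neg, two'_val, map_mul, map_neg, map_ofNat]
      nlinarith [mul_neg_of_pos_of_neg hd h]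
    · simp only [Units.val_mul, two'_val, map_mul, map_ofNat]; linarith
  · rw [sgn_ang_pos, sgn_ang_neg]
    · rfl
    · simp only [Units.val_mul, Units.val_neg, two'_val, map_mul, map_neg, map_ofNat]
      nlinarith [mul_pos hd h]
    · simp only [Units.val_mul, two'_val, map_mul, map_ofNat]; linarith

end Hyp

section Reduction

variable {F : Type*} [Field F] [NumberField F]

lemma exists_real_approx (t : (F →+* ℝ) → ℝ) {ε : ℝ} (hε : 0 < ε) :
    ∃ x : F, ∀ φ : F →+* ℝ, |φ x - t φ| < ε := by
  have hq : ∀ φ, ∃ q : ℚ, |(q : ℝ) - t φ| < ε / 2 := by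
    intro φ
    obtain ⟨q, h1, h2⟩ := exists_rat_btwn (show t φ - ε / 2 < t φ + ε / 2 by linarith)
    exact ⟨q, by rw [abs_lt]; constructor <;> linarith⟩
  choose q hq using hq
  obtain ⟨x, -, hx⟩ := weak_approx (F := F) ∅ (fun _ => 0) (fun _ => 1) (fun _ => one_ne_zero)
    (fun φ => (q φ : F)) (half_pos hε)
  refine ⟨x, fun φ => ?_⟩
  have h1 := hx φ
  rw [map_sub, map_ratCast] at h1
  calc |φ x - t φ| = |(φ x - q φ) + (q φ - t φ)| := by ring_nf
    _ ≤ _ := abs_add_le _ _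
    _ < ε := by linarith [hq φ]

/-- exchange making one entry have the opposite sign to `c` wherever possible -/
lemma exists_acc (c : Fˣ) (M : Multiset Fˣ) (hM : M ≠ 0) :
    ∃ (μ : Fˣ) (M' : Multiset Fˣ), W.mk M = ang μ + W.mk M' ∧ M'.card + 1 = M.card ∧
      ∀ P : F →+* ℝ, (∃ l ∈ M, P l * P c < 0) → P μ * P c < 0 := by
  induction M using Multiset.induction with
  | empty => exact absurd rfl hM
  | cons l M ih =>
    have hmk : W.mk (l ::ₘ M) = ang l + W.mk M := by
      rw [← Multiset.singleton_add, map_add]; rfl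
    by_cases hM0 : M = 0
    · subst hM0
      exact ⟨l, 0, hmk, by simp, fun P ⟨x, hx, h⟩ => by simpa using (Multiset.mem_singleton.1 hx) ▸ h⟩
    obtain ⟨μ, M', h1, h2, h3⟩ := ih hM0
    by_cases hneg : ∃ P : F →+* ℝ, P l * P c < 0
    swap
    · push Not at hneg
      refine ⟨μ, l ::ₘ M', ?_, by simp [h2], fun P ⟨x, hx, h⟩ => ?_⟩
      · rw [hmk, h1, ← Multiset.singleton_add, map_add, ang, ang]; abel
      · rcases Multiset.mem_cons.1 hx with rfl | hx
        · exact absurd h (hneg P).not_gt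
        · exact h3 P ⟨x, hx, h⟩
    obtain ⟨R, hR1, hR2, hR3⟩ : ∃ R : ℝ, 1 < R ∧ (∀ P : F →+* ℝ, |P μ| < R ^ 2 * |P l|) ∧
        ∀ P : F →+* ℝ, |P l| < R ^ 2 * |P μ| := by
      let S : ℝ := ∑ P : F →+* ℝ, (|P μ| / |P l| + |P l| / |P μ|)
      have hS : ∀ P : F →+* ℝ, |P μ| / |P l| + |P l| / |P μ| ≤ S := fun P =>
        Finset.single_le_sum (f := fun P : F →+* ℝ => |P μ| / |P l| + |P l| / |P μ|)
          (fun _ _ => by positivity) (Finset.mem_univ P)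
      have hS0 : 0 ≤ S := Finset.sum_nonneg fun _ _ => by positivity
      have hl : ∀ P : F →+* ℝ, 0 < |P l| := fun P => abs_pos.2 ((_root_.map_ne_zero P).2 l.ne_zero)
      have hμ : ∀ P : F →+* ℝ, 0 < |P μ| := fun P => abs_pos.2 ((_root_.map_ne_zero P).2 μ.ne_zero)
      refine ⟨S + 2, by linarith, fun P => ?_, fun P => ?_⟩
      · rw [← div_lt_iff₀ (hl P)]
        have : 0 ≤ |P l| / |P μ| := by positivity
        nlinarith [hS P]
      · rw [← div_lt_iff₀ (hμ P)]
        have : 0 ≤ |P μ| / |P l| := by positivity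
        nlinarith [hS P]
    have hR0 : 0 < R := by linarith
    obtain ⟨x, hx⟩ := exists_real_approx (F := F) (fun P => if P l * P c < 0 then R + 1 else 0)
      (inv_pos.2 hR0)
    have hRi : R⁻¹ < 1 := inv_lt_one_of_one_lt₀ hR1
    have hbig : ∀ P : F →+* ℝ, P l * P c < 0 → |P μ| < |P l| * P x ^ 2 := by
      intro P hP
      have := hx P
      rw [if_pos hP, abs_lt] at this
      have h5 : R < P x := by linarith
      have := hR2 P
      have h6 : R ^ 2 ≤ P x ^ 2 := pow_le_pow_left₀ hR0.le h5.le 2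
      nlinarith [abs_nonneg (P l)]
    have hsmall : ∀ P : F →+* ℝ, ¬ P l * P c < 0 → |P l| * P x ^ 2 < |P μ| := by
      intro P hP
      have := hx P
      rw [if_neg hP, sub_zero] at this
      have h6 : P x ^ 2 ≤ R⁻¹ ^ 2 := by
        rw [← sq_abs]; exact pow_le_pow_left₀ (abs_nonneg _) this.le 2
      have h7 : |P l| * R⁻¹ ^ 2 < |P μ| := by
        rw [inv_pow, ← div_eq_mul_inv, div_lt_iff₀ (by positivity), mul_comm]; exact hR3 P
      nlinarith [abs_nonneg (P l)]
    have hc0 : ∀ P : F →+* ℝ, P c ≠ 0 := fun P => (_root_.map_ne_zero P).2 c.ne_zero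
    have hsign : ∀ P : F →+* ℝ, (P l * P c < 0 ∨ P μ * P c < 0) → (P l * P x ^ 2 + P μ) * P c < 0 := by
      intro P h
      by_cases hP : P l * P c < 0
      · have h8 := mul_lt_mul_of_pos_right (hbig P hP) (abs_pos.2 (hc0 P))
        rw [← abs_mul, mul_right_comm, ← abs_mul, abs_of_neg hP] at h8
        have := le_abs_self (P μ * P c)
        nlinarith
      · have hμ := h.resolve_left hP
        have h8 := mul_lt_mul_of_pos_right (hsmall P hP) (abs_pos.2 (hc0 P))
        rw [← abs_mul, mul_right_comm, ← abs_mul, abs_of_neg hμ] at h8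
        have := mul_le_mul_of_nonneg_right (le_abs_self (P l * P c)) (sq_nonneg (P x))
        nlinarith
    obtain ⟨P0, hP0⟩ := hneg
    have hx0 : x ≠ 0 := by
      rintro rfl
      have := hbig P0 hP0
      simp at this
      linarith [abs_nonneg (P0 μ)]
    have hs0 : (l : F) * x ^ 2 + μ ≠ 0 := by
      intro h0
      have h9 := hsign P0 (Or.inl hP0)
      rw [← map_pow, ← map_mul, ← map_add, h0] at h9
      simp at h9
    have hR2 := ang_add_ang (l * Units.mk0 x hx0 ^ 2) μ (Units.mk0 _ hs0) (by simp)
    rw [ang_mul_sq] at hR2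
    refine ⟨Units.mk0 _ hs0, (l * Units.mk0 x hx0 ^ 2 * μ * Units.mk0 _ hs0) ::ₘ M', ?_, by simp [h2], ?_⟩
    · rw [hmk, h1, ← add_assoc, hR2, ← Multiset.singleton_add, map_add, add_assoc]; rfl
    · rintro P ⟨y, hy, h⟩
      rw [Units.val_mk0, map_add, map_mul, map_pow]
      apply hsign
      rcases Multiset.mem_cons.1 hy with rfl | hy
      · exact Or.inl h
      · exact Or.inr (h3 P ⟨y, hy, h⟩)

lemma abs_sgn_mk_of_definite (P : F →+* ℝ) (M : Multiset Fˣ) (c : Fˣ) (h : ∀ l ∈ M, 0 ≤ P l * P c) :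
    |sgn P (W.mk M)| = M.card := by
  have hc0 : P c ≠ 0 := (_root_.map_ne_zero P).2 c.ne_zero
  have : sgn P (W.mk M) = M.card * sgn P (ang c) := by
    rw [W.mk_eq_sum, map_multiset_sum, Multiset.map_map]
    rw [Multiset.map_congr rfl (g := fun _ => sgn P (ang c))]
    · simp
    · intro l hl
      have h1 := h l hl
      have hl0 : P l ≠ 0 := (_root_.map_ne_zero P).2 l.ne_zero
      rw [Function.comp_apply]
      rcases lt_or_gt_of_ne hc0 with h2 | h2
      · have : P l < 0 := lt_of_le_of_ne (by nlinarith) hl0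
        rw [sgn_ang_neg P this, sgn_ang_neg P h2]
      · have : 0 < P l := lt_of_le_of_ne (by nlinarith) hl0.symm
        rw [sgn_ang_pos P this, sgn_ang_pos P h2]
  rw [this, abs_mul]
  rcases lt_or_gt_of_ne hc0 with h2 | h2
  · rw [sgn_ang_neg P h2]; simp
  · rw [sgn_ang_pos P h2]; simp

lemma exists_shorter {d : Fˣ} (hd : ¬ IsSquare (d : F)) (M : Multiset Fˣ) (h3 : 3 ≤ M.card)
    (hs : ∀ P : F →+* ℝ, P d < 0 → |sgn P (W.mk M)| < M.card) :
    ∃ M' : Multiset Fˣ, M'.card + 2 = M.card ∧ hh d (W.mk M') = hh d (W.mk M) := by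
  obtain ⟨c, hc⟩ := Multiset.card_pos_iff_exists_mem.1 (by omega : 0 < M.card)
  obtain ⟨M0, rfl⟩ := Multiset.exists_cons_of_mem hc
  rw [Multiset.card_cons] at h3
  obtain ⟨μ, M1, h1, h2, h4⟩ := exists_acc c M0 (by rintro rfl; simp at h3)
  obtain ⟨l, hl⟩ := Multiset.card_pos_iff_exists_mem.1 (by omega : 0 < M1.card)
  obtain ⟨M2, rfl⟩ := Multiset.exists_cons_of_mem hl
  have hopp : ∀ P : F →+* ℝ, P d < 0 → P μ * P c < 0 := by
    intro P hP
    apply h4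
    by_contra hno
    push Not at hno
    have := abs_sgn_mk_of_definite P (c ::ₘ M0) c (by
      intro l hl
      rcases Multiset.mem_cons.1 hl with rfl | hl
      · exact mul_self_nonneg _
      · exact hno l hl)
    exact absurd (hs P hP) (by rw [this]; exact lt_irrefl _)
  obtain ⟨x1, x2, y1, y2, hq⟩ := exists_quaternion_norm (d := d) (b := -c / μ) (c := -l / μ) hd (by
    intro P hP hb
    exfalso
    have := hopp P hP
    rw [Units.val_div_eq_div_val, Units.val_neg, map_div₀, map_neg, neg_div, neg_lt_zero] at hb
    have h5 : P c / P μ * P μ ^ 2 = P μ * P c := by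
      field_simp [(_root_.map_ne_zero P).2 μ.ne_zero]
    have h6 : 0 < P μ ^ 2 := by have := (_root_.map_ne_zero P).2 μ.ne_zero; positivity
    nlinarith [mul_pos hb h6])
  have h5 := hh_three d μ c l x1 x2 y1 y2 (by
    simp only [Units.val_div_eq_div_val, Units.val_neg] at hq
    have := μ.ne_zero
    field_simp at hq
    linear_combination hq)
  have hcons : ∀ (a : Fˣ) (m : Multiset Fˣ), W.mk (a ::ₘ m) = ang a + W.mk m := fun a m => by
    rw [← Multiset.singleton_add, map_add]; rfl
  refine ⟨(-(μ * c * l)) ::ₘ M2, ?_, ?_⟩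
  · simp only [Multiset.card_cons] at h2 ⊢; omega
  · rw [hcons, hcons, h1, hcons, map_add, ← h5, ← map_add]
    congr 1; abel

/-- size normalisation -/
theorem exists_card_eq {d : Fˣ} (hd : ¬ IsSquare (d : F)) {n : ℕ} (hn : 1 ≤ n) (w : W F)
    (hpar : par w = n) (hs : ∀ P : F →+* ℝ, P d < 0 → |sgn P w| ≤ n) :
    ∃ M : Multiset Fˣ, M.card = n ∧ hh d (W.mk M) = hh d w := by
  have hsg : ∀ {w w' : W F}, hh d w = hh d w' → ∀ P : F →+* ℝ, P d < 0 → sgn P w = sgn P w' := by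
    intro w w' h P hP
    have h1 := sgn_hh_neg P d hP w
    have h2 := sgn_hh_neg P d hP w'
    rw [h] at h1
    omega
  have hpar' : ∀ m : ℕ, (m : ZMod 2) = n → m % 2 = n % 2 := fun m hm =>
    (ZMod.natCast_eq_natCast_iff' _ _ _).1 hm
  have step : ∀ N (M : Multiset Fˣ), M.card = N → N % 2 = n % 2 → hh d (W.mk M) = hh d w →
      n ≤ N → ∃ M : Multiset Fˣ, M.card = n ∧ hh d (W.mk M) = hh d w := by
    intro N
    induction N using Nat.strong_induction_on with
    | _ N ih =>
      intro M hM hN hw hle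
      by_cases heq : N = n
      · exact ⟨M, hM.trans heq, hw⟩
      obtain ⟨M', h1, h2⟩ := exists_shorter hd M (by omega) (fun P hP => by
        rw [hsg hw P hP, hM]
        exact lt_of_le_of_lt (hs P hP) (by exact_mod_cast lt_of_le_of_ne hle (Ne.symm heq)))
      exact ih (N - 2) (by omega) M' (by omega) (by omega) (h2.trans hw) (by omega)
  obtain ⟨M, rfl⟩ := W.mk_surjective w
  rw [par_mk] at hpar
  let M' := M + n • {1, -1}
  have hM' : W.mk M' = W.mk M := by
    have : W.mk ({1, -1} : Multiset Fˣ) = 0 := by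
      rw [W.mk_eq_sum]
      simp [ang_neg]
    rw [map_add, map_nsmul, this, smul_zero, add_zero]
  have hc : M'.card = M.card + n * 2 := by simp [M']
  refine step M'.card M' rfl ?_ (by rw [hM']) (by omega)
  have := hpar' _ hpar
  omega

end Reduction

end QF

namespace QF

open IsDedekindDomain NumberField WithZero
open scoped Pointwise Classical nonZeroDivisors

open LinearMap (BilinForm)
open Module (finrank Basis)

/-- trace transfer -/
noncomputable def trT (k F : Type*) [Field k] [CharZero k] [Field F] [CharZero F] [Algebra k F]
    [FiniteDimensional k F] : W F →+ W k :=
  transfer (Algebra.trace k F) (Algebra.trace_ne_zero k F)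

section Moves

variable {k F L : Type*} [Field k] [CharZero k] [Field F] [CharZero F] [Algebra k F]
  [FiniteDimensional k F] [Field L] [CharZero L]
  [Algebra k L] [Algebra F L] [IsScalarTower k F L] [FiniteDimensional k L] [FiniteDimensional F L]

/-- image of a unit in an extension -/
def up (L : Type*) [Field L] [Algebra F L] (d : Fˣ) : Lˣ := Units.map (algebraMap F L).toMonoidHom d

@[simp] lemma up_val (d : Fˣ) : ((up L d : Lˣ) : L) = algebraMap F L d := rfl

lemma up_neg_two_mul (d : Fˣ) : up L (-(two' * d)) = -(two' * up L d) := by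
  ext; simp; exact map_ofNat _ 2

lemma up_two : up L (two' : Fˣ) = two' := by
  ext; simp; exact map_ofNat _ 2

lemma trT_trT (w : W L) : trT k F (trT F L w) = trT k L w :=
  transfer_transfer _ _ _ (fun x => (Algebra.trace_trace x).symm) w

lemma trT_hh_trT (d : Fˣ) (w : W L) : trT k F (hh d (trT F L w)) = trT k L (hh (up L d) w) := by
  have h : ∀ c : Fˣ, scale c (trT F L w) = trT F L (scale (up L c) w) := fun c =>
    (transfer_scale _ c w).symm
  rw [hh, hh, AddMonoidHom.add_apply, AddMonoidHom.add_apply, h, h, ← map_add, trT_trT,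
    up_neg_two_mul, up_two]

lemma par_trT (w : W F) : par (trT k F w) = finrank k F * par w := by
  suffices par.comp (trT k F) = (finrank k F) • par by
    rw [← AddMonoidHom.comp_apply, this]; simp
  refine W.hom_ext fun a => ?_
  rw [AddMonoidHom.comp_apply, trT, transfer_ang,
    par_cl ((ip_oned a).resf (Algebra.trace_ne_zero k F))]
  simp

lemma hh_swap (d e β t : Lˣ) (hβ : (β : L) = 1 - d * e * t ^ 2) :
    hh d (ang 1 + ang (-β)) = hh e (ang 1 + ang (-β)) := by
  rw [hh, hh, AddMonoidHom.add_apply, AddMonoidHom.add_apply, map_add (scale (-(two' * d))),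
    map_add (scale (-(two' * e)))]
  simp only [scale_ang, mul_one]
  congr 1
  have h := ang_add_ang (-(two' * d)) (-(two' * d) * -β) (-(two' * e) * (d * t) ^ 2)
    (by simp [hβ]; ring)
  rw [h, ang_mul_sq]
  congr 1
  refine ang_congr (two' * d * d * t) ?_
  simp; ring

lemma exists_pfister [NumberField L] (j : L →+* ℝ) (d e : Lˣ) (hd : j d < 0) (he : j e < 0) :
    ∃ β t : Lˣ, (β : L) = 1 - d * e * t ^ 2 ∧ j β < 0 ∧ ∀ ψ : L →+* ℝ, ψ ≠ j → 0 < ψ β := by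
  obtain ⟨R, hR1, hR2, hR3⟩ : ∃ R : ℝ, 1 < R ∧ (∀ P : L →+* ℝ, |P (d * e)| < R ^ 2) ∧
      1 < R ^ 2 * |j (d * e)| := by
    let S : ℝ := ∑ P : L →+* ℝ, |P (d * e)|
    have hS : ∀ P : L →+* ℝ, |P (d * e)| ≤ S := fun P =>
      Finset.single_le_sum (f := fun P : L →+* ℝ => |P (d * e)|)
        (fun _ _ => by positivity) (Finset.mem_univ P)
    have hS0 : 0 ≤ S := Finset.sum_nonneg fun _ _ => by positivity
    have h0 : 0 < |j (d * e)| := abs_pos.2 ((_root_.map_ne_zero j).2 (mul_ne_zero d.ne_zero e.ne_zero))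
    have h1 : 0 ≤ 1 / |j (d * e)| := by positivity
    refine ⟨S + 1 / |j (d * e)| + 2, by linarith, fun P => ?_, ?_⟩
    · nlinarith [hS P]
    · rw [← div_lt_iff₀ h0]
      nlinarith
  have hR0 : 0 < R := by linarith
  have hRi : R⁻¹ < 1 := inv_lt_one_of_one_lt₀ hR1
  obtain ⟨x, hx⟩ := exists_real_approx (F := L) (fun P => if P = j then R + 1 else 0)
    (inv_pos.2 hR0)
  have hj := hx j
  rw [if_pos rfl, abs_lt] at hj
  have hjx : R < j x := by linarith
  have hx0 : x ≠ 0 := by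
    rintro rfl
    rw [map_zero] at hjx
    linarith
  have hβj : j (1 - d * e * x ^ 2) < 0 := by
    rw [map_sub, map_one, map_mul j ((d : L) * (e : L)), map_pow]
    have h1 : 0 < j (d * e) := by rw [map_mul]; exact mul_pos_of_neg_of_neg hd he
    rw [abs_of_pos h1] at hR3
    have h6 : R ^ 2 ≤ j x ^ 2 := pow_le_pow_left₀ hR0.le hjx.le 2
    nlinarith
  have hβ0 : (1 - d * e * x ^ 2 : L) ≠ 0 := by
    intro h
    rw [h, map_zero] at hβj
    exact lt_irrefl _ hβj
  refine ⟨Units.mk0 _ hβ0, Units.mk0 x hx0, rfl, hβj, fun ψ hψ => ?_⟩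
  have h1 := hx ψ
  rw [if_neg hψ, sub_zero] at h1
  have h6 : ψ x ^ 2 ≤ R⁻¹ ^ 2 := by
    rw [← sq_abs]; exact pow_le_pow_left₀ (abs_nonneg _) h1.le 2
  have h7 : |ψ (d * e)| * R⁻¹ ^ 2 < 1 := by
    rw [inv_pow, ← div_eq_mul_inv, div_lt_iff₀ (by positivity), one_mul]; exact hR2 ψ
  rw [Units.val_mk0, map_sub, map_one, map_mul ψ ((d : L) * (e : L)), map_pow]
  have h8 := le_abs_self (ψ (d * e))
  nlinarith [abs_nonneg (ψ (d * e)), sq_nonneg (ψ x)]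

lemma sgn_trT_pfister [NumberField F] [NumberField L] (j : L →+* ℝ) (β : Lˣ) (h1 : j β < 0)
    (h2 : ∀ ψ : L →+* ℝ, ψ ≠ j → 0 < ψ β) (P : F →+* ℝ) :
    sgn P (trT F L (ang 1 + ang (-β))) = if P = j.comp (algebraMap F L) then 2 else 0 := by
  have hψ : ∀ ψ : L →+* ℝ, sgn ψ (ang 1 + ang (-β)) = if ψ = j then 2 else 0 := by
    intro ψ
    rw [map_add, sgn_ang_pos ψ (by simp)]
    split_ifs with h
    · subst h
      rw [sgn_ang_pos ψ (by simpa using h1)]; rfl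
    · rw [sgn_ang_neg ψ (by simpa using h2 ψ h)]; rfl
  rw [trT, sgn_transfer_trace]
  simp only [hψ]
  rw [Finset.sum_ite_eq']
  simp [eq_comm]

end Moves

section Compositum

variable {K F₁ F₂ : Type*} [Field K] [NumberField K] [Field F₁] [NumberField F₁] [Field F₂]
  [NumberField F₂] [Algebra K F₁] [Algebra K F₂] [FiniteDimensional K F₁] [FiniteDimensional K F₂]

lemma exists_move_of_compositum {L : Type*} [Field L] [NumberField L] [Algebra K L] [Algebra F₁ L]
    [Algebra F₂ L] [IsScalarTower K F₁ L] [IsScalarTower K F₂ L] [FiniteDimensional K L]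
    (j : L →+* ℝ) (d : F₁ˣ) (e : F₂ˣ) (hd : j (algebraMap F₁ L d) < 0)
    (he : j (algebraMap F₂ L e) < 0) :
    ∃ (Y : W F₁) (Z : W F₂), par Y = 0 ∧ par Z = 0 ∧
      (∀ P, sgn P Y = if P = j.comp (algebraMap F₁ L) then 2 else 0) ∧
      (∀ P, sgn P Z = if P = j.comp (algebraMap F₂ L) then 2 else 0) ∧
      trT K F₁ (hh d Y) = trT K F₂ (hh e Z) := by
  have : FiniteDimensional F₁ L := FiniteDimensional.right K F₁ L
  have : FiniteDimensional F₂ L := FiniteDimensional.right K F₂ L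
  obtain ⟨β, t, hβ, h1, h2⟩ := exists_pfister j (up L d) (up L e) hd he
  refine ⟨trT F₁ L (ang 1 + ang (-β)), trT F₂ L (ang 1 + ang (-β)), ?_, ?_,
    sgn_trT_pfister j β h1 h2, sgn_trT_pfister j β h1 h2, ?_⟩
  · rw [par_trT, map_add, par_ang, par_ang, show (1 + 1 : ZMod 2) = 0 from rfl, mul_zero]
  · rw [par_trT, map_add, par_ang, par_ang, show (1 + 1 : ZMod 2) = 0 from rfl, mul_zero]
  · rw [trT_hh_trT, trT_hh_trT, hh_swap _ _ β t hβ]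

lemma exists_move (P : F₁ →+* ℝ) (Q : F₂ →+* ℝ)
    (hPQ : P.comp (algebraMap K F₁) = Q.comp (algebraMap K F₂)) (d : F₁ˣ) (e : F₂ˣ) (hd : P d < 0)
    (he : Q e < 0) :
    ∃ (Y : W F₁) (Z : W F₂), par Y = 0 ∧ par Z = 0 ∧
      (∀ P', sgn P' Y = if P' = P then 2 else 0) ∧
      (∀ P', sgn P' Z = if P' = Q then 2 else 0) ∧
      trT K F₁ (hh d Y) = trT K F₂ (hh e Z) := by
  let _ : Algebra K ℝ := (P.comp (algebraMap K F₁)).toAlgebra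
  let P' : F₁ →ₐ[K] ℝ := { P with commutes' := fun c => rfl }
  let Q' : F₂ →ₐ[K] ℝ := { Q with commutes' := fun c => (DFunLike.congr_fun hPQ c).symm }
  let L : IntermediateField K ℝ := P'.fieldRange ⊔ Q'.fieldRange
  have f1 : FiniteDimensional K P'.fieldRange :=
    (LinearEquiv.ofInjective P'.toLinearMap P'.injective).finiteDimensional
  have f2 : FiniteDimensional K Q'.fieldRange :=
    (LinearEquiv.ofInjective Q'.toLinearMap Q'.injective).finiteDimensional
  have f3 : FiniteDimensional K L := IntermediateField.finiteDimensional_sup _ _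
  have f4 : NumberField L := NumberField.of_module_finite K L
  let a1 : F₁ →+* L := P.codRestrict L fun x => (le_sup_left : P'.fieldRange ≤ L) ⟨x, rfl⟩
  let a2 : F₂ →+* L := Q.codRestrict L fun x => (le_sup_right : Q'.fieldRange ≤ L) ⟨x, rfl⟩
  let _ : Algebra F₁ L := a1.toAlgebra
  let _ : Algebra F₂ L := a2.toAlgebra
  have t1 : IsScalarTower K F₁ L := IsScalarTower.of_algebraMap_eq fun c => rfl
  have t2 : IsScalarTower K F₂ L := IsScalarTower.of_algebraMap_eq fun c =>
    Subtype.ext (DFunLike.congr_fun hPQ c)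
  exact exists_move_of_compositum (K := K) (L := L) (algebraMap L ℝ) d e hd he

end Compositum

/-- balancing of integers by moves of size two within classes -/
lemma exists_balanced {X Y : Type*} [Fintype X] (p : X → Y) (n : X → ℕ) (S : (X → ℤ) → Prop)
    (hpar : ∀ s, S s → ∀ x, s x % 2 = n x % 2)
    (hmove : ∀ s, S s → ∀ x y, x ≠ y → p x = p y →
      S fun z => s z - (if z = x then 2 else 0) + (if z = y then 2 else 0))
    (hbound : ∀ s, S s → ∀ y, |∑ x ∈ Finset.univ.filter fun x => p x = y, s x| ≤
      ∑ x ∈ Finset.univ.filter fun x => p x = y, (n x : ℤ))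
    {s : X → ℤ} (hs : S s) : ∃ s, S s ∧ ∀ x, |s x| ≤ n x := by
  induction hN : ∑ x, ((s x).natAbs - n x) using Nat.strong_induction_on generalizing s with
  | _ N ih =>
    by_cases hall : ∀ x, |s x| ≤ n x
    · exact ⟨s, hs, hall⟩
    push Not at hall
    obtain ⟨x, hx⟩ := hall
    have hb := abs_le.1 (hbound s hs (p x))
    have fin : ∀ a b : X, a ≠ b → p a = p b →
        ((s a - 2).natAbs - n a) + ((s b + 2).natAbs - n b) < ((s a).natAbs - n a) + ((s b).natAbs - n b) →
        ∃ s, S s ∧ ∀ x, |s x| ≤ n x := by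
      intro a b hab hp hlt
      refine ih _ ?_ (hmove s hs a b hab hp) rfl
      rw [← hN, ← Finset.add_sum_erase _ _ (Finset.mem_univ a),
        ← Finset.add_sum_erase (Finset.univ.erase a) _ (Finset.mem_erase.2 ⟨hab.symm, Finset.mem_univ b⟩),
        ← Finset.add_sum_erase _ (fun x => (s x).natAbs - n x) (Finset.mem_univ a),
        ← Finset.add_sum_erase (Finset.univ.erase a) (fun x => (s x).natAbs - n x)
          (Finset.mem_erase.2 ⟨hab.symm, Finset.mem_univ b⟩)]
      have hrest : ∑ z ∈ (Finset.univ.erase a).erase b,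
          ((s z - (if z = a then 2 else 0) + (if z = b then 2 else 0)).natAbs - n z) =
          ∑ z ∈ (Finset.univ.erase a).erase b, ((s z).natAbs - n z) := by
        refine Finset.sum_congr rfl fun z hz => ?_
        simp only [Finset.mem_erase, Finset.mem_univ, and_true] at hz
        rw [if_neg hz.2, if_neg hz.1, sub_zero, add_zero]
      rw [hrest]
      simp only [if_true, if_neg hab, if_neg hab.symm, add_zero, sub_zero]
      omega
    have hpx := hpar s hs x
    rcases lt_abs.1 hx with hpos | hneg
    · obtain ⟨y, hy, hlt⟩ : ∃ y ∈ Finset.univ.filter fun z => p z = p x, s y < n y := by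
        by_contra hno
        push Not at hno
        have := Finset.sum_lt_sum (s := Finset.univ.filter fun z => p z = p x) hno
          ⟨x, by simp, hpos⟩
        linarith
      have hpy := hpar s hs y
      refine fin x y (by rintro rfl; omega) (Finset.mem_filter.1 hy).2.symm (by omega)
    · obtain ⟨y, hy, hlt⟩ : ∃ y ∈ Finset.univ.filter fun z => p z = p x, -(n y : ℤ) < s y := by
        by_contra hno
        push Not at hno
        have := Finset.sum_lt_sum (s := Finset.univ.filter fun z => p z = p x) hno
          ⟨x, by simp, by linarith⟩
        rw [Finset.sum_neg_distrib] at this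
        linarith
      have hpy := hpar s hs y
      refine fin y x (by rintro rfl; omega) (Finset.mem_filter.1 hy).2 (by omega)

section Core

variable {K : Type*} [Field K] [NumberField K] {ι : Type*} [Fintype ι] (F : ι → Type*)
  [∀ i, Field (F i)] [∀ i, NumberField (F i)] [∀ i, Algebra K (F i)]
  [∀ i, FiniteDimensional K (F i)]

/-- number of real embeddings over `v` at which `d` is negative -/
noncomputable def rho {K F : Type*} [Field K] [Field F] [NumberField F] [Algebra K F]
    (d : Fˣ) (v : K →+* ℝ) : ℕ :=
  (Finset.univ.filter fun P : F →+* ℝ => P.comp (algebraMap K F) = v ∧ P d < 0).card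

lemma sgn_trT_hh {K F : Type*} [Field K] [NumberField K] [Field F] [NumberField F] [Algebra K F]
    [FiniteDimensional K F] (d : Fˣ) (w : W F) (v : K →+* ℝ) :
    sgn v (trT K F (hh d w)) =
      ∑ P ∈ Finset.univ.filter fun P : F →+* ℝ => P.comp (algebraMap K F) = v ∧ P d < 0, 2 * sgn P w := by
  rw [trT, sgn_transfer_trace, ← Finset.filter_filter]
  conv_rhs => rw [Finset.sum_filter]
  refine (Finset.sum_congr rfl fun P _ => ?_)
  split_ifs with h
  · exact sgn_hh_neg P d h w
  · have := (_root_.map_ne_zero P).2 d.ne_zero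
    exact sgn_hh_pos P d (lt_of_le_of_ne (not_lt.1 h) this.symm) w

theorem exists_normalized (d : ∀ i, (F i)ˣ) (hd : ∀ i, ¬ IsSquare (d i : F i)) (n : ι → ℕ)
    (hn : ∀ i, 1 ≤ n i) (w : ∀ i, W (F i)) (hpar : ∀ i, par (w i) = n i)
    (hbound : ∀ v : K →+* ℝ, |sgn v (∑ i, trT K (F i) (hh (d i) (w i)))| ≤
      ∑ i, 2 * (n i : ℤ) * rho (d i) v) :
    ∃ M : ∀ i, Multiset (F i)ˣ, (∀ i, (M i).card = n i) ∧
      ∑ i, trT K (F i) (hh (d i) (W.mk (M i))) = ∑ i, trT K (F i) (hh (d i) (w i)) := by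
  let X := Σ i, {P : F i →+* ℝ // P (d i) < 0}
  let p : X → (K →+* ℝ) := fun x => x.2.1.comp (algebraMap K (F x.1))
  let S : (X → ℤ) → Prop := fun s => ∃ w' : ∀ i, W (F i), (∀ i, par (w' i) = n i) ∧
    ∑ i, trT K (F i) (hh (d i) (w' i)) = ∑ i, trT K (F i) (hh (d i) (w i)) ∧
    ∀ x : X, s x = sgn x.2.1 (w' x.1)
  have hsum : ∀ (g : ∀ i, (F i →+* ℝ) → ℤ) (v : K →+* ℝ),
      ∑ x ∈ Finset.univ.filter fun x : X => p x = v, g x.1 x.2.1 =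
      ∑ i, ∑ P ∈ Finset.univ.filter fun P : F i →+* ℝ => P.comp (algebraMap K (F i)) = v ∧ P (d i) < 0,
        g i P := by
    intro g v
    rw [Finset.sum_filter, Fintype.sum_sigma]
    refine Finset.sum_congr rfl fun i _ => ?_
    rw [Finset.sum_filter]
    have h1 := Finset.sum_subtype (Finset.univ.filter fun P : F i →+* ℝ => P (d i) < 0) (by simp)
      (fun P => if P.comp (algebraMap K (F i)) = v then g i P else 0) (p := fun P => P (d i) < 0) (F := inferInstance)
    refine Eq.trans h1.symm ?_
    rw [Finset.sum_filter]
    refine Finset.sum_congr rfl fun P _ => ?_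
    by_cases h1 : P (d i) < 0 <;> by_cases h2 : P.comp (algebraMap K (F i)) = v <;> simp [h1, h2]
  have key := fun h₁ h₂ h₃ => exists_balanced p (fun x => n x.1) S h₁ h₂ h₃
    (s := fun x => sgn x.2.1 (w x.1)) ⟨w, hpar, rfl, fun _ => rfl⟩
  suffices ∃ s, S s ∧ ∀ x, |s x| ≤ n x.1 by
    obtain ⟨s, ⟨w', h1, h2, h3⟩, hs⟩ := this
    have := fun i => exists_card_eq (hd i) (hn i) (w' i) (h1 i) (fun P hP => by
      have := hs ⟨i, P, hP⟩
      rwa [h3] at this)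
    choose M hM1 hM2 using this
    refine ⟨M, hM1, ?_⟩
    rw [← h2]
    exact Finset.sum_congr rfl fun i _ => by rw [hM2]
  refine key ?_ ?_ ?_
  · rintro s ⟨w', h1, h2, h3⟩ x
    have := intCast_sgn x.2.1 (w' x.1)
    rw [h1, ← h3] at this
    exact (ZMod.intCast_eq_intCast_iff' _ _ 2).1 (by simpa using this)
  · rintro s ⟨w', h1, h2, h3⟩ ⟨i, P, hP⟩ ⟨j, Q, hQ⟩ hne hpe
    obtain ⟨Y, Z, hY, hZ, hY', hZ', hYZ⟩ := exists_move (K := K) P Q hpe (d i) (d j) hP hQ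
    refine ⟨w' - Pi.single i Y + Pi.single j Z, fun l => ?_, ?_, ?_⟩
    · have hz : ∀ (i : ι) (Y : W (F i)), par Y = 0 → par ((Pi.single i Y : ∀ i, W (F i)) l) = 0 := by
        intro i Y hY
        by_cases h : l = i
        · subst h; rw [Pi.single_eq_same, hY]
        · rw [Pi.single_eq_of_ne h, map_zero]
      rw [Pi.add_apply, Pi.sub_apply, map_add, map_sub, hz i Y hY, hz j Z hZ, h1, sub_zero, add_zero]
    · have hz : ∀ (i : ι) (Y : W (F i)), ∑ l, trT K (F l) (hh (d l) ((Pi.single i Y : ∀ i, W (F i)) l)) =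
          trT K (F i) (hh (d i) Y) := by
        intro i Y
        rw [Finset.sum_eq_single i]
        · rw [Pi.single_eq_same]
        · intro l _ h
          rw [Pi.single_eq_of_ne h, map_zero, map_zero]
        · simp
      simp only [Pi.add_apply, Pi.sub_apply, map_add, map_sub, Finset.sum_add_distrib,
        Finset.sum_sub_distrib]
      rw [hz, hz, hYZ, h2, sub_add_cancel]
    · rintro ⟨l, R, hR⟩
      have hz : ∀ (i : ι) (P : F i →+* ℝ) (hP : P (d i) < 0) (Y : W (F i)),
          (∀ P', sgn P' Y = if P' = P then 2 else 0) →
          sgn R ((Pi.single i Y : ∀ i, W (F i)) l) =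
            if (⟨l, R, hR⟩ : X) = ⟨i, P, hP⟩ then 2 else 0 := by
        intro i P hP Y hY
        by_cases h : l = i
        · subst h
          rw [Pi.single_eq_same, hY]
          refine if_congr ?_ rfl rfl
          simp
        · rw [Pi.single_eq_of_ne h, map_zero, if_neg]
          intro h'
          exact h (congrArg Sigma.fst h')
      simp only [Pi.add_apply, Pi.sub_apply, map_add, map_sub]
      rw [hz i P hP Y hY', hz j Q hQ Z hZ', h3]
      congr!
  · rintro s ⟨w', h1, h2, h3⟩ v
    have h4 := hbound v
    rw [← h2, map_sum] at h4
    simp only [sgn_trT_hh] at h4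
    have h5 := hsum (fun i P => sgn P (w' i)) v
    have h6 := hsum (fun i P => (n i : ℤ)) v
    simp only [h3]
    rw [h5, h6]
    simp only [← Finset.mul_sum, abs_mul, Finset.sum_const, nsmul_eq_mul] at h4 ⊢
    have h7 : ∑ i, 2 * (n i : ℤ) * rho (d i) v = 2 * ∑ i, (rho (d i) v : ℤ) * n i := by
      rw [Finset.mul_sum]
      exact Finset.sum_congr rfl fun i _ => by ring
    rw [h7, abs_of_pos (by norm_num : (0:ℤ) < 2)] at h4
    exact le_of_mul_le_mul_left h4 (by norm_num)

end Core

end QF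

namespace QF

open IsDedekindDomain NumberField WithZero
open scoped Pointwise Classical nonZeroDivisors

open LinearMap (BilinForm)
open Module (finrank Basis)

/-- a nontrivial involution of a field extension together with an anti-invariant element -/
structure Inv (K E : Type*) [Field K] [Field E] [Algebra K E] where
  σ : E ≃ₐ[K] E
  σσ : ∀ x, σ (σ x) = x
  s : E
  s_ne : s ≠ 0
  σs : σ s = -s

namespace Inv

variable {K E : Type*} [Field K] [CharZero K] [Field E] [CharZero E] [Algebra K E]
  [FiniteDimensional K E] (I : Inv K E)

/-- the fixed field of the involution -/
noncomputable def F : IntermediateField K E := IntermediateField.fixedField (Subgroup.zpowers I.σ)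

lemma mem_F {x : E} : x ∈ I.F ↔ I.σ x = x := by
  rw [F, IntermediateField.mem_fixedField_iff]
  constructor
  · intro h
    exact h _ (Subgroup.mem_zpowers _)
  · intro h f hf
    have : Subgroup.zpowers I.σ ≤ MulAction.stabilizer (E ≃ₐ[K] E) x :=
      Subgroup.zpowers_le.2 h
    exact this hf

@[simp] lemma σ_coe (c : I.F) : I.σ c = c := I.mem_F.1 c.2

lemma sq_mem : I.s ^ 2 ∈ I.F := by
  rw [mem_F, map_pow, I.σs, neg_sq]

/-- the square of the anti-invariant element -/
noncomputable def d : I.Fˣ := Units.mk0 ⟨I.s ^ 2, I.sq_mem⟩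
  (fun h => pow_ne_zero 2 I.s_ne (congrArg Subtype.val h))

@[simp] lemma coe_d : ((I.d : I.F) : E) = I.s ^ 2 := rfl

lemma ne_neg_s : I.s ≠ -I.s := by
  intro h
  exact I.s_ne (self_eq_neg.1 h)

lemma not_isSquare_d : ¬ IsSquare (I.d : I.F) := by
  rintro ⟨a, ha⟩
  have h := congrArg (Subtype.val) ha
  have h2 : I.s ^ 2 = (a : E) ^ 2 := by
    rw [← coe_d, h, sq]; rfl
  have h3 : I.σ I.s = I.s := by
    rcases sq_eq_sq_iff_eq_or_eq_neg.1 h2 with h | h <;> rw [h]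
    · simp
    · simp
  rw [I.σs] at h3
  exact I.ne_neg_s h3.symm

lemma finrank_eq : finrank I.F E = 2 := by
  rw [F, IntermediateField.finrank_fixedField_eq_card, Nat.card_zpowers]
  refine orderOf_eq_prime (AlgEquiv.ext fun x => ?_) fun h => ?_
  · rw [sq]; exact I.σσ x
  · have := I.σs
    rw [h] at this
    exact I.ne_neg_s this

/-- the trace to the fixed field -/
noncomputable def tr : E →ₗ[I.F] I.F where
  toFun x := ⟨x + I.σ x, by rw [mem_F, map_add, I.σσ, add_comm]⟩
  map_add' x y := Subtype.ext (by simp; ring)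
  map_smul' c x := Subtype.ext (by simp [IntermediateField.smul_def]; ring)

@[simp] lemma coe_tr (x : E) : (I.tr x : E) = x + I.σ x := rfl

lemma tr_σ (x : E) : I.tr (I.σ x) = I.tr x := Subtype.ext (by simp [I.σσ, add_comm])

lemma tr_coe_mul (c : I.F) (x : E) : I.tr (c * x) = c * I.tr x := by
  have := I.tr.map_smul c x
  rwa [IntermediateField.smul_def, smul_eq_mul, smul_eq_mul] at this

lemma eq_zero_of_tr {x : E} (h : ∀ y, I.tr (x * y) = 0) : x = 0 := by
  by_contra hx
  have h1 := congrArg Subtype.val (h x⁻¹)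
  rw [mul_inv_cancel₀ hx] at h1
  simp at h1

/-- the binary form `l * (x * σ y + y * σ x)` over the fixed field -/
noncomputable def herm (l : I.F) : BilinForm I.F E :=
  LinearMap.mk₂ I.F (fun x y => l * I.tr (x * I.σ y))
    (fun x x' y => by rw [add_mul, map_add, mul_add])
    (fun c x y => by
      rw [IntermediateField.smul_def, smul_eq_mul, smul_eq_mul, mul_assoc, tr_coe_mul]; ring)
    (fun x y y' => by rw [map_add, mul_add, map_add, mul_add])
    (fun c x y => by
      rw [IntermediateField.smul_def, smul_eq_mul, smul_eq_mul, map_mul I.σ, σ_coe, mul_left_comm,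
        tr_coe_mul]; ring)

lemma herm_apply (l : I.F) (x y : E) : I.herm l x y = l * I.tr (x * I.σ y) := rfl

lemma ip_herm (l : I.Fˣ) : IP (I.herm (l : I.F)) where
  symm x y := by
    rw [herm_apply, herm_apply, ← tr_σ, map_mul I.σ, I.σσ, mul_comm (I.σ x)]
  nd x hx := I.eq_zero_of_tr fun y => by
    have := hx (I.σ y)
    rw [herm_apply, I.σσ] at this
    exact (mul_eq_zero.1 this).resolve_left l.ne_zero

lemma cl_herm (l : I.Fˣ) : cl (I.herm (l : I.F)) = hh I.d (ang l) := by
  rw [hh_ang, cl_eq_of_ortho (![1, I.s] : Fin 2 → E) ![two' * l, -(two' * I.d) * l]]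
  · simp
  · intro i j
    fin_cases i <;> fin_cases j <;> simp [herm_apply] <;> refine Subtype.ext ?_ <;> simp [I.σs, show ((2 : I.F) : E) = 2 from rfl] <;> ring
  · rw [I.finrank_eq]; rfl

/-- the form over the base field -/
noncomputable def form (l : I.F) : BilinForm K E := resf (Algebra.trace K I.F) (I.herm l)

lemma form_apply (l : I.F) (x y : E) :
    I.form l x y = Algebra.trace K I.F (l * I.tr (x * I.σ y)) := rfl

lemma ip_form (l : I.Fˣ) : IP (I.form (l : I.F)) :=
  (I.ip_herm l).resf (Algebra.trace_ne_zero K I.F)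

lemma cl_form (l : I.Fˣ) : cl (I.form (l : I.F)) = trT K I.F (hh I.d (ang l)) := by
  rw [← cl_herm, trT, transfer_cl _ (I.ip_herm l)]
  rfl

lemma form_mul (l : I.F) {u : E} (hu : u * I.σ u = 1) (x y : E) :
    I.form l (u * x) (u * y) = I.form l x y := by
  rw [form_apply, form_apply, map_mul I.σ, mul_mul_mul_comm, hu, one_mul]

lemma exists_form (ℓ : E →ₗ[K] K) (hσ : ∀ e, ℓ (I.σ e) = ℓ e) (hℓ : ℓ ≠ 0) :
    ∃ l : I.Fˣ, ∀ x y, I.form (l : I.F) x y = ℓ (x * I.σ y) := by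
  let τ : E →ₗ[K] K := (Algebra.trace K I.F) ∘ₗ (I.tr.restrictScalars K)
  have hτ : ∀ x, τ x = Algebra.trace K I.F (I.tr x) := fun _ => rfl
  let φ : E →ₗ[K] Module.Dual K E := (LinearMap.mul K E).compr₂ τ
  have hφ : ∀ c e, φ c e = Algebra.trace K I.F (I.tr (c * e)) := fun _ _ => rfl
  have hinj : Function.Injective φ := by
    rw [injective_iff_map_eq_zero]
    intro c hc
    refine I.eq_zero_of_tr fun y => ?_
    by_contra hy
    refine Algebra.trace_ne_zero K I.F (LinearMap.ext fun z => ?_)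
    have := DFunLike.congr_fun hc ((z * (I.tr (c * y))⁻¹ : I.F) * y)
    rwa [hφ, mul_left_comm, tr_coe_mul, mul_assoc, inv_mul_cancel₀ hy, mul_one] at this
  obtain ⟨c, hc⟩ := (LinearMap.injective_iff_surjective_of_finrank_eq_finrank
    (Subspace.dual_finrank_eq (K := K) (V := E)).symm).1 hinj ℓ
  have hcσ : I.σ c = c := by
    refine hinj (LinearMap.ext fun e => ?_)
    rw [hc, ← hσ, ← hc, hφ, hφ, ← tr_σ, map_mul I.σ, I.σσ]
  have hc0 : c ≠ 0 := by
    rintro rfl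
    rw [map_zero] at hc
    exact hℓ hc.symm
  refine ⟨Units.mk0 ⟨c, I.mem_F.2 hcσ⟩ fun h => hc0 (congrArg Subtype.val h), fun x y => ?_⟩
  rw [form_apply, ← tr_coe_mul, ← hc, hφ]
  rfl

end Inv

end QF

namespace QF

open IsDedekindDomain NumberField WithZero
open scoped Pointwise Classical nonZeroDivisors

open LinearMap (BilinForm)
open Module (finrank Basis)

/-- irreducible symmetric polynomials of even degree -/
class IsSym {K : Type*} [Field K] (f : K[X]) : Prop where
  monic : f.Monic
  irr : Irreducible f
  symm : f.reverse = f
  even : Even f.natDegree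

section SymField

variable {K : Type*} [Field K] [CharZero K] (f : K[X]) [hf : IsSym f]

instance : Fact (Irreducible f) := ⟨hf.irr⟩

instance : CharZero (AdjoinRoot f) := charZero_of_injective_algebraMap (algebraMap K _).injective

instance : FiniteDimensional K (AdjoinRoot f) := (hf.monic).finite_adjoinRoot

lemma root_ne_zero : AdjoinRoot.root f ≠ 0 := by
  intro h
  have h1 := AdjoinRoot.eval₂_root f
  rw [h, eval₂_at_zero, _root_.map_eq_zero] at h1
  have h2 : f.leadingCoeff = f.reverse.coeff 0 := (coeff_zero_reverse f).symm
  rw [hf.symm, h1, hf.monic.leadingCoeff] at h2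
  exact one_ne_zero h2

lemma root_sq_ne_one : AdjoinRoot.root f ^ 2 ≠ 1 := by
  intro h
  have h3 : ∃ c : K, AdjoinRoot.root f = algebraMap K _ c := by
    rcases sq_eq_one_iff.1 h with h | h
    · exact ⟨1, by rw [h, map_one]⟩
    · exact ⟨-1, by rw [h, map_neg, map_one]⟩
  obtain ⟨c, hc⟩ := h3
  have h4 : f = X - C c := by
    have := AdjoinRoot.minpoly_root hf.monic.ne_zero
    rw [hf.monic.leadingCoeff, inv_one, C_1, mul_one, hc, minpoly.eq_X_sub_C] at this
    exact this.symm
  have h5 := hf.even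
  rw [h4, natDegree_X_sub_C] at h5
  exact Nat.not_even_one h5

lemma aeval_inv_root : aeval (AdjoinRoot.root f)⁻¹ f = 0 := by
  have h := AdjoinRoot.eval₂_root f
  let _ : Invertible (AdjoinRoot.root f) := invertibleOfNonzero (root_ne_zero f)
  have := (eval₂_reverse_eq_zero_iff (AdjoinRoot.of f) (AdjoinRoot.root f) f).2 h
  rwa [hf.symm, invOf_eq_inv] at this

/-- the involution as an endomorphism -/
noncomputable def sigmaHom : AdjoinRoot f →ₐ[K] AdjoinRoot f :=
  AdjoinRoot.liftAlgHom f (Algebra.ofId K _) (AdjoinRoot.root f)⁻¹ (aeval_inv_root f)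

lemma sigmaHom_root : sigmaHom f (AdjoinRoot.root f) = (AdjoinRoot.root f)⁻¹ := by
  exact AdjoinRoot.liftAlgHom_root _ _ _ _

lemma sigmaHom_sigmaHom (x : AdjoinRoot f) : sigmaHom f (sigmaHom f x) = x := by
  have : (sigmaHom f).comp (sigmaHom f) = AlgHom.id K _ := by
    refine AdjoinRoot.algHom_ext ?_
    rw [AlgHom.comp_apply, sigmaHom_root, map_inv₀, sigmaHom_root, inv_inv]; rfl
  exact DFunLike.congr_fun this x

/-- the involution attached to a symmetric polynomial -/
noncomputable def inv : Inv K (AdjoinRoot f) where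
  σ := AlgEquiv.ofAlgHom (sigmaHom f) (sigmaHom f) (AlgHom.ext (sigmaHom_sigmaHom f))
    (AlgHom.ext (sigmaHom_sigmaHom f))
  σσ := sigmaHom_sigmaHom f
  s := AdjoinRoot.root f - (AdjoinRoot.root f)⁻¹
  s_ne h := root_sq_ne_one f (by
    have h0 := root_ne_zero f
    have h1 := sub_eq_zero.1 h
    rw [sq]
    nth_rw 2 [h1]
    exact mul_inv_cancel₀ h0)
  σs := by
    change sigmaHom f _ = _
    rw [map_sub, map_inv₀, sigmaHom_root, inv_inv, neg_sub]

lemma inv_σ_root : (inv f).σ (AdjoinRoot.root f) = (AdjoinRoot.root f)⁻¹ := sigmaHom_root f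

lemma charpoly_mul_root :
    (LinearMap.mulLeft K (AdjoinRoot.root f)).charpoly = f := by
  have h := charpoly_leftMulMatrix (AdjoinRoot.powerBasis hf.monic.ne_zero)
  rw [AdjoinRoot.powerBasis_gen, AdjoinRoot.minpoly_root hf.monic.ne_zero, hf.monic.leadingCoeff,
    inv_one, C_1, mul_one, Algebra.leftMulMatrix_apply, LinearMap.charpoly_toMatrix] at h
  exact h

end SymField

section Split

variable {K M E : Type*} [Field K] [AddCommGroup M] [Module K M]
  [FiniteDimensional K M] [AddCommGroup E] [Module K E] [FiniteDimensional K E]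

lemma IP.injective_of_isometry {b : BilinForm K M} (h : IP b) {t : M →ₗ[K] M}
    (ht : ∀ x y, b (t x) (t y) = b x y) : Function.Injective t := by
  rw [injective_iff_map_eq_zero]
  intro x hx
  refine h.nd x fun y => ?_
  rw [← ht, hx, map_zero, LinearMap.zero_apply]

lemma IP.surjective_of_isometry {b : BilinForm K M} (h : IP b) {t : M →ₗ[K] M}
    (ht : ∀ x y, b (t x) (t y) = b x y) : Function.Surjective t :=
  LinearMap.injective_iff_surjective.1 (h.injective_of_isometry ht)

lemma aeval_intertwine {t : M →ₗ[K] M} {u : E →ₗ[K] E} {j : E →ₗ[K] M} (h : ∀ e, j (u e) = t (j e))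
    (p : K[X]) (e : E) : j (aeval u p e) = aeval t p (j e) := by
  induction p using Polynomial.induction_on' generalizing e with
  | add p q hp hq => simp [hp, hq]
  | monomial n a =>
    have : ∀ n e, j ((u ^ n) e) = (t ^ n) (j e) := by
      intro n
      induction n with
      | zero => simp
      | succ n ih => intro e; rw [pow_succ, pow_succ, Module.End.mul_apply, Module.End.mul_apply, ih, h]
    simp [aeval_monomial, this, Module.algebraMap_end_apply]

lemma exists_split [CharZero K] {b : BilinForm K M} (hb : IP b) {t : M →ₗ[K] M}
    (ht : ∀ x y, b (t x) (t y) = b x y) {c : BilinForm K E} (hc : IP c) {u : E →ₗ[K] E}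
    (hu : ∀ x y, c (u x) (u y) = c x y) (j : E →ₗ[K] M) (hj : ∀ x y, b (j x) (j y) = c x y)
    (hju : ∀ e, j (u e) = t (j e)) :
    ∃ (N : Submodule K M) (tN : N →ₗ[K] N), (∀ n, (tN n : M) = t n) ∧ IP (b.restrict N) ∧
      finrank K M = finrank K E + finrank K N ∧ cl b = cl c + cl (b.restrict N) ∧
      t.charpoly = u.charpoly * tN.charpoly := by
  let N : Submodule K M := b.orthogonal (LinearMap.range j)
  have hN : ∀ n, n ∈ N ↔ ∀ e, b n (j e) = 0 := by
    intro n
    rw [hb.mem_orthogonal]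
    exact ⟨fun h e => h _ ⟨e, rfl⟩, by rintro h _ ⟨e, rfl⟩; exact h e⟩
  have htN : ∀ n ∈ N, t n ∈ N := by
    intro n hn
    rw [hN] at hn ⊢
    intro e
    obtain ⟨e, rfl⟩ := hc.surjective_of_isometry hu e
    rw [hju, ht, hn]
  let tN : N →ₗ[K] N := t.restrict htN
  let φ : E × N →ₗ[K] M := j.coprod N.subtype
  have hφb : ∀ x y, b (φ x) (φ y) = orth c (b.restrict N) x y := by
    rintro ⟨e, n⟩ ⟨e', n'⟩
    have h1 := (hN n).1 n.2 e'
    have h2 := (hN n').1 n'.2 e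
    rw [hb.symm] at h2
    simp [φ, hj, h1, h2]
  have hinj : Function.Injective φ := by
    rw [injective_iff_map_eq_zero]
    rintro ⟨e, n⟩ h
    have he : e = 0 := hc.nd e fun y => by
      have := hφb (e, n) (y, 0)
      rw [h] at this
      simpa using this.symm
    subst he
    have : (n : M) = 0 := by simpa [φ] using h
    simpa using this
  have hsurj : Function.Surjective φ := by
    intro m
    let e := (LinearMap.BilinForm.toDual c hc.nondegenerate).symm ((b m).comp j)
    have he : ∀ y, c e y = b m (j y) := fun y => by
      rw [LinearMap.BilinForm.apply_toDual_symm_apply]; rfl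
    refine ⟨(e, ⟨m - j e, (hN _).2 fun y => ?_⟩), by simp [φ]⟩
    rw [map_sub, LinearMap.sub_apply, hj, he, sub_self]
  let Φ : (E × N) ≃ₗ[K] M := LinearEquiv.ofBijective φ ⟨hinj, hsurj⟩
  have hIP : IP (b.restrict N) := by
    refine ⟨fun x y => hb.symm _ _, fun x hx => ?_⟩
    have : (x : M) = 0 := hb.nd _ fun y => by
      obtain ⟨⟨e, n⟩, rfl⟩ := hsurj y
      have h1 : b x n = 0 := hx n
      simp [φ, h1, (hN x).1 x.2 e]
    simpa using this
  refine ⟨N, tN, fun n => rfl, hIP, ?_, ?_, ?_⟩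
  · rw [← Φ.finrank_eq, Module.finrank_prod]
  · rw [cl_congr (hc.orth hIP) (e := Φ) hφb, cl_orth hc hIP]
  · rw [← LinearMap.charpoly_prodMap, ← Φ.charpoly_conj]
    congr 1
    refine LinearMap.ext fun m => ?_
    obtain ⟨⟨e, n⟩, rfl⟩ := Φ.surjective m
    rw [LinearEquiv.conj_apply_apply, Φ.symm_apply_apply]
    change t (j e + n) = j (u e) + t n
    rw [hju, map_add]

lemma isometry_pow {b : BilinForm K M} {t : M →ₗ[K] M}
    (ht : ∀ x y, b (t x) (t y) = b x y) (n : ℕ) (x y : M) : b ((t ^ n) x) ((t ^ n) y) = b x y := by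
  induction n with
  | zero => simp
  | succ n ih => rw [pow_succ', Module.End.mul_apply, Module.End.mul_apply, ht, ih]

lemma isometry_ker_aeval {b : BilinForm K M} {t : M →ₗ[K] M}
    (ht : ∀ x y, b (t x) (t y) = b x y) {f : K[X]} (hf : f.reverse = f) {x : M}
    (hx : aeval t f x = 0) (y : M) : b x (aeval t f y) = 0 := by
  let m := f.natDegree
  have key : ∀ y, b ((t ^ m) x) (aeval t f y) = b (aeval t f x) y := by
    intro y
    rw [aeval_eq_sum_range, LinearMap.sum_apply, LinearMap.sum_apply, map_sum, map_sum,
      LinearMap.sum_apply,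
      ← Finset.sum_flip (fun k => (b ((f.coeff k • t ^ k) x)) y)]
    refine Finset.sum_congr rfl fun k hk => ?_
    have hk' : k ≤ m := Nat.lt_succ_iff.1 (Finset.mem_range.1 hk)
    have hc : f.coeff (m - k) = f.coeff k := by
      conv_rhs => rw [← hf, coeff_reverse, revAt_le hk']
    change b ((t ^ m) x) ((f.coeff k • t ^ k) y) = b ((f.coeff (m - k) • t ^ (m - k)) x) y
    rw [hc, LinearMap.smul_apply, LinearMap.smul_apply, map_smul, map_smul, LinearMap.smul_apply]
    congr 1
    rw [← isometry_pow ht k ((t ^ (m - k)) x), ← Module.End.mul_apply, ← pow_add,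
      Nat.add_sub_cancel' hk']
  have h := key ((t ^ m) y)
  rw [hx, map_zero, LinearMap.zero_apply] at h
  rw [← isometry_pow ht m, ← h]
  congr 1
  rw [← aeval_X_pow (R := K) t, ← Module.End.mul_apply, ← Module.End.mul_apply, ← map_mul, ← map_mul,
    mul_comm]

end Split

end QF

namespace QF

open IsDedekindDomain NumberField WithZero
open scoped Pointwise Classical nonZeroDivisors

open LinearMap (BilinForm)
open Module (finrank Basis)

variable {K : Type*} [Field K] [CharZero K]

lemma exists_line {M : Type*} [AddCommGroup M] [Module K M] [FiniteDimensional K M]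
    {b : BilinForm K M} (hb : IP b) {t : M →ₗ[K] M}
    (ht : ∀ x y, b (t x) (t y) = b x y) (f : K[X]) [hf : IsSym f] {x : M} (hx : aeval t f x = 0)
    (hxx : b x x ≠ 0) :
    ∃ (l : (inv f).Fˣ) (j : AdjoinRoot f →ₗ[K] M),
      (∀ e e', b (j e) (j e') = (inv f).form (l : (inv f).F) e e') ∧
      ∀ e, j (AdjoinRoot.root f * e) = t (j e) := by
  let ev : K[X] →ₗ[K] M := LinearMap.applyₗ x ∘ₗ (aeval t).toLinearMap
  have hev : ∀ p, ev p = aeval t p x := fun _ => rfl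
  let j : AdjoinRoot f →ₗ[K] M := ev ∘ₗ AdjoinRoot.modByMonicHom hf.monic
  have hj : ∀ p, j (AdjoinRoot.mk f p) = aeval t p x := by
    intro p
    change ev (AdjoinRoot.modByMonicHom hf.monic (AdjoinRoot.mk f p)) = _
    rw [AdjoinRoot.modByMonicHom_mk, hev]
    conv_rhs => rw [← modByMonic_add_div p f]
    rw [map_add, LinearMap.add_apply, mul_comm, map_mul, Module.End.mul_apply, hx, map_zero, add_zero]
  have hjt : ∀ e, j (AdjoinRoot.root f * e) = t (j e) := by
    intro e
    obtain ⟨p, rfl⟩ := AdjoinRoot.mk_surjective e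
    rw [← AdjoinRoot.mk_X, ← map_mul, hj, hj, map_mul, aeval_X, Module.End.mul_apply]
  have hj1 : j 1 = x := by
    have := hj 1
    rwa [map_one (AdjoinRoot.mk f), map_one (aeval t), Module.End.one_apply] at this
  let ℓ : AdjoinRoot f →ₗ[K] K := (b.flip x) ∘ₗ j
  have hℓ : ∀ e, ℓ e = b (j e) x := fun _ => rfl
  have hr := root_ne_zero f
  have key : ∀ p e, b (j e) (j (AdjoinRoot.mk f p)) = ℓ (e * (inv f).σ (AdjoinRoot.mk f p)) := by
    intro p
    induction p using Polynomial.induction_on with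
    | C a =>
      intro e
      rw [AdjoinRoot.mk_C, ← AdjoinRoot.algebraMap_eq, AlgEquiv.commutes, Algebra.algebraMap_eq_smul_one,
        map_smul, map_smul, mul_smul_comm, mul_one, map_smul, hj1, hℓ]
    | add p q hp hq =>
      intro e
      rw [map_add, map_add, map_add, map_add, mul_add, map_add, hp, hq]
    | monomial n a h =>
      intro e
      rw [pow_succ', mul_left_comm, map_mul (AdjoinRoot.mk f) X, AdjoinRoot.mk_X, hjt, map_mul (inv f).σ, inv_σ_root]
      have he : e = AdjoinRoot.root f * ((AdjoinRoot.root f)⁻¹ * e) := by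
        rw [mul_inv_cancel_left₀ hr]
      conv_lhs => rw [he]
      rw [hjt, ht, h]
      congr 1
      ring
  have key' : ∀ e e', b (j e) (j e') = ℓ (e * (inv f).σ e') := by
    intro e e'
    obtain ⟨p, rfl⟩ := AdjoinRoot.mk_surjective e'
    exact key p e
  obtain ⟨l, hl⟩ := (inv f).exists_form ℓ (fun e => by
      have h1 := key' 1 e
      have h2 := key' e 1
      rw [one_mul] at h1
      rw [map_one (inv f).σ, mul_one] at h2
      rw [← h1, ← h2, hb.symm]) (by
      intro h
      have := hℓ 1
      rw [h, hj1] at this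
      exact hxx this.symm)
  exact ⟨l, j, fun e e' => by rw [key', hl], hjt⟩

variable {ι : Type*} [Fintype ι] (f : ι → K[X]) [hf : ∀ i, IsSym (f i)]

lemma isCoprime_of_ne (hinj : Function.Injective f) {i j : ι} (hij : i ≠ j) :
    IsCoprime (f i) (f j) := by
  rw [(hf i).irr.coprime_iff_not_dvd]
  intro h
  have := ((hf i).irr.dvd_irreducible_iff_associated (hf j).irr).1 h
  exact hij (hinj (eq_of_monic_of_associated (hf i).monic (hf j).monic this))

lemma exists_anisotropic (hinj : Function.Injective f) {M : Type*} [AddCommGroup M] [Module K M]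
    [FiniteDimensional K M] [Nontrivial M] {b : BilinForm K M} (hb : IP b) {t : M →ₗ[K] M}
    (ht : ∀ x y, b (t x) (t y) = b x y) (hG : aeval t (∏ i, f i) = 0) :
    ∃ i x, aeval t (f i) x = 0 ∧ b x x ≠ 0 := by
  by_contra! hcon
  have h0 : ∀ i x, aeval t (f i) x = 0 → x = 0 := by
    intro i x hx
    refine hb.nd x fun y => ?_
    obtain ⟨u, v, huv⟩ : IsCoprime (f i) (∏ j ∈ Finset.univ.erase i, f j) :=
      IsCoprime.prod_right fun j hj => isCoprime_of_ne f hinj (Finset.ne_of_mem_erase hj).symm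
    have hy : y = aeval t (f i) (aeval t u y) + aeval t (v * ∏ j ∈ Finset.univ.erase i, f j) y := by
      rw [← Module.End.mul_apply, ← map_mul, ← LinearMap.add_apply, ← map_add, mul_comm (f i), huv,
        map_one, Module.End.one_apply]
    have hz : aeval t (f i) (aeval t (v * ∏ j ∈ Finset.univ.erase i, f j) y) = 0 := by
      rw [← Module.End.mul_apply, ← map_mul, mul_left_comm, Finset.mul_prod_erase _ _ (Finset.mem_univ i),
        map_mul, hG, mul_zero, LinearMap.zero_apply]
    set z := aeval t (v * ∏ j ∈ Finset.univ.erase i, f j) y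
    rw [hy, map_add, isometry_ker_aeval ht (hf i).symm hx, zero_add]
    have h1 := hcon i (x + z) (by rw [map_add, hx, hz, add_zero])
    have h2 := hcon i x hx
    have h3 := hcon i z hz
    rw [map_add, map_add, LinearMap.add_apply, LinearMap.add_apply, h2, h3, hb.symm z x, zero_add,
      add_zero, add_self_eq_zero] at h1
    exact h1
  have h1 : ∀ s : Finset ι, ∀ x, aeval t (∏ i ∈ s, f i) x = 0 → x = 0 := by
    intro s
    induction s using Finset.induction_on with
    | empty => intro x hx; simpa using hx
    | insert i s hi ih =>
      intro x hx
      rw [Finset.prod_insert hi, map_mul, Module.End.mul_apply] at hx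
      exact ih x (h0 i _ hx)
  obtain ⟨x, hx⟩ := exists_ne (0 : M)
  exact hx (h1 _ x (by rw [hG, LinearMap.zero_apply]))

theorem exists_decomposition (hinj : Function.Injective f) {M : Type*} [AddCommGroup M] [Module K M]
    [FiniteDimensional K M] {b : BilinForm K M} (hb : IP b) {t : M →ₗ[K] M}
    (ht : ∀ x y, b (t x) (t y) = b x y) (hG : aeval t (∏ i, f i) = 0) :
    ∃ Λ : ∀ i, Multiset ((inv (f i)).F)ˣ,
      cl b = ∑ i, trT K (inv (f i)).F (hh (inv (f i)).d (W.mk (Λ i))) ∧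
      t.charpoly = ∏ i, f i ^ (Λ i).card := by
  induction hN : finrank K M using Nat.strong_induction_on generalizing M with
  | _ N ih =>
    rcases subsingleton_or_nontrivial M with hM | hM
    · refine ⟨fun i => 0, ?_, ?_⟩
      · simp only [map_zero, Finset.sum_const_zero]
        rw [cl_eq_zero_iff hb]
        exact ⟨⊤, fun x => by simp [Subsingleton.elim x 0]⟩
      · have h1 : t.charpoly.natDegree = 0 := by
          rw [LinearMap.charpoly_natDegree, Module.finrank_zero_of_subsingleton]
        simpa using (LinearMap.charpoly_monic t).natDegree_eq_zero.1 h1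
    · obtain ⟨i, x, hx, hxx⟩ := exists_anisotropic f hinj hb ht hG
      obtain ⟨l, j, hj, hjt⟩ := exists_line hb ht (f i) hx hxx
      obtain ⟨N', tN, htN, hbN, hdim, hcl, hch⟩ := exists_split hb ht ((inv (f i)).ip_form l)
        (u := LinearMap.mulLeft K (AdjoinRoot.root (f i)))
        (fun x y => (inv (f i)).form_mul _ (by
          rw [inv_σ_root, mul_inv_cancel₀ (root_ne_zero _)]) x y) j hj hjt
      have hpos : 0 < finrank K (AdjoinRoot (f i)) := Module.finrank_pos
      obtain ⟨Λ, hΛ, hΛ'⟩ := ih (finrank K N') (by omega) hbN (t := tN)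
        (fun x y => by
          change b (tN x : M) (tN y : M) = b x y
          rw [htN, htN, ht])
        (LinearMap.ext fun n => Subtype.ext (by
          have := aeval_intertwine (j := N'.subtype) (t := t) (u := tN) htN (∏ i, f i) n
          rw [hG] at this
          exact this)) rfl
      refine ⟨Function.update Λ i (l ::ₘ Λ i), ?_, ?_⟩
      · rw [hcl, hΛ, (inv (f i)).cl_form, ← Finset.add_sum_erase _ _ (Finset.mem_univ i),
          ← Finset.add_sum_erase Finset.univ (fun a => trT K (inv (f a)).F (hh (inv (f a)).d
            (W.mk (Function.update Λ i (l ::ₘ Λ i) a)))) (Finset.mem_univ i), ← add_assoc]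
        congr 1
        · rw [Function.update_self, ← Multiset.singleton_add, map_add, map_add, map_add]
          rfl
        · refine Finset.sum_congr rfl fun a ha => ?_
          rw [Function.update_of_ne (Finset.ne_of_mem_erase ha)]
      · rw [hch, hΛ', charpoly_mul_root, ← Finset.mul_prod_erase _ _ (Finset.mem_univ i),
          ← Finset.mul_prod_erase Finset.univ (fun a => f a ^
            (Function.update Λ i (l ::ₘ Λ i) a).card) (Finset.mem_univ i), ← mul_assoc]
        congr 1
        · rw [Function.update_self, Multiset.card_cons, pow_succ']
        · refine Finset.prod_congr rfl fun a ha => ?_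
          rw [Function.update_of_ne (Finset.ne_of_mem_erase ha)]

end QF

namespace QF

open IsDedekindDomain NumberField WithZero
open scoped Pointwise Classical nonZeroDivisors

open LinearMap (BilinForm)
open Module (finrank Basis)

section Odd

variable {K K' : Type*} [Field K] [Field K'] [CharZero K'] [Algebra K K'] [FiniteDimensional K K']
  [CharZero K]

/-- Scharlau: over an odd degree extension some transfer sends the unit form to the unit form. -/
lemma exists_transfer_ang_one (hodd : Odd (finrank K K')) :
    ∃ (s : K' →ₗ[K] K) (hs : s ≠ 0), transfer s hs (ang 1) = ang 1 := by
  obtain ⟨m, hm⟩ := hodd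
  let pb := Field.powerBasisOfFiniteOfSeparable K K'
  have hdim : pb.dim = 2 * m + 1 := by rw [← hm, pb.finrank]
  let s : K' →ₗ[K] K := pb.basis.coord ⟨0, by omega⟩
  have hs : ∀ j < pb.dim, s (pb.gen ^ j) = if j = 0 then 1 else 0 := by
    intro j hj
    have := pb.basis_eq_pow ⟨j, hj⟩
    change pb.basis _ = pb.gen ^ j at this
    rw [← this, Basis.coord_apply, Basis.repr_self, Finsupp.single_apply]
    simp [Fin.ext_iff]
  have hs0 : s ≠ 0 := by
    intro h
    have := hs 0 (by omega)
    simp [h] at this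
  refine ⟨s, hs0, ?_⟩
  have hbig := ((ip_oned (1 : K'ˣ)).resf hs0).orth (ip_oned (1 : Kˣ)).neg
  rw [transfer_ang, ← sub_eq_zero, ← cl_oned (1 : Kˣ), sub_eq_add_neg, ← cl_neg (ip_oned _),
    ← cl_orth ((ip_oned _).resf hs0) (ip_oned _).neg, cl_eq_zero_iff hbig]
  let ψ : (Fin (m + 1) → K) →ₗ[K] K' := Fintype.linearCombination K fun j => pb.gen ^ (j : ℕ)
  have hψ : ∀ c, ψ c = ∑ j, c j • pb.gen ^ (j : ℕ) := fun c => rfl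
  have hinj : Function.Injective ψ := by
    have hli := pb.basis.linearIndependent.comp (Fin.castLE (by omega : m + 1 ≤ pb.dim))
      (Fin.castLE_injective _)
    rw [Fintype.linearIndependent_iff] at hli
    refine (injective_iff_map_eq_zero ψ).2 fun c hc => funext (hli c ?_)
    rw [← hc, hψ]
    exact Finset.sum_congr rfl fun j _ => by simp
  have h1 : ∀ c, s (ψ c) = c 0 := by
    intro c
    rw [hψ, map_sum, Finset.sum_eq_single 0]
    · simpa using congrArg (c 0 * ·) (hs 0 (by omega))
    · intro j _ hj
      rw [map_smul, hs _ (by omega), if_neg (fun h => hj (Fin.ext (by simpa using h))), smul_zero]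
    · simp
  have h2 : ∀ c d, s (ψ c * ψ d) = c 0 * d 0 := by
    intro c d
    rw [hψ, hψ, Finset.sum_mul_sum, map_sum, Finset.sum_eq_single 0]
    · rw [map_sum, Finset.sum_eq_single 0]
      · have h0 : s 1 = 1 := by simpa using hs 0 (by omega)
        simp [h0, mul_comm]
      · intro j _ hj
        rw [smul_mul_smul_comm, ← pow_add, map_smul, hs _ (by simp; omega),
          if_neg (fun h => hj (Fin.ext (by simpa using h))), smul_zero]
      · simp
    · intro i _ hi
      rw [map_sum]
      refine Finset.sum_eq_zero fun j _ => ?_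
      rw [smul_mul_smul_comm, ← pow_add, map_smul, hs _ (by omega),
        if_neg (fun h => hi (Fin.ext (Nat.add_eq_zero_iff.1 h).1)), smul_zero]
    · simp
  refine ⟨LinearMap.range (ψ.prod (s ∘ₗ ψ)), hbig.isLag_of ?_ ?_⟩
  · rintro _ ⟨c, rfl⟩ _ ⟨d, rfl⟩
    simp [orth_apply, resf_apply, h1, h2]
  · rw [LinearMap.finrank_range_of_inj]
    · simp [hm]; omega
    · intro c d h
      exact hinj (congrArg Prod.fst h)

lemma DiagOn.baseChange {V ι : Type*} [AddCommGroup V] [Module K V] [Fintype ι] {B : BilinForm K V}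
    {b : Basis ι K V} {a : ι → Kˣ} (hb : DiagOn B b a) :
    DiagOn (BilinForm.baseChange K' B) (b.baseChange K')
      (fun i => Units.map (algebraMap K K').toMonoidHom (a i)) := by
  intro i j
  rw [Basis.baseChange_apply, Basis.baseChange_apply, BilinForm.baseChange_tmul, hb i j]
  split_ifs <;> simp [Algebra.smul_def]

/-- transfer of a base change along an odd degree extension -/
lemma exists_cl_resf_baseChange (hodd : Odd (finrank K K')) :
    ∃ s : K' →ₗ[K] K, s ≠ 0 ∧ ∀ {V : Type*} [AddCommGroup V] [Module K V] [FiniteDimensional K V]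
      (B : BilinForm K V), IP B → IP (BilinForm.baseChange K' B) ∧
        cl (resf s (BilinForm.baseChange K' B)) = cl B := by
  obtain ⟨s, hs, h1⟩ := exists_transfer_ang_one (K := K) (K' := K') hodd
  refine ⟨s, hs, fun {V} _ _ _ B hB => ?_⟩
  obtain ⟨m, b, hb⟩ := hB.exists_isDiag
  have hb' := hb.baseChange (K' := K')
  refine ⟨hb'.ip, ?_⟩
  rw [← transfer_cl hs hb'.ip, hb'.cl_eq, hb.cl_eq, map_sum]
  refine Finset.sum_congr rfl fun i _ => ?_
  have := transfer_scale hs i.val (ang 1)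
  rwa [h1, scale_ang, scale_ang, mul_one, mul_one] at this

/-- the characteristic polynomial after restriction of scalars -/
lemma charpoly_restrictScalars {M : Type*} [AddCommGroup M] [Module K M] [Module K' M]
    [IsScalarTower K K' M] [FiniteDimensional K' M] [FiniteDimensional K M] (t : M →ₗ[K'] M) (p : K[X])
    (h : t.charpoly = p.map (algebraMap K K')) :
    (t.restrictScalars K).charpoly = p ^ finrank K K' := by
  refine Polynomial.funext fun c => ?_
  rw [LinearMap.eval_charpoly, eval_pow, ← Algebra.norm_algebraMap]
  have h2 := LinearMap.eval_charpoly t (algebraMap K K' c)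
  rw [h, eval_map_algebraMap, aeval_algebraMap_apply_eq_algebraMap_eval] at h2
  rw [h2]
  have := LinearMap.det_restrictScalars (R := K) (f := algebraMap K' (Module.End K' M) (algebraMap K K' c) - t)
  rw [← this]
  congr 1
  ext x
  simp [Module.algebraMap_end_apply]

end Odd

end QF

namespace QF

open IsDedekindDomain NumberField WithZero
open scoped Pointwise Classical nonZeroDivisors

open LinearMap (BilinForm)
open Module (finrank Basis)

section Hermitian

variable {ι : Type*} [Fintype ι]

/-- diagonal hermitian form -/
noncomputable def hdg (a : ι → ℝ) (x y : ι → ℂ) : ℂ := ∑ i, (a i : ℂ) * (x i * starRingEnd ℂ (y i))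

lemma hdg_add_left (a : ι → ℝ) (x x' y : ι → ℂ) : hdg a (x + x') y = hdg a x y + hdg a x' y := by
  simp only [hdg, ← Finset.sum_add_distrib, Pi.add_apply]
  exact Finset.sum_congr rfl fun i _ => by ring

lemma hdg_add_right (a : ι → ℝ) (x y y' : ι → ℂ) : hdg a x (y + y') = hdg a x y + hdg a x y' := by
  simp only [hdg, ← Finset.sum_add_distrib, Pi.add_apply, map_add]
  exact Finset.sum_congr rfl fun i _ => by ring

lemma hdg_smul_smul (a : ι → ℝ) (c d : ℂ) (x y : ι → ℂ) :
    hdg a (c • x) (d • y) = c * starRingEnd ℂ d * hdg a x y := by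
  simp only [hdg, Finset.mul_sum, Pi.smul_apply, smul_eq_mul, map_mul]
  exact Finset.sum_congr rfl fun i _ => by ring

lemma finrank_isotropic_le (a : ι → ℝ) (ha : ∀ i, a i ≠ 0) (U : Submodule ℂ (ι → ℂ))
    (hU : ∀ x ∈ U, hdg a x x = 0) :
    finrank ℂ U ≤ (Finset.univ.filter fun i => a i < 0).card ∧
      finrank ℂ U ≤ (Finset.univ.filter fun i => 0 < a i).card := by
  have key : ∀ x ∈ U, ∑ i, a i * Complex.normSq (x i) = 0 := by
    intro x hx
    have := hU x hx
    simp only [hdg, Complex.mul_conj] at this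
    exact_mod_cast this
  refine ⟨finrank_le_card_neg a ha U fun x hx => (key x hx).le, ?_⟩
  have := finrank_le_card_neg (fun i => - a i) (fun i => neg_ne_zero.2 (ha i)) U
    (fun x hx => by simp [key x hx])
  simpa using this

lemma finrank_biSup_le {α : Type*} (Z : Finset α) (E : α → Submodule ℂ (ι → ℂ)) :
    finrank ℂ (⨆ z ∈ Z, E z : Submodule ℂ (ι → ℂ)) ≤ ∑ z ∈ Z, finrank ℂ (E z) := by
  induction Z using Finset.induction_on with
  | empty => simp
  | insert z Z hz ih =>
    rw [Finset.iSup_insert, Finset.sum_insert hz]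
    exact (Submodule.finrank_add_le_finrank_add_finrank _ _).trans (Nat.add_le_add_left ih _)

/-- The signature of a hermitian form is bounded by the dimension of the unit-circle eigenspaces of
a diagonalisable isometry. -/
lemma signature_le (a : ι → ℝ) (ha : ∀ i, a i ≠ 0) (A : Module.End ℂ (ι → ℂ))
    (hA : ∀ x y, hdg a (A x) (A y) = hdg a x y) (htop : ⨆ z, A.eigenspace z = ⊤)
    (Z : Finset ℂ) (hZ : ∀ z, ‖z‖ = 1 → A.HasEigenvalue z → z ∈ Z) :
    |((Finset.univ.filter fun i => 0 < a i).card : ℤ) - (Finset.univ.filter fun i => a i < 0).card| ≤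
      ∑ z ∈ Z, (finrank ℂ (A.eigenspace z) : ℤ) := by
  have hpair : ∀ z w, z * starRingEnd ℂ w ≠ 1 → ∀ x ∈ A.eigenspace z, ∀ y ∈ A.eigenspace w,
      hdg a x y = 0 := by
    intro z w hzw x hx y hy
    have h1 := hA x y
    rw [Module.End.mem_eigenspace_iff.1 hx, Module.End.mem_eigenspace_iff.1 hy, hdg_smul_smul] at h1
    have h2 : (z * starRingEnd ℂ w - 1) * hdg a x y = 0 := by rw [sub_mul, h1]; ring
    exact (mul_eq_zero.1 h2).resolve_left (sub_ne_zero.2 hzw)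
  have hiso : ∀ S : Set ℂ, (∀ z ∈ S, ∀ w ∈ S, z * starRingEnd ℂ w ≠ 1) →
      ∀ x ∈ (⨆ z : S, A.eigenspace (z : ℂ)), ∀ y ∈ (⨆ z : S, A.eigenspace (z : ℂ)), hdg a x y = 0 := by
    intro S hS x hx y hy
    induction hx using Submodule.iSup_induction' with
    | zero => simp [hdg]
    | add x x' _ _ h h' => rw [hdg_add_left, h, h', add_zero]
    | mem z x hx =>
      induction hy using Submodule.iSup_induction' with
      | zero => simp [hdg]
      | add y y' _ _ h h' => rw [hdg_add_right, h, h', add_zero]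
      | mem w y hy => exact hpair z w (hS z z.2 w w.2) x hx y hy
  have hnorm : ∀ z w : ℂ, z * starRingEnd ℂ w = 1 → ‖z‖ * ‖w‖ = 1 := by
    intro z w h
    have := congrArg norm h
    rwa [norm_mul, RCLike.norm_conj, norm_one] at this
  obtain ⟨h1, h2⟩ := finrank_isotropic_le a ha (⨆ z : {z : ℂ | 1 < ‖z‖}, A.eigenspace (z : ℂ))
    (fun x hx => hiso _ (fun z hz w hw h => by
      have := hnorm z w h
      simp only [Set.mem_ofPred_eq] at hz hw
      nlinarith) x hx x hx)
  obtain ⟨h3, h4⟩ := finrank_isotropic_le a ha (⨆ z : {z : ℂ | ‖z‖ < 1}, A.eigenspace (z : ℂ))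
    (fun x hx => hiso _ (fun z hz w hw h => by
      have := hnorm z w h
      simp only [Set.mem_ofPred_eq] at hz hw
      nlinarith [norm_nonneg z, norm_nonneg w]) x hx x hx)
  have h5 := finrank_biSup_le Z A.eigenspace
  have hle : (⊤ : Submodule ℂ (ι → ℂ)) ≤ (⨆ z : {z : ℂ | 1 < ‖z‖}, A.eigenspace (z : ℂ)) ⊔
      (⨆ z : {z : ℂ | ‖z‖ < 1}, A.eigenspace (z : ℂ)) ⊔ ⨆ z ∈ Z, A.eigenspace z := by
    rw [← htop]
    refine iSup_le fun z => ?_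
    rcases lt_trichotomy ‖z‖ 1 with h | h | h
    · exact le_sup_of_le_left (le_sup_of_le_right
        (le_iSup (fun z : {z : ℂ | ‖z‖ < 1} => A.eigenspace (z : ℂ)) ⟨z, h⟩))
    · by_cases hz : A.eigenspace z = ⊥
      · rw [hz]; exact bot_le
      · exact le_sup_of_le_right (le_iSup₂_of_le z (hZ z h hz) le_rfl)
    · exact le_sup_of_le_left (le_sup_of_le_left
        (le_iSup (fun z : {z : ℂ | 1 < ‖z‖} => A.eigenspace (z : ℂ)) ⟨z, h⟩))
  have h6 := Submodule.finrank_mono hle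
  rw [finrank_top, Module.finrank_fintype_fun_eq_card] at h6
  have h7 := h6.trans ((Submodule.finrank_add_le_finrank_add_finrank _ _).trans (Nat.add_le_add_right
    (Submodule.finrank_add_le_finrank_add_finrank _ _) _))
  have h8 : Fintype.card ι = (Finset.univ.filter fun i => 0 < a i).card +
      (Finset.univ.filter fun i => a i < 0).card := by
    rw [← Finset.card_univ, ← Finset.card_filter_add_card_filter_not (s := Finset.univ) (fun i => 0 < a i)]
    congr 2
    ext i
    simp only [Finset.mem_filter, Finset.mem_univ, true_and, not_lt]
    exact ⟨fun h => lt_of_le_of_ne h (ha i), le_of_lt⟩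
  rw [← Nat.cast_sum, abs_le]
  constructor <;> omega

end Hermitian

section Embeddings

open ComplexEmbedding

/-- real embeddings extend along odd degree extensions -/
lemma exists_real_extension {K K' : Type*} [Field K] [NumberField K] [Field K'] [NumberField K']
    [Algebra K K'] [FiniteDimensional K K'] (hodd : Odd (finrank K K')) (v : K →+* ℝ) :
    ∃ v' : K' →+* ℝ, v'.comp (algebraMap K K') = v := by
  let _ : Algebra K ℂ := (Complex.ofRealHom.comp v).toAlgebra
  have halg : ∀ c, algebraMap K ℂ c = (v c : ℂ) := fun _ => rfl
  let τ : (K' →ₐ[K] ℂ) → (K' →ₐ[K] ℂ) := fun φ =>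
    { (starRingEnd ℂ).comp φ.toRingHom with
      commutes' := fun c => by
        change starRingEnd ℂ (φ (algebraMap K K' c)) = _
        rw [AlgHom.commutes, halg, Complex.conj_ofReal] }
  have hτ : ∀ φ x, τ φ x = starRingEnd ℂ (φ x) := fun _ _ => rfl
  have hττ : Function.Involutive τ := fun φ => AlgHom.ext fun x => by
    rw [hτ, hτ, Complex.conj_conj]
  have : Fact (Nat.Prime 2) := ⟨Nat.prime_two⟩
  obtain ⟨φ, hφ⟩ := Equiv.Perm.exists_fixed_point_of_prime (p := 2) (n := 1) (σ := hττ.toPerm) (by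
      rw [AlgHom.card]
      exact fun h => (Nat.not_even_iff_odd.2 hodd) (even_iff_two_dvd.2 h)) (by
      ext1 φ
      rw [pow_one, sq]
      exact hττ φ)
  have hreal : IsReal φ.toRingHom := by
    rw [isReal_iff]
    exact RingHom.ext fun x => DFunLike.congr_fun hφ x
  refine ⟨hreal.embedding, RingHom.ext fun c => ?_⟩
  have := hreal.coe_embedding_apply (algebraMap K K' c)
  have h2 : φ.toRingHom (algebraMap K K' c) = (v c : ℂ) := φ.commutes c
  rw [h2] at this
  exact_mod_cast this

variable {K : Type*} [Field K] [NumberField K]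

lemma exists_real_of_unit_root (f : K[X]) [hf : IsSym f] (v : K →+* ℝ) {z : ℂ} (hz : ‖z‖ = 1)
    (hfz : f.eval₂ (Complex.ofRealHom.comp v) z = 0) :
    ∃ P : (inv f).F →+* ℝ, P.comp (algebraMap K (inv f).F) = v ∧ P (inv f).d < 0 ∧
      ∀ x : (inv f).F, (x : AdjoinRoot f) = AdjoinRoot.root f + (AdjoinRoot.root f)⁻¹ →
        (P x : ℂ) = z + z⁻¹ := by
  let φ : AdjoinRoot f →+* ℂ := AdjoinRoot.lift (Complex.ofRealHom.comp v) z hfz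
  have hφr : φ (AdjoinRoot.root f) = z := AdjoinRoot.lift_root hfz
  have hφc : ∀ c : K, φ (algebraMap K _ c) = (v c : ℂ) := fun c => AdjoinRoot.lift_of hfz
  have hzc : starRingEnd ℂ z = z⁻¹ := by rw [Complex.inv_def, Complex.normSq_eq_norm_sq, hz]; simp
  have hconj : ∀ x, starRingEnd ℂ (φ x) = φ ((inv f).σ x) := by
    intro x
    obtain ⟨p, rfl⟩ := AdjoinRoot.mk_surjective x
    induction p using Polynomial.induction_on' with
    | add p q hp hq => simp only [map_add, hp, hq]
    | monomial n a =>
      rw [← C_mul_X_pow_eq_monomial, map_mul, map_pow, AdjoinRoot.mk_X, AdjoinRoot.mk_C,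
        ← AdjoinRoot.algebraMap_eq, map_mul φ, map_pow φ, hφr, hφc, map_mul (inv f).σ, map_pow (inv f).σ,
        inv_σ_root, AlgEquiv.commutes, map_mul φ, map_pow φ, map_inv₀, hφr, hφc, map_mul, map_pow, hzc,
        Complex.conj_ofReal]
  have hreal : IsReal (φ.comp (algebraMap (inv f).F (AdjoinRoot f))) := by
    rw [isReal_iff]
    refine RingHom.ext fun x => ?_
    change starRingEnd ℂ (φ (x : AdjoinRoot f)) = φ (x : AdjoinRoot f)
    rw [hconj, Inv.σ_coe]
  have hP : ∀ x : (inv f).F, ((hreal.embedding x : ℝ) : ℂ) = φ (x : AdjoinRoot f) := fun x =>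
    hreal.coe_embedding_apply x
  refine ⟨hreal.embedding, RingHom.ext fun c => ?_, ?_, fun x hx => ?_⟩
  · have := (hP (algebraMap K (inv f).F c)).trans (hφc c)
    exact_mod_cast this
  · have h1 : hreal.embedding (inv f).d ≠ 0 := (_root_.map_ne_zero _).2 (Units.ne_zero _)
    refine lt_of_le_of_ne ?_ h1
    have h2 := hP (inv f).d
    have h3 : φ (inv f).s = z - starRingEnd ℂ z := by
      change φ (AdjoinRoot.root f - (AdjoinRoot.root f)⁻¹) = _
      rw [map_sub, map_inv₀, hφr, hzc]
    rw [Inv.coe_d, map_pow, h3, Complex.sub_conj] at h2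
    have h4 := congrArg Complex.re h2
    rw [Complex.ofReal_re, mul_pow, Complex.I_sq, ← Complex.ofReal_pow, mul_neg_one, Complex.neg_re,
      Complex.ofReal_re] at h4
    rw [h4]
    nlinarith
  · rw [hP, hx, map_add, map_inv₀, hφr]

lemma card_unit_roots_le (f : K[X]) [hf : IsSym f] [NumberField (inv f).F] (v : K →+* ℝ) (S : Finset ℂ)
    (hS : ∀ z ∈ S, ‖z‖ = 1 ∧ f.eval₂ (Complex.ofRealHom.comp v) z = 0) :
    S.card ≤ 2 * rho (inv f).d v := by
  have hx : AdjoinRoot.root f + (AdjoinRoot.root f)⁻¹ ∈ (inv f).F := by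
    rw [Inv.mem_F, map_add, map_inv₀, inv_σ_root, inv_inv, add_comm]
  choose P hP1 hP2 hP3 using fun z : S => exists_real_of_unit_root f v (hS z z.2).1 (hS z z.2).2
  rw [← Finset.card_attach]
  refine Finset.card_le_mul_card_image_of_maps_to (f := P) (fun z _ => ?_) 2 fun Q hQ => ?_
  · exact Finset.mem_filter.2 ⟨Finset.mem_univ _, hP1 z, hP2 z⟩
  · rcases (S.attach.filter fun z => P z = Q).eq_empty_or_nonempty with he | ⟨z, hz⟩
    · rw [he]; simp
    have hz0 : ∀ w : S, (w : ℂ) ≠ 0 := fun w h => by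
      have := (hS w w.2).1
      rw [h, norm_zero] at this
      exact zero_ne_one this
    have hsub : (S.attach.filter fun z => P z = Q).image (Subtype.val : S → ℂ) ⊆
        {(z : ℂ), (z : ℂ)⁻¹} := by
      intro _ hw
      obtain ⟨w, hwQ, rfl⟩ := Finset.mem_image.1 hw
      have h1 := hP3 z ⟨_, hx⟩ rfl
      have h2 := hP3 w ⟨_, hx⟩ rfl
      rw [(Finset.mem_filter.1 hwQ).2] at h2
      rw [(Finset.mem_filter.1 hz).2, h2] at h1
      have hz' := hz0 z
      have hw' := hz0 w
      have h3 : ((w : ℂ) - z) * (w * z - 1) = 0 := by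
        field_simp at h1
        linear_combination h1
      rw [Finset.mem_insert, Finset.mem_singleton]
      rcases mul_eq_zero.1 h3 with h | h
      · exact Or.inl (sub_eq_zero.1 h)
      · exact Or.inr (eq_inv_of_mul_eq_one_left (sub_eq_zero.1 h))
    rw [← Finset.card_image_of_injective _ Subtype.val_injective]
    exact (Finset.card_le_card hsub).trans Finset.card_le_two

end Embeddings

end QF

namespace QF

open IsDedekindDomain NumberField WithZero
open scoped Pointwise Classical nonZeroDivisors

open LinearMap (BilinForm)
open Module (finrank Basis)

section Bound

lemma rootMultiplicity_prod_pow {k ι : Type*} [Field k] (s : Finset ι) (q : ι → k[X])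
    (hq : ∀ i, q i ≠ 0) (n : ι → ℕ) (z : k) :
    rootMultiplicity z (∏ i ∈ s, q i ^ n i) = ∑ i ∈ s, n i * rootMultiplicity z (q i) := by
  have hpow : ∀ i m, rootMultiplicity z (q i ^ m) = m * rootMultiplicity z (q i) := by
    intro i m
    induction m with
    | zero => simp
    | succ m ih =>
      rw [pow_succ, rootMultiplicity_mul (mul_ne_zero (pow_ne_zero _ (hq i)) (hq i)), ih]
      ring
  induction s using Finset.induction_on with
  | empty => simp
  | insert i s hi ih =>
    rw [Finset.prod_insert hi, Finset.sum_insert hi, rootMultiplicity_mul, ih, hpow]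
    exact mul_ne_zero (pow_ne_zero _ (hq i)) (Finset.prod_ne_zero_iff.2 fun j _ => pow_ne_zero _ (hq j))

lemma hdg_toLin'_of_real {ι : Type*} [Fintype ι] [DecidableEq ι] (a : ι → ℝ) (T : Matrix ι ι ℝ)
    (hT : ∀ j k, ∑ i, a i * (T i j * T i k) = if j = k then a j else 0) (x y : ι → ℂ) :
    hdg a (Matrix.toLin' (T.map Complex.ofRealHom) x) (Matrix.toLin' (T.map Complex.ofRealHom) y) =
      hdg a x y := by
  have hT' : ∀ j k, ∑ i, (a i : ℂ) * ((T i j : ℂ) * (T i k : ℂ)) = if j = k then (a j : ℂ) else 0 := by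
    intro j k
    have := congrArg (fun r : ℝ => (r : ℂ)) (hT j k)
    push_cast at this
    rw [this]
    split_ifs <;> simp
  have h1 : ∀ (x : ι → ℂ) i, Matrix.toLin' (T.map Complex.ofRealHom) x i = ∑ j, (T i j : ℂ) * x j :=
    fun x i => rfl
  calc hdg a (Matrix.toLin' (T.map Complex.ofRealHom) x) (Matrix.toLin' (T.map Complex.ofRealHom) y)
      = ∑ i, ∑ j, ∑ k, (a i : ℂ) * ((T i j : ℂ) * (T i k : ℂ)) * (x j * starRingEnd ℂ (y k)) := by
        refine Finset.sum_congr rfl fun i _ => ?_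
        rw [h1, h1, map_sum, Finset.sum_mul_sum, Finset.mul_sum]
        refine Finset.sum_congr rfl fun j _ => ?_
        rw [Finset.mul_sum]
        refine Finset.sum_congr rfl fun k _ => ?_
        rw [map_mul, Complex.conj_ofReal]
        ring
    _ = ∑ j, ∑ k, (∑ i, (a i : ℂ) * ((T i j : ℂ) * (T i k : ℂ))) * (x j * starRingEnd ℂ (y k)) := by
        rw [Finset.sum_comm]
        refine Finset.sum_congr rfl fun j _ => ?_
        rw [Finset.sum_comm]
        exact Finset.sum_congr rfl fun k _ => (Finset.sum_mul _ _ _).symm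
    _ = hdg a x y := by
        refine Finset.sum_congr rfl fun j _ => ?_
        simp [hT']

variable {K K' : Type*} [Field K] [NumberField K] [Field K'] [NumberField K'] [Algebra K K']
  [FiniteDimensional K K'] {ι : Type*} [Fintype ι] (f : ι → K[X]) [hf : ∀ i, IsSym (f i)]
  [∀ i, NumberField (inv (f i)).F]

theorem abs_sgn_le (hodd : Odd (finrank K K')) (hinj : Function.Injective f) (n : ι → ℕ)
    {V : Type*} [AddCommGroup V] [Module K V] [FiniteDimensional K V] {B : BilinForm K V} (hB : IP B)
    {t : K' ⊗[K] V →ₗ[K'] K' ⊗[K] V}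
    (ht : ∀ x y, BilinForm.baseChange K' B (t x) (t y) = BilinForm.baseChange K' B x y)
    (hchar : t.charpoly = (∏ i, f i ^ n i).map (algebraMap K K'))
    (hG : aeval t ((∏ i, f i).map (algebraMap K K')) = 0) (v : K →+* ℝ) :
    |sgn v (cl B)| ≤ ∑ i, 2 * (n i : ℤ) * rho (inv (f i)).d v := by
  obtain ⟨m, b, hb⟩ := hB.exists_isDiag
  obtain ⟨v', hv'⟩ := exists_real_extension (K' := K') hodd v
  have hv'' : ∀ c, v' (algebraMap K K' c) = v c := fun c => DFunLike.congr_fun hv' c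
  have hb' := hb.baseChange (K' := K')
  let b' := b.baseChange K'
  let T : Matrix (MT m) (MT m) K' := LinearMap.toMatrixAlgEquiv b' t
  have hTr : ∀ i j, b'.repr (t (b' j)) i = T i j := fun i j =>
    (LinearMap.toMatrixAlgEquiv_apply b' t i j).symm
  let a : MT m → ℝ := fun i => v i.val
  have ha : ∀ i, a i ≠ 0 := fun i => (_root_.map_ne_zero v).2 (Units.ne_zero _)
  have hTT : ∀ j k, ∑ i, a i * (T.map v' i j * T.map v' i k) = if j = k then a j else 0 := by
    intro j k
    have h1 := ht (b' j) (b' k)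
    rw [hb'.apply, hb' j k] at h1
    have h2 := congrArg v' h1
    rw [map_sum] at h2
    convert h2 using 1
    · refine Finset.sum_congr rfl fun i _ => ?_
      rw [map_mul, map_mul]
      exact congrArg₂ (· * ·) (hv'' _).symm
        (congrArg₂ (· * ·) (congrArg v' (hTr i j).symm) (congrArg v' (hTr i k).symm))
    · split_ifs
      · exact (hv'' _).symm
      · rw [map_zero]
  let c : K' →+* ℂ := Complex.ofRealHom.comp v'
  let vc : K →+* ℂ := Complex.ofRealHom.comp v
  have hc : c.comp (algebraMap K K') = vc := by rw [RingHom.comp_assoc, hv']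
  let A : Module.End ℂ (MT m → ℂ) := Matrix.toLin' ((T.map v').map Complex.ofRealHom)
  have hAM : (T.map v').map Complex.ofRealHom = c.mapMatrix T := rfl
  have hA := hdg_toLin'_of_real a (T.map v') hTT
  have hAc : A.charpoly = ∏ i, (f i).map vc ^ n i := by
    rw [Matrix.charpoly_toLin', hAM, RingHom.mapMatrix_apply, Matrix.charpoly_map]
    have : T.charpoly = t.charpoly := LinearMap.charpoly_toMatrix t b'
    rw [this, hchar, Polynomial.map_map, hc, Polynomial.map_prod]
    simp only [Polynomial.map_pow]
  have hsep : ∀ i, ((f i).map vc).Separable := fun i => (hf i).irr.separable.map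
  have hne : ∀ i, (f i).map vc ≠ 0 := fun i => (hsep i).ne_zero
  have hAG : aeval A ((∏ i, f i).map vc) = 0 := by
    have h1 : aeval T ((∏ i, f i).map (algebraMap K K')) = 0 := by
      rw [aeval_algHom_apply, hG, map_zero]
    have h2 : aeval (c.mapMatrix T) (((∏ i, f i).map (algebraMap K K')).map c) = 0 := by
      rw [← map_aeval_eq_aeval_map, h1, map_zero]
      ext x i j
      simp [Matrix.algebraMap_matrix_apply]
      split_ifs <;> simp
    rw [Polynomial.map_map, hc] at h2
    have h3 := aeval_algHom_apply (Matrix.toLinAlgEquiv' (R := ℂ) (n := MT m)) (c.mapMatrix T)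
      ((∏ i, f i).map vc)
    rw [h2, map_zero] at h3
    exact h3
  have htop : ⨆ z, A.eigenspace z = ⊤ := by
    refine Module.End.IsSemisimple.iSup_eigenspace_eq_top
      (Module.End.isSemisimple_of_squarefree_aeval_eq_zero (Separable.squarefree ?_) hAG)
    exact (separable_prod (fun i j hij => isCoprime_of_ne f hinj hij) fun i => (hf i).irr.separable).map
  have hmult := fun z => LinearMap.finrank_eigenspace_le A z
  let Z := A.charpoly.roots.toFinset.filter fun z : ℂ => ‖z‖ = 1
  have hZ : ∀ z, ‖z‖ = 1 → A.HasEigenvalue z → z ∈ Z := by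
    intro z hz hez
    refine Finset.mem_filter.2 ⟨?_, hz⟩
    rw [Multiset.mem_toFinset, ← Multiset.count_pos, count_roots]
    refine lt_of_lt_of_le ?_ (hmult z)
    rw [Module.finrank_pos_iff, Submodule.nontrivial_iff_ne_bot]
    exact hez
  have key := signature_le a ha A hA htop Z hZ
  rw [sgn_cl v hb]
  refine key.trans ?_
  calc ∑ z ∈ Z, (finrank ℂ (A.eigenspace z) : ℤ)
      ≤ ∑ z ∈ Z, ∑ i, (n i : ℤ) * (if eval₂ vc z (f i) = 0 then 1 else 0) := by
        refine Finset.sum_le_sum fun z _ => ?_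
        have h1 := hmult z
        rw [hAc, rootMultiplicity_prod_pow _ _ hne] at h1
        refine (Int.ofNat_le.2 h1).trans ?_
        push_cast
        refine Finset.sum_le_sum fun i _ => mul_le_mul_of_nonneg_left ?_ (by positivity)
        split_ifs with h0
        · exact_mod_cast rootMultiplicity_le_one_of_separable (hsep i) z
        · rw [rootMultiplicity_eq_zero, Nat.cast_zero]
          rwa [IsRoot.def, eval_map]
    _ = ∑ i, (n i : ℤ) * ((Z.filter fun z => eval₂ vc z (f i) = 0).card : ℤ) := by
        rw [Finset.sum_comm]
        refine Finset.sum_congr rfl fun i _ => ?_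
        rw [← Finset.mul_sum, Finset.card_filter]
        push_cast
        rfl
    _ ≤ ∑ i, 2 * (n i : ℤ) * rho (inv (f i)).d v := by
        refine Finset.sum_le_sum fun i _ => ?_
        rw [mul_comm 2, mul_assoc]
        refine mul_le_mul_of_nonneg_left ?_ (by positivity)
        exact_mod_cast card_unit_roots_le (f i) v _ fun z hz =>
          ⟨(Finset.mem_filter.1 (Finset.mem_filter.1 hz).1).2, (Finset.mem_filter.1 hz).2⟩

end Bound

end QF

namespace QF

open IsDedekindDomain NumberField WithZero
open scoped Pointwise Classical nonZeroDivisors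

open LinearMap (BilinForm)
open Module (finrank Basis)

section Realize

universe u

variable {K : Type u} [Field K] [CharZero K] {ι : Type*} [Fintype ι] (f : ι → K[X])

/-- some isometry annihilated by `∏ i, f i` has Witt class `c` and characteristic polynomial `p` -/
def Realizes (c : W K) (p : K[X]) : Prop :=
  ∃ (M : Type u) (_ : AddCommGroup M) (_ : Module K M) (_ : FiniteDimensional K M)
    (b : BilinForm K M) (t : M →ₗ[K] M), IP b ∧ (∀ x y, b (t x) (t y) = b x y) ∧
      aeval t (∏ i, f i) = 0 ∧ cl b = c ∧ t.charpoly = p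

lemma Realizes.zero : Realizes f 0 1 := by
  have h : IP (0 : BilinForm K PUnit.{u + 1}) := ⟨fun _ _ => rfl, fun _ _ => Subsingleton.elim _ _⟩
  refine ⟨PUnit, _, _, inferInstance, 0, 0, h, fun _ _ => rfl, Subsingleton.elim _ _, ?_, ?_⟩
  · rw [cl_eq_zero_iff h]
    exact ⟨⊤, fun x => by simp⟩
  · exact (LinearMap.charpoly_monic _).natDegree_eq_zero.1 (by
      rw [LinearMap.charpoly_natDegree, Module.finrank_zero_of_subsingleton])

variable {f}

lemma Realizes.add {c c' : W K} {p p' : K[X]} (h : Realizes f c p) (h' : Realizes f c' p') :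
    Realizes f (c + c') (p * p') := by
  obtain ⟨M, _, _, _, b, t, hb, ht, hG, rfl, rfl⟩ := h
  obtain ⟨M', _, _, _, b', t', hb', ht', hG', rfl, rfl⟩ := h'
  refine ⟨M × M', _, _, inferInstance, orth b b', t.prodMap t', hb.orth hb', fun x y => ?_, ?_,
    cl_orth hb hb', LinearMap.charpoly_prodMap _ _⟩
  · simp [orth_apply, ht, ht']
  · refine LinearMap.ext fun x => Prod.ext ?_ ?_
    · have := aeval_intertwine (t := t) (u := t.prodMap t') (j := LinearMap.fst K M M') (fun _ => rfl)
        (∏ i, f i) x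
      rwa [hG] at this
    · have := aeval_intertwine (t := t') (u := t.prodMap t') (j := LinearMap.snd K M M') (fun _ => rfl)
        (∏ i, f i) x
      rwa [hG'] at this

variable [hf : ∀ i, IsSym (f i)]

lemma realizes_ang (i : ι) (l : (inv (f i)).Fˣ) :
    Realizes f (trT K (inv (f i)).F (hh (inv (f i)).d (ang l))) (f i) := by
  have hr : AdjoinRoot.root (f i) * (inv (f i)).σ (AdjoinRoot.root (f i)) = 1 := by
    rw [inv_σ_root, mul_inv_cancel₀ (root_ne_zero (f i))]
  refine ⟨AdjoinRoot (f i), _, _, inferInstance, (inv (f i)).form (l : (inv (f i)).F),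
    LinearMap.mulLeft K (AdjoinRoot.root (f i)), (inv (f i)).ip_form l,
    fun x y => (inv (f i)).form_mul _ hr x y, ?_, (inv (f i)).cl_form l, charpoly_mul_root (f i)⟩
  refine aeval_eq_zero_of_dvd_aeval_eq_zero (Finset.dvd_prod_of_mem f (Finset.mem_univ i)) ?_
  have := LinearMap.aeval_self_charpoly (LinearMap.mulLeft K (AdjoinRoot.root (f i)))
  rwa [charpoly_mul_root] at this

lemma realizes_mk (i : ι) (Λ : Multiset (inv (f i)).Fˣ) :
    Realizes f (trT K (inv (f i)).F (hh (inv (f i)).d (W.mk Λ))) (f i ^ Λ.card) := by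
  induction Λ using Multiset.induction with
  | empty => simpa using Realizes.zero f
  | cons l Λ ih =>
    rw [← Multiset.singleton_add, map_add, map_add, map_add, Multiset.card_add, Multiset.card_singleton,
      pow_add, pow_one]
    exact (realizes_ang i l).add ih

lemma realizes_sum (s : Finset ι) (Λ : ∀ i, Multiset (inv (f i)).Fˣ) :
    Realizes f (∑ i ∈ s, trT K (inv (f i)).F (hh (inv (f i)).d (W.mk (Λ i))))
      (∏ i ∈ s, f i ^ (Λ i).card) := by
  induction s using Finset.induction_on with
  | empty => simpa using Realizes.zero f
  | insert i s hi ih =>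
    rw [Finset.sum_insert hi, Finset.prod_insert hi]
    exact (realizes_mk i (Λ i)).add ih

lemma isCoprime_prod_of_notMem (hinj : Function.Injective f) (m : ι → ℕ) {i : ι} {s : Finset ι}
    (hi : i ∉ s) (a : ℕ) : IsCoprime (f i ^ a) (∏ j ∈ s, f j ^ m j) :=
  IsCoprime.prod_right fun _ hj => (isCoprime_of_ne f hinj (ne_of_mem_of_not_mem hj hi).symm).pow

lemma exponents_le (hinj : Function.Injective f) {m k : ι → ℕ}
    (h : ∏ i, f i ^ m i = ∏ i, f i ^ k i) (i : ι) : m i ≤ k i := by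
  have h1 : f i ^ m i ∣ f i ^ k i * ∏ j ∈ Finset.univ.erase i, f j ^ k j := by
    rw [Finset.mul_prod_erase _ (fun j => f j ^ k j) (Finset.mem_univ i), ← h]
    exact Finset.dvd_prod_of_mem (fun j => f j ^ m j) (Finset.mem_univ i)
  exact (pow_dvd_pow_iff (hf i).irr.ne_zero (hf i).irr.not_isUnit).1
    ((isCoprime_prod_of_notMem hinj k (Finset.notMem_erase i _) _).dvd_of_dvd_mul_right h1)

lemma minpoly_eq_prod (hinj : Function.Injective f) {n : ι → ℕ} (hn : ∀ i, 1 ≤ n i) {M : Type*}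
    [AddCommGroup M] [Module K M] [FiniteDimensional K M] {b : BilinForm K M} (hb : IP b)
    {t : M →ₗ[K] M} (ht : ∀ x y, b (t x) (t y) = b x y) (hG : aeval t (∏ i, f i) = 0)
    (hchar : t.charpoly = ∏ i, f i ^ n i) : minpoly K t = ∏ i, f i := by
  refine eq_of_monic_of_associated (minpoly.monic (Algebra.IsIntegral.isIntegral t))
    (monic_prod_of_monic _ _ fun i _ => (hf i).monic)
    (associated_of_dvd_dvd (minpoly.dvd K t hG) ?_)
  refine Fintype.prod_dvd_of_coprime (fun i j hij => isCoprime_of_ne f hinj hij) fun i => ?_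
  by_contra hdvd
  have h1 : minpoly K t ∣ ∏ j ∈ Finset.univ.erase i, f j := by
    refine (((hf i).irr.coprime_iff_not_dvd.2 hdvd).symm).dvd_of_dvd_mul_left (y := f i) ?_
    rw [Finset.mul_prod_erase _ f (Finset.mem_univ i)]
    exact minpoly.dvd K t hG
  have h2 : aeval t (∏ j : {j // j ≠ i}, f j) = 0 := by
    rw [← Finset.prod_subtype (Finset.univ.erase i) (by simp) f]
    exact aeval_eq_zero_of_dvd_aeval_eq_zero h1 (minpoly.aeval K t)
  obtain ⟨Λ, -, hΛ⟩ := exists_decomposition (fun j : {j // j ≠ i} => f j)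
    (hinj.comp Subtype.val_injective) hb ht h2
  have h3 : IsCoprime (f i) (∏ j : {j // j ≠ i}, f j ^ (Λ j).card) :=
    IsCoprime.prod_right fun j _ => (isCoprime_of_ne f hinj j.2.symm).pow_right
  have h4 : f i ∣ ∏ j, f j ^ n j :=
    (dvd_pow_self (f i) (Nat.one_le_iff_ne_zero.1 (hn i))).trans
      (Finset.dvd_prod_of_mem (fun j => f j ^ n j) (Finset.mem_univ i))
  rw [← hchar, hΛ] at h4
  exact (hf i).irr.not_isUnit (h3.isUnit_of_dvd' dvd_rfl h4)

lemma aeval_restrictScalars {K' M : Type*} [Field K'] [Algebra K K'] [AddCommGroup M] [Module K M]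
    [Module K' M] [IsScalarTower K K' M] (t : M →ₗ[K'] M) (p : K[X]) (x : M) :
    aeval (t.restrictScalars K) p x = aeval t (p.map (algebraMap K K')) x := by
  induction p using Polynomial.induction_on' with
  | add p q hp hq => simp [hp, hq]
  | monomial n a =>
    have : ∀ n : ℕ, ((t.restrictScalars K) ^ n) x = (t ^ n) x := fun n => by
      induction n with
      | zero => rfl
      | succ n ih => rw [pow_succ', pow_succ', Module.End.mul_apply, Module.End.mul_apply, ih]; rfl
    rw [map_monomial, aeval_monomial, aeval_monomial, Module.End.mul_apply, Module.End.mul_apply, this,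
      Module.algebraMap_end_apply, Module.algebraMap_end_apply, algebraMap_smul]

end Realize

theorem exists_isometry {K K' : Type*} [Field K] [NumberField K] [Field K'] [NumberField K'] [Algebra K K']
    [FiniteDimensional K K'] (hodd : Odd (finrank K K')) {ι : Type*} [Fintype ι] (f : ι → K[X])
    [hf : ∀ i, IsSym (f i)] (hinj : Function.Injective f) (n : ι → ℕ) (hn : ∀ i, 1 ≤ n i)
    {V : Type*} [AddCommGroup V] [Module K V] [FiniteDimensional K V]
    (hdim : finrank K V = (∏ i, f i ^ n i).natDegree) {B : BilinForm K V} (hB : IP B)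
    {t : K' ⊗[K] V →ₗ[K'] K' ⊗[K] V}
    (ht : ∀ x y, BilinForm.baseChange K' B (t x) (t y) = BilinForm.baseChange K' B x y)
    (hchar : t.charpoly = (∏ i, f i ^ n i).map (algebraMap K K'))
    (hG : aeval t ((∏ i, f i).map (algebraMap K K')) = 0) :
    ∃ T : V ≃ₗ[K] V, (∀ x y, B (T x) (T y) = B x y) ∧
      (T : V →ₗ[K] V).charpoly = ∏ i, f i ^ n i ∧ minpoly K (T : V →ₗ[K] V) = ∏ i, f i := by
  have : ∀ i, NumberField (inv (f i)).F := fun i => NumberField.of_module_finite K _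
  obtain ⟨s, hs, hs'⟩ := exists_cl_resf_baseChange (K := K) (K' := K') hodd
  obtain ⟨hB', hcl⟩ := hs' B hB
  have : FiniteDimensional K (K' ⊗[K] V) := FiniteDimensional.trans K K' _
  obtain ⟨Λ, hΛ, hΛc⟩ := exists_decomposition f hinj (hB'.resf hs) (t := t.restrictScalars K)
    (fun x y => congrArg s (ht x y)) (LinearMap.ext fun x => by
      rw [aeval_restrictScalars, hG]; rfl)
  rw [charpoly_restrictScalars t _ hchar, ← Finset.prod_pow] at hΛc
  simp only [← pow_mul] at hΛc
  have hcard : ∀ i, (Λ i).card = n i * finrank K K' := fun i =>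
    le_antisymm (exponents_le hinj hΛc.symm i) (exponents_le hinj hΛc i)
  have hpar : ∀ i, par (W.mk (Λ i)) = n i := by
    intro i
    rw [par_mk, hcard, Nat.cast_mul, (ZMod.natCast_eq_one_iff_odd).2 hodd, mul_one]
  rw [hcl] at hΛ
  obtain ⟨M, hM, hMs⟩ := exists_normalized (fun i => (inv (f i)).F) (fun i => (inv (f i)).d)
    (fun i => (inv (f i)).not_isSquare_d) n hn (fun i => W.mk (Λ i)) hpar (fun v => by
      rw [← hΛ]
      exact abs_sgn_le f hodd hinj n hB ht hchar hG v)
  obtain ⟨E, _, _, _, b, u, hb, hu, huG, hbc, huc⟩ := realizes_sum (f := f) Finset.univ M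
  simp only [hM] at huc
  rw [hMs, ← hΛ] at hbc
  obtain ⟨e, he⟩ := exists_isometry_of_cl_eq hb hB hbc (by
    rw [hdim, ← huc, LinearMap.charpoly_natDegree])
  let T : V →ₗ[K] V := e.conj u
  have hTe : ∀ x, T (e x) = e (u x) := fun x => by simp [T, LinearEquiv.conj_apply]
  have hT : ∀ x y, B (T x) (T y) = B x y := by
    intro x y
    obtain ⟨x, rfl⟩ := e.surjective x
    obtain ⟨y, rfl⟩ := e.surjective y
    rw [hTe, hTe, he, he, hu]
  have hTc : T.charpoly = ∏ i, f i ^ n i := by rw [LinearEquiv.charpoly_conj, huc]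
  have hTG : aeval T (∏ i, f i) = 0 := by
    refine LinearMap.ext fun x => ?_
    obtain ⟨x, rfl⟩ := e.surjective x
    have := aeval_intertwine (t := T) (u := u) (j := e.toLinearMap) (fun x => (hTe x).symm) (∏ i, f i) x
    rw [huG] at this
    simpa using this.symm
  exact ⟨LinearEquiv.ofBijective T ⟨hB.injective_of_isometry hT, hB.surjective_of_isometry hT⟩, hT, hTc,
    minpoly_eq_prod hinj hn hB hT hTG hTc⟩

end QF

theorem stmt_4 {K K' : Type*} [Field K] [NumberField K] [Field K'] [Algebra K K']
    [FiniteDimensional K K'] (hodd : Odd (Module.finrank K K'))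
    {r : ℕ} (f : Fin r → Polynomial K) (n : Fin r → ℕ)
    (hdist : Function.Injective f)
    (hmonic : ∀ i, (f i).Monic) (hirr : ∀ i, Irreducible (f i))
    (hsymm : ∀ i, (f i).reverse = f i) (heven : ∀ i, Even (f i).natDegree)
    (hn : ∀ i, 1 ≤ n i)
    {V : Type*} [AddCommGroup V] [Module K V] [FiniteDimensional K V]
    (hdim : Module.finrank K V = (∏ i, f i ^ n i).natDegree)
    (B : LinearMap.BilinForm K V) (hBnd : B.Nondegenerate) (hBsymm : B.IsSymm)
    (hloc : HasIsometryWith K' (K' ⊗[K] V) (LinearMap.BilinForm.baseChange K' B)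
      ((∏ i, f i ^ n i).map (algebraMap K K')) ((∏ i, f i).map (algebraMap K K'))) :
    HasIsometryWith K V B (∏ i, f i ^ n i) (∏ i, f i) := by
  have : NumberField K' := NumberField.of_module_finite K K'
  have hf : ∀ i, QF.IsSym (f i) := fun i => ⟨hmonic i, hirr i, hsymm i, heven i⟩
  have hB : QF.IP B := ⟨fun x y => by simpa using hBsymm.eq x y, hBnd.1⟩
  obtain ⟨t, ht, hchar, hmin⟩ := hloc
  have hG : aeval (t : K' ⊗[K] V →ₗ[K'] K' ⊗[K] V)
      ((∏ i, f i).map (algebraMap K K')) = 0 := by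
    rw [← hmin]
    exact minpoly.aeval K' (t : K' ⊗[K] V →ₗ[K'] K' ⊗[K] V)
  exact QF.exists_isometry hodd f hdist n hn hdim hB ht hchar hG
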